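/- Let n ≥ 3 and p > (n−1)/2. There exist constants ε > 0 and C > 0, depending only on n and p, such that the following holds. Let V : ℝ^n → ℂ be measurable with ‖V‖_{F^p} ≤ ε, let f, g be Schwartz functions on ℝ^n, and suppose u : ℝ^n × ℝ → ℂ is such that u(·,t) is a Schwartz function for each t, (x,t) ↦ u(x,t) is continuous, and for every t ∈ ℝ, u(·,t) = cos(t√−Δ)f + (sin(t√−Δ)/√−Δ)g + ∫_0^t (sin((t−s)√−Δ)/√−Δ)(V·u(·,s)) ds. Then ‖u‖_{L²_{x,t}(|V|)} ≤ C ‖V‖_{F^p}^{1/2} (‖f‖_{Ḣ^{1/2}} + ‖g‖_{Ḣ^{−1/2}}). -/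

import Mathlib

noncomputable section

open MeasureTheory Metric Complex
open scoped ENNReal FourierTransform SchwartzMap

/-- The Fourier multiplier operator `m(√−Δ)` on `ℝⁿ`:
`m(√−Δ)h = 𝓕⁻¹(m(|ξ|) 𝓕h(ξ))`. -/
def mOp (n : ℕ) (m : ℝ → ℂ) (h : EuclideanSpace ℝ (Fin n) → ℂ) :
    EuclideanSpace ℝ (Fin n) → ℂ :=
  fun x => 𝓕⁻ (fun ξ : EuclideanSpace ℝ (Fin n) => m ‖ξ‖ * 𝓕 h ξ) x

/-- The multiplier of `e^{it√−Δ}`, i.e. `ρ ↦ e^{itρ}`. -/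
def expMult (t : ℝ) : ℝ → ℂ := fun ρ => Complex.exp (Complex.I * t * ρ)

/-- The multiplier of `cos(t√−Δ)`, i.e. `ρ ↦ cos (tρ)`. -/
def cosMult (t : ℝ) : ℝ → ℂ := fun ρ => ((Real.cos (t * ρ) : ℝ) : ℂ)

/-- The multiplier of `sin(t√−Δ)/√−Δ`, i.e. `ρ ↦ sin (tρ)/ρ`. -/
def sincMult (t : ℝ) : ℝ → ℂ := fun ρ => ((Real.sin (t * ρ) / ρ : ℝ) : ℂ)

/-- The multiplier of `sin(t√−Δ)`, i.e. `ρ ↦ sin (tρ)`. -/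
def sinMult (t : ℝ) : ℝ → ℂ := fun ρ => ((Real.sin (t * ρ) : ℝ) : ℂ)

/-- The multiplier of `(√−Δ)^γ`, i.e. `ρ ↦ ρ^γ`. -/
def powMult (γ : ℝ) : ℝ → ℂ := fun ρ => ((ρ ^ γ : ℝ) : ℂ)

/-- A function is Schwartz if it agrees pointwise with some Schwartz map. -/
def IsSchwartz {n : ℕ} (h : EuclideanSpace ℝ (Fin n) → ℂ) : Prop :=
  ∃ φ : 𝓢(EuclideanSpace ℝ (Fin n), ℂ), ∀ x, h x = φ x

/-- The Fefferman–Phong norm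
`‖V‖_{𝓕^p} = sup_{x, r>0} r^(2-n/p) (∫_{B_r(x)} |V|^p)^(1/p)`. -/
def fpNorm (n : ℕ) (p : ℝ) (V : EuclideanSpace ℝ (Fin n) → ℂ) : ℝ≥0∞ :=
  ⨆ (x : EuclideanSpace ℝ (Fin n)) (r : ℝ) (_ : 0 < r),
    ENNReal.ofReal (r ^ (2 - n / p)) *
      (∫⁻ y in ball x r, ENNReal.ofReal (‖V y‖ ^ p)) ^ (1 / p)

/-- The weak `L^{n/2}` quasinorm `sup_{λ>0} λ · |{|V| > λ}|^{2/n}`. -/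
def wkNorm (n : ℕ) (V : EuclideanSpace ℝ (Fin n) → ℂ) : ℝ≥0∞ :=
  ⨆ (l : ℝ) (_ : 0 < l),
    ENNReal.ofReal l * (volume {x : EuclideanSpace ℝ (Fin n) | l < ‖V x‖}) ^ ((2 : ℝ) / n)

/-- The mixed norm `‖F‖_{L^q_t L^r_x}` for `F : ℝⁿ × ℝ → ℂ`, curried as `F x t`. -/
def mixedNorm (n : ℕ) (q r : ℝ) (F : EuclideanSpace ℝ (Fin n) → ℝ → ℂ) : ℝ≥0∞ :=
  (∫⁻ t : ℝ, (∫⁻ x : EuclideanSpace ℝ (Fin n), (‖F x t‖₊ : ℝ≥0∞) ^ r) ^ (q / r)) ^ (1 / q)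

/-- The weighted norm `‖h‖_{L²_{x,t}(w)}` with weight `w : ℝⁿ → [0,∞]`. -/
def wtNorm (n : ℕ) (w : EuclideanSpace ℝ (Fin n) → ℝ≥0∞)
    (h : EuclideanSpace ℝ (Fin n) → ℝ → ℂ) : ℝ≥0∞ :=
  (∫⁻ t : ℝ, ∫⁻ x : EuclideanSpace ℝ (Fin n), (‖h x t‖₊ : ℝ≥0∞) ^ (2 : ℝ) * w x) ^ ((1 : ℝ) / 2)

/-- The homogeneous Sobolev norm `‖h‖_{Ḣ^γ} = ‖(√−Δ)^γ h‖_{L²}`. -/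
def sobNorm (n : ℕ) (γ : ℝ) (h : EuclideanSpace ℝ (Fin n) → ℂ) : ℝ≥0∞ :=
  eLpNorm (mOp n (powMult γ) h) 2 volume

/-- The point `x/|x|` of the unit sphere, for `x ≠ 0`. -/
def sphMap (n : ℕ) (x : EuclideanSpace ℝ (Fin n)) (hx : x ≠ 0) :
    Metric.sphere (0 : EuclideanSpace ℝ (Fin n)) 1 :=
  ⟨‖x‖⁻¹ • x, by
    rw [mem_sphere_zero_iff_norm, norm_smul, norm_inv, norm_norm,
      inv_mul_cancel₀ (norm_ne_zero_iff.mpr hx)]⟩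

end

noncomputable section
open MeasureTheory Metric Complex
open scoped ENNReal FourierTransform SchwartzMap

section Planch
variable {W : Type*} [NormedAddCommGroup W] [InnerProductSpace ℝ W] [FiniteDimensional ℝ W]
  [MeasurableSpace W] [BorelSpace W]

lemma selfadj_fourier {f g : W → ℂ} (hf : Integrable f) (hg : Integrable g) :
    ∫ x, 𝓕 f x * g x = ∫ x, f x * 𝓕 g x := by
  have := VectorFourier.integral_fourierIntegral_smul_eq_flip (e := Real.fourierChar)
    (μ := (volume : Measure W)) (ν := (volume : Measure W)) (L := innerₗ W)
    Real.continuous_fourierChar continuous_inner hf hg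
  rw [flip_innerₗ] at this
  exact this

lemma fourier_L2_ae {f : W → ℂ} (h1 : Integrable f) (h2 : MemLp f 2) :
    (𝓕 (h2.toLp f) : Lp (α := W) ℂ 2 volume) =ᵐ[volume] 𝓕 f := by
  have hc : Continuous (𝓕 f) :=
    VectorFourier.fourierIntegral_continuous Real.continuous_fourierChar continuous_inner h1
  have key : ∀ᵐ x : W, (𝓕 (h2.toLp f) : Lp (α := W) ℂ 2 volume) x - 𝓕 f x = 0 := by
    apply ae_eq_zero_of_integral_contDiff_smul_eq_zero
    · exact ((Lp.memLp _).locallyIntegrable (by norm_num)).sub hc.locallyIntegrable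
    · intro g gs gc
      have gs' : ContDiff ℝ ((⊤ : ℕ∞) : WithTop ℕ∞) (fun x => ((g x : ℝ) : ℂ)) :=
        Complex.ofRealCLM.contDiff.comp gs
      have gc' : HasCompactSupport (fun x => ((g x : ℝ) : ℂ)) :=
        gc.comp_left (g := fun r : ℝ => (r : ℂ)) (by simp)
      let φ : 𝓢(W, ℂ) := gc'.toSchwartzMap gs'
      have hφ : ∀ x, φ x = g x := fun x => rfl
      have e1 := congrArg (fun T => T φ) (Lp.fourier_toTemperedDistribution_eq (h2.toLp f))
      simp only [TemperedDistribution.fourier_apply, Lp.toTemperedDistribution_apply] at e1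
      have e2 : ∫ x, (𝓕 φ) x • (h2.toLp f) x = ∫ x, f x * 𝓕 (φ : W → ℂ) x := by
        apply integral_congr_ae
        filter_upwards [h2.coeFn_toLp] with x hx
        rw [hx, smul_eq_mul, mul_comm]; rfl
      have i1 : Integrable (fun x => φ x • (𝓕 (h2.toLp f) : Lp (α := W) ℂ 2 volume) x) := by
        have := (φ.memLp 2 (μ := volume)).integrable_mul (Lp.memLp (𝓕 (h2.toLp f) : Lp (α := W) ℂ 2 volume))
        exact this
      have i2 : Integrable (fun x => φ x • 𝓕 f x) :=
        (φ.continuous.smul hc).integrable_of_hasCompactSupport (gc'.smul_right)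
      have : ∀ x, g x • ((𝓕 (h2.toLp f) : Lp (α := W) ℂ 2 volume) x - 𝓕 f x) =
          φ x • (𝓕 (h2.toLp f) : Lp (α := W) ℂ 2 volume) x - φ x • 𝓕 f x := by
        intro x; rw [hφ, smul_sub]; simp
      simp_rw [this]
      rw [integral_sub i1 i2, ← e1, e2, ← selfadj_fourier h1 φ.integrable]
      simp only [smul_eq_mul, mul_comm (φ _), sub_self]
  filter_upwards [key] with x hx using sub_eq_zero.mp hx

lemma memLp_fourier {f : W → ℂ} (h1 : Integrable f) (h2 : MemLp f 2) : MemLp (𝓕 f) 2 :=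
  (memLp_congr_ae (fourier_L2_ae h1 h2)).1 (Lp.memLp _)

lemma eLpNorm_fourier {f : W → ℂ} (h1 : Integrable f) (h2 : MemLp f 2) :
    eLpNorm (𝓕 f) 2 volume = eLpNorm f 2 volume := by
  have := Lp.norm_fourier_eq (h2.toLp f)
  rw [Lp.norm_def, Lp.norm_def, eLpNorm_congr_ae (fourier_L2_ae h1 h2),
    eLpNorm_congr_ae h2.coeFn_toLp] at this
  exact (ENNReal.toReal_eq_toReal_iff' (memLp_fourier h1 h2).2.ne h2.2.ne).1 this

lemma fourierInv_eq_neg' (f : W → ℂ) : 𝓕⁻ f = fun x => 𝓕 f (-x) := by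
  ext x; exact Real.fourierInv_eq_fourier_neg f x

lemma memLp_fourierInv {f : W → ℂ} (h1 : Integrable f) (h2 : MemLp f 2) : MemLp (𝓕⁻ f) 2 := by
  rw [fourierInv_eq_neg']
  exact (memLp_fourier h1 h2).comp_measurePreserving (Measure.measurePreserving_neg volume)

lemma eLpNorm_fourierInv {f : W → ℂ} (h1 : Integrable f) (h2 : MemLp f 2) :
    eLpNorm (𝓕⁻ f) 2 volume = eLpNorm f 2 volume := by
  rw [fourierInv_eq_neg', ← eLpNorm_fourier h1 h2]
  exact eLpNorm_comp_measurePreserving (memLp_fourier h1 h2).1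
    (Measure.measurePreserving_neg volume)

lemma conj_fourier (f : W → ℂ) (x : W) :
    (starRingEnd ℂ) (𝓕 f x) = 𝓕⁻ (fun y => (starRingEnd ℂ) (f y)) x := by
  rw [Real.fourier_eq', Real.fourierInv_eq', ← integral_conj]
  congr 1; ext y
  simp only [smul_eq_mul, map_mul, ← Complex.exp_conj, Complex.conj_I, Complex.conj_ofReal]
  congr 2; push_cast; ring

lemma conj_fourierInv (f : W → ℂ) (x : W) :
    (starRingEnd ℂ) (𝓕⁻ f x) = 𝓕 (fun y => (starRingEnd ℂ) (f y)) x := by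
  rw [Real.fourier_eq', Real.fourierInv_eq', ← integral_conj]
  congr 1; ext y
  simp only [smul_eq_mul, map_mul, ← Complex.exp_conj, Complex.conj_I, Complex.conj_ofReal]
  congr 2; push_cast; ring

lemma integrable_conj' {α : Type*} [MeasurableSpace α] {μ : Measure α} {f : α → ℂ}
    (h : Integrable f μ) : Integrable (fun y => (starRingEnd ℂ) (f y)) μ :=
  (Complex.conjCLE.toContinuousLinearMap).integrable_comp h

lemma memLp_conj' {α : Type*} [MeasurableSpace α] {μ : Measure α} {f : α → ℂ}
    (h : MemLp f 2 μ) : MemLp (fun y => (starRingEnd ℂ) (f y)) 2 μ :=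
  (Complex.conjCLE.toContinuousLinearMap).comp_memLp' h

lemma parseval_fourier {f g : W → ℂ} (h1 : Integrable f) (h2 : MemLp f 2)
    (g1 : Integrable g) (g2 : MemLp g 2) :
    ∫ x, 𝓕 f x * 𝓕⁻ g x = ∫ x, f x * g x := by
  have c1 := integrable_conj' g1
  have c2 := memLp_conj' g2
  have := Lp.inner_fourier_eq (c2.toLp _) (h2.toLp f)
  rw [L2.inner_def, L2.inner_def] at this
  have e1 : ∫ x, 𝓕 f x * 𝓕⁻ g x = ∫ x, inner ℂ ((𝓕 (c2.toLp _) : Lp (α := W) ℂ 2 volume) x)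
      ((𝓕 (h2.toLp f) : Lp (α := W) ℂ 2 volume) x) := by
    apply integral_congr_ae
    filter_upwards [fourier_L2_ae h1 h2, fourier_L2_ae c1 c2] with x hx hy
    rw [hx, hy, ← conj_fourierInv]
    simp
  rw [e1, this]
  apply integral_congr_ae
  filter_upwards [h2.coeFn_toLp, c2.coeFn_toLp] with x hx hy
  rw [hx, hy]
  simp

lemma continuous_fourier' {f : W → ℂ} (h1 : Integrable f) : Continuous (𝓕 f) :=
    VectorFourier.fourierIntegral_continuous Real.continuous_fourierChar continuous_inner h1

lemma norm_fourier_le' (f : W → ℂ) (x : W) : ‖𝓕 f x‖ ≤ ∫ y, ‖f y‖ :=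
  VectorFourier.norm_fourierIntegral_le_integral_norm _ _ _ _ _

lemma norm_fourierInv_le' (f : W → ℂ) (x : W) : ‖𝓕⁻ f x‖ ≤ ∫ y, ‖f y‖ := by
  rw [fourierInv_eq_neg']; exact norm_fourier_le' _ _

lemma continuous_fourierInv' {f : W → ℂ} (h1 : Integrable f) : Continuous (𝓕⁻ f) := by
  rw [fourierInv_eq_neg']; exact (continuous_fourier' h1).comp continuous_neg

end Planch
end

noncomputable section
open MeasureTheory Metric Complex
open scoped ENNReal FourierTransform SchwartzMap

lemma ft_exp_abs {η : ℝ} (hη : 0 < η) (w : ℝ) :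
    𝓕 (fun x : ℝ => ((Real.exp (-(2*Real.pi*η*|x|)) : ℝ) : ℂ)) w = ((η/(Real.pi*(η^2+w^2)) : ℝ) : ℂ) := by
  have hpi := Real.pi_pos
  have h0 : (0:ℝ) < 2*Real.pi*η := by positivity
  rw [Real.fourier_eq']
  have hz1 : (η + w * I : ℂ) ≠ 0 := by
    intro h; have := congrArg Complex.re h; simp at this; linarith
  have hz2 : (η - w * I : ℂ) ≠ 0 := by
    intro h; have := congrArg Complex.re h; simp at this; linarith
  set a : ℂ := -(2*Real.pi*(η + w*I)) with ha
  set b : ℂ := (2*Real.pi*(η - w*I)) with hb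
  have har : a.re < 0 := by simp [ha]; nlinarith
  have hbr : 0 < b.re := by simp [hb]; nlinarith
  have e1 : ∀ x ∈ Set.Ioi (0:ℝ), cexp (↑(-2 * Real.pi * inner ℝ x w) * I) • ((Real.exp (-(2*Real.pi*η*|x|)) : ℝ) : ℂ) = cexp (a * x) := by
    intro x hx
    rw [smul_eq_mul, Complex.ofReal_exp, ← Complex.exp_add, abs_of_pos hx, ha]
    congr 1; simp; ring
  have e2 : ∀ x ∈ Set.Iic (0:ℝ), cexp (↑(-2 * Real.pi * inner ℝ x w) * I) • ((Real.exp (-(2*Real.pi*η*|x|)) : ℝ) : ℂ) = cexp (b * x) := by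
    intro x hx
    rw [smul_eq_mul, Complex.ofReal_exp, ← Complex.exp_add, abs_of_nonpos hx, hb]
    congr 1; simp; ring
  have i1 := (integrableOn_congr_fun e1 measurableSet_Ioi).2 (integrableOn_exp_mul_complex_Ioi har 0)
  have i2 := (integrableOn_congr_fun e2 measurableSet_Iic).2 (integrableOn_exp_mul_complex_Iic hbr 0)
  rw [← intervalIntegral.integral_Iic_add_Ioi i2 i1, setIntegral_congr_fun measurableSet_Ioi e1,
    setIntegral_congr_fun measurableSet_Iic e2, integral_exp_mul_complex_Ioi har,
    integral_exp_mul_complex_Iic hbr]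
  have hpc : (Real.pi : ℂ) ≠ 0 := by exact_mod_cast hpi.ne'
  have hq : (η^2 + w^2 : ℂ) ≠ 0 := by
    have : (0:ℝ) < η^2+w^2 := by positivity
    exact_mod_cast this.ne'
  have hfac : (η^2 + w^2 : ℂ) = (η + w*I)*(η - w*I) := by ring_nf; simp
  rw [ha, hb]
  push_cast
  rw [hfac]
  simp
  field_simp
  ring

lemma integrable_exp_abs {c : ℝ} (hc : 0 < c) : Integrable (fun x : ℝ => Real.exp (-(c*|x|))) := by
  have e1 : ∀ x ∈ Set.Ioi (0:ℝ), Real.exp (-(c*|x|)) = Real.exp (-c * x) := by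
    intro x hx; rw [abs_of_pos hx]; ring_nf
  have e2 : ∀ x ∈ Set.Iic (0:ℝ), Real.exp (-(c*|x|)) = Real.exp (c * x) := by
    intro x hx; rw [abs_of_nonpos hx]; ring_nf
  have i1 := (integrableOn_congr_fun e1 measurableSet_Ioi).2 (integrableOn_exp_mul_Ioi (by linarith) 0)
  have i2 := (integrableOn_congr_fun e2 measurableSet_Iic).2 (integrableOn_exp_mul_Iic hc 0)
  rw [← integrableOn_univ, ← Set.Iic_union_Ioi (a := (0:ℝ))]
  exact i2.union i1

lemma integrable_poisson {η : ℝ} (hη : 0 < η) : Integrable (fun w : ℝ => η/(Real.pi*(η^2+w^2))) := by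
  have := (integrable_inv_one_add_sq.comp_mul_left' (inv_ne_zero hη.ne')).const_mul (1/(Real.pi*η))
  refine this.congr (Filter.Eventually.of_forall fun w => ?_)
  have hpi := Real.pi_pos
  have : 0 < η^2+w^2 := by positivity
  simp only
  field_simp

lemma poisson_inv {η : ℝ} (hη : 0 < η) (β : ℝ) :
    ∫ w : ℝ, ((η/(Real.pi*(η^2+w^2)) : ℝ) : ℂ) * cexp (2*Real.pi*β*w*I) =
      ((Real.exp (-(2*Real.pi*η*|β|)) : ℝ) : ℂ) := by
  have hpi := Real.pi_pos
  have hc : Continuous (fun x : ℝ => ((Real.exp (-(2*Real.pi*η*|x|)) : ℝ) : ℂ)) := by fun_prop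
  have hi : Integrable (fun x : ℝ => ((Real.exp (-(2*Real.pi*η*|x|)) : ℝ) : ℂ)) :=
    (integrable_exp_abs (by positivity)).ofReal
  have hf : 𝓕 (fun x : ℝ => ((Real.exp (-(2*Real.pi*η*|x|)) : ℝ) : ℂ)) = fun w : ℝ => ((η/(Real.pi*(η^2+w^2)) : ℝ) : ℂ) := by
    ext w; exact ft_exp_abs hη w
  have h2 : Integrable (𝓕 (fun x : ℝ => ((Real.exp (-(2*Real.pi*η*|x|)) : ℝ) : ℂ))) := by
    rw [hf]; exact (integrable_poisson hη).ofReal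
  have := congrFun (hc.fourierInv_fourier_eq hi h2) β
  rw [hf, Real.fourierInv_eq'] at this
  rw [← this]
  congr 1; ext w
  rw [smul_eq_mul, mul_comm]; congr 2
  simp; ring

lemma integral_poisson {η : ℝ} (hη : 0 < η) : ∫ w : ℝ, η/(Real.pi*(η^2+w^2)) = 1 := by
  have := poisson_inv hη 0
  simp only [mul_zero, zero_mul, ofReal_zero, Complex.exp_zero, mul_one] at this
  rw [integral_complex_ofReal] at this
  simp at this
  exact_mod_cast this

/-- subordination formula -/
lemma subordination {η : ℝ} (hη : 0 < η) {β : ℝ} (hβ : 0 ≤ β) :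
    Real.exp (-(2*Real.pi*η*β)) = (η/Real.sqrt Real.pi) *
      ∫ s in Set.Ioi (0:ℝ), s^(-(1/2):ℝ) * Real.exp (-(s*η^2)) * Real.exp (-(Real.pi^2*β^2/s)) := by
  have hpi := Real.pi_pos
  have h := poisson_inv hη β
  rw [abs_of_nonneg hβ] at h
  have hin : ∀ w : ℝ, ((η/(Real.pi*(η^2+w^2)) : ℝ) : ℂ) * cexp (2*Real.pi*β*w*I) =
      ∫ s in Set.Ioi (0:ℝ), (η/Real.pi : ℂ) * cexp (-(s*(η^2+w^2))) * cexp (2*Real.pi*β*w*I) := by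
    intro w
    rw [integral_mul_const, integral_const_mul]
    have hq : 0 < η^2+w^2 := by positivity
    have := integral_exp_mul_complex_Ioi (a := -(η^2+w^2 : ℂ)) (by norm_cast; linarith) 0
    have e : ∫ s in Set.Ioi (0:ℝ), cexp (-(s*(η^2+w^2))) = 1/(η^2+w^2 : ℂ) := by
      have e0 : ∀ s : ℝ, cexp (-(s*(η^2+w^2))) = cexp (-(η^2+w^2 : ℂ) * s) := by
        intro s; congr 1; ring
      simp_rw [e0]
      rw [this]
      have hqc : (η^2 + w^2 : ℂ) ≠ 0 := by exact_mod_cast hq.ne'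
      rw [Complex.ofReal_zero, mul_zero, Complex.exp_zero, neg_div_neg_eq]
    rw [e]
    congr 1
    have hqc : (η^2 + w^2 : ℂ) ≠ 0 := by exact_mod_cast hq.ne'
    have hpc : (Real.pi : ℂ) ≠ 0 := by exact_mod_cast hpi.ne'
    push_cast; field_simp
  simp_rw [hin] at h
  rw [integral_integral_swap] at h
  · have h2 : ∀ s ∈ Set.Ioi (0:ℝ), (∫ w : ℝ, (η/Real.pi : ℂ) * cexp (-(s*(η^2+w^2))) * cexp (2*Real.pi*β*w*I)) =
      (((η/Real.sqrt Real.pi) * (s^(-(1/2):ℝ) * Real.exp (-(s*η^2)) * Real.exp (-(Real.pi^2*β^2/s))) : ℝ) : ℂ) := by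
      intro s hs
      have hs' : (0:ℝ) < s := hs
      have g := fourier_gaussian_innerProductSpace (V := ℝ) (b := (s:ℂ)) (by simpa using hs) (-β)
      rw [Real.fourier_eq'] at g
      have : ∀ w : ℝ, (η/Real.pi : ℂ) * cexp (-(s*(η^2+w^2))) * cexp (2*Real.pi*β*w*I) =
        (η/Real.pi : ℂ) * cexp (-(s*η^2)) * (cexp (↑(-2 * Real.pi * inner ℝ w (-β)) * I) • cexp (-↑s * ↑‖w‖ ^ 2)) := by
        intro w
        rw [smul_eq_mul, mul_assoc (η/Real.pi : ℂ), ← Complex.exp_add, ← Complex.exp_add,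
          mul_assoc (η/Real.pi : ℂ), ← Complex.exp_add]
        congr 2
        have : ((‖w‖:ℝ):ℂ)^2 = (w:ℂ)^2 := by
          rw [← Complex.ofReal_pow, Real.norm_eq_abs, sq_abs, Complex.ofReal_pow]
        rw [this]; simp; ring
      simp_rw [this]
      rw [integral_const_mul, g]
      have r1 : ((Real.pi:ℂ)/s)^((Module.finrank ℝ ℝ : ℂ)/2) = (((Real.pi/s)^(1/2:ℝ) : ℝ):ℂ) := by
        rw [Complex.ofReal_cpow (by positivity)]; simp
      rw [r1]
      have r2 : (-(Real.pi:ℂ)^2 * ((‖-β‖:ℝ):ℂ)^2/(s:ℂ)) = ((-(Real.pi^2*β^2/s) : ℝ) : ℂ) := by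
        rw [Real.norm_eq_abs, ← Complex.ofReal_pow |-β|, sq_abs]; push_cast; ring
      rw [r2]
      have r3 : (-((s:ℂ)*(η:ℂ)^2)) = ((-(s*η^2) : ℝ) : ℂ) := by push_cast; ring
      rw [r3]
      norm_cast
      rw [Real.div_rpow hpi.le hs'.le, Real.rpow_neg hs'.le, ← Real.sqrt_eq_rpow, ← Real.sqrt_eq_rpow]
      have hsp : 0 < Real.sqrt Real.pi := Real.sqrt_pos.2 hpi
      have hss : 0 < Real.sqrt s := Real.sqrt_pos.2 hs'
      have h3 : Real.pi = Real.sqrt Real.pi * Real.sqrt Real.pi := (Real.mul_self_sqrt hpi.le).symm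
      have : η / Real.pi = η / (Real.sqrt Real.pi * Real.sqrt Real.pi) := by rw [← h3]
      rw [this]
      field_simp
    rw [setIntegral_congr_fun measurableSet_Ioi h2, integral_complex_ofReal, integral_const_mul] at h
    exact_mod_cast h.symm
  · have : Integrable (fun q : ℝ × ℝ => (η/Real.pi : ℂ) * cexp (-(q.2*(η^2+q.1^2))) * cexp (2*Real.pi*β*q.1*I))
      ((volume : Measure ℝ).prod (volume.restrict (Set.Ioi 0))) := by
      rw [integrable_prod_iff (by fun_prop)]
      have hn : ∀ w s : ℝ, ‖(η/Real.pi : ℂ) * cexp (-(s*(η^2+w^2))) * cexp (2*Real.pi*β*w*I)‖ = η/Real.pi*Real.exp (-(η^2+w^2)*s) := by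
        intro w s
        rw [norm_mul, norm_mul, Complex.norm_exp, Complex.norm_exp]
        have : (-(s*(η^2+w^2)) : ℂ) = ((-(η^2+w^2)*s : ℝ) : ℂ) := by push_cast; ring
        rw [this, Complex.ofReal_re]
        have : (2*Real.pi*β*w*I : ℂ) = ((2*Real.pi*β*w:ℝ):ℂ)*I := by push_cast; ring
        rw [this, Complex.re_ofReal_mul]
        have : ‖(η/Real.pi : ℂ)‖ = η/Real.pi := by
          rw [← Complex.ofReal_div, Complex.norm_real, Real.norm_of_nonneg (by positivity)]
        rw [this]; simp
      constructor
      · refine Filter.Eventually.of_forall fun w => ?_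
        rw [← integrable_norm_iff (by fun_prop)]
        simp only [hn]
        have hq : 0 < η^2+w^2 := by positivity
        exact (integrableOn_exp_mul_Ioi (by linarith) 0).const_mul _
      · simp only [hn]
        refine (integrable_poisson hη).congr (Filter.Eventually.of_forall fun w => ?_)
        have hq : 0 < η^2+w^2 := by positivity
        simp only
        rw [integral_const_mul, integral_exp_mul_Ioi (by linarith), mul_zero, Real.exp_zero, neg_div_neg_eq]
        field_simp
    exact this
end

noncomputable section
open MeasureTheory Metric Complex
open scoped ENNReal FourierTransform SchwartzMap

set_option linter.unusedSectionVars false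
section ExpNorm
variable {W : Type*} [NormedAddCommGroup W] [InnerProductSpace ℝ W] [FiniteDimensional ℝ W]
  [MeasurableSpace W] [BorelSpace W]

lemma exp_neg_le_pow {κ : ℝ} (hκ : 0 < κ) (m : ℕ) {t : ℝ} (ht : 0 ≤ t) :
    Real.exp (-(κ*t)) ≤ (m.factorial * Real.exp κ / κ^m) * (1+t)^(-(m:ℝ)) := by
  have h := Real.pow_div_factorial_le_exp (κ*(1+t)) (by positivity) m
  rw [Real.rpow_neg (by positivity), Real.rpow_natCast]
  have e : Real.exp (κ*(1+t)) = Real.exp κ * Real.exp (κ*t) := by rw [← Real.exp_add]; ring_nf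
  rw [e, mul_pow, div_le_iff₀ (by positivity)] at h
  rw [Real.exp_neg, ← div_eq_mul_inv, div_div, inv_eq_one_div, div_le_div_iff₀ (by positivity) (by positivity)]
  linarith

lemma integrable_exp_norm {κ : ℝ} (hκ : 0 < κ) : Integrable (fun x : W => Real.exp (-(κ*‖x‖))) := by
  have h : Integrable (fun x : W => (1+‖x‖)^(-((Module.finrank ℝ W + 1 : ℕ):ℝ))) :=
    integrable_one_add_norm (by push_cast; linarith)
  refine (h.const_mul ((Module.finrank ℝ W + 1).factorial * Real.exp κ / κ^(Module.finrank ℝ W + 1))).mono'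
    (by fun_prop) (Filter.Eventually.of_forall fun x => ?_)
  rw [Real.norm_of_nonneg (Real.exp_pos _).le]
  exact exp_neg_le_pow hκ _ (norm_nonneg x)

/-- the constant in the Fourier transform of `exp (-2πη|x|)` -/
def cW (W : Type*) [NormedAddCommGroup W] [InnerProductSpace ℝ W] : ℝ :=
  Real.pi^(-(((Module.finrank ℝ W : ℝ)+1)/2)) * Real.Gamma (((Module.finrank ℝ W : ℝ)+1)/2)

lemma cW_pos : 0 < cW W := by
  unfold cW
  have := Real.pi_pos
  have := Real.Gamma_pos_of_pos (s := ((Module.finrank ℝ W : ℝ)+1)/2) (by positivity)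
  positivity

lemma ft_exp_norm_real {η : ℝ} (hη : 0 < η) (ξ : W) :
    𝓕 (fun x : W => ((Real.exp (-(2*Real.pi*η*‖x‖)) : ℝ) : ℂ)) ξ =
      ((cW W * η * (η^2+‖ξ‖^2)^(-(((Module.finrank ℝ W : ℝ)+1)/2)) : ℝ) : ℂ) := by
  have hpi := Real.pi_pos
  have hsp : 0 < Real.sqrt Real.pi := Real.sqrt_pos.2 hpi
  set d := Module.finrank ℝ W with hd
  rw [Real.fourier_eq']
  have h1 : ∀ x : W, cexp (↑(-2 * Real.pi * inner ℝ x ξ) * I) • ((Real.exp (-(2*Real.pi*η*‖x‖)) : ℝ) : ℂ) =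
    ∫ s in Set.Ioi (0:ℝ), ((η/Real.sqrt Real.pi * s^(-(1/2):ℝ) * Real.exp (-(s*η^2)) : ℝ) : ℂ) *
      (cexp (↑(-2 * Real.pi * inner ℝ x ξ) * I) • cexp (-((Real.pi^2/s : ℝ):ℂ) * ((‖x‖:ℝ):ℂ)^2)) := by
    intro x
    rw [subordination hη (norm_nonneg x)]
    rw [← integral_const_mul, ← integral_complex_ofReal, smul_eq_mul, ← integral_const_mul]
    congr 1; ext s
    have : (-((Real.pi^2/s : ℝ):ℂ) * ((‖x‖:ℝ):ℂ)^2) = ((-(Real.pi^2*‖x‖^2/s) : ℝ) : ℂ) := by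
      push_cast; ring
    rw [this, ← Complex.ofReal_exp, smul_eq_mul]
    push_cast; ring
  simp_rw [h1]
  have hG : ∀ s ∈ Set.Ioi (0:ℝ), ∫ x : W, cexp (↑(-2 * Real.pi * inner ℝ x ξ) * I) • cexp (-((Real.pi^2/s : ℝ):ℂ) * ((‖x‖:ℝ):ℂ)^2)
      = (((s/Real.pi)^((d:ℝ)/2) * Real.exp (-(s*‖ξ‖^2)) : ℝ) : ℂ) := by
    intro s hs
    have hs' : (0:ℝ) < s := hs
    have g := fourier_gaussian_innerProductSpace (V := W) (b := ((Real.pi^2/s : ℝ):ℂ)) (by rw [Complex.ofReal_re]; positivity) ξ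
    rw [Real.fourier_eq'] at g
    rw [g, Complex.ofReal_mul, Complex.ofReal_cpow (by positivity), Complex.ofReal_exp]
    have hpc : (Real.pi : ℂ) ≠ 0 := by exact_mod_cast hpi.ne'
    have hsc : (s : ℂ) ≠ 0 := by exact_mod_cast hs'.ne'
    congr 2
    · push_cast; field_simp
    · push_cast; rfl
    · push_cast; field_simp
  rw [integral_integral_swap]
  · have hs2 : ∀ s ∈ Set.Ioi (0:ℝ), (∫ x : W, ((η/Real.sqrt Real.pi * s^(-(1/2):ℝ) * Real.exp (-(s*η^2)) : ℝ) : ℂ) *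
      (cexp (↑(-2 * Real.pi * inner ℝ x ξ) * I) • cexp (-((Real.pi^2/s : ℝ):ℂ) * ((‖x‖:ℝ):ℂ)^2))) =
      ((η * Real.pi^(-(((d:ℝ)+1)/2)) * (s^((((d:ℝ)+1)/2)-1) * Real.exp (-((η^2+‖ξ‖^2)*s))) : ℝ) : ℂ) := by
      intro s hs
      have hs' : (0:ℝ) < s := hs
      rw [integral_const_mul, hG s hs, ← Complex.ofReal_mul]
      congr 1
      rw [Real.div_rpow hs'.le hpi.le, show -((η^2+‖ξ‖^2)*s) = -(s*η^2) + -(s*‖ξ‖^2) by ring, Real.exp_add,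
        show (((d:ℝ)+1)/2)-1 = -(1/2) + (d:ℝ)/2 by ring, Real.rpow_add hs',
        show -(((d:ℝ)+1)/2) = -(1/2) - (d:ℝ)/2 by ring, Real.rpow_sub hpi, Real.rpow_neg hpi.le,
        ← Real.sqrt_eq_rpow]
      field_simp
    rw [setIntegral_congr_fun measurableSet_Ioi hs2, integral_complex_ofReal, integral_const_mul,
      Real.integral_rpow_mul_exp_neg_mul_Ioi (by positivity) (by positivity)]
    congr 1
    unfold cW
    rw [← hd, Real.rpow_neg (x := η^2+‖ξ‖^2) (by positivity), one_div, Real.inv_rpow (by positivity)]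
    ring
  · have hnorm : ∀ (x : W) (s : ℝ), 0 < s → ‖((η/Real.sqrt Real.pi * s^(-(1/2):ℝ) * Real.exp (-(s*η^2)) : ℝ) : ℂ) *
      (cexp (↑(-2 * Real.pi * inner ℝ x ξ) * I) • cexp (-((Real.pi^2/s : ℝ):ℂ) * ((‖x‖:ℝ):ℂ)^2))‖ =
      (η/Real.sqrt Real.pi * s^(-(1/2):ℝ) * Real.exp (-(s*η^2))) * Real.exp (-(Real.pi^2*‖x‖^2/s)) := by
      intro x s hs
      have : (-((Real.pi^2/s : ℝ):ℂ) * ((‖x‖:ℝ):ℂ)^2) = ((-(Real.pi^2*‖x‖^2/s) : ℝ) : ℂ) := by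
        push_cast; ring
      rw [this, ← Complex.ofReal_exp, smul_eq_mul, norm_mul, norm_mul, Complex.norm_exp_ofReal_mul_I, one_mul,
        Complex.norm_real, Complex.norm_real, Real.norm_of_nonneg (by positivity), Real.norm_of_nonneg (by positivity)]
    have hmeas : AEStronglyMeasurable (fun q : W × ℝ => ((η/Real.sqrt Real.pi * q.2^(-(1/2):ℝ) * Real.exp (-(q.2*η^2)) : ℝ) : ℂ) *
      (cexp (↑(-2 * Real.pi * inner ℝ q.1 ξ) * I) • cexp (-((Real.pi^2/q.2 : ℝ):ℂ) * ((‖q.1‖:ℝ):ℂ)^2)))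
      ((volume : Measure W).prod (volume.restrict (Set.Ioi 0))) := by
      apply Measurable.aestronglyMeasurable
      fun_prop
    have : Integrable (fun q : W × ℝ => ((η/Real.sqrt Real.pi * q.2^(-(1/2):ℝ) * Real.exp (-(q.2*η^2)) : ℝ) : ℂ) *
      (cexp (↑(-2 * Real.pi * inner ℝ q.1 ξ) * I) • cexp (-((Real.pi^2/q.2 : ℝ):ℂ) * ((‖q.1‖:ℝ):ℂ)^2)))
      ((volume : Measure W).prod (volume.restrict (Set.Ioi 0))) := by
      rw [integrable_prod_iff hmeas]
      constructor
      · refine Filter.Eventually.of_forall fun x => ?_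
        have hb : IntegrableOn (fun s : ℝ => (η/Real.sqrt Real.pi) * (s^(-(1/2):ℝ) * Real.exp (-η^2*s))) (Set.Ioi 0) := by
          apply Integrable.const_mul
          have := Real.GammaIntegral_convergent (s := 1/2) (by norm_num)
          have h3 := (integrableOn_Ioi_comp_mul_left_iff (fun x : ℝ => Real.exp (-x) * x^((1/2:ℝ)-1)) 0 (a := η^2) (by positivity)).2 (by simpa using this)
          refine IntegrableOn.congr_fun (h3.const_mul (η)) ?_ measurableSet_Ioi
          intro s hs
          have hs' : (0:ℝ) < s := hs
          simp only
          rw [Real.mul_rpow (by positivity) hs'.le, ← Real.rpow_natCast, ← Real.rpow_mul hη.le]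
          norm_num
          rw [Real.rpow_neg_one]
          field_simp
        refine Integrable.mono' hb (by apply Measurable.aestronglyMeasurable; fun_prop) ?_
        filter_upwards [ae_restrict_mem measurableSet_Ioi] with s hs
        rw [hnorm x s hs]
        have hs' : (0:ℝ) < s := hs
        have : Real.exp (-(Real.pi^2*‖x‖^2/s)) ≤ 1 := Real.exp_le_one_iff.2 (by
          have : 0 ≤ Real.pi^2*‖x‖^2/s := by positivity
          linarith)
        calc _ ≤ (η/Real.sqrt Real.pi * s^(-(1/2):ℝ) * Real.exp (-(s*η^2))) * 1 := by gcongr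
          _ = _ := by rw [show -(s*η^2) = -η^2*s by ring]; ring
      · refine (integrable_exp_norm (W := W) (κ := 2*Real.pi*η) (by positivity)).congr (Filter.Eventually.of_forall fun x => ?_)
        simp only
        rw [setIntegral_congr_fun measurableSet_Ioi (fun s hs => hnorm x s hs), subordination hη (norm_nonneg x),
          ← integral_const_mul]
        congr 1; ext s; ring
    exact this

lemma slit_of_re_pos {η : ℂ} (hη : 0 < η.re) {r : ℝ} (hr : 0 ≤ r) : η^2 + r ∈ slitPlane := by
  rw [mem_slitPlane_iff]
  by_cases h : η.im = 0
  · left; simp [pow_two, h]; positivity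
  · right; simp [pow_two]; 
    rw [mul_comm, ← two_mul]; positivity

lemma ft_exp_norm {η : ℂ} (hη : 0 < η.re) (ξ : W) :
    𝓕 (fun x : W => cexp (-(2*Real.pi*η*‖x‖))) ξ =
      cW W * η * (η^2+((‖ξ‖^2 : ℝ) : ℂ))^(((-(((Module.finrank ℝ W : ℝ)+1)/2) : ℝ)) : ℂ) := by
  have hpi := Real.pi_pos
  set U : Set ℂ := {z | 0 < z.re} with hU
  have hUo : IsOpen U := isOpen_lt continuous_const Complex.continuous_re
  have hUc : IsPreconnected U := (convex_halfSpace_re_gt 0).isPreconnected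
  set F : ℂ → ℂ := fun η => 𝓕 (fun x : W => cexp (-(2*Real.pi*η*‖x‖))) ξ with hF
  set G : ℂ → ℂ := fun η => cW W * η * (η^2+((‖ξ‖^2 : ℝ) : ℂ))^(((-(((Module.finrank ℝ W : ℝ)+1)/2) : ℝ)) : ℂ) with hG
  have hGd : DifferentiableOn ℂ G U := by
    intro z hz
    apply DifferentiableAt.differentiableWithinAt
    have : z^2+((‖ξ‖^2 : ℝ) : ℂ) ∈ slitPlane := slit_of_re_pos hz (by positivity)
    apply DifferentiableAt.mul (by fun_prop)
    exact DifferentiableAt.cpow_const (by fun_prop) this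
  have hFd : DifferentiableOn ℂ F U := by
    intro z hz
    apply DifferentiableAt.differentiableWithinAt
    have hz' : 0 < z.re := hz
    have hre : ∀ (w : ℂ) (x : W), ‖cexp (↑(-2 * Real.pi * inner ℝ x ξ) * I) • cexp (-(2*Real.pi*w*‖x‖))‖ = Real.exp (-(2*Real.pi*w.re*‖x‖)) := by
      intro w x
      rw [smul_eq_mul, norm_mul, Complex.norm_exp_ofReal_mul_I, one_mul, Complex.norm_exp]
      congr 1
      have : (-(2*Real.pi*w*‖x‖) : ℂ) = ((-(2*Real.pi*‖x‖):ℝ):ℂ)*w := by push_cast; ring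
      rw [this, Complex.re_ofReal_mul]; ring
    have key := hasDerivAt_integral_of_dominated_loc_of_deriv_le (μ := (volume : Measure W)) (𝕜 := ℂ)
      (F := fun (w : ℂ) (x : W) => cexp (↑(-2 * Real.pi * inner ℝ x ξ) * I) • cexp (-(2*Real.pi*w*‖x‖)))
      (F' := fun (w : ℂ) (x : W) => cexp (↑(-2 * Real.pi * inner ℝ x ξ) * I) • (cexp (-(2*Real.pi*w*‖x‖)) * (-(2*Real.pi*‖x‖))))
      (x₀ := z) (s := ball z (z.re/2)) (bound := fun x => 4/z.re * Real.exp (-(Real.pi*z.re/2*‖x‖)))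
      (ball_mem_nhds z (by linarith)) (Filter.Eventually.of_forall fun w => by
        apply Continuous.aestronglyMeasurable; fun_prop) ?_ ?_ ?_ ?_ ?_
    · have := key.2.differentiableAt
      refine this.congr_of_eventuallyEq (Filter.Eventually.of_forall fun w => ?_)
      simp only [hF]; rw [Real.fourier_eq']
    · rw [← integrable_norm_iff (by apply Continuous.aestronglyMeasurable; fun_prop)]
      simp_rw [hre]
      exact integrable_exp_norm (by positivity)
    · apply Continuous.aestronglyMeasurable; fun_prop
    · refine Filter.Eventually.of_forall fun x w hw => ?_
      have hwr : z.re/2 ≤ w.re := by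
        have h1 : |(w - z).re| ≤ ‖w - z‖ := Complex.abs_re_le_norm _
        have h2 : ‖w - z‖ < z.re/2 := by simpa [dist_eq_norm] using hw
        have := (abs_le.1 (h1.trans h2.le)).1
        simp at this; linarith
      rw [← smul_mul_assoc, norm_mul, hre]
      have : ‖(-(2*Real.pi*‖x‖) : ℂ)‖ = 2*Real.pi*‖x‖ := by
        rw [norm_neg, ← Complex.ofReal_ofNat, ← Complex.ofReal_mul, ← Complex.ofReal_mul, Complex.norm_real, Real.norm_of_nonneg (by positivity)]
      rw [this]
      have h1 : Real.exp (-(2*Real.pi*w.re*‖x‖)) ≤ Real.exp (-(Real.pi*z.re*‖x‖)) := by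
        apply Real.exp_le_exp.2
        have : Real.pi*‖x‖*(z.re/2) ≤ Real.pi*‖x‖*w.re := by gcongr
        nlinarith
      have h2 : Real.pi*z.re/2*‖x‖ ≤ Real.exp (Real.pi*z.re/2*‖x‖) := by
        have := Real.add_one_le_exp (Real.pi*z.re/2*‖x‖); linarith
      have h3 : 2*Real.pi*‖x‖ ≤ 4/z.re * Real.exp (Real.pi*z.re/2*‖x‖) := by
        have : 2*Real.pi*‖x‖ = 4/z.re * (Real.pi*z.re/2*‖x‖) := by field_simp; ring
        rw [this]; gcongr
      calc _ ≤ Real.exp (-(Real.pi*z.re*‖x‖)) * (4/z.re * Real.exp (Real.pi*z.re/2*‖x‖)) := by gcongr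
        _ = 4/z.re * (Real.exp (-(Real.pi*z.re*‖x‖)) * Real.exp (Real.pi*z.re/2*‖x‖)) := by ring
        _ = _ := by rw [← Real.exp_add]; congr 2; ring
    · exact (integrable_exp_norm (by positivity)).const_mul _
    · refine Filter.Eventually.of_forall fun x w hw => ?_
      refine HasDerivAt.const_smul (f := fun y => cexp (-(2*Real.pi*y*‖x‖))) (cexp (↑(-2 * Real.pi * inner ℝ x ξ) * I)) ?_
      apply HasDerivAt.cexp
      have := ((hasDerivAt_id w).const_mul (-(2*Real.pi*‖x‖) : ℂ))
      simp only [id, mul_one] at this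
      refine this.congr_of_eventuallyEq (Filter.Eventually.of_forall fun y => ?_)
      simp only; ring
  have hFa := hFd.analyticOnNhd hUo
  have hGa := hGd.analyticOnNhd hUo
  have hreal : ∀ r : ℝ, 0 < r → F r = G r := by
    intro r hr
    have := ft_exp_norm_real (W := W) hr ξ
    simp only [hF, hG]
    rw [show (fun x : W => cexp (-(2*Real.pi*(r:ℂ)*‖x‖))) = (fun x : W => ((Real.exp (-(2*Real.pi*r*‖x‖)) : ℝ) : ℂ)) by
      ext x; push_cast; rfl, this]
    rw [Complex.ofReal_mul, Complex.ofReal_cpow (by positivity)]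
    push_cast; rfl
  have hfreq : ∃ᶠ z in nhdsWithin (1:ℂ) {1}ᶜ, F z = G z := by
    have ht : Filter.Tendsto (fun k : ℕ => ((1 + 1/((k:ℝ)+1) : ℝ) : ℂ)) Filter.atTop (nhdsWithin (1:ℂ) {1}ᶜ) := by
      rw [tendsto_nhdsWithin_iff]
      constructor
      · have := (tendsto_one_div_add_atTop_nhds_zero_nat (𝕜 := ℝ)).const_add 1
        have := (Complex.continuous_ofReal.tendsto _).comp this
        simpa [Function.comp_def] using this
      · refine Filter.Eventually.of_forall fun k => ?_
        have : (0:ℝ) < 1/((k:ℝ)+1) := by positivity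
        simp only [Set.mem_compl_iff, Set.mem_singleton_iff]
        intro h
        have h' : (1 + 1/((k:ℝ)+1) : ℝ) = 1 := by exact_mod_cast h
        linarith
    exact ht.frequently (Filter.Eventually.frequently (Filter.Eventually.of_forall fun k => hreal _ (by positivity)))
  exact hFa.eqOn_of_preconnected_of_frequently_eq hGa hUc (show (1:ℂ) ∈ U by simp [hU]) hfreq hη
end ExpNorm
end

noncomputable section
open MeasureTheory Metric Complex
open scoped ENNReal FourierTransform SchwartzMap

set_option linter.unusedSectionVars false
section NiceSec
variable {W : Type*} [NormedAddCommGroup W] [InnerProductSpace ℝ W] [FiniteDimensional ℝ W]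
  [MeasurableSpace W] [BorelSpace W]

/-- bounded measurable functions with bounded support -/
def Nice (f : W → ℂ) : Prop :=
  Measurable f ∧ (∃ B, ∀ x, ‖f x‖ ≤ B) ∧ (∃ R, ∀ x, R < ‖x‖ → f x = 0)

lemma Nice.mul_bdd {f g : W → ℂ} (hf : Nice f) (hg : Measurable g) {B : ℝ} (hB : ∀ x, ‖g x‖ ≤ B) :
    Nice (fun x => g x * f x) := by
  obtain ⟨hm, ⟨B', hB'⟩, R, hR⟩ := hf
  refine ⟨hg.mul hm, ⟨B * B', fun x => ?_⟩, R, fun x hx => by simp [hR x hx]⟩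
  rw [norm_mul]
  exact mul_le_mul (hB x) (hB' x) (norm_nonneg _) ((norm_nonneg _).trans (hB x))

lemma Nice.conj {f : W → ℂ} (hf : Nice f) : Nice (fun x => (starRingEnd ℂ) (f x)) := by
  obtain ⟨hm, ⟨B', hB'⟩, R, hR⟩ := hf
  exact ⟨Complex.continuous_conj.measurable.comp hm, ⟨B', fun x => by simpa using hB' x⟩, R,
    fun x hx => by simp [hR x hx]⟩

lemma Nice.memLp {f : W → ℂ} (hf : Nice f) (q : ℝ≥0∞) : MemLp f q := by
  obtain ⟨hm, ⟨B, hB⟩, R, hR⟩ := hf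
  have : IsFiniteMeasure ((volume : Measure W).restrict (closedBall 0 R)) :=
    ⟨by simpa using measure_closedBall_lt_top⟩
  have h1 : MemLp f q (volume.restrict (closedBall 0 R)) :=
    MemLp.of_bound (hm.aestronglyMeasurable) B (Filter.Eventually.of_forall hB)
  have : f = (closedBall (0:W) R).indicator f := by
    ext x
    by_cases hx : x ∈ closedBall (0:W) R
    · simp [hx]
    · simp only [hx, not_false_eq_true, Set.indicator_of_notMem]
      exact hR x (by simpa using hx)
  rw [this, memLp_indicator_iff_restrict measurableSet_closedBall]
  exact h1

lemma Nice.integrable {f : W → ℂ} (hf : Nice f) : Integrable f := memLp_one_iff_integrable.1 (hf.memLp 1)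

/-- squared L2 norm -/
def N2 {α : Type*} [MeasurableSpace α] (μ : Measure α) (f : α → ℂ) : ℝ := ∫ x, ‖f x‖^2 ∂μ

lemma N2_nonneg {α : Type*} [MeasurableSpace α] (μ : Measure α) (f : α → ℂ) : 0 ≤ N2 μ f :=
  integral_nonneg fun _ => by positivity

lemma integrable_sq {α : Type*} [MeasurableSpace α] {μ : Measure α} {f : α → ℂ} (hf : MemLp f 2 μ) :
    Integrable (fun x => ‖f x‖^2) μ := (memLp_two_iff_integrable_sq_norm hf.1).1 hf

lemma N2_of_eLpNorm {α β : Type*} [MeasurableSpace α] [MeasurableSpace β] {μ : Measure α} {ν : Measure β}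
    {f : α → ℂ} {g : β → ℂ} (hf : MemLp f 2 μ) (hg : MemLp g 2 ν)
    (h : eLpNorm f 2 μ = eLpNorm g 2 ν) : N2 μ f = N2 ν g := by
  have h1 := hf.eLpNorm_eq_integral_rpow_norm (by norm_num) (by norm_num)
  have h2 := hg.eLpNorm_eq_integral_rpow_norm (by norm_num) (by norm_num)
  rw [h, h2] at h1
  have p1 : 0 ≤ ∫ x, ‖f x‖^2 ∂μ := N2_nonneg μ f
  have p2 : 0 ≤ ∫ x, ‖g x‖^2 ∂ν := N2_nonneg ν g
  simp only [ENNReal.toReal_ofNat, Real.rpow_ofNat] at h1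
  rw [ENNReal.ofReal_eq_ofReal_iff (by positivity) (by positivity)] at h1
  have h3 := congrArg (fun z => z^(2:ℝ)) h1
  rw [← Real.rpow_mul p1, ← Real.rpow_mul p2] at h3
  norm_num at h3
  exact h3.symm

lemma N2_fourier {f : W → ℂ} (h1 : Integrable f) (h2 : MemLp f 2) : N2 volume (𝓕 f) = N2 volume f :=
  N2_of_eLpNorm (memLp_fourier h1 h2) h2 (eLpNorm_fourier h1 h2)

lemma N2_fourierInv {f : W → ℂ} (h1 : Integrable f) (h2 : MemLp f 2) : N2 volume (𝓕⁻ f) = N2 volume f :=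
  N2_of_eLpNorm (memLp_fourierInv h1 h2) h2 (eLpNorm_fourierInv h1 h2)

/-- the bilinear form with multiplier m -/
def BF (m : W → ℂ) (f g : W → ℂ) : ℂ := ∫ ξ, m ξ * (𝓕 f ξ * 𝓕⁻ g ξ)

lemma norm_mul_le_half {α : Type*} [MeasurableSpace α] {μ : Measure α} {m f g : α → ℂ} {a : ℝ}
    (hm : ∀ x, ‖m x‖ ≤ a) (hf : MemLp f 2 μ) (hg : MemLp g 2 μ) :
    ‖∫ x, m x * (f x * g x) ∂μ‖ ≤ a * ((N2 μ f + N2 μ g)/2) := by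
  rcases isEmpty_or_nonempty α with he | ⟨⟨x0⟩⟩
  · have : μ = 0 := Measure.eq_zero_of_isEmpty μ
    subst this
    simp [N2]
  have ha : 0 ≤ a := (norm_nonneg _).trans (hm x0)
  have i1 := integrable_sq hf
  have i2 := integrable_sq hg
  calc ‖∫ x, m x * (f x * g x) ∂μ‖ ≤ ∫ x, a * ((‖f x‖^2 + ‖g x‖^2)/2) ∂μ := by
        apply norm_integral_le_of_norm_le
        · exact ((i1.add i2).div_const 2).const_mul a
        · refine Filter.Eventually.of_forall fun x => ?_
          rw [norm_mul, norm_mul]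
          have : ‖f x‖ * ‖g x‖ ≤ (‖f x‖^2 + ‖g x‖^2)/2 := by nlinarith [sq_nonneg (‖f x‖ - ‖g x‖)]
          exact mul_le_mul (hm x) this (by positivity) ha
    _ = _ := by
        rw [integral_const_mul, integral_div, integral_add i1 i2]; rfl

lemma BF_bound {m f g : W → ℂ} {a : ℝ} (hm : ∀ x, ‖m x‖ ≤ a) (hf : Nice f) (hg : Nice g) :
    ‖BF m f g‖ ≤ a * ((N2 volume f + N2 volume g)/2) := by
  have := norm_mul_le_half hm (memLp_fourier hf.integrable (hf.memLp 2)) (memLp_fourierInv hg.integrable (hg.memLp 2))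
  rwa [N2_fourier hf.integrable (hf.memLp 2), N2_fourierInv hg.integrable (hg.memLp 2)] at this

lemma integrable_fourier_mul {f g : W → ℂ} (hf : Nice f) (hg : Nice g) :
    Integrable (fun ξ => 𝓕 f ξ * 𝓕⁻ g ξ) := by
  exact (memLp_fourier hf.integrable (hf.memLp 2)).integrable_mul (memLp_fourierInv hg.integrable (hg.memLp 2))

lemma integrable_kernel {k f g : W → ℂ} (hk : Integrable k) (hf : Nice f) (hg : Nice g) :
    Integrable (fun q : W × W => k q.1 * (f q.2 * g (q.2 + q.1))) := by
  have h := Integrable.mul_prod hk hf.integrable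
  obtain ⟨B, hB⟩ := hg.2.1
  have := h.mul_bdd (f := fun q : W × W => k q.1 * f q.2) (g := fun q : W × W => g (q.2 + q.1)) (c := B)
    (by apply Measurable.aestronglyMeasurable; exact hg.1.comp (measurable_snd.add measurable_fst))
    (Filter.Eventually.of_forall fun q => hB _)
  refine this.congr (Filter.Eventually.of_forall fun q => ?_)
  simp only; ring

lemma BF_kernel {k f g : W → ℂ} (hk : Integrable k) (hf : Nice f) (hg : Nice g) :
    BF (𝓕 k) f g = ∫ q : W × W, k q.1 * (f q.2 * g (q.2 + q.1)) := by
  unfold BF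
  rw [selfadj_fourier hk (integrable_fourier_mul hf hg),
    Measure.volume_eq_prod, integral_prod _ (integrable_kernel hk hf hg)]
  congr 1; ext z
  simp only
  rw [integral_const_mul]
  congr 1
  have hgz : Nice (fun x => g (x + z)) := by
    obtain ⟨hm, ⟨B, hB⟩, R, hR⟩ := hg
    refine ⟨hm.comp (measurable_id.add_const z), ⟨B, fun x => hB _⟩, R + ‖z‖, fun x hx => hR _ ?_⟩
    have : ‖x‖ ≤ ‖x+z‖ + ‖z‖ := by simpa using norm_sub_le (x+z) z
    linarith
  rw [← parseval_fourier hf.integrable (hf.memLp 2) hgz.integrable (hgz.memLp 2), Real.fourier_eq']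
  congr 1; ext ξ
  have : 𝓕⁻ (fun x => g (x+z)) ξ = cexp (↑(-2 * Real.pi * inner ℝ ξ z) * I) * 𝓕⁻ g ξ := by
    rw [Real.fourierInv_eq', Real.fourierInv_eq', ← integral_const_mul,
      ← integral_add_right_eq_self (fun y => cexp (↑(-2 * Real.pi * inner ℝ ξ z) * I) *
        (cexp (↑(2 * Real.pi * inner ℝ y ξ) * I) • g y)) z]
    congr 1; ext y
    rw [smul_eq_mul, smul_eq_mul, ← mul_assoc, ← Complex.exp_add]
    congr 2
    rw [inner_add_left, real_inner_comm z ξ]; push_cast; ring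
  rw [this, smul_eq_mul]; ring

lemma layer_cake_exp {F : W → ℝ≥0∞} (hF : Measurable F) {D : ℝ≥0∞} {q κ : ℝ} (hq : -1 < q) (hκ : 0 < κ)
    (y : W) (h : ∀ r > 0, ∫⁻ x in ball y r, F x ≤ D * ENNReal.ofReal (r^q)) :
    ∫⁻ x, ENNReal.ofReal (Real.exp (-(κ*‖x-y‖))) * F x ≤ D * ENNReal.ofReal (Real.Gamma (q+1) * κ^(-q)) := by
  have h1 : ∀ x : W, ENNReal.ofReal (Real.exp (-(κ*‖x-y‖))) * F x =
      ∫⁻ s in Set.Ioi (0:ℝ), ENNReal.ofReal (κ * Real.exp (-(κ*s))) * (ball y s).indicator F x := by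
    intro x
    have e : ∀ s : ℝ, ENNReal.ofReal (κ * Real.exp (-(κ*s))) * (ball y s).indicator F x =
        (Set.Ioi ‖x-y‖).indicator (fun s => ENNReal.ofReal (κ * Real.exp (-(κ*s))) * F x) s := by
      intro s
      by_cases hs : ‖x-y‖ < s
      · rw [Set.indicator_of_mem (show x ∈ ball y s by simpa [dist_eq_norm] using hs),
          Set.indicator_of_mem (show s ∈ Set.Ioi ‖x-y‖ from hs)]
      · rw [Set.indicator_of_notMem (show x ∉ ball y s by simpa [dist_eq_norm] using hs),
          Set.indicator_of_notMem (show s ∉ Set.Ioi ‖x-y‖ from hs), mul_zero]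
    simp_rw [e]
    rw [lintegral_indicator measurableSet_Ioi, Measure.restrict_restrict measurableSet_Ioi,
      Set.inter_eq_left.2 (Set.Ioi_subset_Ioi (norm_nonneg _)), lintegral_mul_const _ (by fun_prop)]
    congr 1
    have hi := (integrableOn_exp_mul_Ioi (a := -κ) (by linarith) ‖x-y‖).const_mul κ
    have := integral_exp_mul_Ioi (a := -κ) (by linarith) ‖x-y‖
    have e3 : ∀ s : ℝ, κ * Real.exp (-(κ*s)) = κ * Real.exp (-κ*s) := by intro s; ring_nf
    simp_rw [e3]
    rw [← ofReal_integral_eq_lintegral_ofReal hi (Filter.Eventually.of_forall fun s => by positivity),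
      integral_const_mul, this]
    congr 1
    rw [neg_div_neg_eq]; field_simp
  simp_rw [h1]
  rw [lintegral_lintegral_swap]
  · calc ∫⁻ s in Set.Ioi (0:ℝ), ∫⁻ x, ENNReal.ofReal (κ * Real.exp (-(κ*s))) * (ball y s).indicator F x
        ≤ ∫⁻ s in Set.Ioi (0:ℝ), D * ENNReal.ofReal (κ * (s^((q+1)-1) * Real.exp (-(κ*s)))) := by
          apply setLIntegral_mono (by fun_prop)
          intro s hs
          have hs' : (0:ℝ) < s := hs
          rw [lintegral_const_mul' _ _ ENNReal.ofReal_ne_top, lintegral_indicator measurableSet_ball]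
          calc _ ≤ ENNReal.ofReal (κ * Real.exp (-(κ*s))) * (D * ENNReal.ofReal (s^q)) := by
                gcongr; exact h s hs
            _ = D * (ENNReal.ofReal (κ * Real.exp (-(κ*s))) * ENNReal.ofReal (s^q)) := by ring
            _ = _ := by
                rw [← ENNReal.ofReal_mul (by positivity)]; congr 2; ring_nf
      _ = _ := by
          rw [lintegral_const_mul _ (by fun_prop)]
          congr 1
          have hgi := Real.integral_rpow_mul_exp_neg_mul_Ioi (a := q+1) (r := κ) (by linarith) hκ
          have hgp : 0 < (1/κ)^(q+1) * Real.Gamma (q+1) := by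
            have := Real.Gamma_pos_of_pos (s := q+1) (by linarith)
            positivity
          have hint : IntegrableOn (fun s => s^((q+1)-1) * Real.exp (-(κ*s))) (Set.Ioi 0) := by
            by_contra hc
            rw [integral_undef hc] at hgi
            linarith
          rw [← ofReal_integral_eq_lintegral_ofReal (hint.const_mul κ), integral_const_mul, hgi]
          · congr 1
            rw [one_div, Real.inv_rpow hκ.le, Real.rpow_add hκ, Real.rpow_one, Real.rpow_neg hκ.le]
            field_simp
          · filter_upwards [ae_restrict_mem measurableSet_Ioi] with s hs
            have hs' : (0:ℝ) < s := hs
            simp only [Pi.zero_apply]; positivity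
  · apply Measurable.aemeasurable
    have hset : MeasurableSet {a : W × ℝ | a.1 ∈ ball y a.2} := by
      simp only [mem_ball]
      exact measurableSet_lt (by fun_prop) (by fun_prop)
    have : (Function.uncurry fun (x : W) (s : ℝ) => ENNReal.ofReal (κ * Real.exp (-(κ*s))) * (ball y s).indicator F x)
      = fun a : W × ℝ => ENNReal.ofReal (κ * Real.exp (-(κ*a.2))) * ({a : W × ℝ | a.1 ∈ ball y a.2}.indicator (fun a => F a.1) a) := by
      ext ⟨x, s⟩
      simp only [Function.uncurry]
      congr 1
    rw [this]
    exact Measurable.mul (by fun_prop) ((hF.comp measurable_fst).indicator hset)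
end NiceSec
end

noncomputable section
open MeasureTheory Metric Complex
open scoped ENNReal FourierTransform SchwartzMap

set_option linter.unusedSectionVars false
section INTSec
variable {W : Type*} [NormedAddCommGroup W] [InnerProductSpace ℝ W] [FiniteDimensional ℝ W]
  [MeasurableSpace W] [BorelSpace W]

lemma kernel_schur {f g b : W → ℝ≥0∞} (hf : Measurable f) (hg : Measurable g) (hb : Measurable b)
    {κ : ℝ} {K : ℝ≥0∞} (h : ∀ y, ∫⁻ x, ENNReal.ofReal (Real.exp (-(κ*‖x-y‖))) * b x ≤ K) :
    ∫⁻ q : W × W, ENNReal.ofReal (Real.exp (-(κ*‖q.1‖))) * (f q.2 * b (q.2+q.1) + g (q.2+q.1) * b q.2)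
      ≤ K * ((∫⁻ x, f x) + ∫⁻ x, g x) := by
  have e : ∀ q : W × W, ENNReal.ofReal (Real.exp (-(κ*‖q.1‖))) * (f q.2 * b (q.2+q.1) + g (q.2+q.1) * b q.2)
      = ENNReal.ofReal (Real.exp (-(κ*‖q.1‖))) * (f q.2 * b (q.2+q.1)) +
        ENNReal.ofReal (Real.exp (-(κ*‖q.1‖))) * (g (q.2+q.1) * b q.2) := fun q => mul_add _ _ _
  simp_rw [e]
  rw [lintegral_add_left (by fun_prop), mul_add]
  apply add_le_add
  · rw [Measure.volume_eq_prod, lintegral_prod_symm' _ (by fun_prop), ← lintegral_const_mul _ hf]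
    apply lintegral_mono
    intro x
    simp only
    have : ∀ z, ENNReal.ofReal (Real.exp (-(κ*‖z‖))) * (f x * b (x+z)) =
        f x * (ENNReal.ofReal (Real.exp (-(κ*‖z‖))) * b (x+z)) := fun z => by ring
    simp_rw [this]
    rw [lintegral_const_mul _ (by fun_prop), mul_comm]
    gcongr
    have h2 := h x
    rw [← lintegral_add_left_eq_self _ x] at h2
    simpa using h2
  · rw [Measure.volume_eq_prod, lintegral_prod _ (by fun_prop)]
    have : ∀ z, ∫⁻ x, ENNReal.ofReal (Real.exp (-(κ*‖z‖))) * (g (x+z) * b x) =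
        ∫⁻ y, ENNReal.ofReal (Real.exp (-(κ*‖z‖))) * (g y * b (y - z)) := by
      intro z
      rw [← lintegral_add_right_eq_self (fun y => ENNReal.ofReal (Real.exp (-(κ*‖z‖))) * (g y * b (y - z))) z]
      simp
    simp_rw [this]
    rw [lintegral_lintegral_swap (by fun_prop), ← lintegral_const_mul _ hg]
    apply lintegral_mono
    intro y
    simp only
    have : ∀ z, ENNReal.ofReal (Real.exp (-(κ*‖z‖))) * (g y * b (y-z)) =
        g y * (ENNReal.ofReal (Real.exp (-(κ*‖z‖))) * b (y-z)) := fun z => by ring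
    simp_rw [this]
    rw [lintegral_const_mul _ (by fun_prop), mul_comm]
    gcongr
    have h2 := h y
    rw [← lintegral_sub_left_eq_self _ y] at h2
    simpa using h2

lemma N2_eq_lintegral {α : Type*} [MeasurableSpace α] {μ : Measure α} {f : α → ℂ} (hf : MemLp f 2 μ) :
    ∫⁻ x, ‖f x‖ₑ^2 ∂μ = ENNReal.ofReal (N2 μ f) := by
  unfold N2
  rw [ofReal_integral_eq_lintegral_ofReal (integrable_sq hf) (Filter.Eventually.of_forall fun x => by positivity)]
  congr 1; ext x
  rw [ENNReal.ofReal_pow (norm_nonneg _), ofReal_norm]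

/-- the bound on truncated geometric mean -/
lemma trunc_bound {p s : ℝ} (hp : 1 ≤ p) : |Real.exp (s/2) - Real.exp (-(|s|/2))| ≤ Real.exp (p*s/2) := by
  rcases le_or_gt 0 s with h | h
  · rw [abs_of_nonneg h]
    have h1 : Real.exp (-(s/2)) ≤ Real.exp (s/2) := Real.exp_le_exp.2 (by linarith)
    have h2 : Real.exp (s/2) ≤ Real.exp (p*s/2) := Real.exp_le_exp.2 (by nlinarith)
    have := Real.exp_pos (-(s/2))
    rw [abs_of_nonneg (by linarith)]; linarith
  · rw [abs_of_neg h]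
    have : -(-s/2) = s/2 := by ring
    rw [this]; simp [Real.exp_pos _ |>.le]


lemma INT_PJ {k : W → ℂ} (hk : Integrable k) (hkm : Measurable k) {a : ℝ}
    (ha : ∀ ξ, ‖𝓕 k ξ‖ ≤ a) {lu : W → ℝ} (hlum : Measurable lu) {Z : W → ℂ} (hZm : Measurable Z)
    (hZn : ∀ x, ‖Z x‖ ≤ 1) {φ ψ : W → ℂ} (hφ : Nice φ) (hψ : Nice ψ) :
    ‖∫ q : W × W, (k q.1 * (φ q.2 * ψ (q.2 + q.1))) * (Z q.2 * Z (q.2 + q.1)) *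
      ((Real.exp (-(|lu q.2 + lu (q.2+q.1)|/2)) : ℝ) : ℂ)‖ ≤ a * ((N2 volume φ + N2 volume ψ)/2) := by
  have hpi := Real.pi_pos
  obtain ⟨U, hU⟩ : ∃ U : ℝ → W → ℂ, U = fun τ x => Z x * cexp ((τ * lu x : ℝ) * I) := ⟨_, rfl⟩
  have hUm : ∀ τ, Measurable (U τ) := by intro τ; simp only [hU]; fun_prop
  have hUn : ∀ τ x, ‖U τ x‖ ≤ 1 := by
    intro τ x; simp only [hU]; rw [norm_mul, Complex.norm_exp_ofReal_mul_I, mul_one]; exact hZn x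
  obtain ⟨c, hc⟩ : ∃ c : W × W → ℂ, c = fun q => k q.1 * (φ q.2 * ψ (q.2 + q.1)) := ⟨_, rfl⟩
  have hci : Integrable c := by rw [hc]; exact integrable_kernel hk hφ hψ
  have hcm : Measurable c := by
    have := hφ.1; have := hψ.1
    simp only [hc]; fun_prop
  obtain ⟨ZZ, hZZ⟩ : ∃ ZZ : W × W → ℂ, ZZ = fun q => Z q.2 * Z (q.2 + q.1) := ⟨_, rfl⟩
  have hZZm : Measurable ZZ := by simp only [hZZ]; fun_prop
  have hZZn : ∀ q, ‖ZZ q‖ ≤ 1 := by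
    intro q; simp only [hZZ]; rw [norm_mul]; exact mul_le_one₀ (hZn _) (norm_nonneg _) (hZn _)
  obtain ⟨s, hs⟩ : ∃ s : W × W → ℝ, s = fun q => lu q.2 + lu (q.2 + q.1) := ⟨_, rfl⟩
  have hsm : Measurable s := by simp only [hs]; fun_prop
  obtain ⟨P, hP⟩ : ∃ P : ℝ → ℝ, P = fun w => (1/2)/(Real.pi*((1/2)^2+w^2)) := ⟨_, rfl⟩
  have hPi : Integrable P := by rw [hP]; exact integrable_poisson (by norm_num)
  have hPpos : ∀ w, 0 ≤ P w := by intro w; simp only [hP]; positivity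
  have hP1 : ∫ w, P w = 1 := by rw [hP]; exact integral_poisson (by norm_num)
  have hUφ : ∀ τ, Nice (fun x => U τ x * φ x) := fun τ => hφ.mul_bdd (hUm τ) (hUn τ)
  have hUψ : ∀ τ, Nice (fun x => U τ x * ψ x) := fun τ => hψ.mul_bdd (hUm τ) (hUn τ)
  obtain ⟨J, hJ⟩ : ∃ J : ℝ → ℂ, J = fun τ => BF (𝓕 k) (fun x => U τ x * φ x) (fun x => U τ x * ψ x) := ⟨_, rfl⟩
  have N2le : ∀ (τ : ℝ) (f : W → ℂ), Nice f → Nice (fun x => U τ x * f x) → N2 volume (fun x => U τ x * f x) ≤ N2 volume f := by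
    intro τ f hf hf'
    apply integral_mono (integrable_sq (hf'.memLp 2)) (integrable_sq (hf.memLp 2))
    intro x
    simp only
    gcongr
    rw [norm_mul]
    calc _ ≤ 1 * ‖f x‖ := by gcongr; exact hUn τ x
      _ = _ := one_mul _
  have ha0 : 0 ≤ a := (norm_nonneg _).trans (ha 0)
  have hJb : ∀ τ, ‖J τ‖ ≤ a * ((N2 volume φ + N2 volume ψ)/2) := by
    intro τ
    rw [hJ]
    refine (BF_bound ha (hUφ τ) (hUψ τ)).trans ?_
    have := N2le τ φ hφ (hUφ τ)
    have := N2le τ ψ hψ (hUψ τ)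
    gcongr
  have hJeq : ∀ τ, J τ = ∫ q, c q * ZZ q * cexp ((τ * s q : ℝ) * I) := by
    intro τ
    simp only [hJ]
    rw [BF_kernel hk (hUφ τ) (hUψ τ)]
    congr 1; ext q
    simp only [hc, hZZ, hU, hs]
    have : cexp ((τ * (lu q.2 + lu (q.2+q.1)) : ℝ) * I) = cexp ((τ * lu q.2 : ℝ) * I) * cexp ((τ * lu (q.2+q.1) : ℝ) * I) := by
      rw [← Complex.exp_add]; congr 1; push_cast; ring
    rw [this]; ring
  have hPJ : ∫ τ, (P τ : ℂ) * J τ = ∫ q, c q * ZZ q * ((Real.exp (-(|s q|/2)) : ℝ) : ℂ) := by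
    simp_rw [hJeq, ← integral_const_mul]
    rw [integral_integral_swap]
    · congr 1; ext q
      have := poisson_inv (η := 1/2) (by norm_num) (s q/(2*Real.pi))
      have e1 : -(2*Real.pi*(1/2)*|s q/(2*Real.pi)|) = -(|s q|/2) := by
        rw [abs_div, abs_of_pos (show 0 < 2*Real.pi by positivity)]; field_simp
      rw [e1] at this
      rw [← this, ← integral_const_mul]
      congr 1; ext τ
      have e2 : ((τ * s q : ℝ) : ℂ) * I = 2 * Real.pi * ((s q/(2*Real.pi) : ℝ) : ℂ) * τ * I := by
        have hpc : (Real.pi : ℂ) ≠ 0 := by exact_mod_cast hpi.ne'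
        push_cast; field_simp
      rw [e2]; simp only [hP]; ring
    · have hPc : Integrable (fun τ => (P τ : ℂ)) := hPi.ofReal
      have h1 := Integrable.mul_prod hPc hci
      have h2 := h1.mul_bdd (c := 1) (g := fun a : ℝ × (W × W) => ZZ a.2 * cexp ((a.1 * s a.2 : ℝ) * I))
        (by apply Measurable.aestronglyMeasurable; fun_prop)
        (Filter.Eventually.of_forall fun a => by
          rw [norm_mul, Complex.norm_exp_ofReal_mul_I, mul_one]; exact hZZn _)
      refine h2.congr (Filter.Eventually.of_forall fun a => ?_)
      simp only [Function.uncurry]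
      ring
  have hPJb : ‖∫ τ, (P τ : ℂ) * J τ‖ ≤ a * ((N2 volume φ + N2 volume ψ)/2) := by
    calc _ ≤ ∫ τ, P τ * (a * ((N2 volume φ + N2 volume ψ)/2)) := by
          apply norm_integral_le_of_norm_le (hPi.mul_const _)
          refine Filter.Eventually.of_forall fun τ => ?_
          rw [norm_mul, Complex.norm_real, Real.norm_of_nonneg (hPpos τ)]
          exact mul_le_mul_of_nonneg_left (hJb τ) (hPpos τ)
      _ = _ := by rw [integral_mul_const, hP1, one_mul]
  rw [hPJ] at hPJb
  simpa only [hc, hZZ, hs] using hPJb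

/-- pointwise algebra for the truncated part -/
lemma INT_pt {x y l p κz β X1 Y1 cn : ℝ} {zz : ℂ} (hp : 1 ≤ p) (hl : 0 < l) (hx : 0 < x) (hy : 0 < y)
    (hz : ‖zz‖ ≤ 1) (hβ : 0 ≤ β) (hX1 : 0 ≤ X1) (hY1 : 0 ≤ Y1)
    (hcn : cn ≤ β * Real.exp κz * (X1 * Y1)) (hcn0 : 0 ≤ cn) :
    cn * (‖zz‖ * |Real.exp ((Real.log (x/l) + Real.log (y/l))/2) - Real.exp (-(|Real.log (x/l) + Real.log (y/l)|/2))|)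
      ≤ β * l^(-p) / 2 * (Real.exp κz * (X1^2 * y^p + Y1^2 * x^p)) := by
  obtain ⟨X, hXd⟩ : ∃ X, X = x ^ (p/2) := ⟨_, rfl⟩
  obtain ⟨Y, hYd⟩ : ∃ Y, Y = y ^ (p/2) := ⟨_, rfl⟩
  have hX0 : 0 ≤ X := by rw [hXd]; positivity
  have hY0 : 0 ≤ Y := by rw [hYd]; positivity
  have hX : x ^ p = X^2 := by
    rw [hXd, ← Real.rpow_natCast, ← Real.rpow_mul hx.le]; congr 1; push_cast; ring
  have hY : y ^ p = Y^2 := by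
    rw [hYd, ← Real.rpow_natCast, ← Real.rpow_mul hy.le]; congr 1; push_cast; ring
  obtain ⟨s, hs⟩ : ∃ s, s = Real.log (x/l) + Real.log (y/l) := ⟨_, rfl⟩
  have hE : Real.exp (p * s/2) = l^(-p) * (X * Y) := by
    have : p * s / 2 = Real.log (x/l) * (p/2) + Real.log (y/l) * (p/2) := by rw [hs]; ring
    rw [this, Real.exp_add, Real.exp_mul, Real.exp_mul]
    rw [Real.exp_log (by positivity), Real.exp_log (by positivity), Real.div_rpow hx.le hl.le, Real.div_rpow hy.le hl.le]
    have : l^(-p) = (l^(p/2))⁻¹ * (l^(p/2))⁻¹ := by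
      rw [← Real.rpow_neg hl.le, ← Real.rpow_add hl]; congr 1; ring
    rw [this, ← hXd, ← hYd]; field_simp
  rw [← hs, hX, hY]
  have t1 := trunc_bound (s := s) hp
  have h3 : ‖zz‖ * |Real.exp (s/2) - Real.exp (-(|s|/2))| ≤ 1 * (l^(-p) * (X * Y)) := by
    rw [← hE]; gcongr
  rw [one_mul] at h3
  have hXY : X1 * Y1 * (X*Y) ≤ (X1^2*Y^2 + Y1^2 * X^2)/2 := by
    nlinarith [sq_nonneg (X1 * Y - Y1 * X)]
  have hlp : 0 ≤ l^(-p) := by positivity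
  calc _ ≤ (β * Real.exp κz * (X1 * Y1)) * (l^(-p) * (X * Y)) := by gcongr
    _ = (β * Real.exp κz * l^(-p)) * (X1 * Y1 * (X*Y)) := by ring
    _ ≤ (β * Real.exp κz * l^(-p)) * ((X1^2*Y^2 + Y1^2 * X^2)/2) := by gcongr
    _ = _ := by ring

set_option maxHeartbeats 800000 in
lemma INT_B {k : W → ℂ} {β κ K l p : ℝ} (hp : 1 ≤ p) (hl : 0 < l)
    (hβ : 0 ≤ β) (hK : 0 ≤ K) (hkb : ∀ z, ‖k z‖ ≤ β * Real.exp (-(κ*‖z‖)))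
    {v : W → ℝ} (hv : Measurable v) (hv0 : ∀ x, 0 ≤ v x)
    (hvK : ∀ y, ∫⁻ x, ENNReal.ofReal (Real.exp (-(κ*‖x-y‖))) * ENNReal.ofReal (v x ^ p) ≤ ENNReal.ofReal K)
    {φ ψ : W → ℂ} (hφ : Nice φ) (hψ : Nice ψ) {B : W × W → ℂ} {Z : W × W → ℂ}
    (hZ1 : ∀ q, ‖Z q‖ ≤ 1) (hZ2 : ∀ q, v q.2 = 0 → Z q = 0) (hZ3 : ∀ q, v (q.2+q.1) = 0 → Z q = 0)
    (hB : ∀ q, B q = (k q.1 * (φ q.2 * ψ (q.2 + q.1))) * (Z q *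
      ((Real.exp ((Real.log (v q.2/l) + Real.log (v (q.2+q.1)/l))/2) -
        Real.exp (-(|Real.log (v q.2/l) + Real.log (v (q.2+q.1)/l)|/2)) : ℝ) : ℂ))) :
    ‖∫ q, B q‖ ≤ β * l^(-p) / 2 * (K * (N2 volume φ + N2 volume ψ)) := by
  have n1 := N2_nonneg volume φ
  have n2 := N2_nonneg volume ψ
  have hBb : ∫⁻ q, ‖B q‖ₑ ≤ ENNReal.ofReal (β * l^(-p) / 2 * (K * (N2 volume φ + N2 volume ψ))) := by
    have hm1 : Measurable fun x => ‖φ x‖ₑ^2 := hφ.1.enorm.pow_const 2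
    have hm2 : Measurable fun x => ‖ψ x‖ₑ^2 := hψ.1.enorm.pow_const 2
    have hks := kernel_schur hm1 hm2 (b := fun x => ENNReal.ofReal (v x ^ p)) (by fun_prop) hvK
    rw [N2_eq_lintegral (hφ.memLp 2), N2_eq_lintegral (hψ.memLp 2), ← ENNReal.ofReal_add (N2_nonneg _ _) (N2_nonneg _ _),
      ← ENNReal.ofReal_mul hK] at hks
    rw [ENNReal.ofReal_mul (by positivity)]
    refine le_trans ?_ (mul_le_mul_right hks _)
    rw [← lintegral_const_mul' _ _ ENNReal.ofReal_ne_top]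
    apply lintegral_mono
    intro q
    simp only
    rw [← ofReal_norm, ← ofReal_norm, ← ofReal_norm,
      ← ENNReal.ofReal_pow (norm_nonneg _), ← ENNReal.ofReal_pow (norm_nonneg _),
      ← ENNReal.ofReal_mul (by positivity), ← ENNReal.ofReal_mul (by positivity),
      ← ENNReal.ofReal_add (mul_nonneg (by positivity) (Real.rpow_nonneg (hv0 _) _)) (mul_nonneg (by positivity) (Real.rpow_nonneg (hv0 _) _)),
      ← ENNReal.ofReal_mul (by positivity), ← ENNReal.ofReal_mul (by positivity)]
    apply ENNReal.ofReal_le_ofReal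
    have r1 := Real.rpow_nonneg (hv0 q.2) p
    have r2 := Real.rpow_nonneg (hv0 (q.2+q.1)) p
    by_cases h1 : v q.2 = 0
    · rw [hB, hZ2 q h1, zero_mul, mul_zero, norm_zero]
      positivity
    by_cases h2 : v (q.2+q.1) = 0
    · rw [hB, hZ3 q h2, zero_mul, mul_zero, norm_zero]
      positivity
    have p1 : 0 < v q.2 := lt_of_le_of_ne (hv0 _) (Ne.symm h1)
    have p2 : 0 < v (q.2+q.1) := lt_of_le_of_ne (hv0 _) (Ne.symm h2)
    rw [hB, norm_mul, norm_mul (Z q), Complex.norm_real, Real.norm_eq_abs]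
    refine INT_pt hp hl p1 p2 (hZ1 q) hβ (norm_nonneg _) (norm_nonneg _) ?_ (norm_nonneg _)
    rw [norm_mul, norm_mul]
    have := hkb q.1
    gcongr
  have := (enorm_integral_le_lintegral_enorm B).trans hBb
  rw [← ofReal_norm] at this
  exact (ENNReal.ofReal_le_ofReal_iff (by positivity)).1 this

end INTSec
end

noncomputable section
open MeasureTheory Metric Complex
open scoped ENNReal FourierTransform SchwartzMap

set_option linter.unusedSectionVars false
section INTSec
variable {W : Type*} [NormedAddCommGroup W] [InnerProductSpace ℝ W] [FiniteDimensional ℝ W]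
  [MeasurableSpace W] [BorelSpace W]

set_option maxHeartbeats 800000 in
/-- weighted interpolation bound -/
lemma INT {k : W → ℂ} (hk : Integrable k) (hkm : Measurable k) {a β κ K l p : ℝ} (hp : 1 ≤ p) (hl : 0 < l)
    (hβ : 0 ≤ β) (hK : 0 ≤ K)
    (ha : ∀ ξ, ‖𝓕 k ξ‖ ≤ a) (hkb : ∀ z, ‖k z‖ ≤ β * Real.exp (-(κ*‖z‖)))
    {v : W → ℝ} (hv : Measurable v) (hv0 : ∀ x, 0 ≤ v x) {Bv : ℝ} (hvB : ∀ x, v x ≤ Bv)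
    (hvK : ∀ y, ∫⁻ x, ENNReal.ofReal (Real.exp (-(κ*‖x-y‖))) * ENNReal.ofReal (v x ^ p) ≤ ENNReal.ofReal K)
    {φ ψ : W → ℂ} (hφ : Nice φ) (hψ : Nice ψ) :
    ‖BF (𝓕 k) (fun x => (Real.sqrt (v x) : ℂ) * φ x) (fun x => (Real.sqrt (v x) : ℂ) * ψ x)‖ ≤
      (l * a + l^(1-p) * β * K) * ((N2 volume φ + N2 volume ψ)/2) := by
  obtain ⟨lu, hlu⟩ : ∃ lu : W → ℝ, lu = fun x => Real.log (v x / l) := ⟨_, rfl⟩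
  have hlum : Measurable lu := by rw [hlu]; fun_prop
  obtain ⟨Z, hZ⟩ : ∃ Z : W → ℂ, Z = fun x => if v x = 0 then 0 else 1 := ⟨_, rfl⟩
  have hZm : Measurable Z := by rw [hZ]; exact Measurable.ite (hv (measurableSet_singleton 0)) measurable_const measurable_const
  have hZn : ∀ x, ‖Z x‖ ≤ 1 := by intro x; simp only [hZ]; split_ifs <;> simp
  have hZ0 : ∀ x, v x = 0 → Z x = 0 := by intro x hx; simp [hZ, hx]
  have hZ01 : ∀ x, v x ≠ 0 → Z x = 1 := by intro x hx; simp [hZ, hx]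
  have hsvm : Measurable (fun x => (Real.sqrt (v x) : ℂ)) := by fun_prop
  have hsvb : ∀ x, ‖(Real.sqrt (v x) : ℂ)‖ ≤ Real.sqrt Bv := by
    intro x; rw [Complex.norm_real, Real.norm_of_nonneg (Real.sqrt_nonneg _)]
    exact Real.sqrt_le_sqrt (hvB x)
  obtain ⟨s, hs⟩ : ∃ s : W × W → ℝ, ∀ q, s q = lu q.2 + lu (q.2 + q.1) := ⟨_, fun _ => rfl⟩
  have hsm : Measurable s := by rw [funext hs]; fun_prop
  obtain ⟨ZZ, hZZ⟩ : ∃ ZZ : W × W → ℂ, ∀ q, ZZ q = Z q.2 * Z (q.2 + q.1) := ⟨_, fun _ => rfl⟩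
  have hZZm : Measurable ZZ := by rw [funext hZZ]; fun_prop
  have hZZn : ∀ q, ‖ZZ q‖ ≤ 1 := by
    intro q; rw [hZZ, norm_mul]; exact mul_le_one₀ (hZn _) (norm_nonneg _) (hZn _)
  have hsq : ∀ q : W × W, (Real.sqrt (v q.2) : ℂ) * (Real.sqrt (v (q.2+q.1)) : ℂ) = l * (ZZ q * ((Real.exp (s q/2) : ℝ) : ℂ)) := by
    intro q
    rw [hZZ]
    by_cases h1 : v q.2 = 0
    · simp [h1, hZ0 _ h1]
    by_cases h2 : v (q.2+q.1) = 0
    · simp [h2, hZ0 _ h2]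
    have p1 : 0 < v q.2 := lt_of_le_of_ne (hv0 _) (Ne.symm h1)
    have p2 : 0 < v (q.2+q.1) := lt_of_le_of_ne (hv0 _) (Ne.symm h2)
    rw [hZ01 _ h1, hZ01 _ h2, one_mul, one_mul]
    rw [← Complex.ofReal_mul, ← Complex.ofReal_mul]
    congr 1
    simp only [hs, hlu]
    rw [add_div, Real.exp_add, Real.exp_half, Real.exp_half, Real.exp_log (by positivity), Real.exp_log (by positivity),
      Real.sqrt_div (by positivity), Real.sqrt_div (by positivity)]
    have := Real.mul_self_sqrt hl.le
    have h3 : 0 < Real.sqrt l := Real.sqrt_pos.2 hl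
    field_simp
    rw [pow_two, this]
  obtain ⟨c, hc⟩ : ∃ c : W × W → ℂ, ∀ q, c q = k q.1 * (φ q.2 * ψ (q.2 + q.1)) := ⟨_, fun _ => rfl⟩
  have hci : Integrable c := by rw [funext hc]; exact integrable_kernel hk hφ hψ
  have hn1 : Nice (fun x => (Real.sqrt (v x) : ℂ) * φ x) := hφ.mul_bdd hsvm hsvb
  have hn2 : Nice (fun x => (Real.sqrt (v x) : ℂ) * ψ x) := hψ.mul_bdd hsvm hsvb
  have hI0 : Integrable (fun q : W × W => k q.1 * ((Real.sqrt (v q.2) : ℂ) * φ q.2 * ((Real.sqrt (v (q.2+q.1)) : ℂ) * ψ (q.2+q.1)))) :=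
    integrable_kernel (f := fun x => (Real.sqrt (v x) : ℂ) * φ x) (g := fun x => (Real.sqrt (v x) : ℂ) * ψ x) hk hn1 hn2
  rw [BF_kernel hk hn1 hn2]
  obtain ⟨B, hB⟩ : ∃ B : W × W → ℂ, ∀ q, B q = c q * (ZZ q * ((Real.exp (s q/2) - Real.exp (-(|s q|/2)) : ℝ) : ℂ)) := ⟨_, fun _ => rfl⟩
  have hT : ∀ q : W × W, k q.1 * ((Real.sqrt (v q.2) : ℂ) * φ q.2 * ((Real.sqrt (v (q.2+q.1)) : ℂ) * ψ (q.2+q.1))) =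
      l * (c q * ZZ q * ((Real.exp (-(|s q|/2)) : ℝ) : ℂ)) + l * B q := by
    intro q
    have : k q.1 * ((Real.sqrt (v q.2) : ℂ) * φ q.2 * ((Real.sqrt (v (q.2+q.1)) : ℂ) * ψ (q.2+q.1))) =
      c q * ((Real.sqrt (v q.2) : ℂ) * (Real.sqrt (v (q.2+q.1)) : ℂ)) := by rw [hc]; ring
    rw [this, hsq q, hB, Complex.ofReal_sub]; ring
  have hI1 : Integrable (fun q => c q * ZZ q * ((Real.exp (-(|s q|/2)) : ℝ) : ℂ)) := by
    have := hci.mul_bdd (c := 1) (g := fun q => ZZ q * ((Real.exp (-(|s q|/2)) : ℝ) : ℂ))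
      (by apply Measurable.aestronglyMeasurable; fun_prop)
      (Filter.Eventually.of_forall fun q => by
        rw [norm_mul, Complex.norm_real, Real.norm_of_nonneg (Real.exp_pos _).le]
        refine mul_le_one₀ (hZZn _) (Real.exp_pos _).le (Real.exp_le_one_iff.2 ?_)
        have := abs_nonneg (s q); linarith)
    refine this.congr (Filter.Eventually.of_forall fun q => ?_)
    simp only; ring
  have hI2 : Integrable (fun q => l * B q) := by
    refine (hI0.sub (hI1.const_mul l)).congr (Filter.Eventually.of_forall fun q => ?_)
    simp only [Pi.sub_apply]; rw [hT q]; ring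
  have h1 := INT_PJ hk hkm ha hlum hZm hZn hφ hψ
  simp only [← hc, ← hs, ← hZZ] at h1
  have h2 := INT_B (B := B) (Z := ZZ) hp hl hβ hK hkb hv hv0 hvK hφ hψ hZZn
    (fun q hq => by rw [hZZ, hZ0 _ hq, zero_mul]) (fun q hq => by rw [hZZ, hZ0 _ hq, mul_zero])
    (fun q => by rw [hB, hc, hs, hlu])
  simp_rw [hT]
  rw [integral_add (hI1.const_mul _) hI2, integral_const_mul, integral_const_mul]
  refine (norm_add_le _ _).trans ?_
  rw [norm_mul, norm_mul, Complex.norm_real, Real.norm_of_nonneg hl.le]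
  refine (add_le_add (mul_le_mul_of_nonneg_left h1 hl.le) (mul_le_mul_of_nonneg_left h2 hl.le)).trans ?_
  rw [show (1:ℝ) - p = 1 + -p by ring, Real.rpow_add hl, Real.rpow_one]
  apply le_of_eq; ring
end INTSec
end

noncomputable section
open MeasureTheory Metric Complex
open scoped ENNReal FourierTransform SchwartzMap

set_option linter.unusedSectionVars false
section ResId

lemma norm_add_I_ge {A : ℂ} (hA : 0 ≤ A.im) {σ : ℝ} (hσ : 0 ≤ σ) :
    ‖A‖ ≤ ‖A + σ * I‖ ∧ σ ≤ ‖A + σ * I‖ := by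
  constructor
  · rw [← sq_le_sq₀ (norm_nonneg _) (norm_nonneg _), Complex.sq_norm, Complex.sq_norm, normSq_apply, normSq_apply]
    simp; nlinarith
  · have := Complex.abs_im_le_norm (A + σ * I)
    simp at this
    exact le_trans (le_trans (by linarith) (le_abs_self _)) this

lemma slit_add_I {A : ℂ} (hA : 0 ≤ A.im) (hs : A ∈ slitPlane) {σ : ℝ} (hσ : 0 ≤ σ) : A + σ * I ∈ slitPlane := by
  rw [mem_slitPlane_iff] at hs ⊢
  simp
  rcases hs with h | h
  · exact Or.inl h
  · right; intro h2; apply h; linarith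

lemma norm_resker_le {A : ℂ} (hA : 0 ≤ A.im) {d : ℝ} (hd : 0 < d) (hAd : d ≤ ‖A‖) {σ a : ℝ} (hσ : 0 < σ) (ha : 2 ≤ a) :
    ‖((σ^(a-2) : ℝ) : ℂ) * (A + σ * I)^((-a : ℝ) : ℂ)‖ ≤ 4 * (d + σ)^(-2:ℝ) := by
  obtain ⟨h1, h2⟩ := norm_add_I_ge hA hσ.le
  have hp : 0 < ‖A + σ * I‖ := lt_of_lt_of_le hσ h2
  rw [norm_mul, Complex.norm_real, Real.norm_of_nonneg (by positivity), Complex.norm_cpow_real]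
  have h3 : d + σ ≤ 2 * ‖A + σ * I‖ := by linarith
  calc σ^(a-2) * ‖A + σ * I‖^(-a) ≤ ‖A + σ * I‖^(a-2) * ‖A + σ * I‖^(-a) := by
        gcongr
    _ = ‖A + σ * I‖^(-2:ℝ) := by rw [← Real.rpow_add hp]; congr 1; ring
    _ ≤ ((d+σ)/2)^(-2:ℝ) := by
        apply Real.rpow_le_rpow_of_nonpos (by positivity) (by linarith) (by norm_num)
    _ = _ := by
        rw [Real.div_rpow (by positivity) (by norm_num), show (2:ℝ)^(-2:ℝ) = 1/4 by
          rw [show (-2:ℝ) = ((-2:ℤ):ℝ) by norm_num, Real.rpow_intCast]; norm_num]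
        ring

lemma integrable_dom {d : ℝ} (hd : 0 < d) : IntegrableOn (fun σ : ℝ => 4 * (d + σ)^(-2:ℝ)) (Set.Ioi 0) := by
  apply Integrable.const_mul
  have := integrableOn_add_rpow_Ioi_of_lt (a := -2) (c := 0) (m := d) (by norm_num) (by linarith)
  rw [IntegrableOn] at this
  simpa [add_comm] using this

lemma measurable_resker (A : ℂ) (a : ℝ) : Measurable (fun σ : ℝ => ((σ^(a-2) : ℝ) : ℂ) * (A + σ * I)^((-a : ℝ) : ℂ)) := by
  fun_prop

lemma integrable_resker {A : ℂ} (hA : 0 ≤ A.im) (hs : A ∈ slitPlane) {a : ℝ} (ha : 2 ≤ a) :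
    IntegrableOn (fun σ : ℝ => ((σ^(a-2) : ℝ) : ℂ) * (A + σ * I)^((-a : ℝ) : ℂ)) (Set.Ioi 0) := by
  have hd : 0 < ‖A‖ := norm_pos_iff.2 (slitPlane_ne_zero hs)
  refine Integrable.mono' (integrable_dom hd) (measurable_resker A a).aestronglyMeasurable ?_
  filter_upwards [ae_restrict_mem measurableSet_Ioi] with σ hσ
  exact norm_resker_le hA hd le_rfl hσ ha

lemma resolvent_identity {A : ℂ} (hA : 0 ≤ A.im) (hs : A ∈ slitPlane) {a : ℝ} (ha : 2 ≤ a) :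
    A⁻¹ = ((a-1 : ℝ) : ℂ) * I^((a-1 : ℝ) : ℂ) *
      ∫ σ in Set.Ioi (0:ℝ), ((σ^(a-2) : ℝ) : ℂ) * (A + σ * I)^((-a : ℝ) : ℂ) := by
  have hA0 := slitPlane_ne_zero hs
  have key : ∫ σ in Set.Ioi (0:ℝ), (((a-1 : ℝ) : ℂ) * A) * (((σ^(a-2) : ℝ) : ℂ) * (A + σ * I)^((-a : ℝ) : ℂ)) =
      I^((1-a : ℝ) : ℂ) - ((((0:ℝ)^(a-1) : ℝ) : ℂ) * (A + (0:ℝ) * I)^((1-a : ℝ) : ℂ)) := by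
    apply integral_Ioi_of_hasDerivAt_of_tendsto (f := fun σ : ℝ => ((σ^(a-1) : ℝ) : ℂ) * (A + σ * I)^((1-a : ℝ) : ℂ))
    · apply ContinuousAt.continuousWithinAt
      apply ContinuousAt.mul
      · apply Complex.continuous_ofReal.continuousAt.comp
        exact Real.continuousAt_rpow_const _ _ (Or.inr (by linarith))
      · apply ContinuousAt.cpow (by fun_prop) continuousAt_const
        simpa using hs
    · intro σ hσ
      have hσ' : (0:ℝ) < σ := hσ
      have hsl := slit_add_I hA hs hσ'.le
      have h1 : HasDerivAt (fun σ : ℝ => ((σ^(a-1) : ℝ) : ℂ)) (((a-1) * σ^(a-1-1) : ℝ) : ℂ) σ :=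
        (Real.hasDerivAt_rpow_const (Or.inl hσ'.ne')).ofReal_comp
      have h2 : HasDerivAt (fun w : ℂ => A + w * I) I (σ:ℂ) := by
        have := ((hasDerivAt_id (σ:ℂ)).mul_const I).const_add A
        simpa using this
      have h3 := (h2.cpow_const (c := ((1-a : ℝ) : ℂ)) hsl).comp_ofReal
      have h4 := h1.mul h3
      refine HasDerivAt.congr_deriv (f := fun σ : ℝ => ((σ^(a-1) : ℝ) : ℂ) * (A + σ * I)^((1-a : ℝ) : ℂ)) h4 ?_
      symm
      have hne := slitPlane_ne_zero hsl
      have e1 : (A + σ * I)^((1-a : ℝ) : ℂ) = (A + σ * I)^((-a : ℝ) : ℂ) * (A + σ * I) := by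
        have : ((1-a : ℝ) : ℂ) = ((-a : ℝ) : ℂ) + 1 := by push_cast; ring
        rw [this, Complex.cpow_add _ _ hne, Complex.cpow_one]
      have e2 : (A + σ * I)^(((1-a : ℝ) : ℂ) - 1) = (A + σ * I)^((-a : ℝ) : ℂ) := by
        congr 1; push_cast; ring
      have e3 : σ^(a-1) = σ^(a-2) * σ := by
        rw [← Real.rpow_add_one hσ'.ne']; congr 1; ring
      have e4 : σ^(a-1-1) = σ^(a-2) := by congr 1; ring
      rw [e1, e2, e3, e4]; push_cast; ring
    · exact (integrable_resker hA hs ha).const_mul _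
    · have h1 : Filter.Tendsto (fun σ : ℝ => (A * ((σ⁻¹ : ℝ) : ℂ) + I)^((1-a : ℝ) : ℂ)) Filter.atTop (nhds (I^((1-a : ℝ) : ℂ))) := by
        have h0 : Filter.Tendsto (fun σ : ℝ => A * ((σ⁻¹ : ℝ) : ℂ) + I) Filter.atTop (nhds I) := by
          have := (((Complex.continuous_ofReal.tendsto 0).comp tendsto_inv_atTop_zero).const_mul A).add_const I
          simpa using this
        exact h0.cpow tendsto_const_nhds (by simp [mem_slitPlane_iff])
      refine h1.congr' ?_
      filter_upwards [Filter.eventually_gt_atTop 0] with σ hσ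
      have hb : A * ((σ⁻¹ : ℝ) : ℂ) + I ≠ 0 := by
        intro h
        have h2 : A + σ * I = 0 := by
          have : A + σ * I = σ * (A * ((σ⁻¹ : ℝ) : ℂ) + I) := by
            have : (σ:ℂ) ≠ 0 := by exact_mod_cast hσ.ne'
            push_cast; field_simp
          rw [this, h, mul_zero]
        exact slitPlane_ne_zero (slit_add_I hA hs hσ.le) h2
      have e : A + σ * I = σ * (A * ((σ⁻¹ : ℝ) : ℂ) + I) := by
        have : (σ:ℂ) ≠ 0 := by exact_mod_cast hσ.ne'
        push_cast; field_simp
      have hσc : (σ:ℂ) ≠ 0 := by exact_mod_cast hσ.ne'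
      have : (A + σ * I)^((1-a : ℝ) : ℂ) = ((σ^(1-a) : ℝ) : ℂ) * (A * ((σ⁻¹ : ℝ) : ℂ) + I)^((1-a : ℝ) : ℂ) := by
        rw [e, Complex.cpow_def_of_ne_zero (mul_ne_zero hσc hb), Complex.cpow_def_of_ne_zero hb,
          Complex.log_ofReal_mul hσ hb, Complex.ofReal_cpow hσ.le, Complex.cpow_def_of_ne_zero hσc,
          ← Complex.exp_add, Complex.ofReal_log hσ.le]
        congr 1; ring
      rw [this, ← mul_assoc, ← Complex.ofReal_mul, ← Real.rpow_add hσ]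
      simp
  rw [integral_const_mul] at key
  rw [Real.zero_rpow (by linarith)] at key
  simp only [Complex.ofReal_zero, zero_mul, sub_zero] at key
  have hI : I^((a-1 : ℝ) : ℂ) * I^((1-a : ℝ) : ℂ) = 1 := by
    rw [← Complex.cpow_add _ _ I_ne_zero]
    have : ((a-1 : ℝ) : ℂ) + ((1-a : ℝ) : ℂ) = 0 := by push_cast; ring
    rw [this, cpow_zero]
  symm
  apply eq_inv_of_mul_eq_one_right
  rw [← hI, ← key]; ring
end ResId
end

noncomputable section
open MeasureTheory Metric Complex
open scoped ENNReal FourierTransform SchwartzMap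

set_option linter.unusedSectionVars false
section KerSec
variable {W : Type*} [NormedAddCommGroup W] [InnerProductSpace ℝ W] [FiniteDimensional ℝ W]
  [MeasurableSpace W] [BorelSpace W]

lemma eta_exists {w : ℂ} (hw : 0 < w.im) : ∃ η : ℂ, η^2 = w ∧ 0 < η.re ∧ w.im ≤ 2 * η.re * ‖η‖ := by
  have hw0 : w ≠ 0 := by intro h; simp [h] at hw
  have hsq : (w^((1/2:ℝ):ℂ))^2 = w := by
    rw [← Complex.cpow_nat_mul]; push_cast; norm_num
  obtain ⟨η, hη⟩ : ∃ η, η = w^((1/2:ℝ):ℂ) := ⟨_, rfl⟩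
  rw [← hη] at hsq
  have hre : 0 < η.re := by
    rw [hη, Complex.cpow_ofReal_re]
    have := norm_pos_iff.2 hw0
    have h1 := Complex.neg_pi_lt_arg w
    have h2 : w.arg < Real.pi := by
      rcases (Complex.arg_le_pi w).lt_or_eq with h | h
      · exact h
      · rw [Complex.arg_eq_pi_iff] at h; linarith [h.2]
    apply mul_pos (by positivity)
    apply Real.cos_pos_of_mem_Ioo; constructor <;> nlinarith
  refine ⟨η, hsq, hre, ?_⟩
  have h1 : w.im = 2 * η.re * η.im := by rw [← hsq, pow_two]; simp; ring
  rw [h1]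
  have := (le_abs_self _).trans (Complex.abs_im_le_norm η)
  gcongr

/-- the resolvent power kernel -/
def rker (W : Type*) [NormedAddCommGroup W] [InnerProductSpace ℝ W] (η : ℂ) : W → ℂ :=
  fun x => ((cW W : ℂ) * η)⁻¹ * cexp (-(2*Real.pi*η*‖x‖))

lemma norm_rker {η : ℂ} (x : W) : ‖rker W η x‖ = (cW W * ‖η‖)⁻¹ * Real.exp (-(2*Real.pi*η.re*‖x‖)) := by
  unfold rker
  rw [norm_mul, norm_inv, norm_mul, Complex.norm_real, Real.norm_of_nonneg (cW_pos (W := W)).le, Complex.norm_exp]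
  congr 2
  simp

lemma continuous_rker (η : ℂ) : Continuous (rker W η) := by unfold rker; fun_prop

lemma integrable_rker {η : ℂ} (hη : 0 < η.re) : Integrable (rker W η) := by
  refine Integrable.mono' (g := fun x => (cW W * ‖η‖)⁻¹ * Real.exp (-((2*Real.pi*η.re)*‖x‖)))
    ((integrable_exp_norm (by have := Real.pi_pos; positivity)).const_mul _) (continuous_rker η).aestronglyMeasurable ?_
  exact Filter.Eventually.of_forall fun x => (norm_rker x).le

lemma fourier_rker {η : ℂ} (hη : 0 < η.re) (ξ : W) : 𝓕 (rker W η) ξ =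
    (((‖ξ‖^2 : ℝ) : ℂ) + η^2)^(((-((Module.finrank ℝ W + 1)/2) : ℝ)) : ℂ) := by
  have h := ft_exp_norm hη ξ
  have hη0 : η ≠ 0 := by intro h; simp [h] at hη
  have hc : (cW W : ℂ) ≠ 0 := by exact_mod_cast (cW_pos (W := W)).ne'
  have : 𝓕 (rker W η) ξ = ((cW W : ℂ) * η)⁻¹ * 𝓕 (fun x : W => cexp (-(2*Real.pi*η*‖x‖))) ξ := by
    unfold rker
    rw [Real.fourier_eq', Real.fourier_eq', ← integral_const_mul]
    congr 1; ext x; simp only [smul_eq_mul]; ring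
  rw [this, h, add_comm (((‖ξ‖^2 : ℝ) : ℂ))]
  field_simp

/-- Morrey condition -/
def Mor (p : ℝ) (v : W → ℝ) : Prop :=
  ∀ y : W, ∀ r > 0, ∫⁻ x in ball y r, ENNReal.ofReal (v x ^ p) ≤ ENNReal.ofReal (r^((Module.finrank ℝ W : ℝ) - 2*p))

lemma Mor.layer {p : ℝ} {v : W → ℝ} (hv : Mor p v) (hm : Measurable v) (hp : 2*p ≤ Module.finrank ℝ W) {κ : ℝ} (hκ : 0 < κ) (y : W) :
    ∫⁻ x, ENNReal.ofReal (Real.exp (-(κ*‖x-y‖))) * ENNReal.ofReal (v x ^ p) ≤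
      ENNReal.ofReal (Real.Gamma ((Module.finrank ℝ W : ℝ) - 2*p + 1) * κ^(-((Module.finrank ℝ W : ℝ) - 2*p))) := by
  have := layer_cake_exp (F := fun x => ENNReal.ofReal (v x ^ p)) (by fun_prop) (D := 1) (q := (Module.finrank ℝ W : ℝ) - 2*p)
    (by linarith) hκ y (fun r hr => by rw [one_mul]; exact hv y r hr)
  rwa [one_mul] at this

lemma one_layer [Nontrivial W] {κ : ℝ} (hκ : 0 < κ) (y : W) :
    ∫⁻ x, ENNReal.ofReal (Real.exp (-(κ*‖x-y‖))) ≤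
      volume (ball (0:W) 1) * ENNReal.ofReal (Real.Gamma ((Module.finrank ℝ W : ℝ) + 1) * κ^(-(Module.finrank ℝ W : ℝ))) := by
  have := layer_cake_exp (W := W) (F := fun x => 1) (by fun_prop) (D := volume (ball (0:W) 1)) (q := (Module.finrank ℝ W : ℝ))
    (by have : (0:ℝ) ≤ Module.finrank ℝ W := by positivity
        linarith) hκ y (fun r hr => by
      rw [lintegral_const, one_mul, Measure.restrict_apply MeasurableSet.univ, Set.univ_inter, Measure.addHaar_ball _ _ hr.le, mul_comm,
        Real.rpow_natCast])
  simpa using this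

lemma alg_II {σ b θ p n s l κ : ℝ} (hσ : 0 < σ) (hb : 0 < b) (hθ : θ * p = (n-1)/2) (hs : s = (n+1)/2)
    (hl : l = σ^(2-θ) * b^(θ-1)) (hκ : κ = σ/Real.sqrt b) :
    σ^(s-2) * (l * σ^(-s)) = σ^(-θ) * b^(θ-1) ∧
    σ^(s-2) * (l^(1-p) * (Real.sqrt b)⁻¹ * κ^(-(n-2*p))) = σ^(-θ) * b^(θ-1) := by
  obtain ⟨x, rfl⟩ : ∃ x, σ = Real.exp x := ⟨Real.log σ, (Real.exp_log hσ).symm⟩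
  obtain ⟨y, rfl⟩ : ∃ y, b = Real.exp y := ⟨Real.log b, (Real.exp_log hb).symm⟩
  subst hl hκ
  rw [← Real.exp_half]
  simp only [← Real.exp_mul, ← Real.exp_add, ← Real.exp_neg, ← Real.exp_sub]
  constructor
  · congr 1; ring
  · congr 1; subst hs
    linear_combination (x - y) * hθ

/-- Part II : small sigma -/
lemma part_II {p θ : ℝ} (hp : 1 ≤ p) (hp2 : 2*p ≤ Module.finrank ℝ W) (hθ : θ * p = ((Module.finrank ℝ W : ℝ) - 1)/2)
    {z : ℂ} (hz : 0 ≤ z.im) (hz0 : z ≠ 0) {σ : ℝ} (hσ : 0 < σ) (hσb : σ ≤ ‖z‖) {v : W → ℝ} (hv : Measurable v) (hv0 : ∀ x, 0 ≤ v x) {Bv : ℝ}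
    (hvB : ∀ x, v x ≤ Bv) (hM : Mor p v) {φ ψ : W → ℂ} (hφ : Nice φ) (hψ : Nice ψ) :
    σ^(((Module.finrank ℝ W : ℝ) + 1)/2 - 2) * ‖BF (fun ξ => (((‖ξ‖^2 : ℝ) : ℂ) + z + σ * I)^(((-((Module.finrank ℝ W + 1)/2) : ℝ)) : ℂ))
      (fun x => (Real.sqrt (v x) : ℂ) * φ x) (fun x => (Real.sqrt (v x) : ℂ) * ψ x)‖ ≤
    (1 + (cW W)⁻¹ * Real.Gamma ((Module.finrank ℝ W : ℝ) - 2*p + 1)) * (σ^(-θ) * ‖z‖^(θ-1)) * ((N2 volume φ + N2 volume ψ)/2) := by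
  obtain ⟨n, hn⟩ : ∃ n : ℝ, n = (Module.finrank ℝ W : ℝ) := ⟨_, rfl⟩
  obtain ⟨b, hb⟩ : ∃ b : ℝ, b = ‖z‖ := ⟨_, rfl⟩
  have hb0 : 0 < b := by rw [hb]; exact norm_pos_iff.2 hz0
  rw [← hb] at hσb ⊢
  have hpi := Real.pi_gt_three
  have hc := cW_pos (W := W)
  obtain ⟨η, h1, h2, h3⟩ := eta_exists (w := z + σ * I) (by simp; linarith)
  obtain ⟨w1, w2⟩ := norm_add_I_ge hz hσ.le
  have hηn : ‖η‖^2 = ‖z + σ * I‖ := by rw [← h1, norm_pow]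
  have hηup : ‖η‖^2 ≤ 2 * b := by
    rw [hηn]; refine (norm_add_le _ _).trans ?_
    rw [norm_mul, Complex.norm_real, Real.norm_of_nonneg hσ.le, norm_I, mul_one, ← hb]; linarith
  have hηlo : b ≤ ‖η‖^2 := by rw [hηn, hb]; exact w1
  have hηlo' : Real.sqrt b ≤ ‖η‖ := Real.sqrt_le_iff.2 ⟨norm_nonneg _, hηlo⟩
  have hsb : 0 < Real.sqrt b := Real.sqrt_pos.2 hb0
  have hηup' : ‖η‖ ≤ 2 * Real.sqrt b := by
    rw [← sq_le_sq₀ (norm_nonneg _) (by positivity), mul_pow, Real.sq_sqrt hb0.le]; linarith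
  obtain ⟨κ, hκ⟩ : ∃ κ : ℝ, κ = σ / Real.sqrt b := ⟨_, rfl⟩
  have hκ0 : 0 < κ := by rw [hκ]; positivity
  have hκη : κ ≤ 2 * Real.pi * η.re := by
    rw [hκ, div_le_iff₀ hsb]
    have h4 : (z + σ * I).im = z.im + σ := by simp
    rw [h4] at h3
    have h5 : 2 * η.re * ‖η‖ ≤ 2 * η.re * (2 * Real.sqrt b) := by gcongr
    have h6 : 0 < η.re * Real.sqrt b := by positivity
    nlinarith
  obtain ⟨l, hl⟩ : ∃ l : ℝ, l = σ^(2-θ) * b^(θ-1) := ⟨_, rfl⟩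
  have hl0 : 0 < l := by rw [hl]; positivity
  have hΓ : 0 < Real.Gamma (n - 2*p + 1) := Real.Gamma_pos_of_pos (by rw [hn]; linarith)
  have hF : 𝓕 (rker W η) = fun ξ => (((‖ξ‖^2 : ℝ) : ℂ) + z + σ * I)^(((-((Module.finrank ℝ W + 1)/2) : ℝ)) : ℂ) := by
    ext ξ; rw [fourier_rker h2, h1, add_assoc]
  have hint := INT (k := rker W η) (a := σ^(-((n+1)/2))) (β := (cW W * Real.sqrt b)⁻¹) (κ := κ)
    (K := Real.Gamma (n - 2*p + 1) * κ^(-(n - 2*p))) (l := l) (p := p) (integrable_rker h2) (continuous_rker η).measurable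
    hp hl0 (by positivity) (by positivity) (fun ξ => ?_) (fun x => ?_) hv hv0 hvB (fun y => ?_) hφ hψ
  · rw [hF] at hint
    refine (mul_le_mul_of_nonneg_left hint (by positivity)).trans ?_
    rw [← mul_assoc]
    have hN : 0 ≤ (N2 volume φ + N2 volume ψ)/2 := by have := N2_nonneg volume φ; have := N2_nonneg volume ψ; positivity
    apply mul_le_mul_of_nonneg_right _ hN
    rw [← hn] at hθ ⊢
    obtain ⟨a1, a2⟩ := alg_II hσ hb0 hθ (s := (n+1)/2) rfl hl hκ
    apply le_of_eq
    calc _ = σ^((n+1)/2-2) * (l * σ^(-((n+1)/2))) + (cW W)⁻¹ * Real.Gamma (n - 2*p + 1) * (σ^((n+1)/2-2) * (l^(1-p) * (Real.sqrt b)⁻¹ * κ^(-(n-2*p)))) := by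
          rw [mul_inv]; ring
      _ = _ := by rw [a1, a2]; ring
  · rw [hF, Complex.norm_cpow_real, ← hn]
    apply Real.rpow_le_rpow_of_nonpos hσ
    · exact (norm_add_I_ge (A := ((‖ξ‖^2 : ℝ) : ℂ) + z) (by rw [add_im, ofReal_im]; linarith) hσ.le).2
    · rw [hn]; have : (0:ℝ) ≤ Module.finrank ℝ W := by positivity
      linarith
  · rw [norm_rker]
    gcongr
  · rw [hn]; exact hM.layer hv hp2 hκ0 y
end KerSec
end

noncomputable section
open MeasureTheory Metric Complex
open scoped ENNReal FourierTransform SchwartzMap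

set_option linter.unusedSectionVars false
section PartOne
variable {W : Type*} [NormedAddCommGroup W] [InnerProductSpace ℝ W] [FiniteDimensional ℝ W]
  [MeasurableSpace W] [BorelSpace W]

lemma pt_I {X Y hx hy bx by' : ℝ} (h1 : 0 ≤ hx) (h2 : 0 ≤ hy) (h3 : 0 ≤ bx) (h4 : 0 ≤ by') :
    Real.sqrt (hx*bx) * X * (Real.sqrt (hy*by') * Y) ≤ (X^2*hx*by' + Y^2*hy*bx)/2 := by
  rw [Real.sqrt_mul h1, Real.sqrt_mul h2]
  have := Real.sq_sqrt h1
  have := Real.sq_sqrt h2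
  have := Real.sq_sqrt h3
  have := Real.sq_sqrt h4
  have e : X^2*hx*by' + Y^2*hy*bx = (X*√hx*√by')^2 + (Y*√hy*√bx)^2 := by
    simp only [mul_pow, *]
  rw [e]
  nlinarith [sq_nonneg (X*√hx*√by' - Y*√hy*√bx)]

/-- cutoff profile -/
def hfun (p t : ℝ) : ℝ := t / (1 + t^p)

lemma hfun_nonneg {p t : ℝ} (ht : 0 ≤ t) : 0 ≤ hfun p t := by unfold hfun; positivity

lemma measurable_hfun (p : ℝ) : Measurable (hfun p) := by unfold hfun; fun_prop

/-- constant of part I -/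
def CI (W : Type*) [NormedAddCommGroup W] [InnerProductSpace ℝ W] [MeasurableSpace W] [BorelSpace W] [FiniteDimensional ℝ W] (p : ℝ) : ℝ≥0∞ :=
  ENNReal.ofReal ((2 * cW W)⁻¹) * (volume (ball (0:W) 1) * ENNReal.ofReal (Real.Gamma ((Module.finrank ℝ W : ℝ) + 1)) +
    ENNReal.ofReal (Real.Gamma ((Module.finrank ℝ W : ℝ) - 2*p + 1)))

lemma CI_lt_top (p : ℝ) : CI W p < ⊤ := by
  unfold CI
  exact ENNReal.mul_lt_top ENNReal.ofReal_lt_top (ENNReal.add_lt_top.2 ⟨ENNReal.mul_lt_top measure_ball_lt_top ENNReal.ofReal_lt_top, ENNReal.ofReal_lt_top⟩)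

lemma part_I_K [Nontrivial W] {p : ℝ} (hp2 : 2*p ≤ Module.finrank ℝ W) {σ : ℝ} (hσ : 0 < σ)
    {v : W → ℝ} (hv : Measurable v) (hv0 : ∀ x, 0 ≤ v x) (hM : Mor p v) (y : W) :
    ∫⁻ x, ENNReal.ofReal (Real.exp (-(Real.sqrt σ*‖x-y‖))) * ENNReal.ofReal (σ * (1 + (v x/σ)^p)) ≤
      (volume (ball (0:W) 1) * ENNReal.ofReal (Real.Gamma ((Module.finrank ℝ W : ℝ) + 1)) +
        ENNReal.ofReal (Real.Gamma ((Module.finrank ℝ W : ℝ) - 2*p + 1))) * ENNReal.ofReal (σ^(1-(Module.finrank ℝ W : ℝ)/2)) := by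
  have hs : 0 < Real.sqrt σ := Real.sqrt_pos.2 hσ
  have h1 := one_layer hs y
  have h2 := hM.layer hv hp2 hs y
  have e : ∀ x, ENNReal.ofReal (Real.exp (-(Real.sqrt σ*‖x-y‖))) * ENNReal.ofReal (σ * (1 + (v x/σ)^p)) =
      ENNReal.ofReal σ * ENNReal.ofReal (Real.exp (-(Real.sqrt σ*‖x-y‖))) +
      ENNReal.ofReal (σ^(1-p)) * (ENNReal.ofReal (Real.exp (-(Real.sqrt σ*‖x-y‖))) * ENNReal.ofReal (v x ^p)) := by
    intro x
    have := Real.rpow_nonneg (hv0 x) p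
    rw [← ENNReal.ofReal_mul (by positivity), ← ENNReal.ofReal_mul (by positivity), ← ENNReal.ofReal_mul (by positivity), ← ENNReal.ofReal_mul (by positivity),
      ← ENNReal.ofReal_add (by positivity) (by positivity), Real.div_rpow (hv0 x) hσ.le, Real.rpow_sub hσ, Real.rpow_one]
    congr 1
    field_simp
  simp_rw [e]
  rw [lintegral_add_left (by fun_prop), lintegral_const_mul _ (by fun_prop), lintegral_const_mul _ (by fun_prop)]
  refine (add_le_add (mul_le_mul_right h1 _) (mul_le_mul_right h2 _)).trans ?_
  have hn0 : (0:ℝ) ≤ Module.finrank ℝ W := by positivity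
  rw [add_mul]
  have g1 := Real.Gamma_pos_of_pos (show 0 < (Module.finrank ℝ W : ℝ) + 1 by linarith)
  have g2 := Real.Gamma_pos_of_pos (show 0 < (Module.finrank ℝ W : ℝ) - 2*p + 1 by linarith)
  have s1 : σ * Real.sqrt σ^(-(Module.finrank ℝ W : ℝ)) = σ^(1-(Module.finrank ℝ W : ℝ)/2) := by
    rw [Real.sqrt_eq_rpow, ← Real.rpow_mul hσ.le]
    nth_rw 1 [← Real.rpow_one σ]
    rw [← Real.rpow_add hσ]; congr 1; ring
  have s2 : σ^(1-p) * Real.sqrt σ^(-((Module.finrank ℝ W : ℝ)-2*p)) = σ^(1-(Module.finrank ℝ W : ℝ)/2) := by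
    rw [Real.sqrt_eq_rpow, ← Real.rpow_mul hσ.le, ← Real.rpow_add hσ]; congr 1; ring
  apply le_of_eq
  congr 1
  · rw [← s1, ENNReal.ofReal_mul g1.le, ENNReal.ofReal_mul hσ.le]; ring
  · rw [← s2, ENNReal.ofReal_mul g2.le, ENNReal.ofReal_mul (by positivity)]; ring

lemma part_I [Nontrivial W] {p : ℝ} (hp2 : 2*p ≤ Module.finrank ℝ W)
    {z : ℂ} (hz : 0 ≤ z.im) {σ : ℝ} (hσ : 0 < σ) (hσb : ‖z‖ ≤ σ) {v : W → ℝ} (hv : Measurable v) (hv0 : ∀ x, 0 ≤ v x) {Bv : ℝ}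
    (hvB : ∀ x, v x ≤ Bv) (hM : Mor p v) {φ ψ : W → ℂ} (hφ : Nice φ) (hψ : Nice ψ) :
    ENNReal.ofReal (σ^(((Module.finrank ℝ W : ℝ) + 1)/2 - 2)) * ‖BF (fun ξ => (((‖ξ‖^2 : ℝ) : ℂ) + z + σ * I)^(((-((Module.finrank ℝ W + 1)/2) : ℝ)) : ℂ))
      (fun x => (Real.sqrt (v x) : ℂ) * φ x) (fun x => (Real.sqrt (v x) : ℂ) * ψ x)‖ₑ ≤
    CI W p * (ENNReal.ofReal σ⁻¹ * ((∫⁻ x, ENNReal.ofReal (‖φ x‖^2 * hfun p (v x/σ))) + ∫⁻ x, ENNReal.ofReal (‖ψ x‖^2 * hfun p (v x/σ)))) := by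
  have hpi := Real.pi_gt_three
  have hc := cW_pos (W := W)
  obtain ⟨η, h1, h2, h3⟩ := eta_exists (w := z + σ * I) (by simp; linarith)
  obtain ⟨w1, w2⟩ := norm_add_I_ge hz hσ.le
  have hηn : ‖η‖^2 = ‖z + σ * I‖ := by rw [← h1, norm_pow]
  have hηup : ‖η‖^2 ≤ 2 * σ := by
    rw [hηn]; refine (norm_add_le _ _).trans ?_
    rw [norm_mul, Complex.norm_real, Real.norm_of_nonneg hσ.le, norm_I, mul_one]; linarith
  have hηlo : σ ≤ ‖η‖^2 := by rw [hηn]; exact w2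
  have hηlo' : Real.sqrt σ ≤ ‖η‖ := Real.sqrt_le_iff.2 ⟨norm_nonneg _, hηlo⟩
  have hsb : 0 < Real.sqrt σ := Real.sqrt_pos.2 hσ
  have hηup' : ‖η‖ ≤ 2 * Real.sqrt σ := by
    rw [← sq_le_sq₀ (norm_nonneg _) (by positivity), mul_pow, Real.sq_sqrt hσ.le]; linarith
  have hκη : Real.sqrt σ ≤ 2 * Real.pi * η.re := by
    have h4 : (z + σ * I).im = z.im + σ := by simp
    rw [h4] at h3
    have h5 : 2 * η.re * ‖η‖ ≤ 2 * η.re * (2 * Real.sqrt σ) := by gcongr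
    have h6 : 0 < η.re * Real.sqrt σ := by positivity
    have h7 := Real.mul_self_sqrt hσ.le
    have h8 : Real.sqrt σ * Real.sqrt σ ≤ (2 * Real.pi * η.re) * Real.sqrt σ := by nlinarith
    exact le_of_mul_le_mul_right h8 hsb
  have hF : 𝓕 (rker W η) = fun ξ => (((‖ξ‖^2 : ℝ) : ℂ) + z + σ * I)^(((-((Module.finrank ℝ W + 1)/2) : ℝ)) : ℂ) := by
    ext ξ; rw [fourier_rker h2, h1, add_assoc]
  have hsvm : Measurable (fun x => (Real.sqrt (v x) : ℂ)) := by fun_prop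
  have hsvb : ∀ x, ‖(Real.sqrt (v x) : ℂ)‖ ≤ Real.sqrt Bv := by
    intro x; rw [Complex.norm_real, Real.norm_of_nonneg (Real.sqrt_nonneg _)]
    exact Real.sqrt_le_sqrt (hvB x)
  have hn1 : Nice (fun x => (Real.sqrt (v x) : ℂ) * φ x) := hφ.mul_bdd hsvm hsvb
  have hn2 : Nice (fun x => (Real.sqrt (v x) : ℂ) * ψ x) := hψ.mul_bdd hsvm hsvb
  rw [← hF, BF_kernel (integrable_rker h2) hn1 hn2]
  have mφ := hφ.1
  have mψ := hψ.1
  have mh := measurable_hfun p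
  have hks := kernel_schur (f := fun x => ENNReal.ofReal (‖φ x‖^2 * hfun p (v x/σ))) (g := fun x => ENNReal.ofReal (‖ψ x‖^2 * hfun p (v x/σ)))
    (by fun_prop) (by fun_prop) (b := fun x => ENNReal.ofReal (σ * (1 + (v x/σ)^p))) (by fun_prop) (part_I_K hp2 hσ hv hv0 hM)
  have hhb : ∀ x, hfun p (v x/σ) * (σ * (1 + (v x/σ)^p)) = v x := by
    intro x
    have : 0 ≤ (v x/σ)^p := Real.rpow_nonneg (div_nonneg (hv0 x) hσ.le) p
    unfold hfun
    have : 1 + (v x/σ)^p ≠ 0 := by positivity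
    field_simp
  have hb0 : ∀ x, 0 ≤ σ * (1 + (v x/σ)^p) := by
    intro x
    have : 0 ≤ (v x/σ)^p := Real.rpow_nonneg (div_nonneg (hv0 x) hσ.le) p
    positivity
  have hh0 : ∀ x, 0 ≤ hfun p (v x/σ) := fun x => hfun_nonneg (div_nonneg (hv0 x) hσ.le)
  have hB : ‖∫ q : W × W, rker W η q.1 * ((Real.sqrt (v q.2) : ℂ) * φ q.2 * ((Real.sqrt (v (q.2 + q.1)) : ℂ) * ψ (q.2+q.1)))‖ₑ ≤
      ENNReal.ofReal ((2 * cW W * Real.sqrt σ)⁻¹) * ∫⁻ q : W × W, ENNReal.ofReal (Real.exp (-(Real.sqrt σ*‖q.1‖))) *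
        (ENNReal.ofReal (‖φ q.2‖^2 * hfun p (v q.2/σ)) * ENNReal.ofReal (σ * (1 + (v (q.2+q.1)/σ)^p)) +
          ENNReal.ofReal (‖ψ (q.2+q.1)‖^2 * hfun p (v (q.2+q.1)/σ)) * ENNReal.ofReal (σ * (1 + (v q.2/σ)^p))) := by
    refine (enorm_integral_le_lintegral_enorm _).trans ?_
    rw [← lintegral_const_mul' _ _ ENNReal.ofReal_ne_top]
    apply lintegral_mono
    intro q
    have b1 := hb0 q.2
    have b2 := hb0 (q.2+q.1)
    have a1 := hh0 q.2
    have a2 := hh0 (q.2+q.1)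
    simp only
    rw [← ENNReal.ofReal_mul (by positivity), ← ENNReal.ofReal_mul (by positivity), ← ENNReal.ofReal_add (by positivity) (by positivity),
      ← ENNReal.ofReal_mul (by positivity), ← ENNReal.ofReal_mul (by positivity), ← ofReal_norm]
    apply ENNReal.ofReal_le_ofReal
    have hpt := pt_I (X := ‖φ q.2‖) (Y := ‖ψ (q.2+q.1)‖) a1 a2 b1 b2
    rw [hhb, hhb] at hpt
    have hk : ‖rker W η q.1‖ ≤ (cW W * Real.sqrt σ)⁻¹ * Real.exp (-(Real.sqrt σ * ‖q.1‖)) := by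
      rw [norm_rker]; gcongr
    rw [norm_mul, norm_mul, norm_mul, norm_mul, Complex.norm_real, Complex.norm_real, Real.norm_of_nonneg (Real.sqrt_nonneg _), Real.norm_of_nonneg (Real.sqrt_nonneg _)]
    refine (mul_le_mul hk hpt (by positivity) (by positivity)).trans (le_of_eq ?_)
    rw [mul_inv, mul_inv, mul_inv]; ring
  refine (mul_le_mul_right (hB.trans (mul_le_mul_right hks _)) _).trans (le_of_eq ?_)
  have e : ENNReal.ofReal (σ^(((Module.finrank ℝ W : ℝ) + 1)/2 - 2)) * ENNReal.ofReal ((2 * cW W * Real.sqrt σ)⁻¹) * ENNReal.ofReal (σ^(1-(Module.finrank ℝ W : ℝ)/2))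
      = ENNReal.ofReal ((2 * cW W)⁻¹) * ENNReal.ofReal σ⁻¹ := by
    rw [← ENNReal.ofReal_mul (by positivity), ← ENNReal.ofReal_mul (by positivity), ← ENNReal.ofReal_mul (by positivity)]
    congr 1
    rw [mul_inv, Real.sqrt_eq_rpow, ← Real.rpow_neg hσ.le, ← Real.rpow_neg_one σ]
    have : σ^(-1:ℝ) = σ^(((Module.finrank ℝ W : ℝ) + 1)/2 - 2) * σ^(-(1/2:ℝ)) * σ^(1-(Module.finrank ℝ W : ℝ)/2) := by
      rw [← Real.rpow_add hσ, ← Real.rpow_add hσ]; congr 1; ring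
    rw [this]; ring
  unfold CI
  calc _ = (ENNReal.ofReal (σ^(((Module.finrank ℝ W : ℝ) + 1)/2 - 2)) * ENNReal.ofReal ((2 * cW W * Real.sqrt σ)⁻¹) * ENNReal.ofReal (σ^(1-(Module.finrank ℝ W : ℝ)/2)))
        * ((volume (ball (0:W) 1) * ENNReal.ofReal (Real.Gamma ((Module.finrank ℝ W : ℝ) + 1)) +
    ENNReal.ofReal (Real.Gamma ((Module.finrank ℝ W : ℝ) - 2*p + 1))) * ((∫⁻ x, ENNReal.ofReal (‖φ x‖^2 * hfun p (v x/σ))) + ∫⁻ x, ENNReal.ofReal (‖ψ x‖^2 * hfun p (v x/σ)))) := by ring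
    _ = _ := by rw [e]; ring
end PartOne
end

noncomputable section
open MeasureTheory Metric Complex
open scoped ENNReal FourierTransform SchwartzMap

set_option linter.unusedSectionVars false
section RESec
variable {W : Type*} [NormedAddCommGroup W] [InnerProductSpace ℝ W] [FiniteDimensional ℝ W]
  [MeasurableSpace W] [BorelSpace W]

lemma lint_rpow_Ioc {t r : ℝ} (ht : 0 ≤ t) (hr : -1 < r) :
    ∫⁻ σ in Set.Ioc 0 t, ENNReal.ofReal (σ^r) = ENNReal.ofReal (t^(r+1)/(r+1)) := by
  have h1 : IntegrableOn (fun σ : ℝ => σ^r) (Set.Ioc 0 t) := by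
    rw [← intervalIntegrable_iff_integrableOn_Ioc_of_le ht]
    exact intervalIntegral.intervalIntegrable_rpow' hr
  rw [← ofReal_integral_eq_lintegral_ofReal h1]
  · rw [← intervalIntegral.integral_of_le ht, integral_rpow (Or.inl hr), Real.zero_rpow (by linarith), sub_zero]
  · filter_upwards [ae_restrict_mem measurableSet_Ioc] with σ hσ
    exact Real.rpow_nonneg hσ.1.le _

lemma hfun_int {p t : ℝ} (hp : 1 < p) (ht : 0 ≤ t) :
    ∫⁻ σ in Set.Ioi (0:ℝ), ENNReal.ofReal (σ⁻¹ * hfun p (t/σ)) ≤ ENNReal.ofReal (1 + 1/(p-1)) := by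
  rcases ht.eq_or_lt with rfl | ht
  · simp [hfun]
  rw [← Set.Ioc_union_Ioi_eq_Ioi ht.le]
  refine (lintegral_union_le _ _ _).trans ?_
  rw [add_comm, ENNReal.ofReal_add zero_le_one (by have : 0 < p - 1 := by linarith
                                                   positivity)]
  apply add_le_add
  · have h1 : ∫⁻ σ in Set.Ioi t, ENNReal.ofReal (t * σ^(-2:ℝ)) = ENNReal.ofReal 1 := by
      rw [← ofReal_integral_eq_lintegral_ofReal ((integrableOn_Ioi_rpow_of_lt (by norm_num) ht).const_mul t)]
      · rw [integral_const_mul, integral_Ioi_rpow_of_lt (by norm_num) ht]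
        congr 1
        norm_num
        rw [Real.rpow_neg_one]; field_simp
      · filter_upwards [ae_restrict_mem measurableSet_Ioi] with σ hσ
        have : 0 < σ := ht.trans hσ
        positivity
    rw [← h1]
    apply setLIntegral_mono (by fun_prop)
    intro σ hσ
    have h0 : 0 < σ := ht.trans hσ
    apply ENNReal.ofReal_le_ofReal
    have : hfun p (t/σ) ≤ t/σ := by
      unfold hfun
      apply div_le_self (by positivity)
      have : 0 ≤ (t/σ)^p := by positivity
      linarith
    calc σ⁻¹ * hfun p (t/σ) ≤ σ⁻¹ * (t/σ) := by gcongr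
      _ = _ := by rw [Real.rpow_neg h0.le, Real.rpow_two]; field_simp
  · have h1 : ∫⁻ σ in Set.Ioc 0 t, ENNReal.ofReal (t^(1-p)) * ENNReal.ofReal (σ^(p-2)) = ENNReal.ofReal (1/(p-1)) := by
      rw [lintegral_const_mul _ (by fun_prop), lint_rpow_Ioc ht.le (by linarith), ← ENNReal.ofReal_mul (by positivity)]
      congr 1
      rw [show p - 2 + 1 = p - 1 by ring, ← mul_div_assoc, ← Real.rpow_add ht]; simp
    rw [← h1]
    apply setLIntegral_mono (by fun_prop)
    intro σ hσ
    have h0 : 0 < σ := hσ.1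
    rw [← ENNReal.ofReal_mul (by positivity)]
    apply ENNReal.ofReal_le_ofReal
    have : hfun p (t/σ) ≤ (t/σ)^(1-p) := by
      unfold hfun
      rw [Real.rpow_sub (by positivity), Real.rpow_one]
      gcongr
      linarith
    calc σ⁻¹ * hfun p (t/σ) ≤ σ⁻¹ * (t/σ)^(1-p) := by gcongr
      _ = _ := by
        rw [Real.div_rpow ht.le h0.le, ← Real.rpow_neg_one σ, div_eq_mul_inv, ← Real.rpow_neg h0.le, mul_left_comm, ← Real.rpow_add h0]
        congr 2; ring

lemma tI {p : ℝ} (hp : 1 < p) {v : W → ℝ} (hv : Measurable v) (hv0 : ∀ x, 0 ≤ v x) {φ : W → ℂ} (hφ : Nice φ) :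
    ∫⁻ σ in Set.Ioi (0:ℝ), ENNReal.ofReal σ⁻¹ * ∫⁻ x, ENNReal.ofReal (‖φ x‖^2 * hfun p (v x/σ)) ≤
      ENNReal.ofReal (1 + 1/(p-1)) * ENNReal.ofReal (N2 volume φ) := by
  have mh := measurable_hfun p
  have mφ := hφ.1
  simp_rw [← lintegral_const_mul' _ _ ENNReal.ofReal_ne_top]
  rw [lintegral_lintegral_swap (by fun_prop), ← N2_eq_lintegral (hφ.memLp 2), ← lintegral_const_mul _ (by fun_prop)]
  apply lintegral_mono
  intro x
  simp only
  rw [mul_comm, ← ofReal_norm, ← ENNReal.ofReal_pow (norm_nonneg _)]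
  refine le_trans (le_of_eq ?_) (mul_le_mul_right (hfun_int hp (hv0 x)) _)
  rw [← lintegral_const_mul' _ _ ENNReal.ofReal_ne_top]
  apply setLIntegral_congr_fun measurableSet_Ioi
  intro σ hσ
  have : (0:ℝ) < σ := hσ
  simp only
  rw [← ENNReal.ofReal_mul (by positivity), ← ENNReal.ofReal_mul (by positivity)]
  congr 1; ring

/-- the resolvent constant -/
def CR (W : Type*) [NormedAddCommGroup W] [InnerProductSpace ℝ W] [MeasurableSpace W] [BorelSpace W] [FiniteDimensional ℝ W] (p : ℝ) : ℝ≥0∞ :=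
  ENNReal.ofReal ((((Module.finrank ℝ W : ℝ)+1)/2) - 1) *
   (ENNReal.ofReal ((1 + (cW W)⁻¹ * Real.Gamma ((Module.finrank ℝ W : ℝ) - 2*p + 1)) * (1 - ((Module.finrank ℝ W : ℝ) - 1)/2/p)⁻¹) +
    CI W p * (ENNReal.ofReal (1 + 1/(p-1)) * 2))

lemma CR_lt_top (p : ℝ) : CR W p < ⊤ := by
  unfold CR
  refine ENNReal.mul_lt_top ENNReal.ofReal_lt_top (ENNReal.add_lt_top.2 ⟨ENNReal.ofReal_lt_top, ENNReal.mul_lt_top (CI_lt_top p) ?_⟩)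
  exact ENNReal.mul_lt_top ENNReal.ofReal_lt_top (by simp)

lemma norm_res_ge {ζ : ℂ} (hζ : 0 < ζ.re) (r : ℝ) : ζ.re^2 ≤ ‖((r^2 : ℝ) : ℂ) + ζ^2‖ := by
  have e : ((r^2 : ℝ) : ℂ) + ζ^2 = (ζ + r * I) * (ζ - r * I) := by
    push_cast; linear_combination (r:ℂ)^2 * I_sq
  rw [e, norm_mul, pow_two]
  have h1 := (le_abs_self _).trans (Complex.abs_re_le_norm (ζ + r * I))
  have h2 := (le_abs_self _).trans (Complex.abs_re_le_norm (ζ - r * I))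
  simp at h1 h2
  gcongr

set_option maxHeartbeats 800000 in
lemma RE_swap {ζ : ℂ} (hζ : 0 < ζ.re) (hz : 0 ≤ (ζ^2).im) {a : ℝ} (ha : 2 ≤ a) {f g : W → ℂ} (hf : Nice f) (hg : Nice g) :
    BF (fun ξ => (((‖ξ‖^2 : ℝ) : ℂ) + ζ^2)⁻¹) f g = ((a-1 : ℝ) : ℂ) * I^((a-1 : ℝ) : ℂ) *
      ∫ σ in Set.Ioi (0:ℝ), ((σ^(a-2) : ℝ) : ℂ) * BF (fun ξ => (((‖ξ‖^2 : ℝ) : ℂ) + ζ^2 + σ * I)^((-a : ℝ) : ℂ)) f g := by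
  have hgh := integrable_fourier_mul hf hg
  have c1 := continuous_fourier' hf.integrable
  have c2 := continuous_fourierInv' hg.integrable
  unfold BF
  have e1 : ∀ ξ : W, (((‖ξ‖^2 : ℝ) : ℂ) + ζ^2)⁻¹ * (𝓕 f ξ * 𝓕⁻ g ξ) = (((a-1 : ℝ) : ℂ) * I^((a-1 : ℝ) : ℂ)) *
      ∫ σ in Set.Ioi (0:ℝ), (((σ^(a-2) : ℝ) : ℂ) * (((‖ξ‖^2 : ℝ) : ℂ) + ζ^2 + σ * I)^((-a : ℝ) : ℂ)) * (𝓕 f ξ * 𝓕⁻ g ξ) := by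
    intro ξ
    rw [resolvent_identity (by rw [add_im, ofReal_im]; linarith)
      (by have := slit_of_re_pos hζ (r := ‖ξ‖^2) (by positivity); rwa [add_comm] at this) ha, integral_mul_const]
    ring
  simp_rw [e1]
  rw [integral_const_mul, integral_integral_swap]
  · congr 2; ext σ
    rw [← integral_const_mul]
    congr 1; ext ξ; ring
  · have hd : 0 < ζ.re^2 := by positivity
    have hdom := Integrable.mul_prod (ν := volume.restrict (Set.Ioi (0:ℝ))) hgh.norm (integrable_dom hd)
    refine hdom.mono' ?_ ?_
    · apply Measurable.aestronglyMeasurable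
      have := c1.measurable
      have := c2.measurable
      simp only [Function.uncurry_def]
      fun_prop
    · rw [← Measure.restrict_univ (μ := (volume : Measure W)), Measure.prod_restrict]
      filter_upwards [ae_restrict_mem (MeasurableSet.univ.prod measurableSet_Ioi)] with x hx
      simp only [Function.uncurry_def]
      rw [norm_mul, mul_comm]
      gcongr
      exact norm_resker_le (by rw [add_im, ofReal_im]; linarith) hd (norm_res_ge hζ _) hx.2 ha

lemma RE_pos {p : ℝ} (hn : 3 ≤ Module.finrank ℝ W) (hp : ((Module.finrank ℝ W : ℝ) - 1)/2 < p) (hp2 : 2*p ≤ Module.finrank ℝ W)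
    {ζ : ℂ} (hζ : 0 < ζ.re) (hz : 0 ≤ (ζ^2).im) {v : W → ℝ} (hv : Measurable v) (hv0 : ∀ x, 0 ≤ v x) {Bv : ℝ}
    (hvB : ∀ x, v x ≤ Bv) (hM : Mor p v) {φ ψ : W → ℂ} (hφ : Nice φ) (hψ : Nice ψ) :
    ‖BF (fun ξ => (((‖ξ‖^2 : ℝ) : ℂ) + ζ^2)⁻¹) (fun x => (Real.sqrt (v x) : ℂ) * φ x) (fun x => (Real.sqrt (v x) : ℂ) * ψ x)‖ₑ
      ≤ CR W p * ENNReal.ofReal ((N2 volume φ + N2 volume ψ)/2) := by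
  have hW : Nontrivial W := Module.nontrivial_of_finrank_pos (R := ℝ) (by omega)
  obtain ⟨n, hnn⟩ : ∃ n : ℝ, n = (Module.finrank ℝ W : ℝ) := ⟨_, rfl⟩
  have hn3 : 3 ≤ n := by rw [hnn]; exact_mod_cast hn
  have hp1 : 1 < p := by rw [← hnn] at hp; linarith
  have hsvm : Measurable (fun x => (Real.sqrt (v x) : ℂ)) := by fun_prop
  have hsvb : ∀ x, ‖(Real.sqrt (v x) : ℂ)‖ ≤ Real.sqrt Bv := by
    intro x; rw [Complex.norm_real, Real.norm_of_nonneg (Real.sqrt_nonneg _)]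
    exact Real.sqrt_le_sqrt (hvB x)
  have hn1 : Nice (fun x => (Real.sqrt (v x) : ℂ) * φ x) := hφ.mul_bdd hsvm hsvb
  have hn2 : Nice (fun x => (Real.sqrt (v x) : ℂ) * ψ x) := hψ.mul_bdd hsvm hsvb
  have hN1 := N2_nonneg volume φ
  have hN2 := N2_nonneg volume ψ
  have hζ0 : ζ^2 ≠ 0 := by
    apply pow_ne_zero; intro h; simp [h] at hζ
  have hb0 : 0 < ‖ζ^2‖ := norm_pos_iff.2 hζ0
  rw [RE_swap hζ hz (a := ((Module.finrank ℝ W : ℝ)+1)/2) (by rw [← hnn]; linarith) hn1 hn2]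
  obtain ⟨θ, hθ⟩ : ∃ θ : ℝ, θ = ((Module.finrank ℝ W : ℝ) - 1)/2/p := ⟨_, rfl⟩
  have hθp : θ * p = ((Module.finrank ℝ W : ℝ) - 1)/2 := by rw [hθ]; field_simp
  have hθ1 : θ < 1 := by rw [hθ, div_lt_one (by linarith)]; exact hp
  rw [enorm_mul, CR, mul_assoc]
  have hc : ‖((((Module.finrank ℝ W : ℝ)+1)/2 - 1 : ℝ) : ℂ) * I^((((Module.finrank ℝ W : ℝ)+1)/2 - 1 : ℝ) : ℂ)‖ₑ =
      ENNReal.ofReal ((((Module.finrank ℝ W : ℝ)+1)/2) - 1) := by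
    rw [← ofReal_norm, norm_mul, Complex.norm_cpow_real, norm_I, Real.one_rpow, mul_one, Complex.norm_real, Real.norm_of_nonneg (by rw [← hnn]; linarith)]
  rw [hc]
  apply mul_le_mul_right
  refine (enorm_integral_le_lintegral_enorm _).trans ?_
  rw [← Set.Ioc_union_Ioi_eq_Ioi hb0.le]
  refine (lintegral_union_le _ _ _).trans ?_
  rw [add_mul]
  have hC0 : 0 ≤ 1 + (cW W)⁻¹ * Real.Gamma ((Module.finrank ℝ W : ℝ) - 2*p + 1) := by
    have := cW_pos (W := W)
    have g2 := Real.Gamma_pos_of_pos (show 0 < (Module.finrank ℝ W : ℝ) - 2*p + 1 by linarith)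
    positivity
  apply add_le_add
  · obtain ⟨C, hC⟩ : ∃ C, C = 1 + (cW W)⁻¹ * Real.Gamma ((Module.finrank ℝ W : ℝ) - 2*p + 1) := ⟨_, rfl⟩
    rw [← hC] at hC0 ⊢
    have h1 : ∫⁻ σ in Set.Ioc 0 ‖ζ^2‖, ENNReal.ofReal (C * ‖ζ^2‖^(θ-1) * ((N2 volume φ + N2 volume ψ)/2)) * ENNReal.ofReal (σ^(-θ)) =
        ENNReal.ofReal (C * (1 - ((Module.finrank ℝ W : ℝ) - 1)/2/p)⁻¹) * ENNReal.ofReal ((N2 volume φ + N2 volume ψ)/2) := by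
      have h1θ : 0 < 1 - θ := by linarith
      rw [lintegral_const_mul _ (by fun_prop), lint_rpow_Ioc hb0.le (by linarith), ← ENNReal.ofReal_mul (by positivity), ← hθ,
        ← ENNReal.ofReal_mul (by positivity)]
      congr 1
      have : ‖ζ^2‖^(θ-1) * ‖ζ^2‖^(-θ+1) = 1 := by rw [← Real.rpow_add hb0]; simp
      rw [show -θ + 1 = 1 - θ by ring] at this ⊢
      calc _ = C * ((N2 volume φ + N2 volume ψ)/2) * (1-θ)⁻¹ * (‖ζ^2‖^(θ-1) * ‖ζ^2‖^(1-θ)) := by ring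
        _ = _ := by rw [this]; ring
    rw [← h1]
    apply setLIntegral_mono (by fun_prop)
    intro σ hσ
    have hσ0 : 0 < σ := hσ.1
    have h2 := part_II hp1.le hp2 hθp hz hζ0 hσ.1 hσ.2 hv hv0 hvB hM hφ hψ
    rw [← ENNReal.ofReal_mul (by positivity), ← ofReal_norm, norm_mul, Complex.norm_real, Real.norm_of_nonneg (by positivity)]
    apply ENNReal.ofReal_le_ofReal
    refine h2.trans (le_of_eq ?_)
    rw [hC]; ring
  · have h2 : ∀ σ ∈ Set.Ioi ‖ζ^2‖, ‖((σ^(((Module.finrank ℝ W : ℝ)+1)/2-2) : ℝ) : ℂ) * BF (fun ξ => (((‖ξ‖^2 : ℝ) : ℂ) + ζ^2 + σ * I)^((-(((Module.finrank ℝ W : ℝ)+1)/2) : ℝ) : ℂ))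
        (fun x => (Real.sqrt (v x) : ℂ) * φ x) (fun x => (Real.sqrt (v x) : ℂ) * ψ x)‖ₑ ≤
        CI W p * (ENNReal.ofReal σ⁻¹ * (∫⁻ x, ENNReal.ofReal (‖φ x‖^2 * hfun p (v x/σ))) + ENNReal.ofReal σ⁻¹ * ∫⁻ x, ENNReal.ofReal (‖ψ x‖^2 * hfun p (v x/σ))) := by
      intro σ hσ
      have hσ0 : 0 < σ := hb0.trans hσ
      have h2 := part_I hp2 hz hσ0 (le_of_lt hσ) hv hv0 hvB hM hφ hψ
      rw [enorm_mul, ← ofReal_norm, Complex.norm_real, Real.norm_of_nonneg (by positivity), ← mul_add]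
      exact h2
    have mh := measurable_hfun p
    have mφ := hφ.1
    have mψ := hψ.1
    have m1 : Measurable (fun σ : ℝ => ENNReal.ofReal σ⁻¹ * (∫⁻ x, ENNReal.ofReal (‖φ x‖^2 * hfun p (v x/σ)))) := by
      apply Measurable.mul (by fun_prop)
      apply Measurable.lintegral_prod_right' (f := fun q : ℝ × W => ENNReal.ofReal (‖φ q.2‖^2 * hfun p (v q.2/q.1)))
      fun_prop
    have m2 : Measurable (fun σ : ℝ => ENNReal.ofReal σ⁻¹ * (∫⁻ x, ENNReal.ofReal (‖ψ x‖^2 * hfun p (v x/σ)))) := by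
      apply Measurable.mul (by fun_prop)
      apply Measurable.lintegral_prod_right' (f := fun q : ℝ × W => ENNReal.ofReal (‖ψ q.2‖^2 * hfun p (v q.2/q.1)))
      fun_prop
    refine (setLIntegral_mono (by fun_prop) h2).trans ?_
    refine (lintegral_mono_set (Set.Ioi_subset_Ioi hb0.le)).trans ?_
    rw [lintegral_const_mul _ (by fun_prop), lintegral_add_left m1, mul_assoc]
    apply mul_le_mul_right
    refine (add_le_add (tI hp1 hv hv0 hφ) (tI hp1 hv hv0 hψ)).trans (le_of_eq ?_)
    rw [← mul_add, ← ENNReal.ofReal_add hN1 hN2, mul_assoc]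
    congr 1
    rw [← ENNReal.ofReal_ofNat, ← ENNReal.ofReal_mul (by norm_num)]
    congr 1; ring
end RESec
end

noncomputable section
open MeasureTheory Metric Complex
open scoped ENNReal FourierTransform SchwartzMap
set_option linter.unusedSectionVars false
section RE2Sec
variable {W : Type*} [NormedAddCommGroup W] [InnerProductSpace ℝ W] [FiniteDimensional ℝ W] [MeasurableSpace W] [BorelSpace W]

/-- Admissible exponents. -/
def Adm (W : Type*) [NormedAddCommGroup W] [InnerProductSpace ℝ W] (p : ℝ) : Prop :=
  3 ≤ Module.finrank ℝ W ∧ ((Module.finrank ℝ W : ℝ) - 1)/2 < p ∧ 2*p ≤ Module.finrank ℝ W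

/-- Admissible bounded weights. -/
def Wt (p : ℝ) (v : W → ℝ) : Prop := Measurable v ∧ (∀ x, 0 ≤ v x) ∧ (∃ B, ∀ x, v x ≤ B) ∧ Mor p v

lemma N2_conj {α : Type*} [MeasurableSpace α] (μ : Measure α) (f : α → ℂ) :
    N2 μ (fun x => (starRingEnd ℂ) (f x)) = N2 μ f := by
  unfold N2; simp

lemma conj_BF (m f g : W → ℂ) : (starRingEnd ℂ) (BF m f g) =
    BF (fun ξ => (starRingEnd ℂ) (m ξ)) (fun x => (starRingEnd ℂ) (g x)) (fun x => (starRingEnd ℂ) (f x)) := by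
  unfold BF
  rw [← integral_conj]
  congr 1; ext ξ
  simp only [map_mul, conj_fourier, conj_fourierInv]
  ring

lemma RE_all {p : ℝ} (hA : Adm W p)
    {ζ : ℂ} (hζ : 0 < ζ.re) {v : W → ℝ} (hv : Wt p v) {φ ψ : W → ℂ} (hφ : Nice φ) (hψ : Nice ψ) :
    ‖BF (fun ξ => (((‖ξ‖^2 : ℝ) : ℂ) + ζ^2)⁻¹) (fun x => (Real.sqrt (v x) : ℂ) * φ x) (fun x => (Real.sqrt (v x) : ℂ) * ψ x)‖
      ≤ (CR W p).toReal * ((N2 volume φ + N2 volume ψ)/2) := by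
  obtain ⟨hn, hp, hp2⟩ := hA
  obtain ⟨hvm, hv0, ⟨B, hB⟩, hM⟩ := hv
  have key : ∀ {ζ : ℂ} (_ : 0 < ζ.re) (_ : 0 ≤ (ζ^2).im) {φ ψ : W → ℂ} (_ : Nice φ) (_ : Nice ψ), 
    ‖BF (fun ξ => (((‖ξ‖^2 : ℝ) : ℂ) + ζ^2)⁻¹) (fun x => (Real.sqrt (v x) : ℂ) * φ x) (fun x => (Real.sqrt (v x) : ℂ) * ψ x)‖
      ≤ (CR W p).toReal * ((N2 volume φ + N2 volume ψ)/2) := by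
    intro ζ hζ hz φ ψ hφ hψ
    have h := RE_pos hn hp hp2 hζ hz hvm hv0 hB hM hφ hψ
    have h0 : 0 ≤ (N2 volume φ + N2 volume ψ)/2 := by
      have := N2_nonneg volume φ
      have := N2_nonneg volume ψ
      positivity
    rw [← ENNReal.ofReal_toReal (CR_lt_top (W := W) p).ne, ← ENNReal.ofReal_mul (by positivity), ← ofReal_norm] at h
    exact (ENNReal.ofReal_le_ofReal_iff (by positivity)).1 h
  by_cases hz : 0 ≤ (ζ^2).im
  · exact key hζ hz hφ hψ
  · have h := key (ζ := (starRingEnd ℂ) ζ) (by simpa using hζ) (by rw [← map_pow, conj_im]; linarith) hψ.conj hφ.conj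
    rw [N2_conj, N2_conj, add_comm (N2 _ _)] at h
    refine le_trans (le_of_eq ?_) h
    rw [← Complex.norm_conj, conj_BF]
    simp

lemma Wt.avg {p : ℝ} (hp : 1 ≤ p) {v1 v2 : W → ℝ} (h1 : Wt p v1) (h2 : Wt p v2) : Wt p (fun x => (v1 x + v2 x)/2) := by
  obtain ⟨m1, n1, ⟨B1, b1⟩, M1⟩ := h1
  obtain ⟨m2, n2, ⟨B2, b2⟩, M2⟩ := h2
  refine ⟨by fun_prop, fun x => by have := n1 x; have := n2 x; positivity, ⟨(B1+B2)/2, fun x => by have := b1 x; have := b2 x; linarith⟩, ?_⟩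
  intro y r hr
  have hc := convexOn_rpow hp
  have hpt : ∀ x, ENNReal.ofReal (((v1 x + v2 x)/2)^p) ≤ ENNReal.ofReal (1/2) * ENNReal.ofReal (v1 x ^p) + ENNReal.ofReal (1/2) * ENNReal.ofReal (v2 x^p) := by
    intro x
    have a1 : 0 ≤ v1 x ^ p := Real.rpow_nonneg (n1 x) _
    have a2 : 0 ≤ v2 x ^ p := Real.rpow_nonneg (n2 x) _
    rw [← ENNReal.ofReal_mul (by norm_num), ← ENNReal.ofReal_mul (by norm_num), ← ENNReal.ofReal_add (by positivity) (by positivity)]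
    apply ENNReal.ofReal_le_ofReal
    have hc2 := hc.2
    have := hc2 (n1 x) (n2 x) (show (0:ℝ) ≤ 1/2 by norm_num) (show (0:ℝ) ≤ 1/2 by norm_num) (by norm_num)
    simp only [smul_eq_mul] at this
    rwa [show (v1 x + v2 x)/2 = 1/2 * v1 x + 1/2 * v2 x by ring]
  refine (lintegral_mono hpt).trans ?_
  rw [lintegral_add_left (by fun_prop), lintegral_const_mul _ (by fun_prop), lintegral_const_mul _ (by fun_prop)]
  refine (add_le_add (mul_le_mul_right (M1 y r hr) _) (mul_le_mul_right (M2 y r hr) _)).trans (le_of_eq ?_)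
  rw [← add_mul, ← ENNReal.ofReal_add (by norm_num) (by norm_num)]
  norm_num

lemma Wt.translate {p : ℝ} {v : W → ℝ} (h : Wt p v) (a : W) : Wt p (fun x => v (x + a)) := by
  obtain ⟨m1, n1, ⟨B1, b1⟩, M1⟩ := h
  refine ⟨by fun_prop, fun x => n1 _, ⟨B1, fun x => b1 _⟩, ?_⟩
  intro y r hr
  refine le_trans (le_of_eq ?_) (M1 (y+a) r hr)
  rw [← lintegral_indicator measurableSet_ball, ← lintegral_indicator measurableSet_ball,
    ← lintegral_add_right_eq_self (Set.indicator (ball (y+a) r) _) a]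
  congr 1; ext x
  simp [Set.indicator, mem_ball, dist_eq_norm]

lemma Wt.mono {p : ℝ} (hp : 0 ≤ p) {v w : W → ℝ} (h : Wt p v) (hw : Measurable w) (h0 : ∀ x, 0 ≤ w x) (hwv : ∀ x, w x ≤ v x) : Wt p w := by
  obtain ⟨m1, n1, ⟨B1, b1⟩, M1⟩ := h
  refine ⟨hw, h0, ⟨B1, fun x => (hwv x).trans (b1 _)⟩, ?_⟩
  intro y r hr
  refine (lintegral_mono fun x => ?_).trans (M1 y r hr)
  apply ENNReal.ofReal_le_ofReal
  exact Real.rpow_le_rpow (h0 x) (hwv x) hp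

lemma N2_mul_le {α : Type*} [MeasurableSpace α] {μ : Measure α} {φ : α → ℂ} (hφ : MemLp φ 2 μ) {c : α → ℂ} {B : ℝ} (hB : ∀ x, ‖c x‖^2 ≤ B) :
    N2 μ (fun x => c x * φ x) ≤ B * N2 μ φ := by
  unfold N2
  rw [← integral_const_mul]
  apply integral_mono_of_nonneg
  · exact Filter.Eventually.of_forall fun x => by positivity
  · exact (integrable_sq hφ).const_mul _
  · refine Filter.Eventually.of_forall fun x => ?_
    simp only [norm_mul, mul_pow]
    exact mul_le_mul_of_nonneg_right (hB x) (by positivity)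

/-- constant -/
def C2 (W : Type*) [NormedAddCommGroup W] [InnerProductSpace ℝ W] [MeasurableSpace W] [BorelSpace W] [FiniteDimensional ℝ W] (p : ℝ) : ℝ :=
  2 * (CR W p).toReal + 1

lemma C2_pos (p : ℝ) : 0 < C2 W p := by unfold C2; positivity

lemma sqrt_ratio {a b : ℝ} (ha : 0 ≤ a) (hab : a ≤ 2 * b) : Real.sqrt b * Real.sqrt (a/b) = Real.sqrt a ∧ (Real.sqrt (a/b))^2 ≤ 2 := by
  have hb : 0 ≤ b := by linarith
  constructor
  · rw [← Real.sqrt_mul hb]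
    congr 1
    rcases eq_or_lt_of_le hb with h | h
    · rw [← h] at hab ⊢; simp; linarith
    · field_simp
  · rw [Real.sq_sqrt (by positivity)]
    rcases eq_or_lt_of_le hb with h | h
    · rw [← h]; simp
    · rw [div_le_iff₀ h]; exact hab

lemma RE2 {p : ℝ} (hA : Adm W p)
    {ζ : ℂ} (hζ : 0 < ζ.re) {v1 v2 : W → ℝ} (hv1 : Wt p v1) (hv2 : Wt p v2) {φ ψ : W → ℂ} (hφ : Nice φ) (hψ : Nice ψ) :
    ‖BF (fun ξ => (((‖ξ‖^2 : ℝ) : ℂ) + ζ^2)⁻¹) (fun x => (Real.sqrt (v1 x) : ℂ) * φ x) (fun x => (Real.sqrt (v2 x) : ℂ) * ψ x)‖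
      ≤ C2 W p * ((N2 volume φ + N2 volume ψ)/2) := by
  have hp1 : 1 ≤ p := by
    have := hA.1
    have h3 : (3:ℝ) ≤ Module.finrank ℝ W := by exact_mod_cast this
    linarith [hA.2.1]
  have hv := hv1.avg hp1 hv2
  obtain ⟨v, hvd⟩ : ∃ v : W → ℝ, v = (fun x => (v1 x + v2 x)/2) := ⟨_, rfl⟩
  rw [← hvd] at hv
  have q1 : ∀ x, _ := fun x => sqrt_ratio (a := v1 x) (b := v x) (hv1.2.1 x) (by rw [hvd]; have := hv2.2.1 x; simp only; linarith)
  have q2 : ∀ x, _ := fun x => sqrt_ratio (a := v2 x) (b := v x) (hv2.2.1 x) (by rw [hvd]; have := hv1.2.1 x; simp only; linarith)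
  have mv := hv.1
  have mv1 := hv1.1
  have mv2 := hv2.1
  have b1 : ∀ x, ‖(Real.sqrt (v1 x / v x) : ℂ)‖^2 ≤ 2 := fun x => by
    rw [Complex.norm_real, Real.norm_of_nonneg (Real.sqrt_nonneg _)]; exact (q1 x).2
  have b2 : ∀ x, ‖(Real.sqrt (v2 x / v x) : ℂ)‖^2 ≤ 2 := fun x => by
    rw [Complex.norm_real, Real.norm_of_nonneg (Real.sqrt_nonneg _)]; exact (q2 x).2
  have n1 : Nice (fun x => (Real.sqrt (v1 x / v x) : ℂ) * φ x) := hφ.mul_bdd (by fun_prop) (B := 2) (fun x => by nlinarith [b1 x])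
  have n2 : Nice (fun x => (Real.sqrt (v2 x / v x) : ℂ) * ψ x) := hψ.mul_bdd (by fun_prop) (B := 2) (fun x => by nlinarith [b2 x])
  have h := RE_all hA hζ hv n1 n2
  have e1 : (fun x => (Real.sqrt (v x) : ℂ) * ((Real.sqrt (v1 x / v x) : ℂ) * φ x)) = fun x => (Real.sqrt (v1 x) : ℂ) * φ x := by
    ext x; rw [← mul_assoc, ← ofReal_mul, (q1 x).1]
  have e2 : (fun x => (Real.sqrt (v x) : ℂ) * ((Real.sqrt (v2 x / v x) : ℂ) * ψ x)) = fun x => (Real.sqrt (v2 x) : ℂ) * ψ x := by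
    ext x; rw [← mul_assoc, ← ofReal_mul, (q2 x).1]
  rw [e1, e2] at h
  refine h.trans ?_
  have i1 := N2_mul_le (hφ.memLp 2) b1
  have i2 := N2_mul_le (hψ.memLp 2) b2
  have j1 := N2_nonneg volume φ
  have j2 := N2_nonneg volume ψ
  unfold C2
  have := ENNReal.toReal_nonneg (a := CR W p)
  nlinarith
end RE2Sec
end

noncomputable section
open MeasureTheory Metric Complex
open scoped ENNReal FourierTransform SchwartzMap
set_option linter.unusedSectionVars false
section STSec
variable {W : Type*} [NormedAddCommGroup W] [InnerProductSpace ℝ W] [FiniteDimensional ℝ W] [MeasurableSpace W] [BorelSpace W]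
variable {X : Type*} [MeasurableSpace X]

lemma measurable_FR {F : X × W → ℂ} (hF : Measurable F) : Measurable (fun q : X × W => 𝓕 (fun w => F (q.1, w)) q.2) := by
  simp_rw [Real.fourier_eq']
  apply StronglyMeasurable.measurable
  apply StronglyMeasurable.integral_prod_right' (f := fun r : (X × W) × W => Complex.exp (↑(-2 * Real.pi * inner ℝ r.2 r.1.2) * Complex.I) • F (r.1.1, r.2))
  apply Measurable.stronglyMeasurable
  fun_prop

lemma measurable_FRi {F : X × W → ℂ} (hF : Measurable F) : Measurable (fun q : X × W => 𝓕⁻ (fun w => F (q.1, w)) q.2) := by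
  simp_rw [Real.fourierInv_eq']
  apply StronglyMeasurable.measurable
  apply StronglyMeasurable.integral_prod_right' (f := fun r : (X × W) × W => Complex.exp (↑(2 * Real.pi * inner ℝ r.2 r.1.2) * Complex.I) • F (r.1.1, r.2))
  apply Measurable.stronglyMeasurable
  fun_prop

/-- partial FT in space -/
def PF (G : W × ℝ → ℂ) (q : W × ℝ) : ℂ := 𝓕 (fun x => G (x, q.2)) q.1
/-- partial inverse FT in space -/
def PFi (G : W × ℝ → ℂ) (q : W × ℝ) : ℂ := 𝓕⁻ (fun x => G (x, q.2)) q.1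
/-- partial FT in time -/
def TF (G : W × ℝ → ℂ) (q : W × ℝ) : ℂ := 𝓕 (fun t => G (q.1, t)) q.2
/-- partial inverse FT in time -/
def TFi (G : W × ℝ → ℂ) (q : W × ℝ) : ℂ := 𝓕⁻ (fun t => G (q.1, t)) q.2

lemma measurable_TF {F : W × ℝ → ℂ} (hF : Measurable F) : Measurable (TF F) := measurable_FR hF
lemma measurable_TFi {F : W × ℝ → ℂ} (hF : Measurable F) : Measurable (TFi F) := measurable_FRi hF
lemma measurable_PF {F : W × ℝ → ℂ} (hF : Measurable F) : Measurable (PF F) := by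
  have e : PF F = fun q : W × ℝ => ∫ x, Complex.exp (↑(-2 * Real.pi * inner ℝ x q.1) * Complex.I) • F (x, q.2) := by
    ext q; unfold PF; rw [Real.fourier_eq']
  rw [e]
  apply StronglyMeasurable.measurable
  apply StronglyMeasurable.integral_prod_right' (f := fun r : (W × ℝ) × W => Complex.exp (↑(-2 * Real.pi * inner ℝ r.2 r.1.1) * Complex.I) • F (r.2, r.1.2))
  apply Measurable.stronglyMeasurable
  fun_prop
lemma measurable_PFi {F : W × ℝ → ℂ} (hF : Measurable F) : Measurable (PFi F) := by
  have e : PFi F = fun q : W × ℝ => ∫ x, Complex.exp (↑(2 * Real.pi * inner ℝ x q.1) * Complex.I) • F (x, q.2) := by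
    ext q; unfold PFi; rw [Real.fourierInv_eq']
  rw [e]
  apply StronglyMeasurable.measurable
  apply StronglyMeasurable.integral_prod_right' (f := fun r : (W × ℝ) × W => Complex.exp (↑(2 * Real.pi * inner ℝ r.2 r.1.1) * Complex.I) • F (r.2, r.1.2))
  apply Measurable.stronglyMeasurable
  fun_prop

lemma conj_PF (G : W × ℝ → ℂ) (q : W × ℝ) : (starRingEnd ℂ) (PF G q) = PFi (fun z => (starRingEnd ℂ) (G z)) q := conj_fourier _ _
lemma conj_PFi (G : W × ℝ → ℂ) (q : W × ℝ) : (starRingEnd ℂ) (PFi G q) = PF (fun z => (starRingEnd ℂ) (G z)) q := conj_fourierInv _ _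
lemma conj_TF (G : W × ℝ → ℂ) (q : W × ℝ) : (starRingEnd ℂ) (TF G q) = TFi (fun z => (starRingEnd ℂ) (G z)) q := conj_fourier _ _
lemma conj_TFi (G : W × ℝ → ℂ) (q : W × ℝ) : (starRingEnd ℂ) (TFi G q) = TF (fun z => (starRingEnd ℂ) (G z)) q := conj_fourierInv _ _

/-- Nice on space-time -/
def NiceST (G : W × ℝ → ℂ) : Prop :=
  Measurable G ∧ (∃ B, ∀ z, ‖G z‖ ≤ B) ∧ (∃ R, ∀ z : W × ℝ, (R < ‖z.1‖ ∨ R < |z.2|) → G z = 0)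

lemma NiceST.conj {G : W × ℝ → ℂ} (h : NiceST G) : NiceST (fun z => (starRingEnd ℂ) (G z)) := by
  obtain ⟨hm, ⟨B', hB'⟩, R, hR⟩ := h
  exact ⟨Complex.continuous_conj.measurable.comp hm, ⟨B', fun x => by simpa using hB' x⟩, R,
    fun x hx => by simp [hR x hx]⟩

lemma NiceST.mul_bdd {f g : W × ℝ → ℂ} (hf : NiceST f) (hg : Measurable g) {B : ℝ} (hB : ∀ x, ‖g x‖ ≤ B) :
    NiceST (fun x => g x * f x) := by
  obtain ⟨hm, ⟨B', hB'⟩, R, hR⟩ := hf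
  refine ⟨hg.mul hm, ⟨B * B', fun x => ?_⟩, R, fun x hx => by simp [hR x hx]⟩
  rw [norm_mul]
  exact mul_le_mul (hB x) (hB' x) (norm_nonneg _) ((norm_nonneg _).trans (hB x))

lemma NiceST.space {G : W × ℝ → ℂ} (h : NiceST G) (t : ℝ) : Nice (fun x => G (x, t)) := by
  obtain ⟨hm, ⟨B', hB'⟩, R, hR⟩ := h
  exact ⟨by fun_prop, ⟨B', fun x => hB' _⟩, R, fun x hx => hR _ (Or.inl hx)⟩

lemma NiceST.time {G : W × ℝ → ℂ} (h : NiceST G) (x : W) : Nice (fun t => G (x, t)) := by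
  obtain ⟨hm, ⟨B', hB'⟩, R, hR⟩ := h
  exact ⟨by fun_prop, ⟨B', fun x => hB' _⟩, R, fun x hx => hR _ (Or.inr hx)⟩

lemma NiceST.memLp {f : W × ℝ → ℂ} (hf : NiceST f) (q : ℝ≥0∞) : MemLp f q (volume.prod volume) := by
  obtain ⟨hm, ⟨B, hB⟩, R, hR⟩ := hf
  have hms : MeasurableSet ((closedBall (0:W) R) ×ˢ (closedBall (0:ℝ) R)) := measurableSet_closedBall.prod measurableSet_closedBall
  have : IsFiniteMeasure (((volume : Measure W).prod (volume : Measure ℝ)).restrict ((closedBall (0:W) R) ×ˢ (closedBall (0:ℝ) R))) :=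
    ⟨by rw [Measure.restrict_apply_univ, Measure.prod_prod]; exact ENNReal.mul_lt_top measure_closedBall_lt_top measure_closedBall_lt_top⟩
  have h1 : MemLp f q ((volume.prod volume).restrict ((closedBall (0:W) R) ×ˢ (closedBall (0:ℝ) R))) :=
    MemLp.of_bound (hm.aestronglyMeasurable) B (Filter.Eventually.of_forall hB)
  have : f = ((closedBall (0:W) R) ×ˢ (closedBall (0:ℝ) R)).indicator f := by
    ext x
    by_cases hx : x ∈ ((closedBall (0:W) R) ×ˢ (closedBall (0:ℝ) R))
    · simp [hx]
    · rw [Set.indicator_of_notMem hx]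
      apply hR
      by_contra hc
      push Not at hc
      exact hx ⟨by simpa using hc.1, by simpa using hc.2⟩
  rw [this, memLp_indicator_iff_restrict hms]
  exact h1

lemma NiceST.integrable {f : W × ℝ → ℂ} (hf : NiceST f) : Integrable f (volume.prod volume) := memLp_one_iff_integrable.1 (hf.memLp 1)

lemma NiceST.int_bound {G : W × ℝ → ℂ} (h : NiceST G) : ∃ B, (∀ t, ∫ x, ‖G (x,t)‖ ≤ B) ∧ (∀ x, ∫ t, ‖G (x,t)‖ ≤ B) := by
  obtain ⟨hm, ⟨B', hB'⟩, R, hR⟩ := h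
  refine ⟨max (B' * (volume (closedBall (0:W) R)).toReal) (B' * (volume (closedBall (0:ℝ) R)).toReal), fun t => le_max_of_le_left ?_, fun x => le_max_of_le_right ?_⟩
  · rw [← setIntegral_eq_integral_of_forall_compl_eq_zero (s := closedBall (0:W) R) (fun x hx => by rw [hR _ (Or.inl (by simpa using hx))]; simp)]
    refine (le_abs_self _).trans ?_
    refine norm_setIntegral_le_of_norm_le_const measure_closedBall_lt_top (f := fun x => ‖G (x,t)‖) (fun x _ => by simpa using hB' _)
  · rw [← setIntegral_eq_integral_of_forall_compl_eq_zero (s := closedBall (0:ℝ) R) (fun t ht => by rw [hR _ (Or.inr (by simpa using ht))]; simp)]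
    refine (le_abs_self _).trans ?_
    refine norm_setIntegral_le_of_norm_le_const measure_closedBall_lt_top (f := fun t => ‖G (x,t)‖) (fun t _ => by simpa using hB' _)

lemma NiceST.PF_time {G : W × ℝ → ℂ} (h : NiceST G) (ξ : W) : Nice (fun t => PF G (ξ, t)) := by
  obtain ⟨B, hB, -⟩ := h.int_bound
  have hm := measurable_PF h.1
  refine ⟨by fun_prop, ⟨B, fun t => (norm_fourier_le' _ _).trans (hB t)⟩, ?_⟩
  obtain ⟨-, -, R, hR⟩ := h
  refine ⟨R, fun t ht => ?_⟩
  simp only [PF]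
  rw [Real.fourier_eq']
  have : ∀ v, G (v, t) = 0 := fun v => hR _ (Or.inr ht)
  simp [this]

lemma NiceST.TF_space {G : W × ℝ → ℂ} (h : NiceST G) (τ : ℝ) : Nice (fun x => TF G (x, τ)) := by
  obtain ⟨B, -, hB⟩ := h.int_bound
  have hm := measurable_TF h.1
  refine ⟨by fun_prop, ⟨B, fun t => (norm_fourier_le' _ _).trans (hB t)⟩, ?_⟩
  obtain ⟨-, -, R, hR⟩ := h
  refine ⟨R, fun t ht => ?_⟩
  simp only [TF]
  rw [Real.fourier_eq']
  have : ∀ v, G (t, v) = 0 := fun v => hR _ (Or.inl ht)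
  simp [this]

lemma NiceST.PFi_time {G : W × ℝ → ℂ} (h : NiceST G) (ξ : W) : Nice (fun t => PFi G (ξ, t)) := by
  have := (h.conj.PF_time ξ).conj
  simpa [conj_PF] using this

lemma NiceST.TFi_space {G : W × ℝ → ℂ} (h : NiceST G) (τ : ℝ) : Nice (fun x => TFi G (x, τ)) := by
  have := (h.conj.TF_space τ).conj
  simpa [conj_TF] using this

lemma lint_TF {F : W × ℝ → ℂ} (hF : Measurable F) (hn : ∀ x, Nice (fun t => F (x,t))) :
    ∫⁻ z, ‖TF F z‖ₑ^2 ∂(volume.prod volume) = ∫⁻ z, ‖F z‖ₑ^2 ∂(volume.prod volume) := by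
  have m1 := measurable_TF hF
  rw [lintegral_prod _ (by fun_prop), lintegral_prod _ (by fun_prop)]
  congr 1; ext x
  rw [N2_eq_lintegral ((hn x).memLp 2), ← N2_fourier (hn x).integrable ((hn x).memLp 2), ← N2_eq_lintegral (memLp_fourier (hn x).integrable ((hn x).memLp 2))]
  rfl

lemma lint_PF {F : W × ℝ → ℂ} (hF : Measurable F) (hn : ∀ t, Nice (fun x => F (x,t))) :
    ∫⁻ z, ‖PF F z‖ₑ^2 ∂(volume.prod volume) = ∫⁻ z, ‖F z‖ₑ^2 ∂(volume.prod volume) := by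
  have m1 := measurable_PF hF
  rw [lintegral_prod_symm _ (by fun_prop), lintegral_prod_symm _ (by fun_prop)]
  congr 1; ext t
  rw [N2_eq_lintegral ((hn t).memLp 2), ← N2_fourier (hn t).integrable ((hn t).memLp 2), ← N2_eq_lintegral (memLp_fourier (hn t).integrable ((hn t).memLp 2))]
  rfl

lemma memLp_two_iff_lint {μ : Measure X} {f : X → ℂ} (hf : Measurable f) : MemLp f 2 μ ↔ ∫⁻ x, ‖f x‖ₑ^2 ∂μ < ⊤ := by
  rw [MemLp, eLpNorm_lt_top_iff_lintegral_rpow_enorm_lt_top (by norm_num) (by norm_num)]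
  simp [hf.aestronglyMeasurable]

lemma memLp_PF {F : W × ℝ → ℂ} (hF : NiceST F) : MemLp (PF F) 2 (volume.prod volume) := by
  rw [memLp_two_iff_lint (measurable_PF hF.1), lint_PF hF.1 hF.space, ← memLp_two_iff_lint hF.1]
  exact hF.memLp 2
lemma memLp_TF {F : W × ℝ → ℂ} (hF : NiceST F) : MemLp (TF F) 2 (volume.prod volume) := by
  rw [memLp_two_iff_lint (measurable_TF hF.1), lint_TF hF.1 hF.time, ← memLp_two_iff_lint hF.1]
  exact hF.memLp 2
lemma memLp_TFPF {F : W × ℝ → ℂ} (hF : NiceST F) : MemLp (TF (PF F)) 2 (volume.prod volume) := by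
  rw [memLp_two_iff_lint (measurable_TF (measurable_PF hF.1)), lint_TF (measurable_PF hF.1) hF.PF_time, ← memLp_two_iff_lint (measurable_PF hF.1)]
  exact memLp_PF hF

lemma N2_TF {F : W × ℝ → ℂ} (hF : NiceST F) : ∫ τ, N2 volume (fun x => TF F (x,τ)) = N2 (volume.prod volume) F := by
  have h2 := lint_TF hF.1 hF.time
  rw [N2_eq_lintegral (memLp_TF hF), N2_eq_lintegral (hF.memLp 2), ENNReal.ofReal_eq_ofReal_iff (N2_nonneg _ _) (N2_nonneg _ _)] at h2
  rw [← h2]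
  unfold N2
  rw [integral_prod_symm _ (integrable_sq (memLp_TF hF))]

lemma integrable_N2_TF {F : W × ℝ → ℂ} (hF : NiceST F) : Integrable (fun τ => N2 volume (fun x => TF F (x,τ))) :=
  (integrable_sq (memLp_TF hF)).integral_prod_right

lemma TFPF_comm {F : W × ℝ → ℂ} (hF : NiceST F) (q : W × ℝ) : TF (PF F) q = PF (TF F) q := by
  unfold TF PF
  simp_rw [Real.fourier_eq', smul_eq_mul]
  simp_rw [← integral_const_mul]
  rw [integral_integral_swap]
  · congr 1; ext x; congr 1; ext t
    ring
  · refine (hF.integrable.swap.norm).mono' ?_ ?_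
    · have := hF.1
      simp only [Function.uncurry_def]
      apply Measurable.aestronglyMeasurable
      fun_prop
    · refine Filter.Eventually.of_forall fun z => ?_
      simp only [Function.uncurry_def]
      rw [norm_mul, norm_mul, norm_exp_ofReal_mul_I, norm_exp_ofReal_mul_I]
      simp [Prod.swap]
end STSec
end

noncomputable section
open MeasureTheory Metric Complex
open scoped ENNReal FourierTransform SchwartzMap
set_option linter.unusedSectionVars false
section FBSec
variable {W : Type*} [NormedAddCommGroup W] [InnerProductSpace ℝ W] [FiniteDimensional ℝ W] [MeasurableSpace W] [BorelSpace W]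

/-- damped retarded kernel -/
def kd (δ ρ r : ℝ) : ℂ := (Set.Ioi (0:ℝ)).indicator (fun r => ((Real.exp (-δ * r) * (Real.sin (r * ρ)/ρ) : ℝ) : ℂ)) r

lemma measurable_kd (δ : ℝ) : Measurable (fun q : ℝ × ℝ => kd δ q.1 q.2) := by
  unfold kd
  have : (fun q : ℝ × ℝ => (Set.Ioi (0:ℝ)).indicator (fun r => ((Real.exp (-δ * r) * (Real.sin (r * q.1)/q.1) : ℝ) : ℂ)) q.2) =
    (Prod.snd ⁻¹' Set.Ioi (0:ℝ)).indicator (fun q : ℝ × ℝ => ((Real.exp (-δ * q.2) * (Real.sin (q.2 * q.1)/q.1) : ℝ) : ℂ)) := by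
    ext q; simp [Set.indicator]
  rw [this]
  apply Measurable.indicator
  · fun_prop
  · exact measurable_snd measurableSet_Ioi

lemma sinc_le (r ρ : ℝ) : |Real.sin (r * ρ)/ρ| ≤ |r| := by
  rcases eq_or_ne ρ 0 with h | h
  · simp [h]
  · rw [abs_div, div_le_iff₀ (abs_pos.2 h), ← abs_mul]
    exact Real.abs_sin_le_abs

lemma norm_kd_le {δ : ℝ} (hδ : 0 ≤ δ) (ρ r : ℝ) : ‖kd δ ρ r‖ ≤ |r| := by
  unfold kd Set.indicator
  split_ifs with h
  · have hr : (0:ℝ) < r := h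
    rw [Complex.norm_real, norm_mul, Real.norm_eq_abs, Real.norm_eq_abs, Real.abs_exp]
    have h1 : Real.exp (-δ * r) ≤ 1 := by rw [Real.exp_le_one_iff]; nlinarith
    calc _ ≤ 1 * |r| := mul_le_mul h1 (sinc_le r ρ) (abs_nonneg _) zero_le_one
      _ = _ := one_mul _
  · simp

lemma integrable_kd {δ ρ : ℝ} (hδ : 0 < δ) : Integrable (kd δ ρ) := by
  unfold kd
  rw [integrable_indicator_iff measurableSet_Ioi]
  have h1 := exp_neg_integrableOn_Ioi 0 hδ
  have h2 : Integrable (fun r => Real.exp (-δ * r) * (Real.sin (r * ρ)/ρ)) (volume.restrict (Set.Ioi (0:ℝ))) := by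
   refine h1.mul_bdd (c := |ρ⁻¹|) (g := fun r => Real.sin (r * ρ)/ρ) (by fun_prop) ?_
   · refine Filter.Eventually.of_forall fun r => ?_
     rw [Real.norm_eq_abs, abs_div, abs_inv, div_eq_mul_inv]
     exact mul_le_of_le_one_left (by positivity) (Real.abs_sin_le_one _)
  exact h2.ofReal

lemma ft_kd {δ ρ : ℝ} (hδ : 0 < δ) (hρ : 0 < ρ) (τ : ℝ) :
    𝓕 (kd δ ρ) τ = (((ρ^2 : ℝ) : ℂ) + ((δ : ℂ) + ((2 * Real.pi * τ : ℝ) : ℂ) * I)^2)⁻¹ := by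
  rw [Real.fourier_eq']
  obtain ⟨ζ, hζ⟩ : ∃ ζ : ℂ, ζ = (δ : ℂ) + ((2 * Real.pi * τ : ℝ) : ℂ) * I := ⟨_, rfl⟩
  have hζr : ζ.re = δ := by rw [hζ]; simp
  rw [← hζ]
  have n1 : ζ - I * ρ ≠ 0 := by intro h; have := congrArg re h; simp [hζr] at this; linarith
  have n2 : ζ + I * ρ ≠ 0 := by intro h; have := congrArg re h; simp [hζr] at this; linarith
  have i1 : (-(ζ - I * ρ)).re < 0 := by simp [hζr]; linarith
  have i2 : (-(ζ + I * ρ)).re < 0 := by simp [hζr]; linarith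
  have e : (fun v : ℝ => cexp (((-2 * Real.pi * inner ℝ v τ : ℝ) : ℂ) * I) • kd δ ρ v) =
     (Set.Ioi (0:ℝ)).indicator (fun r : ℝ => (2 * I * ρ)⁻¹ * (cexp (-(ζ - I * ρ) * r) - cexp (-(ζ + I * ρ) * r))) := by
    ext r
    unfold kd Set.indicator
    split_ifs with h
    · have s : (((Real.exp (-δ * r) * (Real.sin (r * ρ)/ρ) : ℝ)) : ℂ) = cexp (-δ * r) * ((2 * I * ρ)⁻¹ * (cexp (I * ρ * r) - cexp (-(I * ρ * r)))) := by
        push_cast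
        rw [Complex.sin]
        have : (ρ:ℂ) ≠ 0 := by exact_mod_cast hρ.ne'
        rw [show -((r:ℂ) * ρ) * I = -(I * ρ * r) by ring, show ((r:ℂ) * ρ) * I = (I * ρ * r) by ring]
        field_simp
        simp only [I_sq]
        ring
      simp only
      rw [s, smul_eq_mul]
      have a1 : cexp (-(ζ - I * ρ) * r) = cexp (((-2 * Real.pi * inner ℝ r τ : ℝ) : ℂ) * I) * cexp (-δ * r) * cexp (I * ρ * r) := by
        rw [← Complex.exp_add, ← Complex.exp_add, hζ]; congr 1; simp; ring
      have a2 : cexp (-(ζ + I * ρ) * r) = cexp (((-2 * Real.pi * inner ℝ r τ : ℝ) : ℂ) * I) * cexp (-δ * r) * cexp (-(I * ρ * r)) := by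
        rw [← Complex.exp_add, ← Complex.exp_add, hζ]; congr 1; simp; ring
      rw [a1, a2]; ring
    · simp
  rw [e, integral_indicator measurableSet_Ioi, integral_const_mul, integral_sub (integrableOn_exp_mul_complex_Ioi i1 0) (integrableOn_exp_mul_complex_Ioi i2 0),
    integral_exp_mul_complex_Ioi i1, integral_exp_mul_complex_Ioi i2]
  have hρ' : (ρ:ℂ) ≠ 0 := by exact_mod_cast hρ.ne'
  have e3 : ((ρ^2 : ℝ) : ℂ) + ζ^2 = (ζ - I * ρ) * (ζ + I * ρ) := by push_cast; linear_combination (ρ:ℂ)^2 * I_sq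
  rw [e3]
  simp only [ofReal_zero, mul_zero, Complex.exp_zero]
  have hI := I_ne_zero
  field_simp
  ring

/-- Duhamel bilinear form -/
def DB (δ : ℝ) (G H : W × ℝ → ℂ) : ℂ :=
  ∫ ξ : W, ∫ q : ℝ × ℝ, kd δ ‖ξ‖ q.1 * (PF G (ξ, q.2) * PFi H (ξ, q.2 + q.1))

lemma memLp_conj_iff {α : Type*} [MeasurableSpace α] {μ : Measure α} {f : α → ℂ} (hf : MemLp f 2 μ) :
    MemLp (fun x => (starRingEnd ℂ) (f x)) 2 μ := by
  refine hf.of_le (Complex.continuous_conj.comp_aestronglyMeasurable hf.1) (Filter.Eventually.of_forall fun x => by simp)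

lemma memLp_PFi {F : W × ℝ → ℂ} (hF : NiceST F) : MemLp (PFi F) 2 (volume.prod volume) := by
  have := memLp_conj_iff (memLp_PF hF.conj)
  simpa [conj_PF] using this
lemma memLp_TFiPFi {F : W × ℝ → ℂ} (hF : NiceST F) : MemLp (TFi (PFi F)) 2 (volume.prod volume) := by
  have := memLp_conj_iff (memLp_TFPF hF.conj)
  have e : PFi F = fun z => (starRingEnd ℂ) (PF (fun z => (starRingEnd ℂ) (F z)) z) := by
    ext z; rw [conj_PF]; simp
  rw [e]
  simpa only [conj_TF] using this
lemma TFiPFi_comm {F : W × ℝ → ℂ} (hF : NiceST F) (q : W × ℝ) : TFi (PFi F) q = PFi (TFi F) q := by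
  have := TFPF_comm hF.conj q
  apply_fun (starRingEnd ℂ) at this
  rw [conj_TF, conj_PF] at this
  simp only [conj_PF, conj_TF] at this
  simpa using this
lemma N2_TFi {F : W × ℝ → ℂ} (hF : NiceST F) : ∫ τ, N2 volume (fun x => TFi F (x,τ)) = N2 (volume.prod volume) F := by
  have := N2_TF hF.conj
  rw [N2_conj] at this
  rw [← this]
  congr 1; ext τ
  rw [← N2_conj]
  simp only [conj_TFi]
lemma integrable_N2_TFi {F : W × ℝ → ℂ} (hF : NiceST F) : Integrable (fun τ => N2 volume (fun x => TFi F (x,τ))) := by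
  refine (integrable_N2_TF hF.conj).congr (Filter.Eventually.of_forall fun τ => ?_)
  simp only
  rw [← N2_conj]
  simp only [conj_TF]
  simp

lemma DB_eq {δ : ℝ} (hδ : 0 < δ) [Nontrivial W] {G H : W × ℝ → ℂ} (hG : NiceST G) (hH : NiceST H) :
    DB δ G H = ∫ τ : ℝ, BF (fun ξ : W => (((‖ξ‖^2 : ℝ) : ℂ) + ((δ : ℂ) + ((2 * Real.pi * τ : ℝ) : ℂ) * I)^2)⁻¹) (fun x => TF G (x,τ)) (fun x => TFi H (x,τ)) := by
  have e1 : DB δ G H = ∫ ξ : W, ∫ τ : ℝ, (((‖ξ‖^2 : ℝ) : ℂ) + ((δ : ℂ) + ((2 * Real.pi * τ : ℝ) : ℂ) * I)^2)⁻¹ * (TF (PF G) (ξ,τ) * TFi (PFi H) (ξ,τ)) := by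
    unfold DB
    apply integral_congr_ae
    have : ∀ᵐ ξ : W, ξ ≠ 0 := by
      simp [ae_iff, measure_singleton]
    filter_upwards [this] with ξ hξ
    have := BF_kernel (k := kd δ ‖ξ‖) (f := fun t => PF G (ξ, t)) (g := fun t => PFi H (ξ, t)) (integrable_kd hδ) (hG.PF_time ξ) (hH.PFi_time ξ)
    rw [← this]
    unfold BF
    congr 1; ext τ
    rw [ft_kd hδ (norm_pos_iff.2 hξ)]
    rfl
  rw [e1, integral_integral_swap]
  · congr 1; ext τ
    unfold BF
    congr 1; ext ξ
    rw [TFPF_comm hG, TFiPFi_comm hH]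
    rfl
  · have hi := (memLp_TFPF hG).integrable_mul (memLp_TFiPFi hH)
    refine hi.bdd_mul (c := (δ^2)⁻¹) ?_ ?_
    · apply Measurable.aestronglyMeasurable; fun_prop
    · refine Filter.Eventually.of_forall fun z => ?_
      rw [norm_inv]
      apply inv_anti₀ (by positivity)
      have := norm_res_ge (ζ := (δ : ℂ) + ((2 * Real.pi * z.2 : ℝ) : ℂ) * I) (by simpa using hδ) ‖z.1‖
      simpa using this

lemma TF_mul (a : W → ℂ) (φ : W × ℝ → ℂ) (q : W × ℝ) : TF (fun z => a z.1 * φ z) q = a q.1 * TF φ q := by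
  unfold TF
  rw [Real.fourier_eq', Real.fourier_eq', ← integral_const_mul]
  congr 1; ext t; simp only [smul_eq_mul]; ring
lemma TFi_mul (a : W → ℂ) (φ : W × ℝ → ℂ) (q : W × ℝ) : TFi (fun z => a z.1 * φ z) q = a q.1 * TFi φ q := by
  unfold TFi
  rw [Real.fourierInv_eq', Real.fourierInv_eq', ← integral_const_mul]
  congr 1; ext t; simp only [smul_eq_mul]; ring

lemma NiceST.sqrt_mul {p : ℝ} {v : W → ℝ} (hv : Wt p v) {φ : W × ℝ → ℂ} (hφ : NiceST φ) : NiceST (fun z => (Real.sqrt (v z.1) : ℂ) * φ z) := by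
  obtain ⟨B, hB⟩ := hv.2.2.1
  have := hv.1
  refine hφ.mul_bdd (by fun_prop) (B := Real.sqrt B) (fun x => ?_)
  rw [Complex.norm_real, Real.norm_of_nonneg (Real.sqrt_nonneg _)]
  exact Real.sqrt_le_sqrt (hB _)

lemma FB_damped {p : ℝ} (hA : Adm W p) {δ : ℝ} (hδ : 0 < δ) {v1 v2 : W → ℝ} (hv1 : Wt p v1) (hv2 : Wt p v2) {φ ψ : W × ℝ → ℂ} (hφ : NiceST φ) (hψ : NiceST ψ) :
    ‖DB δ (fun z => (Real.sqrt (v1 z.1) : ℂ) * φ z) (fun z => (Real.sqrt (v2 z.1) : ℂ) * ψ z)‖ ≤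
      C2 W p * ((N2 (volume.prod volume) φ + N2 (volume.prod volume) ψ)/2) := by
  have hW : Nontrivial W := Module.nontrivial_of_finrank_pos (R := ℝ) (by have := hA.1; omega)
  rw [DB_eq hδ (hφ.sqrt_mul hv1) (hψ.sqrt_mul hv2), ← N2_TF hφ, ← N2_TFi hψ, ← integral_add (integrable_N2_TF hφ) (integrable_N2_TFi hψ),
    ← integral_div, ← integral_const_mul]
  refine norm_integral_le_of_norm_le ((((integrable_N2_TF hφ).add (integrable_N2_TFi hψ)).div_const 2).const_mul _) (Filter.Eventually.of_forall fun τ => ?_)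
  have := RE2 hA (ζ := (δ : ℂ) + ((2 * Real.pi * τ : ℝ) : ℂ) * I) (by simpa using hδ) hv1 hv2 (hφ.TF_space τ) (hψ.TFi_space τ)
  simpa only [TF_mul (fun x => (Real.sqrt (v1 x) : ℂ)), TFi_mul (fun x => (Real.sqrt (v2 x) : ℂ))] using this
end FBSec
end

noncomputable section
open MeasureTheory Metric Complex
open scoped ENNReal FourierTransform SchwartzMap
set_option linter.unusedSectionVars false
section TripSec
variable {W : Type*} [NormedAddCommGroup W] [InnerProductSpace ℝ W] [FiniteDimensional ℝ W] [MeasurableSpace W] [BorelSpace W]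

lemma trip_mp : MeasurePreserving (fun z : W × (ℝ × ℝ) => ((z.1, z.2.2), z.2.1)) (volume.prod (volume.prod volume)) ((volume.prod volume).prod volume) := by
  have h1 := (measurePreserving_prodAssoc (volume : Measure W) (volume : Measure ℝ) (volume : Measure ℝ)).symm
  have h2 : MeasurePreserving (Prod.swap : ℝ × ℝ → ℝ × ℝ) (volume.prod volume) (volume.prod volume) := Measure.measurePreserving_swap
  have h3 := (MeasurePreserving.id (volume : Measure W)).prod h2
  exact h1.comp h3

lemma shear_mp : MeasurePreserving (fun z : W × (ℝ × ℝ) => (z.1, (z.2.1, z.2.2 + z.2.1))) (volume.prod (volume.prod volume)) (volume.prod (volume.prod volume)) := by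
  have h2 := measurePreserving_prod_add (volume : Measure ℝ) (volume : Measure ℝ)
  have h3 := (MeasurePreserving.id (volume : Measure W)).prod h2
  convert h3 using 1
  ext z <;> simp [add_comm]

lemma trip_memLp {a : W × ℝ → ℂ} (ha : MemLp a 2 (volume.prod volume)) (R : ℝ) :
    MemLp (fun z : W × (ℝ × ℝ) => a (z.1, z.2.2) * (closedBall (0:ℝ) R).indicator (fun _ => (1:ℂ)) z.2.1) 2 (volume.prod (volume.prod volume)) := by
  have h : MemLp (fun z : (W × ℝ) × ℝ => a z.1 * (closedBall (0:ℝ) R).indicator (fun _ => (1:ℂ)) z.2) 2 ((volume.prod volume).prod volume) := by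
    have hm : Measurable ((closedBall (0:ℝ) R).indicator (fun _ => (1:ℂ))) := measurable_const.indicator measurableSet_closedBall
    rw [memLp_two_iff_integrable_sq_norm]
    · have h1 := integrable_sq ha
      have h2 : Integrable ((closedBall (0:ℝ) R).indicator (fun _ => (1:ℝ))) := by
        rw [integrable_indicator_iff measurableSet_closedBall]
        exact integrableOn_const measure_closedBall_lt_top.ne
      refine (h1.mul_prod h2).congr (Filter.Eventually.of_forall fun z => ?_)
      simp only [norm_mul, mul_pow, Set.indicator]
      split_ifs <;> simp
    · exact ha.1.comp_fst.mul hm.aestronglyMeasurable.comp_snd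
  exact h.comp_measurePreserving trip_mp

lemma trip_integrable {a b : W × ℝ → ℂ} (ha : MemLp a 2 (volume.prod volume)) (hb : MemLp b 2 (volume.prod volume)) {R : ℝ}
    (ha0 : ∀ z : W × ℝ, R < |z.2| → a z = 0) (hb0 : ∀ z : W × ℝ, R < |z.2| → b z = 0) :
    Integrable (fun z : W × (ℝ × ℝ) => a (z.1, z.2.2) * b (z.1, z.2.2 + z.2.1)) (volume.prod (volume.prod volume)) := by
  have h1 := trip_memLp ha (2*R)
  have h2 := (trip_memLp hb (2*R)).comp_measurePreserving shear_mp
  have h3 := h1.integrable_mul h2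
  refine h3.congr (Filter.Eventually.of_forall fun z => ?_)
  simp only [Function.comp_def, Pi.mul_apply, Set.indicator]
  split_ifs with h
  · ring
  · have : a (z.1, z.2.2) = 0 ∨ b (z.1, z.2.2 + z.2.1) = 0 := by
      by_contra hc
      push Not at hc
      have q1 := not_lt.1 (fun h => hc.1 (ha0 _ h))
      have q2 := not_lt.1 (fun h => hc.2 (hb0 _ h))
      apply h
      simp only [mem_closedBall_zero_iff, Real.norm_eq_abs] at *
      have := abs_sub_abs_le_abs_sub z.2.1 (-z.2.2)
      rw [abs_neg, sub_neg_eq_add, add_comm z.2.1] at this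
      linarith
    rcases this with h | h <;> simp [h]

lemma PF_zero {G : W × ℝ → ℂ} {R : ℝ} (hR : ∀ z : W × ℝ, R < |z.2| → G z = 0) (z : W × ℝ) (hz : R < |z.2|) : PF G z = 0 := by
  unfold PF
  have : (fun x => G (x, z.2)) = fun x => 0 := by ext x; exact hR _ hz
  rw [this, Real.fourier_eq']; simp
lemma PFi_zero {G : W × ℝ → ℂ} {R : ℝ} (hR : ∀ z : W × ℝ, R < |z.2| → G z = 0) (z : W × ℝ) (hz : R < |z.2|) : PFi G z = 0 := by
  unfold PFi
  have : (fun x => G (x, z.2)) = fun x => 0 := by ext x; exact hR _ hz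
  rw [this, Real.fourierInv_eq']; simp

lemma NiceST.time_supp2 {G H : W × ℝ → ℂ} (hG : NiceST G) (hH : NiceST H) : ∃ R, 0 ≤ R ∧ (∀ z : W × ℝ, R < |z.2| → G z = 0) ∧ (∀ z : W × ℝ, R < |z.2| → H z = 0) := by
  obtain ⟨-, -, R1, h1⟩ := hG
  obtain ⟨-, -, R2, h2⟩ := hH
  exact ⟨max (max R1 R2) 0, le_max_right _ _, fun z hz => h1 z (Or.inr (lt_of_le_of_lt ((le_max_left _ _).trans (le_max_left _ _)) hz)),
    fun z hz => h2 z (Or.inr (lt_of_le_of_lt ((le_max_right _ _).trans (le_max_left _ _)) hz))⟩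

lemma DB_dom {G H : W × ℝ → ℂ} {R : ℝ} (h1 : ∀ z : W × ℝ, R < |z.2| → G z = 0) (h2 : ∀ z : W × ℝ, R < |z.2| → H z = 0) {δ : ℝ} (hδ : 0 ≤ δ) (z : W × (ℝ × ℝ)) :
    ‖kd δ ‖z.1‖ z.2.1 * (PF G (z.1, z.2.2) * PFi H (z.1, z.2.2 + z.2.1))‖ ≤ (2*R) * ‖PF G (z.1, z.2.2) * PFi H (z.1, z.2.2 + z.2.1)‖ := by
  rw [norm_mul]
  by_cases hc : PF G (z.1, z.2.2) * PFi H (z.1, z.2.2 + z.2.1) = 0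
  · simp [hc]
  · apply mul_le_mul_of_nonneg_right _ (norm_nonneg _)
    refine (norm_kd_le hδ _ _).trans ?_
    have q1 := not_lt.1 (fun h => hc (by rw [PF_zero h1 _ h, zero_mul]))
    have q2 := not_lt.1 (fun h => hc (by rw [PFi_zero h2 _ h, mul_zero]))
    simp only at q1 q2
    have := abs_sub_abs_le_abs_sub z.2.1 (-z.2.2)
    rw [abs_neg, sub_neg_eq_add, add_comm z.2.1] at this
    linarith

lemma DB_meas {G H : W × ℝ → ℂ} (hG : NiceST G) (hH : NiceST H) (δ : ℝ) : Measurable (fun z : W × (ℝ × ℝ) => kd δ ‖z.1‖ z.2.1 * (PF G (z.1, z.2.2) * PFi H (z.1, z.2.2 + z.2.1))) := by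
  have m1 := measurable_PF hG.1
  have m2 := measurable_PFi hH.1
  have m3 : Measurable (fun z : W × (ℝ × ℝ) => kd δ ‖z.1‖ z.2.1) := (measurable_kd δ).comp (g := fun q : ℝ × ℝ => kd δ q.1 q.2) (f := fun z : W × (ℝ × ℝ) => (‖z.1‖, z.2.1)) (by fun_prop)
  fun_prop

lemma DB_integrable {G H : W × ℝ → ℂ} (hG : NiceST G) (hH : NiceST H) {δ : ℝ} (hδ : 0 ≤ δ) :
    Integrable (fun z : W × (ℝ × ℝ) => kd δ ‖z.1‖ z.2.1 * (PF G (z.1, z.2.2) * PFi H (z.1, z.2.2 + z.2.1))) (volume.prod (volume.prod volume)) := by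
  obtain ⟨R, hR, h1, h2⟩ := hG.time_supp2 hH
  have hi := trip_integrable (memLp_PF hG) (memLp_PFi hH) (PF_zero h1) (PFi_zero h2)
  refine (hi.norm.const_mul (2*R)).mono' (DB_meas hG hH δ).aestronglyMeasurable (Filter.Eventually.of_forall fun z => DB_dom h1 h2 hδ z)

lemma DB_tendsto {G H : W × ℝ → ℂ} (hG : NiceST G) (hH : NiceST H) :
    Filter.Tendsto (fun k : ℕ => DB (1/((k:ℝ)+1)) G H) Filter.atTop (nhds (DB 0 G H)) := by
  obtain ⟨R, hR, h1, h2⟩ := hG.time_supp2 hH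
  have hi := trip_integrable (memLp_PF hG) (memLp_PFi hH) (PF_zero h1) (PFi_zero h2)
  have e : ∀ δ : ℝ, 0 ≤ δ → DB δ G H = ∫ z, kd δ ‖z.1‖ z.2.1 * (PF G (z.1, z.2.2) * PFi H (z.1, z.2.2 + z.2.1)) ∂(volume.prod (volume.prod volume)) := by
    intro δ hδ
    rw [integral_prod _ (DB_integrable hG hH hδ)]; rfl
  rw [e 0 le_rfl]
  have e' : (fun k : ℕ => DB (1/((k:ℝ)+1)) G H) = fun k : ℕ => ∫ z, kd (1/((k:ℝ)+1)) ‖z.1‖ z.2.1 * (PF G (z.1, z.2.2) * PFi H (z.1, z.2.2 + z.2.1)) ∂(volume.prod (volume.prod volume)) := by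
    ext k; exact e _ (by positivity)
  rw [e']
  refine tendsto_integral_of_dominated_convergence _ (fun k => (DB_meas hG hH _).aestronglyMeasurable) (hi.norm.const_mul (2*R))
    (fun k => Filter.Eventually.of_forall fun z => DB_dom h1 h2 (by positivity) z) (Filter.Eventually.of_forall fun z => ?_)
  apply Filter.Tendsto.mul_const
  unfold kd Set.indicator
  split_ifs with h
  · have hc : Continuous (fun δ : ℝ => ((Real.exp (-δ * z.2.1) * (Real.sin (z.2.1 * ‖z.1‖)/‖z.1‖) : ℝ) : ℂ)) := by fun_prop
    exact (hc.tendsto 0).comp tendsto_one_div_add_atTop_nhds_zero_nat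
  · exact tendsto_const_nhds

lemma FB {p : ℝ} (hA : Adm W p) {v1 v2 : W → ℝ} (hv1 : Wt p v1) (hv2 : Wt p v2) {φ ψ : W × ℝ → ℂ} (hφ : NiceST φ) (hψ : NiceST ψ) :
    ‖DB 0 (fun z => (Real.sqrt (v1 z.1) : ℂ) * φ z) (fun z => (Real.sqrt (v2 z.1) : ℂ) * ψ z)‖ ≤
      C2 W p * ((N2 (volume.prod volume) φ + N2 (volume.prod volume) ψ)/2) :=
  le_of_tendsto (DB_tendsto (hφ.sqrt_mul hv1) (hψ.sqrt_mul hv2)).norm (Filter.Eventually.of_forall fun k => FB_damped hA (by positivity) hv1 hv2 hφ hψ)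
end TripSec
end

noncomputable section
open MeasureTheory Metric Complex
open scoped ENNReal FourierTransform SchwartzMap
set_option linter.unusedSectionVars false
section FreeSec
variable {W : Type*} [NormedAddCommGroup W] [InnerProductSpace ℝ W] [FiniteDimensional ℝ W] [MeasurableSpace W] [BorelSpace W]

/-- Poisson-like kernel -/
def Pk (δ ρ ω : ℝ) : ℝ := 2 * δ * ω / ((δ^2 + (ω + ρ)^2) * (δ^2 + (ω - ρ)^2))

lemma im_res {δ : ℝ} (hδ : 0 < δ) (ρ ω : ℝ) : ((((ρ^2 : ℝ) : ℂ) + ((δ : ℂ) + (ω : ℂ) * I)^2)⁻¹).im = - Pk δ ρ ω := by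
  have e : (((ρ^2 : ℝ) : ℂ) + ((δ : ℂ) + (ω : ℂ) * I)^2) = ((ρ^2 + δ^2 - ω^2 : ℝ) : ℂ) + ((2 * δ * ω : ℝ) : ℂ) * I := by
    push_cast; linear_combination (ω:ℂ)^2 * I_sq
  rw [e, Complex.inv_im]
  have : Complex.normSq (((ρ^2 + δ^2 - ω^2 : ℝ) : ℂ) + ((2 * δ * ω : ℝ) : ℂ) * I) = (δ^2 + (ω + ρ)^2) * (δ^2 + (ω - ρ)^2) := by
    rw [Complex.normSq_add_mul_I]; ring
  rw [this, Pk, neg_div]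
  simp only [add_im, mul_im, ofReal_im, ofReal_re, I_re, I_im]
  ring

lemma res_bound {δ : ℝ} (hδ : 0 < δ) (ω r : ℝ) : ‖(((r^2 : ℝ) : ℂ) + ((δ : ℂ) + (ω : ℂ) * I)^2)⁻¹‖ ≤ (δ^2)⁻¹ := by
  rw [norm_inv]
  apply inv_anti₀ (by positivity)
  have := norm_res_ge (ζ := (δ : ℂ) + (ω : ℂ) * I) (by simpa using hδ) r
  simpa using this

lemma Pk_nonneg {δ ρ ω : ℝ} (hδ : 0 < δ) (hω : 0 ≤ ω) : 0 ≤ Pk δ ρ ω := by unfold Pk; positivity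

lemma free_i {p : ℝ} (hA : Adm W p) {δ : ℝ} (hδ : 0 < δ) {v : W → ℝ} (hv : Wt p v) {φ : W → ℂ} (hφ : Nice φ) {ω : ℝ} (hω : 0 ≤ ω) :
    ∫⁻ ξ : W, ENNReal.ofReal (Pk δ ‖ξ‖ ω * ‖𝓕 (fun x => (Real.sqrt (v x) : ℂ) * φ x) ξ‖^2) ≤ ENNReal.ofReal (C2 W p * N2 volume φ) := by
  have h := RE2 hA (ζ := (δ : ℂ) + (ω : ℂ) * I) (by simpa using hδ) hv hv hφ hφ.conj
  obtain ⟨B, hB⟩ := hv.2.2.1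
  have mv := hv.1
  have hn : Nice (fun x => (Real.sqrt (v x) : ℂ) * φ x) := hφ.mul_bdd (by fun_prop) (B := Real.sqrt B) (fun x => by
    rw [Complex.norm_real, Real.norm_of_nonneg (Real.sqrt_nonneg _)]
    exact Real.sqrt_le_sqrt (hB _))
  obtain ⟨f, hf⟩ : ∃ f, f = (fun x => (Real.sqrt (v x) : ℂ) * φ x) := ⟨_, rfl⟩
  rw [N2_conj, add_self_div_two] at h
  have e : (fun x => (Real.sqrt (v x) : ℂ) * (starRingEnd ℂ) (φ x)) = fun x => (starRingEnd ℂ) (f x) := by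
    ext x; rw [hf]; simp
  rw [e, ← hf] at h
  rw [← hf] at hn ⊢
  have i2 := integrable_sq (memLp_fourier hn.integrable (hn.memLp 2))
  have c1 := continuous_fourier' hn.integrable
  have i3 : Integrable (fun ξ : W => (((‖ξ‖^2 : ℝ) : ℂ) + ((δ : ℂ) + (ω : ℂ) * I)^2)⁻¹ * (((‖𝓕 f ξ‖^2 : ℝ)) : ℂ)) := by
    refine (i2.ofReal (𝕜 := ℂ)).bdd_mul (c := (δ^2)⁻¹) (by apply Measurable.aestronglyMeasurable; fun_prop) (Filter.Eventually.of_forall fun ξ => res_bound hδ _ _)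
  have e2 : BF (fun ξ => (((‖ξ‖^2 : ℝ) : ℂ) + ((δ : ℂ) + (ω : ℂ) * I)^2)⁻¹) f (fun x => (starRingEnd ℂ) (f x)) =
      ∫ ξ : W, (((‖ξ‖^2 : ℝ) : ℂ) + ((δ : ℂ) + (ω : ℂ) * I)^2)⁻¹ * (((‖𝓕 f ξ‖^2 : ℝ)) : ℂ) := by
    unfold BF
    congr 1; ext ξ
    rw [← conj_fourier, Complex.mul_conj, Complex.normSq_eq_norm_sq]
  have e3 : ∀ ξ : W, ((((‖ξ‖^2 : ℝ) : ℂ) + ((δ : ℂ) + (ω : ℂ) * I)^2)⁻¹ * (((‖𝓕 f ξ‖^2 : ℝ)) : ℂ)).im = - (Pk δ ‖ξ‖ ω * ‖𝓕 f ξ‖^2) := by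
    intro ξ
    rw [Complex.im_mul_ofReal, im_res hδ]; ring
  have i4 : Integrable (fun ξ : W => Pk δ ‖ξ‖ ω * ‖𝓕 f ξ‖^2) := by
    have := i3.im.neg
    refine this.congr (Filter.Eventually.of_forall fun ξ => ?_)
    have := e3 ξ
    simp only [Pi.neg_apply, RCLike.im_to_complex]
    rw [this, neg_neg]
  rw [← ofReal_integral_eq_lintegral_ofReal i4 (Filter.Eventually.of_forall fun ξ => mul_nonneg (Pk_nonneg hδ hω) (by positivity))]
  apply ENNReal.ofReal_le_ofReal
  refine le_trans ?_ h
  rw [e2]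
  refine le_trans ?_ (Complex.abs_im_le_norm _)
  have : (∫ ξ : W, (((‖ξ‖^2 : ℝ) : ℂ) + ((δ : ℂ) + (ω : ℂ) * I)^2)⁻¹ * (((‖𝓕 f ξ‖^2 : ℝ)) : ℂ)).im = - ∫ ξ, Pk δ ‖ξ‖ ω * ‖𝓕 f ξ‖^2 := by
    have h5 := integral_im i3
    simp only [RCLike.im_to_complex] at h5
    rw [← h5, ← integral_neg]
    congr 1; ext ξ; exact e3 ξ
  rw [this, abs_neg]
  exact le_abs_self _

lemma Pk_lower {δ ρ ω : ℝ} (hδ : 0 < δ) (hρ : 0 < ρ) (h1 : ρ ≤ ω) (h2 : ω ≤ ρ + δ) : ρ / (δ * (δ^2 + (2*ρ+δ)^2)) ≤ Pk δ ρ ω := by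
  unfold Pk
  rw [div_le_div_iff₀ (by positivity) (by positivity)]
  have a1 : (δ^2 + (ω + ρ)^2) ≤ (δ^2 + (2*ρ+δ)^2) := by nlinarith
  have a2 : (δ^2 + (ω - ρ)^2) ≤ 2 * δ^2 := by nlinarith
  have hω : 0 ≤ ω := by linarith
  calc ρ * ((δ^2 + (ω + ρ)^2) * (δ^2 + (ω - ρ)^2)) ≤ ω * ((δ^2 + (2*ρ+δ)^2) * (2 * δ^2)) := by gcongr
    _ = _ := by ring

lemma free_iii {A : ℝ → ℝ} (hA : Continuous A) (hA0 : ∀ τ, 0 ≤ A τ) {δ ρ : ℝ} (hδ : 0 < δ) (hρ : 0 < ρ) :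
    ENNReal.ofReal (ρ / (2 * Real.pi * (δ^2 + (2*ρ+δ)^2)) * ∫ y in (0:ℝ)..1, A ((ρ + δ * y)/(2*Real.pi))) ≤
      ∫⁻ τ in Set.Ioi (0:ℝ), ENNReal.ofReal (Pk δ ρ (2 * Real.pi * τ) * A τ) := by
  have hpi := Real.pi_pos
  have e1 : ∫ y in (0:ℝ)..1, A ((ρ + δ * y)/(2*Real.pi)) = (δ/(2*Real.pi))⁻¹ * ∫ τ in (ρ/(2*Real.pi))..((ρ+δ)/(2*Real.pi)), A τ := by
    have := intervalIntegral.integral_comp_mul_add (a := 0) (b := 1) A (c := δ/(2*Real.pi)) (by positivity) (ρ/(2*Real.pi))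
    rw [smul_eq_mul] at this
    rw [show (ρ+δ)/(2*Real.pi) = δ/(2*Real.pi) * 1 + ρ/(2*Real.pi) by ring, show (∫ τ in (ρ/(2*Real.pi))..(δ/(2*Real.pi) * 1 + ρ/(2*Real.pi)), A τ) = ∫ τ in (δ/(2*Real.pi) * 0 + ρ/(2*Real.pi))..(δ/(2*Real.pi) * 1 + ρ/(2*Real.pi)), A τ by simp, ← this]
    congr 1; ext y; congr 1; ring
  have hle : ρ/(2*Real.pi) ≤ (ρ+δ)/(2*Real.pi) := by gcongr; linarith
  rw [e1, intervalIntegral.integral_of_le hle]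
  have e2 : ρ / (2 * Real.pi * (δ^2 + (2*ρ+δ)^2)) * ((δ/(2*Real.pi))⁻¹ * ∫ τ in Set.Ioc (ρ/(2*Real.pi)) ((ρ+δ)/(2*Real.pi)), A τ) =
      ∫ τ in Set.Ioc (ρ/(2*Real.pi)) ((ρ+δ)/(2*Real.pi)), ρ / (δ * (δ^2 + (2*ρ+δ)^2)) * A τ := by
    rw [integral_const_mul, ← mul_assoc]; congr 1; field_simp
  rw [e2, ofReal_integral_eq_lintegral_ofReal]
  · refine le_trans ?_ (lintegral_mono_set (s := Set.Ioc (ρ/(2*Real.pi)) ((ρ+δ)/(2*Real.pi))) ?_)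
    · apply setLIntegral_mono' measurableSet_Ioc
      intro τ hτ
      apply ENNReal.ofReal_le_ofReal
      apply mul_le_mul_of_nonneg_right _ (hA0 τ)
      have h1 := hτ.1
      have h2 := hτ.2
      rw [div_lt_iff₀ (by positivity)] at h1
      rw [le_div_iff₀ (by positivity)] at h2
      exact Pk_lower hδ hρ (by linarith) (by linarith)
    · intro τ hτ
      have : 0 < ρ/(2*Real.pi) := by positivity
      exact this.trans hτ.1
  · exact ((hA.const_mul _).integrableOn_Icc (a := ρ/(2*Real.pi)) (b := (ρ+δ)/(2*Real.pi))).mono_set Set.Ioc_subset_Icc_self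
  · refine Filter.Eventually.of_forall fun τ => mul_nonneg (by positivity) (hA0 τ)

lemma free_delta {p : ℝ} (hA : Adm W p) {δ : ℝ} (hδ : 0 < δ) {v : W → ℝ} (hv : Wt p v) {ψ : W × ℝ → ℂ} (hψ : NiceST ψ) {H : W × ℝ → ℂ} (hH : H = (fun z => (Real.sqrt (v z.1) : ℂ) * ψ z)) :
    ∫⁻ ξ : W, ENNReal.ofReal (‖ξ‖ / (2 * Real.pi * (δ^2 + (2*‖ξ‖+δ)^2)) * ∫ y in (0:ℝ)..1, ‖TF (PF H) (ξ, (‖ξ‖ + δ * y)/(2*Real.pi))‖^2) ≤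
      ENNReal.ofReal (C2 W p * N2 (volume.prod volume) ψ) := by
  have hW : Nontrivial W := Module.nontrivial_of_finrank_pos (R := ℝ) (by have := hA.1; omega)
  have hHn : NiceST H := by rw [hH]; exact hψ.sqrt_mul hv
  have mT := measurable_TF (measurable_PF hHn.1)
  calc _ ≤ ∫⁻ ξ : W, ∫⁻ τ in Set.Ioi (0:ℝ), ENNReal.ofReal (Pk δ ‖ξ‖ (2 * Real.pi * τ) * ‖TF (PF H) (ξ, τ)‖^2) := by
        apply lintegral_mono_ae
        have : ∀ᵐ ξ : W, ξ ≠ 0 := by simp [ae_iff, measure_singleton]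
        filter_upwards [this] with ξ hξ
        exact free_iii (A := fun τ => ‖TF (PF H) (ξ, τ)‖^2) ((continuous_fourier' (hHn.PF_time ξ).integrable).norm.pow 2) (fun τ => by positivity) hδ (norm_pos_iff.2 hξ)
    _ = ∫⁻ τ in Set.Ioi (0:ℝ), ∫⁻ ξ : W, ENNReal.ofReal (Pk δ ‖ξ‖ (2 * Real.pi * τ) * ‖TF (PF H) (ξ, τ)‖^2) := by
        apply lintegral_lintegral_swap
        apply Measurable.aemeasurable
        unfold Function.uncurry Pk
        fun_prop
    _ ≤ ∫⁻ τ in Set.Ioi (0:ℝ), ENNReal.ofReal (C2 W p * N2 volume (fun x => TF ψ (x,τ))) := by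
        apply setLIntegral_mono' measurableSet_Ioi
        intro τ hτ
        have hτ0 : (0:ℝ) < τ := hτ
        refine le_trans (le_of_eq ?_) (free_i hA hδ hv (hψ.TF_space τ) (ω := 2 * Real.pi * τ) (by positivity))
        congr 1; ext ξ
        rw [TFPF_comm hHn]
        congr 4
        unfold PF
        rw [hH]
        simp only [TF_mul (fun x => (Real.sqrt (v x) : ℂ))]
    _ ≤ ∫⁻ τ, ENNReal.ofReal (C2 W p * N2 volume (fun x => TF ψ (x,τ))) := setLIntegral_le_lintegral _ _
    _ = _ := by
        rw [← ofReal_integral_eq_lintegral_ofReal ((integrable_N2_TF hψ).const_mul _) (Filter.Eventually.of_forall fun τ => mul_nonneg (C2_pos p).le (N2_nonneg _ _)),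
          integral_const_mul, N2_TF hψ]

lemma free_F {p : ℝ} (hA : Adm W p) {v : W → ℝ} (hv : Wt p v) {ψ : W × ℝ → ℂ} (hψ : NiceST ψ) {H : W × ℝ → ℂ} (hH : H = (fun z => (Real.sqrt (v z.1) : ℂ) * ψ z)) :
    ∫⁻ ξ : W, ENNReal.ofReal (‖ξ‖⁻¹ * ‖TF (PF H) (ξ, ‖ξ‖/(2*Real.pi))‖^2) ≤
      ENNReal.ofReal (8 * Real.pi * C2 W p * N2 (volume.prod volume) ψ) := by
  have hW : Nontrivial W := Module.nontrivial_of_finrank_pos (R := ℝ) (by have := hA.1; omega)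
  have hHn : NiceST H := by rw [hH]; exact hψ.sqrt_mul hv
  have mT := measurable_TF (measurable_PF hHn.1)
  have hpi := Real.pi_pos
  obtain ⟨Fd, hFd⟩ : ∃ Fd : ℝ → W → ℝ, Fd = fun δ ξ => (‖ξ‖ / (2 * Real.pi * (δ^2 + (2*‖ξ‖+δ)^2)) * ∫ y in (0:ℝ)..1, ‖TF (PF H) (ξ, (‖ξ‖ + δ * y)/(2*Real.pi))‖^2) := ⟨_, rfl⟩
  have hmeas : ∀ δ, Measurable (Fd δ) := by
    intro δ
    rw [hFd]
    apply Measurable.mul (by fun_prop)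
    simp_rw [intervalIntegral.integral_of_le zero_le_one]
    apply StronglyMeasurable.measurable
    apply StronglyMeasurable.integral_prod_right' (f := fun q : W × ℝ => ‖TF (PF H) (q.1, (‖q.1‖ + δ * q.2)/(2*Real.pi))‖^2)
    apply Measurable.stronglyMeasurable
    fun_prop
  have hbound : ∀ k : ℕ, ∫⁻ ξ : W, ENNReal.ofReal (Fd (1/((k:ℝ)+1)) ξ) ≤ ENNReal.ofReal (C2 W p * N2 (volume.prod volume) ψ) := by
    intro k; rw [hFd]; exact free_delta hA (by positivity) hv hψ hH
  have hlim : ∀ ξ : W, ξ ≠ 0 → Filter.Tendsto (fun k : ℕ => ENNReal.ofReal (Fd (1/((k:ℝ)+1)) ξ)) Filter.atTop (nhds (ENNReal.ofReal ((8 * Real.pi)⁻¹ * (‖ξ‖⁻¹ * ‖TF (PF H) (ξ, ‖ξ‖/(2*Real.pi))‖^2)))) := by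
    intro ξ hξ
    have hρ := norm_pos_iff.2 hξ
    apply (ENNReal.continuous_ofReal.tendsto _).comp
    have hc := continuous_fourier' (hHn.PF_time ξ).integrable
    have hc1 : Continuous (fun δ : ℝ => ∫ y in (0:ℝ)..1, ‖TF (PF H) (ξ, (‖ξ‖ + δ * y)/(2*Real.pi))‖^2) := by
      apply intervalIntegral.continuous_parametric_intervalIntegral_of_continuous'
      have : Continuous (fun τ => TF (PF H) (ξ, τ)) := hc
      have h2 : Continuous (fun q : ℝ × ℝ => (‖ξ‖ + q.1 * q.2)/(2*Real.pi)) := by fun_prop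
      exact ((this.comp h2).norm).pow 2
    have hc2 : ContinuousAt (fun δ : ℝ => ‖ξ‖ / (2 * Real.pi * (δ^2 + (2*‖ξ‖+δ)^2))) 0 := by
      apply ContinuousAt.div (by fun_prop) (by fun_prop)
      positivity
    have h3 := (hc2.mul hc1.continuousAt).tendsto.comp (tendsto_one_div_add_atTop_nhds_zero_nat (𝕜 := ℝ))
    rw [hFd]
    refine le_trans h3 (le_of_eq (congrArg nhds ?_))
    simp only [Pi.mul_apply, zero_mul, add_zero, intervalIntegral.integral_const, sub_zero, smul_eq_mul, one_mul]
    rw [← mul_assoc]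
    congr 1
    rw [zero_pow two_ne_zero, zero_add]
    field_simp
    norm_num
  have hfat := lintegral_liminf_le (u := Filter.atTop) (μ := (volume : Measure W)) (f := fun (k : ℕ) ξ => ENNReal.ofReal (Fd (1/((k:ℝ)+1)) ξ)) (fun k => (hmeas _).ennreal_ofReal)
  have h4 : ∫⁻ ξ : W, ENNReal.ofReal ((8 * Real.pi)⁻¹ * (‖ξ‖⁻¹ * ‖TF (PF H) (ξ, ‖ξ‖/(2*Real.pi))‖^2)) ≤ ENNReal.ofReal (C2 W p * N2 (volume.prod volume) ψ) := by
    refine le_trans (le_of_eq ?_) (hfat.trans ?_)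
    · apply lintegral_congr_ae
      have : ∀ᵐ ξ : W, ξ ≠ 0 := by simp [ae_iff, measure_singleton]
      filter_upwards [this] with ξ hξ
      exact (hlim ξ hξ).liminf_eq.symm
    · exact Filter.liminf_le_of_le (by isBoundedDefault) (fun b hb => by
        obtain ⟨k, hk⟩ := hb.exists
        exact hk.trans (hbound k))
  have h5 : ∀ ξ : W, ENNReal.ofReal (‖ξ‖⁻¹ * ‖TF (PF H) (ξ, ‖ξ‖/(2*Real.pi))‖^2) = ENNReal.ofReal (8 * Real.pi) * ENNReal.ofReal ((8 * Real.pi)⁻¹ * (‖ξ‖⁻¹ * ‖TF (PF H) (ξ, ‖ξ‖/(2*Real.pi))‖^2)) := by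
    intro ξ
    rw [← ENNReal.ofReal_mul (by positivity)]
    congr 1; field_simp
  simp_rw [h5]
  rw [lintegral_const_mul' _ _ ENNReal.ofReal_ne_top, mul_assoc (8 * Real.pi), ENNReal.ofReal_mul (p := 8 * Real.pi) (by positivity)]
  exact mul_le_mul_right h4 _
end FreeSec
end

noncomputable section
open MeasureTheory Metric Complex
open scoped ENNReal FourierTransform SchwartzMap
set_option linter.unusedSectionVars false
section HalfSec
variable {W : Type*} [NormedAddCommGroup W] [InnerProductSpace ℝ W] [FiniteDimensional ℝ W] [MeasurableSpace W] [BorelSpace W]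

lemma selfadj_fourierInv {f g : W → ℂ} (hf : Integrable f) (hg : Integrable g) :
    ∫ x, 𝓕⁻ f x * g x = ∫ x, f x * 𝓕⁻ g x := by
  have h := selfadj_fourier (integrable_conj' hf) (integrable_conj' hg)
  have h2 := congrArg (starRingEnd ℂ) h
  rw [← integral_conj, ← integral_conj] at h2
  simpa [conj_fourier] using h2

/-- half wave evolution -/
def HW (a : W → ℂ) : W × ℝ → ℂ := PFi (fun z : W × ℝ => Complex.exp (((z.2 * ‖z.1‖ : ℝ) : ℂ) * I) * a z.1)

lemma HW_meas {a : W → ℂ} (ha : Measurable a) : Measurable (HW a) := measurable_PFi (by fun_prop)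

lemma HW_bound (a : W → ℂ) (z : W × ℝ) : ‖HW a z‖ ≤ ∫ ξ, ‖a ξ‖ := by
  refine (norm_fourierInv_le' _ _).trans (le_of_eq ?_)
  congr 1; ext ξ
  rw [norm_mul, Complex.norm_exp_ofReal_mul_I, one_mul]

lemma integrable_wave {a : W → ℂ} (ha : Integrable a) {k : W × ℝ → ℂ} (hk : Measurable k) {B R : ℝ} (hB : ∀ z, ‖k z‖ ≤ B) (hR : ∀ z : W × ℝ, R < |z.2| → k z = 0) :
    Integrable (fun z : W × ℝ => a z.1 * k z) (volume.prod volume) := by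
  have hi : Integrable ((closedBall (0:ℝ) R).indicator (fun _ => B)) volume :=
    (integrable_indicator_iff measurableSet_closedBall).2 (integrableOn_const measure_closedBall_lt_top.ne)
  have h2 := ha.norm.mul_prod hi
  refine h2.mono' (ha.1.comp_fst.mul hk.aestronglyMeasurable) (Filter.Eventually.of_forall fun z => ?_)
  rw [norm_mul]
  apply mul_le_mul_of_nonneg_left _ (norm_nonneg _)
  by_cases hz : z.2 ∈ closedBall (0:ℝ) R
  · rw [Set.indicator_of_mem hz]; exact hB z
  · rw [Set.indicator_of_notMem hz, hR z (by simpa using hz)]; simp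

lemma PFi_bdd {H : W × ℝ → ℂ} (hH : NiceST H) : ∃ B R : ℝ, (∀ z, ‖PFi H z‖ ≤ B) ∧ (∀ z : W × ℝ, R < |z.2| → PFi H z = 0) := by
  obtain ⟨B, hB, -⟩ := hH.int_bound
  obtain ⟨R, hR, h1, h2⟩ := hH.time_supp2 hH
  exact ⟨B, R, fun z => (norm_fourierInv_le' _ _).trans (hB z.2), PFi_zero h1⟩

lemma half_pair {a : W → ℂ} (ha : Integrable a) (ham : Measurable a) {H : W × ℝ → ℂ} (hH : NiceST H) :
    ∫ z, HW a z * H z ∂(volume.prod volume) = ∫ ξ, a ξ * TFi (PFi H) (ξ, ‖ξ‖/(2*Real.pi)) := by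
  have hpi := Real.pi_pos
  have i1 : Integrable (fun z => HW a z * H z) (volume.prod volume) :=
    hH.integrable.bdd_mul (c := ∫ ξ, ‖a ξ‖) (HW_meas ham).aestronglyMeasurable (Filter.Eventually.of_forall (HW_bound a))
  rw [integral_prod_symm _ i1]
  obtain ⟨B, R, hB, hR⟩ := PFi_bdd hH
  have mP := measurable_PFi hH.1
  have i2 : Integrable (fun z : W × ℝ => a z.1 * (Complex.exp (((z.2 * ‖z.1‖ : ℝ) : ℂ) * I) * PFi H z)) (volume.prod volume) := by
    apply integrable_wave ha (k := fun z => Complex.exp (((z.2 * ‖z.1‖ : ℝ) : ℂ) * I) * PFi H z) (by fun_prop) (B := B) (R := R)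
    · intro z; rw [norm_mul, Complex.norm_exp_ofReal_mul_I, one_mul]; exact hB z
    · intro z hz; rw [hR z hz, mul_zero]
  have e1 : ∀ t : ℝ, ∫ x, HW a (x,t) * H (x,t) = ∫ ξ, a ξ * (Complex.exp (((t * ‖ξ‖ : ℝ) : ℂ) * I) * PFi H (ξ,t)) := by
    intro t
    have := selfadj_fourierInv (f := fun ξ => Complex.exp (((t * ‖ξ‖ : ℝ) : ℂ) * I) * a ξ) (g := fun x => H (x,t))
      (ha.bdd_mul (c := 1) (by fun_prop) (Filter.Eventually.of_forall fun ξ => by rw [Complex.norm_exp_ofReal_mul_I])) (hH.space t).integrable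
    refine this.trans ?_
    congr 1; ext ξ
    unfold PFi; ring
  simp_rw [e1]
  rw [← integral_prod_symm _ i2, integral_prod _ i2]
  congr 1; ext ξ
  simp only []
  rw [integral_const_mul]
  congr 1
  unfold TFi
  rw [Real.fourierInv_eq']
  congr 1; ext t
  rw [smul_eq_mul]
  congr 2
  simp only [RCLike.inner_apply, conj_trivial]
  push_cast
  field_simp
end HalfSec
end

noncomputable section
open MeasureTheory Metric Complex
open scoped ENNReal FourierTransform SchwartzMap
set_option linter.unusedSectionVars false
section HalfEst
variable {W : Type*} [NormedAddCommGroup W] [InnerProductSpace ℝ W] [FiniteDimensional ℝ W] [MeasurableSpace W] [BorelSpace W]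

lemma free_Fi {p : ℝ} (hA : Adm W p) {v : W → ℝ} (hv : Wt p v) {ψ : W × ℝ → ℂ} (hψ : NiceST ψ) {H : W × ℝ → ℂ} (hH : H = (fun z => (Real.sqrt (v z.1) : ℂ) * ψ z)) :
    ∫⁻ ξ : W, ENNReal.ofReal (‖ξ‖⁻¹ * ‖TFi (PFi H) (ξ, ‖ξ‖/(2*Real.pi))‖^2) ≤
      ENNReal.ofReal (8 * Real.pi * C2 W p * N2 (volume.prod volume) ψ) := by
  have h := free_F hA hv hψ.conj (H := fun z => (starRingEnd ℂ) (H z)) (by rw [hH]; ext z; simp)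
  rw [N2_conj] at h
  refine le_trans (le_of_eq ?_) h
  congr 1; ext ξ
  congr 3
  rw [← RCLike.norm_conj, conj_TFi]
  congr 2; ext z; rw [conj_PFi]

lemma half_est_box {p : ℝ} (hA : Adm W p) {v : W → ℝ} (hv : Wt p v) {a : W → ℂ} (ha : Integrable a) (ham : Measurable a)
    {K : Set (W × ℝ)} (hK : MeasurableSet K) {R : ℝ} (hR : ∀ z ∈ K, ‖z.1‖ ≤ R ∧ |z.2| ≤ R) :
    ∫⁻ z in K, ENNReal.ofReal (v z.1 * ‖HW a z‖^2) ∂(volume.prod volume) ≤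
      ENNReal.ofReal (8 * Real.pi * C2 W p) * ∫⁻ ξ : W, ENNReal.ofReal (‖ξ‖ * ‖a ξ‖^2) := by
  have hW : Nontrivial W := Module.nontrivial_of_finrank_pos (R := ℝ) (by have := hA.1; omega)
  have hpi := Real.pi_pos
  have hC : 0 < C2 W p := C2_pos p
  obtain ⟨hvm, hv0, ⟨B, hB⟩, -⟩ := id hv
  have hmH := HW_meas ham
  obtain ⟨ψ, hψd⟩ : ∃ ψ : W × ℝ → ℂ, ψ = K.indicator (fun z => (Real.sqrt (v z.1) : ℂ) * (starRingEnd ℂ) (HW a z)) := ⟨_, rfl⟩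
  have hψ : NiceST ψ := by
    refine ⟨?_, ⟨Real.sqrt B * ∫ ξ, ‖a ξ‖, fun z => ?_⟩, R, fun z hz => ?_⟩
    · rw [hψd]; exact Measurable.indicator (by
        have : Measurable (fun z => (starRingEnd ℂ) (HW a z)) := Complex.continuous_conj.measurable.comp hmH
        fun_prop) hK
    · rw [hψd]
      refine (norm_indicator_le_norm_self _ _).trans ?_
      rw [norm_mul, RCLike.norm_conj, Complex.norm_real, Real.norm_of_nonneg (Real.sqrt_nonneg _)]
      exact mul_le_mul (Real.sqrt_le_sqrt (hB _)) (HW_bound a z) (norm_nonneg _) (Real.sqrt_nonneg _)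
    · rw [hψd]; apply Set.indicator_of_notMem
      intro hzK
      have := hR z hzK
      rcases hz with h | h <;> linarith
  obtain ⟨H, hH⟩ : ∃ H : W × ℝ → ℂ, H = (fun z => (Real.sqrt (v z.1) : ℂ) * ψ z) := ⟨_, rfl⟩
  have hHn : NiceST H := by rw [hH]; exact hψ.sqrt_mul hv
  have hpt : ∀ z, HW a z * H z = ((‖ψ z‖^2 : ℝ) : ℂ) := by
    intro z
    rw [hH, hψd]
    by_cases hz : z ∈ K
    · simp only [Set.indicator_of_mem hz, norm_mul, RCLike.norm_conj, Complex.norm_real, Real.norm_of_nonneg (Real.sqrt_nonneg _)]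
      rw [mul_pow, Real.sq_sqrt (hv0 _)]
      have : (HW a z) * (starRingEnd ℂ) (HW a z) = ((‖HW a z‖^2 : ℝ) : ℂ) := by rw [Complex.mul_conj, Complex.normSq_eq_norm_sq]
      have h2 : ((Real.sqrt (v z.1) : ℝ) : ℂ) * (Real.sqrt (v z.1) : ℝ) = (v z.1 : ℝ) := by rw [← Complex.ofReal_mul, Real.mul_self_sqrt (hv0 _)]
      rw [Complex.ofReal_mul, ← this, ← h2]; ring
    · simp only [Set.indicator_of_notMem hz]; simp
  have hX1 : ∫⁻ z in K, ENNReal.ofReal (v z.1 * ‖HW a z‖^2) ∂(volume.prod volume) = ENNReal.ofReal (N2 (volume.prod volume) ψ) := by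
    unfold N2
    rw [ofReal_integral_eq_lintegral_ofReal (integrable_sq (hψ.memLp 2)) (Filter.Eventually.of_forall fun z => by positivity), ← lintegral_indicator hK]
    congr 1; ext z
    rw [hψd]
    by_cases hz : z ∈ K
    · simp only [Set.indicator_of_mem hz, norm_mul, RCLike.norm_conj, Complex.norm_real, Real.norm_of_nonneg (Real.sqrt_nonneg _)]
      rw [mul_pow, Real.sq_sqrt (hv0 _)]
    · simp only [Set.indicator_of_notMem hz]; simp
  have hX2 : ((N2 (volume.prod volume) ψ : ℝ) : ℂ) = ∫ ξ, a ξ * TFi (PFi H) (ξ, ‖ξ‖/(2*Real.pi)) := by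
    rw [← half_pair ha ham hHn]
    simp_rw [hpt]
    rw [integral_complex_ofReal]; rfl
  have hN := N2_nonneg (volume.prod volume) ψ
  obtain ⟨X, hX⟩ : ∃ X, X = N2 (volume.prod volume) ψ := ⟨_, rfl⟩
  rw [hX1]
  have hF := free_Fi hA hv hψ hH
  rw [← hX] at hX1 hX2 hN hF ⊢
  obtain ⟨S, hS⟩ : ∃ S, S = ∫⁻ ξ : W, ENNReal.ofReal (‖ξ‖ * ‖a ξ‖^2) := ⟨_, rfl⟩
  obtain ⟨c, hc⟩ : ∃ c, c = 8 * Real.pi * C2 W p := ⟨_, rfl⟩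
  have hc0 : 0 < c := by rw [hc]; positivity
  have h1 : ENNReal.ofReal X ≤ ENNReal.ofReal (c/2) * S + ENNReal.ofReal (X/2) := by
    calc ENNReal.ofReal X = ‖((X:ℝ):ℂ)‖ₑ := by
          rw [← ofReal_norm, Complex.norm_real, Real.norm_of_nonneg hN]
      _ ≤ ∫⁻ ξ, ‖a ξ * TFi (PFi H) (ξ, ‖ξ‖/(2*Real.pi))‖ₑ := by rw [hX2]; exact enorm_integral_le_lintegral_enorm _
      _ ≤ ∫⁻ ξ, (ENNReal.ofReal (c/2) * ENNReal.ofReal (‖ξ‖ * ‖a ξ‖^2) + ENNReal.ofReal (1/(2*c)) * ENNReal.ofReal (‖ξ‖⁻¹ * ‖TFi (PFi H) (ξ, ‖ξ‖/(2*Real.pi))‖^2)) := by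
          apply lintegral_mono_ae
          have : ∀ᵐ ξ : W, ξ ≠ 0 := by simp [ae_iff, measure_singleton]
          filter_upwards [this] with ξ hξ
          have hρ := norm_pos_iff.2 hξ
          rw [← ENNReal.ofReal_mul (by positivity), ← ENNReal.ofReal_mul (by positivity), ← ENNReal.ofReal_add (by positivity) (by positivity), ← ofReal_norm]
          apply ENNReal.ofReal_le_ofReal
          rw [norm_mul]
          obtain ⟨A, hA⟩ : ∃ A, A = ‖a ξ‖ := ⟨_, rfl⟩
          obtain ⟨E, hE⟩ : ∃ E, E = ‖TFi (PFi H) (ξ, ‖ξ‖/(2*Real.pi))‖ := ⟨_, rfl⟩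
          rw [← hA, ← hE]
          have : c/2 * (‖ξ‖ * A^2) + 1/(2*c) * (‖ξ‖⁻¹ * E^2) - A * E = (c * ‖ξ‖ * A - E)^2 / (2 * c * ‖ξ‖) := by
            field_simp; ring
          have h2 : 0 ≤ (c * ‖ξ‖ * A - E)^2 / (2 * c * ‖ξ‖) := by positivity
          linarith
      _ = ENNReal.ofReal (c/2) * S + ENNReal.ofReal (1/(2*c)) * ∫⁻ ξ : W, ENNReal.ofReal (‖ξ‖⁻¹ * ‖TFi (PFi H) (ξ, ‖ξ‖/(2*Real.pi))‖^2) := by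
          rw [lintegral_add_left (by fun_prop), lintegral_const_mul' _ _ ENNReal.ofReal_ne_top, lintegral_const_mul' _ _ ENNReal.ofReal_ne_top, hS]
      _ ≤ ENNReal.ofReal (c/2) * S + ENNReal.ofReal (1/(2*c)) * ENNReal.ofReal (c * X) := by
          rw [hc] at *; gcongr
      _ = _ := by
          rw [← ENNReal.ofReal_mul (by positivity)]
          congr 2; field_simp
  rw [← hS, ← hc]
  have e1 : ENNReal.ofReal X = ENNReal.ofReal (X/2) + ENNReal.ofReal (X/2) := by
    rw [← ENNReal.ofReal_add (by positivity) (by positivity)]; congr 1; ring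
  have e2 : ENNReal.ofReal (X/2) ≤ ENNReal.ofReal (c/2) * S := by
    rw [e1] at h1
    exact (ENNReal.add_le_add_iff_right ENNReal.ofReal_ne_top).1 h1
  have e3 : ENNReal.ofReal c = ENNReal.ofReal (c/2) + ENNReal.ofReal (c/2) := by
    rw [← ENNReal.ofReal_add (by positivity) (by positivity)]; congr 1; ring
  rw [e1, e3, add_mul]
  exact add_le_add e2 e2

lemma lint_exhaust {α : Type*} [MeasurableSpace α] {μ : Measure α} {f : α → ℝ≥0∞} {S : ℕ → Set α} (hS : Monotone S) (hU : ∀ x, ∃ k, x ∈ S k) {B : ℝ≥0∞}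
    (h : ∀ k, ∫⁻ x in S k, f x ∂μ ≤ B) : ∫⁻ x, f x ∂μ ≤ B := by
  have h2 := setLIntegral_iUnion_of_directed (μ := μ) f (hS.directed_le)
  have h3 : ⋃ i, S i = Set.univ := by ext x; simpa using hU x
  rw [h3, setLIntegral_univ] at h2
  rw [h2]
  exact iSup_le h

/-- unbounded weights -/
def WtU (p : ℝ) (v : W → ℝ) : Prop := Measurable v ∧ (∀ x, 0 ≤ v x) ∧ Mor p v

/-- truncation -/
def tru (v : W → ℝ) (N : ℝ) (x : W) : ℝ := Set.indicator {x | v x ≤ N} v x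

lemma WtU.tru {p : ℝ} (hp : 0 ≤ p) {v : W → ℝ} (h : WtU p v) (N : ℝ) : Wt p (tru v N) := by
  obtain ⟨m1, n1, M1⟩ := h
  have hms : MeasurableSet {x | v x ≤ N} := measurableSet_le m1 measurable_const
  have h0 : ∀ x, 0 ≤ _root_.tru v N x := fun x => Set.indicator_nonneg (fun x _ => n1 x) x
  refine ⟨m1.indicator hms, h0, ⟨max N 0, fun x => ?_⟩, ?_⟩
  · unfold _root_.tru Set.indicator
    split_ifs with h
    · exact le_max_of_le_left h
    · exact le_max_right _ _
  · intro y r hr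
    refine (lintegral_mono fun x => ?_).trans (M1 y r hr)
    apply ENNReal.ofReal_le_ofReal
    exact Real.rpow_le_rpow (h0 x) (Set.indicator_le_self' (fun x _ => n1 x) x) hp

lemma half_est {p : ℝ} (hA : Adm W p) (hp : 0 ≤ p) {v : W → ℝ} (hv : WtU p v) {a : W → ℂ} (ha : Integrable a) (ham : Measurable a) :
    ∫⁻ z, ENNReal.ofReal (v z.1 * ‖HW a z‖^2) ∂(volume.prod volume) ≤
      ENNReal.ofReal (8 * Real.pi * C2 W p) * ∫⁻ ξ : W, ENNReal.ofReal (‖ξ‖ * ‖a ξ‖^2) := by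
  have hvm := hv.1
  have hm : ∀ k : ℕ, MeasurableSet ({z : W × ℝ | v z.1 ≤ k ∧ ‖z.1‖ ≤ k ∧ |z.2| ≤ k}) := fun k => 
    (measurableSet_le (f := fun z : W × ℝ => v z.1) (g := fun _ => (k:ℝ)) (by fun_prop) (by fun_prop)).inter
      ((measurableSet_le (f := fun z : W × ℝ => ‖z.1‖) (g := fun _ => (k:ℝ)) (by fun_prop) (by fun_prop)).inter
        (measurableSet_le (f := fun z : W × ℝ => |z.2|) (g := fun _ => (k:ℝ)) (by fun_prop) (by fun_prop)))
  refine lint_exhaust (S := fun k : ℕ => {z : W × ℝ | v z.1 ≤ k ∧ ‖z.1‖ ≤ k ∧ |z.2| ≤ k}) ?_ ?_ (fun k => ?_)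
  · intro i j hij z hz
    have : (i:ℝ) ≤ j := by exact_mod_cast hij
    exact ⟨hz.1.trans this, hz.2.1.trans this, hz.2.2.trans this⟩
  · intro z
    obtain ⟨k, hk⟩ := exists_nat_ge (max (v z.1) (max ‖z.1‖ |z.2|))
    exact ⟨k, (le_max_left _ _).trans hk, ((le_max_left _ _).trans (le_max_right _ _)).trans hk, ((le_max_right _ _).trans (le_max_right _ _)).trans hk⟩
  · refine le_trans (le_of_eq ?_) (half_est_box hA (hv.tru hp k) ha ham (hm k) (R := k) fun z hz => hz.2)
    apply setLIntegral_congr_fun (hm k)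
    intro z hz
    have : tru v k z.1 = v z.1 := Set.indicator_of_mem (s := {x | v x ≤ (k:ℝ)}) hz.1 _
    simp only [this]
end HalfEst
end

noncomputable section
open MeasureTheory Metric Complex
open scoped ENNReal FourierTransform SchwartzMap
set_option linter.unusedSectionVars false
section FreeEst
variable {W : Type*} [NormedAddCommGroup W] [InnerProductSpace ℝ W] [FiniteDimensional ℝ W] [MeasurableSpace W] [BorelSpace W]

lemma integrable_inv_norm (hd : 3 ≤ Module.finrank ℝ W) : Integrable (fun ξ : W => ‖ξ‖⁻¹ * ((1+‖ξ‖)^(Module.finrank ℝ W + 1))⁻¹) := by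
  have hW : Nontrivial W := Module.nontrivial_of_finrank_pos (R := ℝ) (by omega)
  rw [integrable_fun_norm_addHaar (μ := (volume : Measure W)) (f := fun y : ℝ => y⁻¹ * ((1+y)^(Module.finrank ℝ W + 1))⁻¹)]
  obtain ⟨m, hm⟩ : ∃ m, Module.finrank ℝ W = m + 3 := ⟨Module.finrank ℝ W - 3, by omega⟩
  rw [hm]
  refine Integrable.mono' (g := fun y : ℝ => (1+y^2)⁻¹) integrable_inv_one_add_sq.integrableOn (by fun_prop) ?_
  refine (ae_restrict_iff' measurableSet_Ioi).2 (Filter.Eventually.of_forall fun y hy => ?_)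
  have hy0 : (0:ℝ) < y := hy
  rw [Real.norm_of_nonneg (by positivity), smul_eq_mul, show m + 3 - 1 = m + 1 + 1 by omega]
  have : y ^ (m+1+1) * (y⁻¹ * ((1 + y)^(m+3+1))⁻¹) = y^(m+1) / (1+y)^(m+4) := by field_simp; ring
  rw [this, inv_eq_one_div, div_le_div_iff₀ (by positivity) (by positivity), one_mul]
  calc y^(m+1) * (1+y^2) ≤ (1+y)^(m+1) * (1+y)^3 := by
        apply mul_le_mul _ (by nlinarith [pow_pos hy0 3]) (by positivity) (by positivity)
        gcongr; linarith
    _ = _ := by ring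

lemma schwartz_decay (φ : 𝓢(W, ℂ)) (k : ℕ) : ∃ C, 0 ≤ C ∧ ∀ x, ‖φ x‖ ≤ C * ((1+‖x‖)^k)⁻¹ := by
  have h := SchwartzMap.one_add_le_sup_seminorm_apply (𝕜 := ℝ) (m := (k, 0)) (le_refl k) (le_refl 0) φ
  refine ⟨2 ^ k * (Finset.Iic (k, 0)).sup (fun m => SchwartzMap.seminorm ℝ m.1 m.2) φ, by positivity, fun x => ?_⟩
  have h2 := h x
  rw [norm_iteratedFDeriv_zero] at h2
  rw [← div_eq_mul_inv, le_div_iff₀ (by positivity), mul_comm]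
  exact h2

lemma schwartz_inv_integrable (hd : 3 ≤ Module.finrank ℝ W) (φ : 𝓢(W, ℂ)) : Integrable (fun ξ => ‖ξ‖⁻¹ * ‖φ ξ‖) := by
  obtain ⟨C, hC, h⟩ := schwartz_decay φ (Module.finrank ℝ W + 1)
  refine ((integrable_inv_norm hd).const_mul C).mono' (by fun_prop) (Filter.Eventually.of_forall fun ξ => ?_)
  rw [Real.norm_of_nonneg (by positivity)]
  calc _ ≤ ‖ξ‖⁻¹ * (C * ((1+‖ξ‖)^(Module.finrank ℝ W + 1))⁻¹) := by gcongr; exact h ξ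
    _ = _ := by ring

lemma schwartz_pow_integrable (φ : 𝓢(W, ℂ)) : Integrable (fun ξ => ‖ξ‖ * ‖φ ξ‖) := by
  simpa using φ.integrable_pow_mul volume 1

/-- Plancherel for multiplied Schwartz functions -/
lemma plancherel_mult (φ : 𝓢(W, ℂ)) {m : ℝ → ℝ} (hm : Measurable m) (hm0 : ∀ r, 0 ≤ r → 0 ≤ m r) 
    (h1 : Integrable (fun ξ => m ‖ξ‖ * ‖φ ξ‖)) (h2 : Integrable (fun ξ => m ‖ξ‖^2 * ‖φ ξ‖)) :
    eLpNorm (𝓕⁻ (fun ξ => (m ‖ξ‖ : ℂ) * φ ξ)) 2 volume ^ 2 = ∫⁻ ξ, ENNReal.ofReal (m ‖ξ‖^2 * ‖φ ξ‖^2) := by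
  obtain ⟨C, hC, hb⟩ := schwartz_decay φ 0
  have hmeas : AEStronglyMeasurable (fun ξ => (m ‖ξ‖ : ℂ) * φ ξ) volume := (Measurable.mul (by fun_prop) φ.continuous.measurable).aestronglyMeasurable
  have e : ∀ ξ, ‖(m ‖ξ‖ : ℂ) * φ ξ‖ = m ‖ξ‖ * ‖φ ξ‖ := fun ξ => by
    rw [norm_mul, Complex.norm_real, Real.norm_of_nonneg (hm0 _ (norm_nonneg _))]
  have i1 : Integrable (fun ξ => (m ‖ξ‖ : ℂ) * φ ξ) := by
    rw [← integrable_norm_iff hmeas]; simp_rw [e]; exact h1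
  have i3 : Integrable (fun ξ => ‖(m ‖ξ‖ : ℂ) * φ ξ‖^2) := by
    simp_rw [e]
    have mφ := φ.continuous.measurable
    refine (h2.const_mul C).mono' (Measurable.aestronglyMeasurable (by fun_prop)) (Filter.Eventually.of_forall fun ξ => ?_)
    rw [Real.norm_of_nonneg (by positivity)]
    have := hb ξ
    simp only [pow_zero, inv_one, mul_one] at this
    calc (m ‖ξ‖ * ‖φ ξ‖)^2 = ‖φ ξ‖ * (m ‖ξ‖^2 * ‖φ ξ‖) := by ring
      _ ≤ _ := by gcongr
  have i2 : MemLp (fun ξ => (m ‖ξ‖ : ℂ) * φ ξ) 2 := (memLp_two_iff_integrable_sq_norm hmeas).2 i3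
  rw [eLpNorm_fourierInv i1 i2, eLpNorm_eq_lintegral_rpow_enorm_toReal (by norm_num) (by norm_num), ← ENNReal.rpow_natCast, ← ENNReal.rpow_mul]
  norm_num
  congr 1; ext ξ
  rw [← mul_pow, ENNReal.ofReal_pow (mul_nonneg (hm0 _ (norm_nonneg _)) (norm_nonneg _)), ← e, ofReal_norm, enorm_mul, mul_pow]

lemma sob_half {n : ℕ} (f : 𝓢(EuclideanSpace ℝ (Fin n), ℂ)) :
    sobNorm n (1/2) f ^ 2 = ∫⁻ ξ, ENNReal.ofReal (‖ξ‖ * ‖𝓕 (f : EuclideanSpace ℝ (Fin n) → ℂ) ξ‖^2) := by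
  have hc : ∀ ξ, 𝓕 (f : EuclideanSpace ℝ (Fin n) → ℂ) ξ = (𝓕 f) ξ := fun ξ => by rw [SchwartzMap.fourier_coe]
  have e : ∀ r : ℝ, 0 ≤ r → (r^(1/2:ℝ))^2 = r := fun r hr => by
    rw [← Real.rpow_natCast, ← Real.rpow_mul hr]; norm_num
  have h2 : Integrable (fun ξ => (‖ξ‖^(1/2:ℝ))^2 * ‖(𝓕 f) ξ‖) := by
    simp_rw [e _ (norm_nonneg _)]; exact schwartz_pow_integrable _
  have h1 : Integrable (fun ξ => ‖ξ‖^(1/2:ℝ) * ‖(𝓕 f) ξ‖) := by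
    refine ((schwartz_pow_integrable (𝓕 f)).add (𝓕 f).integrable.norm).mono' (Measurable.aestronglyMeasurable ?_) (Filter.Eventually.of_forall fun ξ => ?_)
    · have := (𝓕 f).continuous.measurable
      fun_prop
    · rw [Real.norm_of_nonneg (by positivity)]
      simp only [Pi.add_apply]
      have := e _ (norm_nonneg ξ)
      have h3 : ‖ξ‖^(1/2:ℝ) ≤ ‖ξ‖ + 1 := by nlinarith [sq_nonneg (‖ξ‖^(1/2:ℝ) - 1), norm_nonneg ξ]
      nlinarith [norm_nonneg ((𝓕 f) ξ)]
  have h := plancherel_mult (𝓕 f) (m := fun r => r^(1/2:ℝ)) (by fun_prop) (fun r hr => by positivity) h1 h2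
  unfold sobNorm mOp powMult
  simp_rw [hc]
  refine h.trans ?_
  simp_rw [e _ (norm_nonneg _)]

lemma sob_neg_half {n : ℕ} (hn : 3 ≤ n) (f : 𝓢(EuclideanSpace ℝ (Fin n), ℂ)) :
    sobNorm n (-(1/2)) f ^ 2 = ∫⁻ ξ, ENNReal.ofReal (‖ξ‖⁻¹ * ‖𝓕 (f : EuclideanSpace ℝ (Fin n) → ℂ) ξ‖^2) := by
  have hd : 3 ≤ Module.finrank ℝ (EuclideanSpace ℝ (Fin n)) := by simpa using hn
  have hc : ∀ ξ, 𝓕 (f : EuclideanSpace ℝ (Fin n) → ℂ) ξ = (𝓕 f) ξ := fun ξ => by rw [SchwartzMap.fourier_coe]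
  have e : ∀ r : ℝ, 0 ≤ r → (r^(-(1/2):ℝ))^2 = r⁻¹ := fun r hr => by
    rw [← Real.rpow_natCast, ← Real.rpow_mul hr]; norm_num [Real.rpow_neg_one]
  have h2 : Integrable (fun ξ => (‖ξ‖^(-(1/2):ℝ))^2 * ‖(𝓕 f) ξ‖) := by
    simp_rw [e _ (norm_nonneg _)]; exact schwartz_inv_integrable hd _
  have h1 : Integrable (fun ξ => ‖ξ‖^(-(1/2):ℝ) * ‖(𝓕 f) ξ‖) := by
    refine ((schwartz_inv_integrable hd (𝓕 f)).add (𝓕 f).integrable.norm).mono' (Measurable.aestronglyMeasurable ?_) (Filter.Eventually.of_forall fun ξ => ?_)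
    · have := (𝓕 f).continuous.measurable
      fun_prop
    · rw [Real.norm_of_nonneg (by positivity)]
      simp only [Pi.add_apply]
      have := e _ (norm_nonneg ξ)
      have h3 : ‖ξ‖^(-(1/2):ℝ) ≤ ‖ξ‖⁻¹ + 1 := by nlinarith [sq_nonneg (‖ξ‖^(-(1/2):ℝ) - 1), inv_nonneg.2 (norm_nonneg ξ)]
      nlinarith [norm_nonneg ((𝓕 f) ξ)]
  have h := plancherel_mult (𝓕 f) (m := fun r => r^(-(1/2):ℝ)) (by fun_prop) (fun r hr => by positivity) h1 h2
  unfold sobNorm mOp powMult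
  simp_rw [hc]
  refine h.trans ?_
  simp_rw [e _ (norm_nonneg _)]

/-- the free wave -/
def frw {n : ℕ} (f g : 𝓢(EuclideanSpace ℝ (Fin n), ℂ)) (z : EuclideanSpace ℝ (Fin n) × ℝ) : ℂ :=
  mOp n (cosMult z.2) f z.1 + mOp n (sincMult z.2) g z.1

/-- half-wave amplitudes -/
def amp {n : ℕ} (σ : ℂ) (f g : 𝓢(EuclideanSpace ℝ (Fin n), ℂ)) (ξ : EuclideanSpace ℝ (Fin n)) : ℂ :=
  ((𝓕 f) ξ + σ * ((‖ξ‖⁻¹ : ℝ) : ℂ) * (𝓕 g) ξ) / 2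

lemma amp_meas {n : ℕ} (σ : ℂ) (f g : 𝓢(EuclideanSpace ℝ (Fin n), ℂ)) : Measurable (amp σ f g) := by
  unfold amp
  have := (𝓕 f).continuous.measurable
  have := (𝓕 g).continuous.measurable
  fun_prop

lemma sg_integrable {n : ℕ} (hn : 3 ≤ n) (g : 𝓢(EuclideanSpace ℝ (Fin n), ℂ)) : Integrable (fun ξ => ((‖ξ‖⁻¹ : ℝ) : ℂ) * (𝓕 g) ξ) := by
  have hd : 3 ≤ Module.finrank ℝ (EuclideanSpace ℝ (Fin n)) := by simpa using hn
  have := (𝓕 g).continuous.measurable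
  refine (schwartz_inv_integrable hd (𝓕 g)).mono' (Measurable.aestronglyMeasurable (by fun_prop)) (Filter.Eventually.of_forall fun ξ => ?_)
  rw [norm_mul, Complex.norm_real, Real.norm_of_nonneg (by positivity)]

lemma amp_integrable {n : ℕ} (hn : 3 ≤ n) (σ : ℂ) (f g : 𝓢(EuclideanSpace ℝ (Fin n), ℂ)) : Integrable (amp σ f g) := by
  unfold amp
  refine Integrable.div_const (Integrable.add (𝓕 f).integrable ?_) 2
  simp_rw [mul_assoc]
  exact (sg_integrable hn g).const_mul σ

lemma fourierInv_add' {a b : W → ℂ} (ha : Integrable a) (hb : Integrable b) (x : W) :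
    𝓕⁻ a x + 𝓕⁻ b x = 𝓕⁻ (fun ξ => a ξ + b ξ) x := by
  have hF : ∀ {c : W → ℂ}, Integrable c → Integrable (fun v => Complex.exp (↑(2 * Real.pi * inner ℝ v x) * I) • c v) := by
    intro c hc
    simp only [smul_eq_mul]
    exact hc.bdd_mul (c := 1) (by fun_prop) (Filter.Eventually.of_forall fun ξ => by rw [Complex.norm_exp_ofReal_mul_I])
  rw [Real.fourierInv_eq', Real.fourierInv_eq', Real.fourierInv_eq', ← integral_add (hF ha) (hF hb)]
  congr 1; ext v
  rw [smul_add]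

lemma frw_eq {n : ℕ} (hn : 3 ≤ n) (f g : 𝓢(EuclideanSpace ℝ (Fin n), ℂ)) (z : EuclideanSpace ℝ (Fin n) × ℝ) :
    frw f g z = HW (amp (-I) f g) z + HW (amp I f g) (z.1, -z.2) := by
  have hb : ∀ (t : ℝ) {a : EuclideanSpace ℝ (Fin n) → ℂ}, Integrable a → Integrable (fun ξ => Complex.exp (((t * ‖ξ‖ : ℝ) : ℂ) * I) * a ξ) := by
    intro t a ha
    exact ha.bdd_mul (c := 1) (by fun_prop) (Filter.Eventually.of_forall fun ξ => by rw [Complex.norm_exp_ofReal_mul_I])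
  unfold frw HW PFi mOp cosMult sincMult
  have hc : ∀ (f : 𝓢(EuclideanSpace ℝ (Fin n), ℂ)) ξ, 𝓕 (f : EuclideanSpace ℝ (Fin n) → ℂ) ξ = (𝓕 f) ξ := fun f ξ => by rw [SchwartzMap.fourier_coe]
  simp_rw [hc]
  rw [fourierInv_add' ?_ ?_, fourierInv_add' (hb _ (amp_integrable hn _ f g)) (hb _ (amp_integrable hn _ f g))]
  · refine congrArg (fun h : EuclideanSpace ℝ (Fin n) → ℂ => (𝓕⁻ h : EuclideanSpace ℝ (Fin n) → ℂ) z.1) (funext fun ξ => ?_)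
    unfold amp
    rw [Complex.exp_mul_I, Complex.exp_mul_I, neg_mul z.2, Complex.ofReal_neg, Complex.cos_neg, Complex.sin_neg]
    push_cast
    linear_combination ((Complex.sin (z.2 * ‖ξ‖)) * ((‖ξ‖:ℂ)⁻¹) * (𝓕 g) ξ) * I_sq
  · refine (𝓕 f).integrable.bdd_mul (c := 1) (by fun_prop) (Filter.Eventually.of_forall fun ξ => ?_)
    rw [Complex.norm_real]; exact Real.abs_cos_le_one _
  · have : (fun ξ : EuclideanSpace ℝ (Fin n) => ((Real.sin (z.2 * ‖ξ‖) / ‖ξ‖ : ℝ) : ℂ) * (𝓕 g) ξ) = fun ξ => (Real.sin (z.2 * ‖ξ‖) : ℂ) * (((‖ξ‖⁻¹ : ℝ) : ℂ) * (𝓕 g) ξ) := by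
      ext ξ; push_cast; ring
    rw [this]
    refine (sg_integrable hn g).bdd_mul (c := 1) (by fun_prop) (Filter.Eventually.of_forall fun ξ => ?_)
    rw [Complex.norm_real]; exact Real.abs_sin_le_one _

lemma amp_est {n : ℕ} (hn : 3 ≤ n) {σ : ℂ} (hσ : ‖σ‖ = 1) (f g : 𝓢(EuclideanSpace ℝ (Fin n), ℂ)) :
    ∫⁻ ξ, ENNReal.ofReal (‖ξ‖ * ‖amp σ f g ξ‖^2) ≤ ENNReal.ofReal (1/2) * (sobNorm n (1/2) f ^ 2 + sobNorm n (-(1/2)) g ^ 2) := by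
  have m1 := (𝓕 f).continuous.measurable
  rw [sob_half, sob_neg_half hn]
  have hc : ∀ (f : 𝓢(EuclideanSpace ℝ (Fin n), ℂ)) ξ, 𝓕 (f : EuclideanSpace ℝ (Fin n) → ℂ) ξ = (𝓕 f) ξ := fun f ξ => by rw [SchwartzMap.fourier_coe]
  simp_rw [hc]
  rw [← lintegral_add_left (by fun_prop), ← lintegral_const_mul' _ _ ENNReal.ofReal_ne_top]
  apply lintegral_mono
  intro ξ
  simp only []
  rw [← ENNReal.ofReal_add (by positivity) (by positivity), ← ENNReal.ofReal_mul (by positivity)]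
  apply ENNReal.ofReal_le_ofReal
  have h1 : ‖amp σ f g ξ‖ ≤ (‖(𝓕 f) ξ‖ + ‖ξ‖⁻¹ * ‖(𝓕 g) ξ‖)/2 := by
    unfold amp
    rw [norm_div]
    have := norm_add_le ((𝓕 f) ξ) (σ * ((‖ξ‖⁻¹ : ℝ) : ℂ) * (𝓕 g) ξ)
    rw [norm_mul, norm_mul, hσ, one_mul, Complex.norm_real, Real.norm_of_nonneg (by positivity)] at this
    simp only [Complex.norm_ofNat]
    linarith
  have h2 : ‖amp σ f g ξ‖^2 ≤ ((‖(𝓕 f) ξ‖ + ‖ξ‖⁻¹ * ‖(𝓕 g) ξ‖)/2)^2 := by gcongr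
  have h3 : ‖ξ‖ * (‖ξ‖⁻¹)^2 = ‖ξ‖⁻¹ := by
    by_cases h : ‖ξ‖ = 0
    · simp [h]
    · field_simp
  calc ‖ξ‖ * ‖amp σ f g ξ‖^2 ≤ ‖ξ‖ * ((‖(𝓕 f) ξ‖^2 + (‖ξ‖⁻¹ * ‖(𝓕 g) ξ‖)^2)/2) := by
        gcongr
        refine h2.trans ?_
        nlinarith [sq_nonneg (‖(𝓕 f) ξ‖ - ‖ξ‖⁻¹ * ‖(𝓕 g) ξ‖)]
    _ = 1/2 * (‖ξ‖ * ‖(𝓕 f) ξ‖^2 + ‖ξ‖ * (‖ξ‖⁻¹)^2 * ‖(𝓕 g) ξ‖^2) := by ring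
    _ = _ := by rw [h3]

lemma free_est {n : ℕ} (hn : 3 ≤ n) {p : ℝ} (hA : Adm (EuclideanSpace ℝ (Fin n)) p) (hp : 0 ≤ p) {v : EuclideanSpace ℝ (Fin n) → ℝ} (hv : WtU p v)
    (f g : 𝓢(EuclideanSpace ℝ (Fin n), ℂ)) :
    ∫⁻ z, ENNReal.ofReal (v z.1 * ‖frw f g z‖^2) ∂(volume.prod volume) ≤
      ENNReal.ofReal (16 * Real.pi * C2 (EuclideanSpace ℝ (Fin n)) p) * (sobNorm n (1/2) f ^ 2 + sobNorm n (-(1/2)) g ^ 2) := by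
  have hpi := Real.pi_pos
  have hC : 0 < C2 (EuclideanSpace ℝ (Fin n)) p := C2_pos p
  obtain ⟨S, hS⟩ : ∃ S, S = (sobNorm n (1/2) f ^ 2 + sobNorm n (-(1/2)) g ^ 2) := ⟨_, rfl⟩
  have hvm := hv.1
  have hv0 := hv.2.1
  have m1 := HW_meas (amp_meas (-I) f g)
  have m2 := HW_meas (amp_meas I f g)
  have key : ∀ σ : ℂ, ‖σ‖ = 1 → ∫⁻ z, ENNReal.ofReal (v z.1 * ‖HW (amp σ f g) z‖^2) ∂(volume.prod volume) ≤ ENNReal.ofReal (4 * Real.pi * C2 (EuclideanSpace ℝ (Fin n)) p) * S := by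
    intro σ hσ
    refine (half_est hA hp hv (amp_integrable hn σ f g) (amp_meas σ f g)).trans ?_
    refine (mul_le_mul_right (amp_est hn hσ f g) _).trans (le_of_eq ?_)
    rw [← mul_assoc, ← ENNReal.ofReal_mul (by positivity), hS]
    congr 2; ring
  have k1 := key (-I) (by simp)
  have k2 := key I (by simp)
  have hmp : MeasurePreserving (fun z : EuclideanSpace ℝ (Fin n) × ℝ => (z.1, -z.2)) (volume.prod volume) (volume.prod volume) :=
    (MeasurePreserving.id volume).prod (Measure.measurePreserving_neg volume)
  have k3 : ∫⁻ z, ENNReal.ofReal (v z.1 * ‖HW (amp I f g) (z.1, -z.2)‖^2) ∂(volume.prod volume) ≤ ENNReal.ofReal (4 * Real.pi * C2 (EuclideanSpace ℝ (Fin n)) p) * S := by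
    refine le_trans (le_of_eq ?_) k2
    exact hmp.lintegral_comp (f := fun z => ENNReal.ofReal (v z.1 * ‖HW (amp I f g) z‖^2)) (by fun_prop)
  calc _ ≤ ∫⁻ z, (ENNReal.ofReal 2 * ENNReal.ofReal (v z.1 * ‖HW (amp (-I) f g) z‖^2) + ENNReal.ofReal 2 * ENNReal.ofReal (v z.1 * ‖HW (amp I f g) (z.1, -z.2)‖^2)) ∂(volume.prod volume) := by
        apply lintegral_mono
        intro z
        simp only []
        rw [← ENNReal.ofReal_mul (by positivity), ← ENNReal.ofReal_mul (by positivity), ← ENNReal.ofReal_add (mul_nonneg zero_le_two (mul_nonneg (hv0 _) (by positivity))) (mul_nonneg zero_le_two (mul_nonneg (hv0 _) (by positivity)))]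
        apply ENNReal.ofReal_le_ofReal
        rw [frw_eq hn]
        have h1 := norm_add_le (HW (amp (-I) f g) z) (HW (amp I f g) (z.1, -z.2))
        have h2 : ‖HW (amp (-I) f g) z + HW (amp I f g) (z.1, -z.2)‖^2 ≤ 2 * ‖HW (amp (-I) f g) z‖^2 + 2 * ‖HW (amp I f g) (z.1, -z.2)‖^2 := by
          refine (pow_le_pow_left₀ (norm_nonneg _) h1 2).trans ?_
          nlinarith [sq_nonneg (‖HW (amp (-I) f g) z‖ - ‖HW (amp I f g) (z.1, -z.2)‖)]
        nlinarith [mul_le_mul_of_nonneg_left h2 (hv0 z.1)]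
    _ ≤ ENNReal.ofReal 2 * (ENNReal.ofReal (4 * Real.pi * C2 (EuclideanSpace ℝ (Fin n)) p) * S) + ENNReal.ofReal 2 * (ENNReal.ofReal (4 * Real.pi * C2 (EuclideanSpace ℝ (Fin n)) p) * S) := by
        rw [lintegral_add_left (by fun_prop), lintegral_const_mul' _ _ (by norm_num), lintegral_const_mul' _ _ (by norm_num)]
        gcongr
    _ = _ := by
        rw [← hS, ← add_mul, ← ENNReal.ofReal_add (by norm_num) (by norm_num), ← mul_assoc, ← ENNReal.ofReal_mul (by norm_num)]
        congr 2
        ring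
end FreeEst
end

noncomputable section
open MeasureTheory Metric Complex
open scoped ENNReal FourierTransform SchwartzMap
set_option linter.unusedSectionVars false
section FS

/-- Chebyshev sequence `sin (kθ) / sin θ` as a polynomial in `c = cos θ`. -/
def chebu (c : ℝ) : ℕ → ℝ
  | 0 => 0
  | 1 => 1
  | (k+2) => 2 * c * chebu c (k+1) - chebu c k

lemma chebu_sin (θ : ℝ) (k : ℕ) : chebu (Real.cos θ) k * Real.sin θ = Real.sin (k * θ) ∧
    chebu (Real.cos θ) (k+1) * Real.sin θ = Real.sin ((k+1) * θ) := by
  induction k with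
  | zero => simp [chebu]
  | succ k ih =>
    obtain ⟨h1, h2⟩ := ih
    refine ⟨by push_cast; exact h2, ?_⟩
    rw [chebu, sub_mul, mul_assoc, h1, h2]
    push_cast
    have e1 : ((k:ℝ) + 1 + 1) * θ = (k+1)*θ + θ := by ring
    have e2 : (k:ℝ) * θ = (k+1)*θ - θ := by ring
    rw [e1, e2, Real.sin_add, Real.sin_sub]
    ring

lemma chebu_rec (θ : ℝ) (k : ℕ) : chebu (Real.cos θ) (k+1) = Real.cos θ * chebu (Real.cos θ) k + Real.cos (k * θ) := by
  induction k with
  | zero => simp [chebu]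
  | succ k ih =>
    have h1 := (chebu_sin θ k).1
    rw [chebu, ih]
    push_cast
    rw [add_mul, one_mul, Real.cos_add, ← h1]
    linear_combination (chebu (Real.cos θ) k) * Real.sin_sq_add_cos_sq θ

lemma chebu_bound {c : ℝ} (h1 : -1 ≤ c) (h2 : c ≤ 1) (k : ℕ) : |chebu c k| ≤ k := by
  have hc : c = Real.cos (Real.arccos c) := (Real.cos_arccos h1 h2).symm
  rw [hc]
  induction k with
  | zero => simp [chebu]
  | succ k ih =>
    rw [chebu_rec]
    push_cast
    refine (abs_add_le _ _).trans ?_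
    rw [abs_mul]
    have := Real.abs_cos_le_one (Real.arccos c)
    have := Real.abs_cos_le_one (k * Real.arccos c)
    nlinarith [abs_nonneg (chebu (Real.cos (Real.arccos c)) k)]

lemma tendsto_scaled {f : ℝ → ℝ} {f' : ℝ} (hf : HasDerivAt f f' 0) (hf0 : f 0 = 0) {a : ℕ → ℝ} {l : ℝ}
    (ha : Filter.Tendsto (fun N : ℕ => (N:ℝ) * a N) Filter.atTop (nhds l)) :
    Filter.Tendsto (fun N : ℕ => (N:ℝ) * f (a N)) Filter.atTop (nhds (f' * l)) := by
  have h := hf.hasFDerivAt.hasFDerivWithinAt (s := Set.univ)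
  have ha0 : Filter.Tendsto a Filter.atTop (nhds 0) := by
    have h3 := (tendsto_inv_atTop_zero.comp (tendsto_natCast_atTop_atTop (R := ℝ))).mul ha
    rw [zero_mul] at h3
    refine h3.congr' ?_
    filter_upwards [Filter.eventually_gt_atTop 0] with N hN
    have : (N:ℝ) ≠ 0 := by positivity
    simp only [Function.comp]
    field_simp
  have h2 := h.lim (c := fun N : ℕ => (N:ℝ)) (d := a) (v := l) ha0 (Filter.Eventually.of_forall fun _ => Set.mem_univ _) (by simpa using ha)
  simp only [zero_add, hf0, sub_zero, smul_eq_mul] at h2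
  convert h2 using 2
  simp [mul_comm]

variable {n : ℕ}
/-- discrete symbol -/
def csym (h : ℝ) (ξ : EuclideanSpace ℝ (Fin n)) : ℝ := (n:ℝ)⁻¹ * ∑ i, Real.cos (2 * Real.pi * (h * ξ i))

lemma csym_cont (h : ℝ) : Continuous (csym h : EuclideanSpace ℝ (Fin n) → ℝ) := by
  unfold csym; fun_prop

lemma csym_abs (h : ℝ) (ξ : EuclideanSpace ℝ (Fin n)) : |csym h ξ| ≤ 1 := by
  unfold csym
  rw [abs_mul, abs_of_nonneg (by positivity)]
  have : |∑ i, Real.cos (2 * Real.pi * (h * ξ i))| ≤ n := by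
    refine (Finset.abs_sum_le_sum_abs _ _).trans ?_
    refine (Finset.sum_le_sum (fun i _ => Real.abs_cos_le_one _)).trans ?_
    simp
  by_cases hn : n = 0
  · subst hn; simp
  · have : (0:ℝ) < n := by positivity
    rw [inv_mul_le_iff₀ this]; linarith

lemma chebu_cont (k : ℕ) : Continuous (fun c => chebu c k) ∧ Continuous (fun c => chebu c (k+1)) := by
  induction k with
  | zero => exact ⟨by simp only [chebu]; fun_prop, by simp only [chebu]; fun_prop⟩
  | succ k ih =>
    obtain ⟨h1, h2⟩ := ih
    exact ⟨h2, by simp only [chebu]; fun_prop⟩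

lemma cheb_limit (hn : 0 < n) {r : ℝ} (hr : 0 < r) {ξ : EuclideanSpace ℝ (Fin n)} (hξ : ξ ≠ 0) :
    Filter.Tendsto (fun N : ℕ => r / N * chebu (csym (r * Real.sqrt n / (2 * Real.pi) / N) ξ) N) Filter.atTop (nhds (Real.sin (r * ‖ξ‖) / ‖ξ‖)) := by
  have hpi := Real.pi_pos
  have hn' : (0:ℝ) < n := by positivity
  have hρ : 0 < ‖ξ‖ := norm_pos_iff.2 hξ
  obtain ⟨L, hL⟩ : ∃ L, L = r * Real.sqrt n / (2 * Real.pi) := ⟨_, rfl⟩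
  rw [← hL]
  obtain ⟨a, ha⟩ : ∃ a : ℕ → ℝ, a = fun N : ℕ => Real.sqrt ((1 - csym (L / N) ξ)/2) := ⟨_, rfl⟩
  -- step 1
  have s1 : Filter.Tendsto (fun N : ℕ => (N:ℝ) * a N) Filter.atTop (nhds (r * ‖ξ‖ / 2)) := by
    have e : ∀ N : ℕ, (N:ℝ) * a N = Real.sqrt ((n:ℝ)⁻¹ * ∑ i, ((N:ℝ) * Real.sin (Real.pi * L * ξ i / N))^2) := by
      intro N
      rw [ha]
      simp only []
      rw [show (N:ℝ) * Real.sqrt ((1 - csym (L / N) ξ)/2) = Real.sqrt ((N:ℝ)^2 * ((1 - csym (L / N) ξ)/2)) by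
        rw [Real.sqrt_mul (by positivity), Real.sqrt_sq (by positivity)]]
      congr 1
      simp_rw [mul_pow]
      rw [← Finset.mul_sum]
      have : (1 - csym (L/N) ξ)/2 = (n:ℝ)⁻¹ * ∑ i, Real.sin (Real.pi * L * ξ i / N)^2 := by
        unfold csym
        have h1 : ∀ i, Real.cos (2 * Real.pi * (L / N * ξ i)) = 1 - 2 * Real.sin (Real.pi * L * ξ i / N)^2 := by
          intro i
          rw [show 2 * Real.pi * (L / N * ξ i) = 2 * (Real.pi * L * ξ i / N) by ring, Real.cos_two_mul, Real.cos_sq']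
          ring
        simp_rw [h1]
        rw [Finset.sum_sub_distrib, ← Finset.mul_sum]
        simp
        field_simp
        ring
      rw [this]; ring
    simp_rw [e]
    have h1 : r * ‖ξ‖ / 2 = Real.sqrt ((n:ℝ)⁻¹ * ∑ i, (1 * (Real.pi * L * ξ i))^2) := by
      simp_rw [one_mul, mul_pow]
      rw [← Finset.mul_sum, ← EuclideanSpace.real_norm_sq_eq, hL]
      symm
      rw [Real.sqrt_eq_iff_mul_self_eq (by positivity) (by positivity)]
      have := Real.sq_sqrt hn'.le
      field_simp
      rw [this]
    rw [h1]
    refine (Real.continuous_sqrt.tendsto _).comp ?_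
    refine Filter.Tendsto.const_mul _ (tendsto_finsetSum _ fun i _ => ?_)
    refine Filter.Tendsto.pow ?_ 2
    refine tendsto_scaled (f := Real.sin) (by simpa using Real.hasDerivAt_sin 0) Real.sin_zero ?_
    refine tendsto_const_nhds.congr' ?_
    filter_upwards [Filter.eventually_gt_atTop 0] with N hN
    have : (N:ℝ) ≠ 0 := by positivity
    field_simp
  have hcs : ∀ N : ℕ, 0 ≤ (1 - csym (L / N) ξ)/2 ∧ (1 - csym (L / N) ξ)/2 ≤ 1 := fun N => by
    have := abs_le.1 (csym_abs (L/N) ξ); constructor <;> linarith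
  have d1 : HasDerivAt (fun y => 2 * Real.arcsin y) 2 0 := by
    have := (Real.hasDerivAt_arcsin (x := 0) (by norm_num) (by norm_num)).const_mul 2
    simpa using this
  have d2 : HasDerivAt (fun y => Real.sin (2 * Real.arcsin y)) 2 0 := by
    have := d1.sin
    simpa using this
  have s2 := tendsto_scaled d1 (by simp) s1
  have s3 := tendsto_scaled d2 (by simp) s1
  have e4 : 2 * (r * ‖ξ‖ / 2) = r * ‖ξ‖ := by ring
  rw [e4] at s2 s3
  have hrρ : r * ‖ξ‖ ≠ 0 := by positivity
  have s4 := ((Real.continuous_sin.tendsto _).comp s2).div s3 hrρ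
  have s5 := s4.const_mul r
  have e5 : r * (Real.sin (r * ‖ξ‖) / (r * ‖ξ‖)) = Real.sin (r * ‖ξ‖) / ‖ξ‖ := by field_simp
  rw [e5] at s5
  refine s5.congr' ?_
  filter_upwards [s3.eventually_ne hrρ] with N hN
  have hcos : csym (L / N) ξ = Real.cos (2 * Real.arcsin (a N)) := by
    rw [Real.cos_two_mul, Real.cos_sq', Real.sin_arcsin, ha]
    · simp only []
      rw [Real.sq_sqrt (hcs N).1]; ring
    · rw [ha]; exact le_trans (by norm_num) (Real.sqrt_nonneg _)
    · rw [ha]; exact Real.sqrt_le_one.2 (hcs N).2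
  rw [hcos]
  have := (chebu_sin (2 * Real.arcsin (a N)) N).1
  have h6 := left_ne_zero_of_mul hN
  have h7 := right_ne_zero_of_mul hN
  rw [Pi.div_apply, Function.comp_apply, ← this]
  field_simp
end FS
end

noncomputable section
open MeasureTheory Metric Complex
open scoped ENNReal FourierTransform SchwartzMap
set_option linter.unusedSectionVars false
section FS2
variable {W : Type*} [NormedAddCommGroup W] [InnerProductSpace ℝ W] [FiniteDimensional ℝ W] [MeasurableSpace W] [BorelSpace W]

lemma fourier_mod (P : W → ℂ) (a x : W) : 𝓕 (fun ξ => Complex.exp (↑(2 * Real.pi * inner ℝ ξ a) * I) * P ξ) x = 𝓕 P (x - a) := by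
  rw [Real.fourier_eq', Real.fourier_eq']
  congr 1; ext v
  rw [smul_eq_mul, smul_eq_mul, ← mul_assoc, ← Complex.exp_add, inner_sub_right]
  congr 2; push_cast; ring

lemma fourier_lin {P Q : W → ℂ} (hP : Integrable P) (hQ : Integrable Q) (a b : ℂ) (x : W) :
    𝓕 (fun ξ => a * P ξ + b * Q ξ) x = a * 𝓕 P x + b * 𝓕 Q x := by
  have hF : ∀ {c : W → ℂ}, Integrable c → Integrable (fun v => Complex.exp (↑(-2 * Real.pi * inner ℝ v x) * I) * c v) := by
    intro c hc
    exact hc.bdd_mul (c := 1) (by fun_prop) (Filter.Eventually.of_forall fun ξ => by rw [Complex.norm_exp_ofReal_mul_I])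
  rw [Real.fourier_eq', Real.fourier_eq', Real.fourier_eq']
  simp only [smul_eq_mul]
  rw [← integral_const_mul, ← integral_const_mul, ← integral_add ((hF hP).const_mul a) ((hF hQ).const_mul b)]
  congr 1; ext v
  ring

/-- `P` is integrable with Fourier transform supported in a ball -/
def FSup (P : W → ℂ) (d : ℝ) : Prop := Integrable P ∧ ∀ x, d < ‖x‖ → 𝓕 P x = 0

lemma FSup.mono {P : W → ℂ} {d d' : ℝ} (h : FSup P d) (hd : d ≤ d') : FSup P d' := ⟨h.1, fun x hx => h.2 x (by linarith)⟩

lemma FSup.lin {P Q : W → ℂ} {d : ℝ} (hP : FSup P d) (hQ : FSup Q d) (a b : ℂ) : FSup (fun ξ => a * P ξ + b * Q ξ) d :=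
  ⟨(hP.1.const_mul a).add (hQ.1.const_mul b), fun x hx => by rw [fourier_lin hP.1 hQ.1, hP.2 x hx, hQ.2 x hx]; simp⟩

lemma FSup.zero (d : ℝ) : FSup (fun _ : W => (0:ℂ)) d := ⟨integrable_zero _ _ _, fun x _ => by rw [Real.fourier_eq']; simp⟩

lemma FSup.mod {P : W → ℂ} {d h : ℝ} (hP : FSup P d) (a : W) (ha : ‖a‖ ≤ h) : FSup (fun ξ => Complex.exp (↑(2 * Real.pi * inner ℝ ξ a) * I) * P ξ) (d + h) := by
  refine ⟨hP.1.bdd_mul (c := 1) (by fun_prop) (Filter.Eventually.of_forall fun ξ => by rw [Complex.norm_exp_ofReal_mul_I]), fun x hx => ?_⟩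
  rw [fourier_mod]
  apply hP.2
  have := norm_sub_norm_le x a
  linarith

lemma FSup.cos {P : W → ℂ} {d h : ℝ} (hP : FSup P d) (a : W) (ha : ‖a‖ ≤ h) : FSup (fun ξ => (Real.cos (2 * Real.pi * inner ℝ ξ a) : ℂ) * P ξ) (d + h) := by
  have h1 := (hP.mod a ha).lin (hP.mod (-a) (by rwa [norm_neg])) (1/2) (1/2)
  convert h1 using 1
  ext ξ
  rw [inner_neg_right, mul_neg, Complex.ofReal_neg, Complex.exp_mul_I, Complex.exp_mul_I, Complex.cos_neg, Complex.sin_neg, Complex.ofReal_cos]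
  ring

lemma FSup.sum {ι : Type*} (s : Finset ι) {P : ι → W → ℂ} {d : ℝ} (h : ∀ i ∈ s, FSup (P i) d) : FSup (fun ξ => ∑ i ∈ s, P i ξ) d := by
  classical
  induction s using Finset.induction_on with
  | empty => simpa using FSup.zero d
  | insert i s hi ih =>
    have h1 := (h i (Finset.mem_insert_self _ _)).lin (ih fun j hj => h j (Finset.mem_insert_of_mem hj)) 1 1
    convert h1 using 1
    ext ξ
    rw [Finset.sum_insert hi]; simp

variable {n : ℕ}
local notation "E" => EuclideanSpace ℝ (Fin n)

lemma FSup.csym {P : E → ℂ} {d h : ℝ} (hh : 0 ≤ h) (hP : FSup P d) : FSup (fun ξ => (csym h ξ : ℂ) * P ξ) (d + h) := by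
  have h1 : ∀ i ∈ (Finset.univ : Finset (Fin n)), FSup (fun ξ : E => (Real.cos (2 * Real.pi * inner ℝ ξ (h • EuclideanSpace.single i (1:ℝ))) : ℂ) * P ξ) (d+h) := by
    intro i _
    apply hP.cos
    rw [norm_smul]; simp [abs_of_nonneg hh]
  have h2 := (FSup.sum Finset.univ h1).lin (FSup.zero (d+h)) (n:ℂ)⁻¹ 0
  convert h2 using 1
  ext ξ
  unfold _root_.csym
  push_cast
  rw [mul_assoc, Finset.sum_mul, mul_zero, add_zero]
  congr 2
  ext i
  rw [inner_smul_right, EuclideanSpace.inner_single_right]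
  simp

lemma FSup.cheb {P : E → ℂ} {d h : ℝ} (hh : 0 ≤ h) (hP : FSup P d) (k : ℕ) :
    FSup (fun ξ => (chebu (_root_.csym h ξ) k : ℂ) * P ξ) (d + k * h) ∧ FSup (fun ξ => (chebu (_root_.csym h ξ) (k+1) : ℂ) * P ξ) (d + k * h) := by
  induction k with
  | zero => exact ⟨by simpa [chebu] using FSup.zero d, by simpa [chebu] using hP⟩
  | succ k ih =>
    obtain ⟨h1, h2⟩ := ih
    have e : d + ((k+1:ℕ):ℝ) * h = d + k * h + h := by push_cast; ring
    rw [e]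
    refine ⟨h2.mono (by linarith), ?_⟩
    have h3 := (h2.csym hh).lin (h1.mono (d' := d + k*h+h) (by linarith)) 2 (-1)
    convert h3 using 1
    ext ξ
    rw [chebu]; push_cast; ring

lemma fs_main (hn : 0 < n) {r : ℝ} (hr : 0 < r) {P G : E → ℂ} {d : ℝ} (hP : FSup P d) (hG : Integrable G)
    (hG0 : ∀ x, ‖x‖ ≤ d + r * n → G x = 0) :
    ∫ ξ, 𝓕 G ξ * (((Real.sin (r * ‖ξ‖) / ‖ξ‖ : ℝ) : ℂ) * P ξ) = 0 := by
  have hpi := Real.pi_pos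
  obtain ⟨L, hL⟩ : ∃ L, L = r * Real.sqrt n / (2 * Real.pi) := ⟨_, rfl⟩
  have hL0 : 0 ≤ L := by rw [hL]; positivity
  have hLn : L ≤ r * n := by
    rw [hL, div_le_iff₀ (by positivity), mul_assoc]
    apply mul_le_mul_of_nonneg_left _ hr.le
    have h1 : (1:ℝ) ≤ n := by exact_mod_cast hn
    have h2 := Real.sq_sqrt (show (0:ℝ) ≤ n by positivity)
    have h3 : Real.sqrt n ≤ n := by nlinarith [Real.sqrt_nonneg (n:ℝ), Real.one_le_sqrt.2 h1]
    have h4 := Real.pi_gt_three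
    nlinarith
  obtain ⟨F, hF⟩ : ∃ F : ℕ → E → ℂ, F = fun (N : ℕ) ξ => 𝓕 G ξ * (((r / N * chebu (csym (L / N) ξ) N : ℝ) : ℂ) * P ξ) := ⟨_, rfl⟩
  have z : ∀ N : ℕ, 0 < N → ∫ ξ, F N ξ = 0 := by
    intro N hN
    have hN' : (0:ℝ) < N := by positivity
    have h1 := (hP.cheb (h := L / N) (by positivity) N).1
    have e : d + N * (L / N) = d + L := by field_simp
    rw [e] at h1
    have h2 := h1.lin (FSup.zero (d+L)) ((r / N : ℝ) : ℂ) 0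
    have h3 : ∀ ξ, F N ξ = 𝓕 G ξ * (((r / N : ℝ) : ℂ) * ((chebu (csym (L / N) ξ) N : ℂ) * P ξ) + 0 * 0) := by
      intro ξ; rw [hF]; push_cast; ring
    simp_rw [h3]
    rw [selfadj_fourier hG h2.1]
    refine integral_eq_zero_of_ae (Filter.Eventually.of_forall fun x => ?_)
    simp only [Pi.zero_apply]
    by_cases hx : ‖x‖ ≤ d + r * n
    · rw [hG0 x hx, zero_mul]
    · rw [h2.2 x (by push Not at hx; linarith), mul_zero]
  have hlim : Filter.Tendsto (fun N => ∫ ξ, F N ξ) Filter.atTop (nhds (∫ ξ, 𝓕 G ξ * (((Real.sin (r * ‖ξ‖) / ‖ξ‖ : ℝ) : ℂ) * P ξ))) := by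
    refine tendsto_integral_of_dominated_convergence (fun ξ => (∫ x, ‖G x‖) * r * ‖P ξ‖) ?_ ?_ ?_ ?_
    · intro N
      rw [hF]
      have c1 := continuous_fourier' hG
      have c2 := ((chebu_cont N).1.comp (csym_cont (n := n) (L/N))).measurable
      have c3 : Measurable fun ξ => chebu (csym (n := n) (L/N) ξ) N := c2
      exact c1.aestronglyMeasurable.mul ((Measurable.aestronglyMeasurable (by fun_prop)).mul hP.1.aestronglyMeasurable)
    · exact hP.1.norm.const_mul _
    · intro N
      refine Filter.Eventually.of_forall fun ξ => ?_
      rw [hF]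
      simp only []
      rw [norm_mul, norm_mul, Complex.norm_real, Real.norm_eq_abs, abs_mul, abs_of_nonneg (by positivity), mul_assoc (∫ x, ‖G x‖)]
      have h1 := norm_fourier_le' G ξ
      have hc := abs_le.1 (csym_abs (L/N) ξ)
      have h2 := chebu_bound hc.1 hc.2 N
      have h3 : r / N * |chebu (csym (L / N) ξ) N| ≤ r := by
        by_cases hN : N = 0
        · subst hN; simp [hr.le]
        · have : (0:ℝ) < N := by positivity
          calc _ ≤ r / N * N := by gcongr
            _ = r := by field_simp
      gcongr
    · have hE : Nontrivial E := Module.nontrivial_of_finrank_pos (R := ℝ) (by simpa using hn)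
      have : ∀ᵐ ξ : E, ξ ≠ 0 := by simp [ae_iff, measure_singleton]
      filter_upwards [this] with ξ hξ
      rw [hF]
      simp only []
      refine Filter.Tendsto.const_mul _ (Filter.Tendsto.mul_const _ ?_)
      have := cheb_limit hn hr hξ
      rw [← hL] at this
      exact (Complex.continuous_ofReal.tendsto _).comp this
  refine tendsto_nhds_unique hlim (tendsto_const_nhds.congr' ?_)
  filter_upwards [Filter.eventually_gt_atTop 0] with N hN
  rw [z N hN]
end FS2
end

noncomputable section
open MeasureTheory Metric Complex
open scoped ENNReal FourierTransform SchwartzMap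
set_option linter.unusedSectionVars false
section Molls
variable {W : Type*} [NormedAddCommGroup W] [InnerProductSpace ℝ W] [FiniteDimensional ℝ W] [MeasurableSpace W] [BorelSpace W]

/-- mollifier at scale `κ` -/
def Moll (κ : ℝ) (θ : 𝓢(W, ℂ)) (η : W → ℝ) : Prop :=
  (∀ x, θ x = (η x : ℂ)) ∧ (∀ x, 0 ≤ η x) ∧ (∫ x, η x = 1) ∧ (∀ x, κ < ‖x‖ → η x = 0) ∧ Integrable η

lemma exists_moll {κ : ℝ} (hκ : 0 < κ) : ∃ (θ : 𝓢(W, ℂ)) (η : W → ℝ), Moll κ θ η := by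
  obtain ⟨f, hf⟩ : ∃ f : ContDiffBump (0 : W), f.rOut = κ := ⟨⟨κ/2, κ, by positivity, by linarith⟩, rfl⟩
  have h1 : ContDiff ℝ ((⊤ : ℕ∞) : WithTop ℕ∞) (fun x => ((f.normed volume x : ℝ) : ℂ)) := Complex.ofRealCLM.contDiff.comp f.contDiff_normed
  have h2 : HasCompactSupport (fun x => ((f.normed volume x : ℝ) : ℂ)) := f.hasCompactSupport_normed.comp_left (g := fun r : ℝ => (r : ℂ)) (by simp)
  refine ⟨h2.toSchwartzMap h1, f.normed volume, fun x => rfl, f.nonneg_normed, f.integral_normed, fun x hx => ?_, f.integrable_normed⟩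
  by_contra h
  have : x ∈ Function.support (f.normed volume) := h
  rw [f.support_normed_eq, hf] at this
  simp at this
  linarith

lemma Moll.ft_norm {κ : ℝ} {θ : 𝓢(W, ℂ)} {η : W → ℝ} (h : Moll κ θ η) (ξ : W) : ‖𝓕 (θ : W → ℂ) ξ‖ ≤ 1 := by
  refine (norm_fourier_le' _ _).trans (le_of_eq ?_)
  rw [← h.2.2.1]
  congr 1; ext x
  rw [h.1, Complex.norm_real, Real.norm_of_nonneg (h.2.1 x)]

lemma Moll.ft_sub {κ : ℝ} {θ : 𝓢(W, ℂ)} {η : W → ℝ} (h : Moll κ θ η) (ξ : W) : ‖𝓕 (θ : W → ℂ) ξ - 1‖ ≤ 2 * Real.pi * κ * ‖ξ‖ := by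
  have hpi := Real.pi_pos
  have e : 𝓕 (θ : W → ℂ) ξ - 1 = ∫ x, (Complex.exp (↑(-2 * Real.pi * inner ℝ x ξ) * I) - 1) * (η x : ℂ) := by
    have e1 : (1:ℂ) = ∫ x, (η x : ℂ) := by rw [integral_complex_ofReal, h.2.2.1]; simp
    have i1 : Integrable (fun x => (η x : ℂ)) := h.2.2.2.2.ofReal
    rw [Real.fourier_eq']
    conv_lhs => rw [e1]
    rw [← integral_sub _ i1]
    · congr 1; ext x
      rw [h.1, smul_eq_mul]; ring
    · simp_rw [h.1, smul_eq_mul]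
      exact i1.bdd_mul (c := 1) (by fun_prop) (Filter.Eventually.of_forall fun ξ => by rw [Complex.norm_exp_ofReal_mul_I])
  rw [e]
  refine (norm_integral_le_of_norm_le (h.2.2.2.2.const_mul (2 * Real.pi * κ * ‖ξ‖)) (Filter.Eventually.of_forall fun x => ?_)).trans ?_
  · rw [norm_mul, Complex.norm_real, Real.norm_of_nonneg (h.2.1 x)]
    by_cases hx : κ < ‖x‖
    · rw [h.2.2.2.1 x hx]; simp
    · apply mul_le_mul_of_nonneg_right _ (h.2.1 x)
      rw [mul_comm]
      have := Real.norm_exp_I_mul_ofReal_sub_one_le (x := -2 * Real.pi * inner ℝ x ξ)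
      refine this.trans ?_
      rw [Real.norm_eq_abs, abs_mul, abs_mul, abs_neg, abs_of_pos hpi]
      have h2 := abs_real_inner_le_norm x ξ
      push Not at hx
      have h3 : |inner ℝ x ξ| ≤ κ * ‖ξ‖ := h2.trans (by gcongr)
      rw [abs_of_pos (by norm_num : (0:ℝ) < 2)]
      calc _ ≤ 2 * Real.pi * (κ * ‖ξ‖) := by gcongr
        _ = _ := by ring
  · rw [integral_const_mul, h.2.2.1, mul_one]

lemma Moll.fsup {κ : ℝ} {θ : 𝓢(W, ℂ)} {η : W → ℝ} (h : Moll κ θ η) {H : W → ℂ} (hH : Integrable H) {d : ℝ} (hd : ∀ x, d < ‖x‖ → H x = 0) :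
    FSup (fun ξ => 𝓕⁻ H ξ * 𝓕 (θ : W → ℂ) ξ) (d + κ) := by
  have hc : 𝓕 (θ : W → ℂ) = ((𝓕 θ : 𝓢(W, ℂ)) : W → ℂ) := by rw [SchwartzMap.fourier_coe]
  have i0 : Integrable (𝓕 (θ : W → ℂ)) := by rw [hc]; exact (𝓕 θ).integrable
  have i1 : Integrable (fun ξ => 𝓕⁻ H ξ * 𝓕 (θ : W → ℂ) ξ) :=
    i0.bdd_mul (f := fun ξ => 𝓕⁻ H ξ) (c := ∫ x, ‖H x‖) (continuous_fourierInv' hH).aestronglyMeasurable (Filter.Eventually.of_forall fun ξ => norm_fourierInv_le' H ξ)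
  refine ⟨i1, fun x hx => ?_⟩
  rw [Real.fourier_eq']
  have e : ∀ ξ, Complex.exp (↑(-2 * Real.pi * inner ℝ ξ x) * I) • (𝓕⁻ H ξ * 𝓕 (θ : W → ℂ) ξ) = 𝓕⁻ H ξ * (Complex.exp (↑(-2 * Real.pi * inner ℝ ξ x) * I) * 𝓕 (θ : W → ℂ) ξ) := fun ξ => by
    rw [smul_eq_mul]; ring
  simp_rw [e]
  rw [selfadj_fourierInv hH (i0.bdd_mul (c := 1) (by fun_prop) (Filter.Eventually.of_forall fun ξ => by rw [Complex.norm_exp_ofReal_mul_I]))]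
  refine integral_eq_zero_of_ae (Filter.Eventually.of_forall fun y => ?_)
  simp only [Pi.zero_apply]
  by_cases hy : d < ‖y‖
  · rw [hd y hy, zero_mul]
  · have e2 : 𝓕⁻ (fun ξ => Complex.exp (↑(-2 * Real.pi * inner ℝ ξ x) * I) * 𝓕 (θ : W → ℂ) ξ) y = 𝓕⁻ (𝓕 (θ : W → ℂ)) (y - x) := by
      rw [Real.fourierInv_eq', Real.fourierInv_eq']
      congr 1; ext v
      rw [smul_eq_mul, smul_eq_mul, ← mul_assoc, ← Complex.exp_add, inner_sub_right]
      congr 2; push_cast; ring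
    rw [e2, θ.continuous.fourierInv_fourier_eq θ.integrable i0, h.1, h.2.2.2.1, Complex.ofReal_zero, mul_zero]
    have := norm_sub_norm_le x y
    rw [norm_sub_rev] at this
    push Not at hy; linarith

lemma PFi_trans (H : W × ℝ → ℂ) (y : W) (q : W × ℝ) : PFi (fun z => H (z.1 + y, z.2)) q = Complex.exp (↑(-2 * Real.pi * inner ℝ y q.1) * I) * PFi H q := by
  unfold PFi
  rw [Real.fourierInv_eq', Real.fourierInv_eq', ← integral_const_mul]
  conv_rhs => rw [← integral_add_right_eq_self _ y]
  congr 1; ext v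
  rw [smul_eq_mul, smul_eq_mul, ← mul_assoc, ← Complex.exp_add, inner_add_left]
  congr 2; push_cast; ring

lemma DB_moll {κ : ℝ} {θ : 𝓢(W, ℂ)} {η : W → ℝ} (h : Moll κ θ η) {G H : W × ℝ → ℂ} (hG : NiceST G) (hH : NiceST H) {B : ℝ}
    (hB : ∀ y, ‖DB 0 G (fun z => H (z.1 + y, z.2))‖ ≤ B) (hHy : ∀ y, NiceST (fun z : W × ℝ => H (z.1 + y, z.2))) :
    ‖∫ z : W × (ℝ × ℝ), (kd 0 ‖z.1‖ z.2.1 * (PF G (z.1, z.2.2) * PFi H (z.1, z.2.2 + z.2.1))) * 𝓕 (θ : W → ℂ) z.1 ∂(volume.prod (volume.prod volume))‖ ≤ B := by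
  have hi := DB_integrable hG hH le_rfl
  obtain ⟨F, hF⟩ : ∃ F : W × (ℝ × ℝ) → ℂ, F = fun z : W × (ℝ × ℝ) => kd 0 ‖z.1‖ z.2.1 * (PF G (z.1, z.2.2) * PFi H (z.1, z.2.2 + z.2.1)) := ⟨_, rfl⟩
  rw [← hF] at hi
  have e1 : ∀ z : W × (ℝ × ℝ), (kd 0 ‖z.1‖ z.2.1 * (PF G (z.1, z.2.2) * PFi H (z.1, z.2.2 + z.2.1))) * 𝓕 (θ : W → ℂ) z.1 = ∫ y, Complex.exp (↑(-2 * Real.pi * inner ℝ y z.1) * I) * (F z * θ y) := by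
    intro z
    rw [Real.fourier_eq', hF, ← integral_const_mul]
    congr 1; ext y
    rw [smul_eq_mul]; ring
  simp_rw [e1]
  have i2 : Integrable (fun q : (W × (ℝ × ℝ)) × W => Complex.exp (↑(-2 * Real.pi * inner ℝ q.2 q.1.1) * I) * (F q.1 * θ q.2)) ((volume.prod (volume.prod volume)).prod volume) :=
    (hi.mul_prod θ.integrable).bdd_mul (c := 1) (Continuous.aestronglyMeasurable (by fun_prop)) (Filter.Eventually.of_forall fun ξ => by rw [Complex.norm_exp_ofReal_mul_I])
  rw [integral_integral_swap i2]
  have e2 : ∀ y, ∫ z : W × (ℝ × ℝ), Complex.exp (↑(-2 * Real.pi * inner ℝ y z.1) * I) * (F z * θ y) ∂(volume.prod (volume.prod volume)) = θ y * DB 0 G (fun z => H (z.1 + y, z.2)) := by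
    intro y
    have e3 : DB 0 G (fun z => H (z.1 + y, z.2)) = ∫ z : W × (ℝ × ℝ), kd 0 ‖z.1‖ z.2.1 * (PF G (z.1, z.2.2) * PFi (fun z => H (z.1 + y, z.2)) (z.1, z.2.2 + z.2.1)) ∂(volume.prod (volume.prod volume)) := by
      rw [integral_prod _ (DB_integrable hG (hHy y) le_rfl)]; rfl
    rw [e3, ← integral_const_mul]
    congr 1; ext z
    rw [PFi_trans, hF]; ring
  simp_rw [e2]
  have hB0 : ∫ y, η y * B = B := by rw [integral_mul_const, h.2.2.1, one_mul]
  rw [← hB0]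
  refine norm_integral_le_of_norm_le (h.2.2.2.2.mul_const B) (Filter.Eventually.of_forall fun y => ?_)
  rw [norm_mul, h.1, Complex.norm_real, Real.norm_of_nonneg (h.2.1 y)]
  exact mul_le_mul_of_nonneg_left (hB y) (h.2.1 y)
end Molls
end

noncomputable section
open MeasureTheory Metric Complex
open scoped ENNReal FourierTransform SchwartzMap
set_option linter.unusedSectionVars false
section Core
variable {W : Type*} [NormedAddCommGroup W] [InnerProductSpace ℝ W] [FiniteDimensional ℝ W] [MeasurableSpace W] [BorelSpace W]

lemma norm_kd_le2 (ρ r : ℝ) (hρ : 0 ≤ ρ) : ‖kd 0 ρ r‖ ≤ (1 + |r|) * (1 + ρ)⁻¹ := by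
  have h1 : |Real.sin (r * ρ) / ρ| * (1 + ρ) ≤ 1 + |r| := by
    have a1 := sinc_le r ρ
    have a2 : |Real.sin (r * ρ) / ρ| * ρ ≤ 1 := by
      by_cases h : ρ = 0
      · simp [h]
      · have hp : 0 < ρ := lt_of_le_of_ne hρ (Ne.symm h)
        rw [abs_div, abs_of_pos hp, div_mul_cancel₀ _ h]; exact Real.abs_sin_le_one _
    nlinarith
  rw [← div_eq_mul_inv, le_div_iff₀ (by positivity)]
  refine le_trans ?_ h1
  apply mul_le_mul_of_nonneg_right _ (by positivity)
  unfold kd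
  by_cases hr : r ∈ Set.Ioi (0:ℝ)
  · rw [Set.indicator_of_mem hr, Complex.norm_real, neg_zero, zero_mul, Real.exp_zero, one_mul, Real.norm_eq_abs]
  · rw [Set.indicator_of_notMem hr]; simp

/-- triple integrand -/
def FF (G H : W × ℝ → ℂ) (z : W × (ℝ × ℝ)) : ℂ := kd 0 ‖z.1‖ z.2.1 * (PF G (z.1, z.2.2) * PFi H (z.1, z.2.2 + z.2.1))

lemma FF_meas {G H : W × ℝ → ℂ} (hG : Measurable G) (hH : Measurable H) : Measurable (FF G H) := by
  have h1 := measurable_PF hG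
  have h2 := measurable_PFi hH
  have h3 := measurable_kd 0
  unfold FF
  refine Measurable.mul ?_ ?_
  · exact h3.comp (f := fun z : W × (ℝ × ℝ) => (‖z.1‖, z.2.1)) (by fun_prop)
  · exact (h1.comp (f := fun z : W × (ℝ × ℝ) => (z.1, z.2.2)) (by fun_prop)).mul (h2.comp (f := fun z : W × (ℝ × ℝ) => (z.1, z.2.2 + z.2.1)) (by fun_prop))

/-- general bound: time support -/
lemma FF_bound {G H : W × ℝ → ℂ} (hG0 : ∀ z : W × ℝ, z.2 ≤ 0 → G z = 0) {B R : ℝ} (hR : 0 ≤ R) (hB : ∀ z, ‖PFi H z‖ ≤ B) (hR0 : ∀ z : W × ℝ, R < |z.2| → PFi H z = 0)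
    (z : W × (ℝ × ℝ)) : ‖FF G H z‖ ≤ ‖kd 0 ‖z.1‖ z.2.1‖ * ‖PF G (z.1, z.2.2)‖ * ((closedBall (0:ℝ) R ×ˢ closedBall (0:ℝ) R).indicator (fun _ => B) z.2) := by
  have hB0 : 0 ≤ B := (norm_nonneg _).trans (hB (0,0))
  by_cases h1 : z.2.1 ≤ 0
  · have : FF G H z = 0 := by
      unfold FF kd
      rw [Set.indicator_of_notMem (by simpa using h1)]; simp
    rw [this, norm_zero]
    refine mul_nonneg (by positivity) (Set.indicator_nonneg (fun _ _ => hB0) _)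
  by_cases h2 : z.2.2 ≤ 0
  · have : FF G H z = 0 := by
      unfold FF PF
      have : (fun x => G (x, z.2.2)) = fun _ => (0:ℂ) := funext fun x => hG0 _ h2
      simp only [this]
      rw [Real.fourier_eq']; simp
    rw [this, norm_zero]
    refine mul_nonneg (by positivity) (Set.indicator_nonneg (fun _ _ => hB0) _)
  push Not at h1 h2
  unfold FF
  rw [norm_mul, norm_mul, ← mul_assoc]
  apply mul_le_mul_of_nonneg_left _ (by positivity)
  by_cases hz : z.2 ∈ closedBall (0:ℝ) R ×ˢ closedBall (0:ℝ) R
  · rw [Set.indicator_of_mem hz]; exact hB _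
  · rw [Set.indicator_of_notMem hz, hR0 _ ?_, norm_zero]
    simp only [Set.mem_prod, mem_closedBall, dist_zero_right, Real.norm_eq_abs, not_and_or, not_le] at hz
    rw [abs_of_pos h1, abs_of_pos h2] at hz
    simp only
    rw [abs_of_pos (by positivity)]
    rcases hz with h | h <;> linarith

lemma FF_integrable {G H : W × ℝ → ℂ} (hG : Measurable G) (hG0 : ∀ z : W × ℝ, z.2 ≤ 0 → G z = 0) {M : ℝ}
    (hM1 : ∀ s, Integrable (fun ξ => (1 + ‖ξ‖)⁻¹ * ‖PF G (ξ, s)‖)) (hM2 : ∀ s, ∫ ξ, (1 + ‖ξ‖)⁻¹ * ‖PF G (ξ, s)‖ ≤ M)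
    (hH : NiceST H) : Integrable (FF G H) (volume.prod (volume.prod volume)) := by
  obtain ⟨B, R', hB, hR'⟩ := PFi_bdd hH
  obtain ⟨R, hR, hRR⟩ : ∃ R, 0 ≤ R ∧ R' ≤ R := ⟨max 0 R', le_max_left _ _, le_max_right _ _⟩
  have hR0 : ∀ z : W × ℝ, R < |z.2| → PFi H z = 0 := fun z hz => hR' z (by linarith)
  have hB0 : 0 ≤ B := (norm_nonneg _).trans (hB (0,0))
  have hM0 : 0 ≤ M := (integral_nonneg (fun ξ => by positivity)).trans (hM2 0)
  have mF := FF_meas hG hH.1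
  refine ⟨mF.aestronglyMeasurable, ?_⟩
  rw [HasFiniteIntegral, lintegral_prod_symm _ mF.enorm.aemeasurable]
  have hq : ∀ q : ℝ × ℝ, ∫⁻ ξ, ‖FF G H (ξ, q)‖ₑ ≤ (closedBall (0:ℝ) R ×ˢ closedBall (0:ℝ) R).indicator (fun _ => ENNReal.ofReal ((1+R) * M * B)) q := by
    intro q
    by_cases hz : q ∈ closedBall (0:ℝ) R ×ˢ closedBall (0:ℝ) R
    · rw [Set.indicator_of_mem hz]
      have hr : |q.1| ≤ R := by simpa using hz.1
      have hi := (hM1 q.2).const_mul ((1+R) * B)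
      calc _ ≤ ∫⁻ ξ, ENNReal.ofReal ((1+R) * B * ((1 + ‖ξ‖)⁻¹ * ‖PF G (ξ, q.2)‖)) := by
            apply lintegral_mono
            intro ξ
            simp only []
            rw [← ofReal_norm]
            apply ENNReal.ofReal_le_ofReal
            refine (FF_bound hG0 hR hB hR0 (ξ, q)).trans ?_
            rw [Set.indicator_of_mem hz]
            have h3 := norm_kd_le2 ‖ξ‖ q.1 (norm_nonneg _)
            calc _ ≤ ((1 + R) * (1 + ‖ξ‖)⁻¹) * ‖PF G (ξ, q.2)‖ * B := by
                  gcongr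
                  refine h3.trans ?_
                  gcongr
              _ = _ := by ring
        _ = ENNReal.ofReal (∫ ξ, (1+R) * B * ((1 + ‖ξ‖)⁻¹ * ‖PF G (ξ, q.2)‖)) :=
            (ofReal_integral_eq_lintegral_ofReal hi (Filter.Eventually.of_forall fun ξ => by positivity)).symm
        _ ≤ _ := by
            apply ENNReal.ofReal_le_ofReal
            rw [integral_const_mul]
            calc _ ≤ (1+R) * B * M := by gcongr; exact hM2 _
              _ = _ := by ring
    · rw [Set.indicator_of_notMem hz]
      have : ∀ ξ, ‖FF G H (ξ, q)‖ₑ = 0 := by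
        intro ξ
        have := FF_bound hG0 hR hB hR0 (ξ, q)
        rw [Set.indicator_of_notMem hz, mul_zero] at this
        simpa using this
      simp [this]
  refine (lintegral_mono hq).trans_lt ?_
  rw [lintegral_indicator (measurableSet_closedBall.prod measurableSet_closedBall), setLIntegral_const]
  refine ENNReal.mul_lt_top ENNReal.ofReal_lt_top ?_
  rw [Measure.prod_prod]
  exact ENNReal.mul_lt_top measure_closedBall_lt_top measure_closedBall_lt_top

lemma FF_domK {G H : W × ℝ → ℂ} (hG0 : ∀ z : W × ℝ, z.2 ≤ 0 → G z = 0) {B R B' : ℝ} (hR : 0 ≤ R) (hB : ∀ z, ‖PFi H z‖ ≤ B) (hR0 : ∀ z : W × ℝ, R < |z.2| → PFi H z = 0)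
    (hB' : ∀ s, ∫ x, ‖G (x, s)‖ ≤ B') (m : W → ℂ) (z : W × (ℝ × ℝ)) :
    ‖FF G H z * m z.1‖ ≤ (R * B' * ‖m z.1‖) * ((closedBall (0:ℝ) R ×ˢ closedBall (0:ℝ) R).indicator (fun _ => B) z.2) := by
  have hB0 : 0 ≤ B := (norm_nonneg _).trans (hB (0,0))
  have hB'0 : 0 ≤ B' := (integral_nonneg (fun ξ => by positivity)).trans (hB' 0)
  have h1 := FF_bound hG0 hR hB hR0 z
  have h2 : ‖PF G (z.1, z.2.2)‖ ≤ B' := (norm_fourier_le' _ _).trans (hB' _)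
  rw [norm_mul]
  by_cases hz : z.2 ∈ closedBall (0:ℝ) R ×ˢ closedBall (0:ℝ) R
  · rw [Set.indicator_of_mem hz] at h1 ⊢
    have hr : |z.2.1| ≤ R := by simpa using hz.1
    have h3 := norm_kd_le (le_refl (0:ℝ)) ‖z.1‖ z.2.1
    calc _ ≤ ‖kd 0 ‖z.1‖ z.2.1‖ * ‖PF G (z.1, z.2.2)‖ * B * ‖m z.1‖ := by gcongr
      _ ≤ R * B' * B * ‖m z.1‖ := by gcongr; exact h3.trans hr
      _ = _ := by ring
  · rw [Set.indicator_of_notMem hz, mul_zero] at h1 ⊢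
    rw [le_antisymm h1 (norm_nonneg _), zero_mul]

lemma domK_integrable {m : W → ℂ} (hm : Integrable m) (B R B' : ℝ) :
    Integrable (fun z : W × (ℝ × ℝ) => (R * B' * ‖m z.1‖) * ((closedBall (0:ℝ) R ×ˢ closedBall (0:ℝ) R).indicator (fun _ => B) z.2)) (volume.prod (volume.prod volume)) := by
  refine Integrable.mul_prod (f := fun ξ => R * B' * ‖m ξ‖) (hm.norm.const_mul _) ?_
  rw [integrable_indicator_iff (measurableSet_closedBall.prod measurableSet_closedBall)]
  refine integrableOn_const ?_
  rw [Measure.prod_prod]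
  exact (ENNReal.mul_lt_top measure_closedBall_lt_top measure_closedBall_lt_top).ne

lemma fourier_sub' {P Q : W → ℂ} (hP : Integrable P) (hQ : Integrable Q) (x : W) :
    𝓕 (fun ξ => P ξ - Q ξ) x = 𝓕 P x - 𝓕 Q x := by
  have := fourier_lin hP hQ 1 (-1) x
  simp only [one_mul, neg_mul, ← sub_eq_add_neg] at this
  exact this

variable {n : ℕ}
local notation "E" => EuclideanSpace ℝ (Fin n)

lemma core_est (hn : 0 < n) {G H GK : E × ℝ → ℂ} (hG : Measurable G) (hG0 : ∀ z : E × ℝ, z.2 ≤ 0 → G z = 0) (hGi : ∀ s, Integrable (fun x => G (x, s))) {M : ℝ}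
    (hM1 : ∀ s, Integrable (fun ξ : E => (1 + ‖ξ‖)⁻¹ * ‖PF G (ξ, s)‖)) (hM2 : ∀ s, ∫ ξ : E, (1 + ‖ξ‖)⁻¹ * ‖PF G (ξ, s)‖ ≤ M)
    (hH : NiceST H) {R κ : ℝ} (hκ : 0 < κ) (hHs : ∀ z : E × ℝ, R < ‖z.1‖ + n * z.2 → H z = 0)
    (hGKm : Measurable GK) (hGK1 : ∀ z : E × ℝ, ‖z.1‖ + n * z.2 ≤ R + κ → GK z = G z) (hGK2 : ∀ z, ‖GK z‖ ≤ ‖G z‖)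
    {B' : ℝ} (hB' : ∀ s, ∫ x, ‖GK (x, s)‖ ≤ B') {Gn : ℕ → E × ℝ → ℂ} (hGn : ∀ k, NiceST (Gn k)) (hGn1 : ∀ k z, ‖Gn k z‖ ≤ ‖GK z‖)
    (hGn2 : ∀ z, Filter.Tendsto (fun k => Gn k z) Filter.atTop (nhds (GK z))) {Bd : ℝ}
    (hDB : ∀ k y, ‖DB 0 (Gn k) (fun z => H (z.1 + y, z.2))‖ ≤ Bd) (hHy : ∀ y, NiceST (fun z : E × ℝ => H (z.1 + y, z.2))) :
    ‖∫ z, FF G H z ∂(volume.prod (volume.prod volume))‖ ≤ Bd := by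
  obtain ⟨B, R', hB, hR'⟩ := PFi_bdd hH
  obtain ⟨T, hT, hRR⟩ : ∃ R, 0 ≤ R ∧ R' ≤ R := ⟨max 0 R', le_max_left _ _, le_max_right _ _⟩
  have hT0 : ∀ z : E × ℝ, T < |z.2| → PFi H z = 0 := fun z hz => hR' z (by linarith)
  have hGKi : ∀ s, Integrable (fun x => GK (x, s)) := fun s =>
    (hGi s).mono (Measurable.aestronglyMeasurable (hGKm.comp (by fun_prop))) (Filter.Eventually.of_forall fun x => hGK2 _)
  have hGK0 : ∀ z : E × ℝ, z.2 ≤ 0 → GK z = 0 := fun z hz => by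
    have := hGK2 z
    rw [hG0 z hz] at this
    simpa using this
  have hGn0 : ∀ k, ∀ z : E × ℝ, z.2 ≤ 0 → Gn k z = 0 := fun k z hz => by
    have := hGn1 k z
    rw [hGK0 z hz] at this
    simpa using this
  have hGnB : ∀ k s, ∫ x, ‖Gn k (x, s)‖ ≤ B' := fun k s => by
    refine le_trans (integral_mono_of_nonneg (Filter.Eventually.of_forall fun x => norm_nonneg _) (hGKi s).norm (Filter.Eventually.of_forall fun x => hGn1 k _)) (hB' s)
  have hFi := FF_integrable hG hG0 hM1 hM2 hH
  -- step for a fixed mollifier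
  have step : ∀ κ' : ℝ, 0 < κ' → κ' ≤ κ → ∀ (θ : 𝓢(E, ℂ)) (η : E → ℝ), Moll κ' θ η →
      ‖∫ z, FF G H z * 𝓕 (θ : E → ℂ) z.1 ∂(volume.prod (volume.prod volume))‖ ≤ Bd := by
    intro κ' hκ' hκκ θ η hθ
    have hc : 𝓕 (θ : E → ℂ) = ((𝓕 θ : 𝓢(E, ℂ)) : E → ℂ) := by rw [SchwartzMap.fourier_coe]
    have i0 : Integrable (𝓕 (θ : E → ℂ)) := by rw [hc]; exact (𝓕 θ).integrable
    have hcont : Continuous (𝓕 (θ : E → ℂ)) := continuous_fourier' θ.integrable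
    have mθ : Measurable (fun z : E × (ℝ × ℝ) => 𝓕 (θ : E → ℂ) z.1) := hcont.measurable.comp measurable_fst
    have iD := domK_integrable i0 B T B'
    have iK : Integrable (fun z => FF GK H z * 𝓕 (θ : E → ℂ) z.1) (volume.prod (volume.prod volume)) :=
      iD.mono' ((FF_meas hGKm hH.1).mul mθ).aestronglyMeasurable (Filter.Eventually.of_forall fun z => FF_domK hGK0 hT hB hT0 hB' _ z)
    have i1 : Integrable (fun z => FF G H z * 𝓕 (θ : E → ℂ) z.1) (volume.prod (volume.prod volume)) :=
      hFi.mul_bdd (c := 1) (g := fun z : E × (ℝ × ℝ) => 𝓕 (θ : E → ℂ) z.1) mθ.aestronglyMeasurable (Filter.Eventually.of_forall fun z => hθ.ft_norm _)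
    have eK : ∫ z, FF G H z * 𝓕 (θ : E → ℂ) z.1 ∂(volume.prod (volume.prod volume)) = ∫ z, FF GK H z * 𝓕 (θ : E → ℂ) z.1 ∂(volume.prod (volume.prod volume)) := by
      rw [integral_prod_symm _ i1, integral_prod_symm _ iK]
      refine integral_congr_ae ?_
      have a1 := i1.prod_left_ae
      have a2 := iK.prod_left_ae
      filter_upwards [a1, a2] with q h1 h2
      rw [← sub_eq_zero, ← integral_sub h1 h2]
      by_cases hr : q.1 ≤ 0
      · refine integral_eq_zero_of_ae (Filter.Eventually.of_forall fun ξ => ?_)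
        have hk : kd 0 ‖ξ‖ q.1 = 0 := by
          unfold kd
          rw [Set.indicator_of_notMem (by simpa using hr)]
        simp only [FF, hk, zero_mul, sub_self, Pi.zero_apply]
      push Not at hr
      have hs := hθ.fsup (hH.space (q.2 + q.1)).integrable (d := R - n * (q.2 + q.1)) (fun x hx => hHs _ (by simp only []; linarith))
      have hsm := hs.mono (d' := R - n * (q.2 + q.1) + κ) (by linarith)
      have key := fs_main hn hr hsm (G := fun x => G (x, q.2) - GK (x, q.2)) ((hGi _).sub (hGKi _)) (fun x hx => by
        rw [hGK1 _ (by simp only []; linarith), sub_self])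
      refine Eq.trans ?_ key
      congr 1; ext ξ
      rw [fourier_sub' (hGi _) (hGKi _)]
      unfold FF kd PF PFi
      rw [Set.indicator_of_mem (by simpa using hr)]
      simp only [neg_zero, zero_mul, Real.exp_zero, one_mul]
      ring
    rw [eK]
    have lim : Filter.Tendsto (fun k => ∫ z, FF (Gn k) H z * 𝓕 (θ : E → ℂ) z.1 ∂(volume.prod (volume.prod volume))) Filter.atTop (nhds (∫ z, FF GK H z * 𝓕 (θ : E → ℂ) z.1 ∂(volume.prod (volume.prod volume)))) := by
      refine tendsto_integral_of_dominated_convergence _ (fun k => ((FF_meas (hGn k).1 hH.1).mul mθ).aestronglyMeasurable) iD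
        (fun k => Filter.Eventually.of_forall fun z => FF_domK (hGn0 k) hT hB hT0 (hGnB k) _ z) (Filter.Eventually.of_forall fun z => ?_)
      refine Filter.Tendsto.mul_const _ ?_
      unfold FF
      refine Filter.Tendsto.const_mul _ (Filter.Tendsto.mul_const _ ?_)
      unfold PF
      simp_rw [Real.fourier_eq', smul_eq_mul]
      refine tendsto_integral_of_dominated_convergence (fun x => ‖GK (x, z.2.2)‖) (fun k => ?_) (hGKi _).norm (fun k => Filter.Eventually.of_forall fun x => ?_) (Filter.Eventually.of_forall fun x => ?_)
      · have := (hGn k).1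
        exact Measurable.aestronglyMeasurable (by fun_prop)
      · rw [norm_mul, Complex.norm_exp_ofReal_mul_I, one_mul]; exact hGn1 k _
      · exact Filter.Tendsto.const_mul _ (hGn2 _)
    refine le_of_tendsto lim.norm (Filter.Eventually.of_forall fun k => ?_)
    exact DB_moll hθ (hGn k) hH (hDB k) hHy
  have hex : ∀ j : ℕ, ∃ (θ : 𝓢(E, ℂ)) (η : E → ℝ), Moll (κ / (j+1)) θ η := fun j => exists_moll (by positivity)
  choose θ η hθ using hex
  have lim : Filter.Tendsto (fun j => ∫ z, FF G H z * 𝓕 (θ j : E → ℂ) z.1 ∂(volume.prod (volume.prod volume))) Filter.atTop (nhds (∫ z, FF G H z ∂(volume.prod (volume.prod volume)))) := by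
    refine tendsto_integral_of_dominated_convergence (fun z => ‖FF G H z‖) (fun j => ?_) hFi.norm (fun j => Filter.Eventually.of_forall fun z => ?_) (Filter.Eventually.of_forall fun z => ?_)
    · have hcont : Continuous (𝓕 (θ j : E → ℂ)) := continuous_fourier' (θ j).integrable
      have mθ : Measurable (fun z : E × (ℝ × ℝ) => 𝓕 (θ j : E → ℂ) z.1) := hcont.measurable.comp measurable_fst
      exact ((FF_meas hG hH.1).mul mθ).aestronglyMeasurable
    · rw [norm_mul]
      exact mul_le_of_le_one_right (norm_nonneg _) ((hθ j).ft_norm _)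
    · have h1 : Filter.Tendsto (fun j => 𝓕 (θ j : E → ℂ) z.1) Filter.atTop (nhds 1) := by
        rw [tendsto_iff_norm_sub_tendsto_zero]
        refine squeeze_zero (fun j => norm_nonneg _) (fun j => (hθ j).ft_sub z.1) ?_
        have h2 := (tendsto_one_div_add_atTop_nhds_zero_nat (𝕜 := ℝ)).const_mul (2 * Real.pi * κ * ‖z.1‖)
        rw [mul_zero] at h2
        refine h2.congr fun j => ?_
        ring
      simpa using h1.const_mul (FF G H z)
  refine le_of_tendsto lim.norm (Filter.Eventually.of_forall fun j => ?_)
  refine step (κ / (j+1)) (by positivity) (div_le_self hκ.le (by linarith [Nat.cast_nonneg (α := ℝ) j])) (θ j) (η j) (hθ j)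
end Core
end

noncomputable section
open MeasureTheory Metric Complex
open scoped ENNReal FourierTransform SchwartzMap
set_option linter.unusedSectionVars false
section Duh
variable {W : Type*} [NormedAddCommGroup W] [InnerProductSpace ℝ W] [FiniteDimensional ℝ W] [MeasurableSpace W] [BorelSpace W]

/-- the wave started at time s -/
def wv (G : W × ℝ → ℂ) (x : W) (s t : ℝ) : ℂ := 𝓕⁻ (fun ξ => kd 0 ‖ξ‖ (t - s) * PF G (ξ, s)) x

/-- Duhamel integral -/
def duh (G : W × ℝ → ℂ) (z : W × ℝ) : ℂ := ∫ s, wv G z.1 s z.2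

lemma wv_meas {G : W × ℝ → ℂ} (hG : Measurable G) : Measurable (fun q : (ℝ × ℝ) × W => wv G q.2 q.1.1 q.1.2) := by
  have h1 := measurable_PF hG
  have h3 := measurable_kd 0
  refine measurable_FRi (X := ℝ × ℝ) (F := fun q : (ℝ × ℝ) × W => kd 0 ‖q.2‖ (q.1.2 - q.1.1) * PF G (q.2, q.1.1)) ?_
  refine Measurable.mul ?_ ?_
  · exact h3.comp (f := fun z : (ℝ × ℝ) × W => (‖z.2‖, z.1.2 - z.1.1)) (by fun_prop)
  · exact h1.comp (f := fun z : (ℝ × ℝ) × W => (z.2, z.1.1)) (by fun_prop)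

lemma duh_meas {G : W × ℝ → ℂ} (hG : Measurable G) : Measurable (duh G) := by
  have h := wv_meas hG
  unfold duh
  apply StronglyMeasurable.measurable
  apply StronglyMeasurable.integral_prod_right' (f := fun r : (W × ℝ) × ℝ => wv G r.1.1 r.2 r.1.2)
  apply Measurable.stronglyMeasurable
  exact h.comp (f := fun r : (W × ℝ) × ℝ => ((r.2, r.1.2), r.1.1)) (by fun_prop)

lemma PF_zero' {G : W × ℝ → ℂ} {s : ℝ} (h : ∀ x, G (x, s) = 0) (ξ : W) : PF G (ξ, s) = 0 := by
  unfold PF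
  simp only [h]
  rw [Real.fourier_eq']; simp

lemma wv_zero {G : W × ℝ → ℂ} (hG0 : ∀ z : W × ℝ, z.2 ≤ 0 → G z = 0) (x : W) {s t : ℝ} (h : s ∉ Set.Ioo 0 |t|) : wv G x s t = 0 := by
  have : (fun ξ => kd 0 ‖ξ‖ (t - s) * PF G (ξ, s)) = fun _ => (0:ℂ) := by
    ext ξ
    by_cases hs : s ≤ 0
    · rw [PF_zero' (fun x => hG0 _ hs), mul_zero]
    · have : ¬ (0 < t - s) := fun hh => h ⟨not_le.1 hs, by linarith [le_abs_self t]⟩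
      unfold kd
      rw [Set.indicator_of_notMem (by simpa using this), zero_mul]
  unfold wv
  rw [this, Real.fourierInv_eq']; simp

lemma wv_int {G : W × ℝ → ℂ} (hG : Measurable G) (s t : ℝ)
    (hM1 : Integrable (fun ξ => (1 + ‖ξ‖)⁻¹ * ‖PF G (ξ, s)‖)) : Integrable (fun ξ => kd 0 ‖ξ‖ (t - s) * PF G (ξ, s)) := by
  have h1 := measurable_PF hG
  have h3 := measurable_kd 0
  refine (hM1.const_mul (1 + |t-s|)).mono' (Measurable.aestronglyMeasurable ?_) (Filter.Eventually.of_forall fun ξ => ?_)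
  · refine Measurable.mul ?_ ?_
    · exact h3.comp (f := fun z : W => (‖z‖, t - s)) (by fun_prop)
    · exact h1.comp (f := fun z : W => (z, s)) (by fun_prop)
  · rw [norm_mul]
    calc _ ≤ ((1 + |t-s|) * (1 + ‖ξ‖)⁻¹) * ‖PF G (ξ, s)‖ := by gcongr; exact norm_kd_le2 _ _ (norm_nonneg _)
      _ = _ := by ring

lemma wv_bound {G : W × ℝ → ℂ} (hG0 : ∀ z : W × ℝ, z.2 ≤ 0 → G z = 0) {M : ℝ}
    (hM1 : ∀ s, Integrable (fun ξ => (1 + ‖ξ‖)⁻¹ * ‖PF G (ξ, s)‖)) (hM2 : ∀ s, ∫ ξ, (1 + ‖ξ‖)⁻¹ * ‖PF G (ξ, s)‖ ≤ M) (x : W) (s t : ℝ) :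
    ‖wv G x s t‖ ≤ (Set.Ioo 0 |t|).indicator (fun _ => (1 + 2 * |t|) * M) s := by
  by_cases h : s ∈ Set.Ioo 0 |t|
  · rw [Set.indicator_of_mem h]
    have hd : |t - s| ≤ 2 * |t| := by
      have := abs_sub t s
      rw [abs_of_pos h.1] at this
      linarith [h.2]
    unfold wv
    refine (norm_fourierInv_le' _ _).trans ?_
    calc _ ≤ ∫ ξ, (1 + 2 * |t|) * ((1 + ‖ξ‖)⁻¹ * ‖PF G (ξ, s)‖) := by
          refine integral_mono_of_nonneg (Filter.Eventually.of_forall fun x => norm_nonneg _) ((hM1 s).const_mul _) (Filter.Eventually.of_forall fun ξ => ?_)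
          simp only []
          rw [norm_mul]
          calc _ ≤ ((1 + |t-s|) * (1 + ‖ξ‖)⁻¹) * ‖PF G (ξ, s)‖ := by gcongr; exact norm_kd_le2 _ _ (norm_nonneg _)
            _ ≤ ((1 + 2*|t|) * (1 + ‖ξ‖)⁻¹) * ‖PF G (ξ, s)‖ := by gcongr
            _ = _ := by ring
      _ ≤ _ := by
          rw [integral_const_mul]
          gcongr
          exact hM2 s
  · rw [Set.indicator_of_notMem h, wv_zero hG0 x h, norm_zero]

lemma duh_bound {G : W × ℝ → ℂ} (hG0 : ∀ z : W × ℝ, z.2 ≤ 0 → G z = 0) {M : ℝ}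
    (hM1 : ∀ s, Integrable (fun ξ => (1 + ‖ξ‖)⁻¹ * ‖PF G (ξ, s)‖)) (hM2 : ∀ s, ∫ ξ, (1 + ‖ξ‖)⁻¹ * ‖PF G (ξ, s)‖ ≤ M) (z : W × ℝ) :
    ‖duh G z‖ ≤ |z.2| * ((1 + 2 * |z.2|) * M) := by
  unfold duh
  refine (norm_integral_le_integral_norm _).trans ?_
  have hi : Integrable ((Set.Ioo 0 |z.2|).indicator (fun _ => (1 + 2 * |z.2|) * M)) :=
    (integrable_indicator_iff measurableSet_Ioo).2 (integrableOn_const (by simp))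
  refine (integral_mono_of_nonneg (Filter.Eventually.of_forall fun s => norm_nonneg _) hi (Filter.Eventually.of_forall fun s => wv_bound hG0 hM1 hM2 z.1 s z.2)).trans (le_of_eq ?_)
  rw [integral_indicator measurableSet_Ioo, setIntegral_const]
  simp

lemma duh_dual {G H : W × ℝ → ℂ} (hG : Measurable G) (hG0 : ∀ z : W × ℝ, z.2 ≤ 0 → G z = 0) {M : ℝ}
    (hM1 : ∀ s, Integrable (fun ξ => (1 + ‖ξ‖)⁻¹ * ‖PF G (ξ, s)‖)) (hM2 : ∀ s, ∫ ξ, (1 + ‖ξ‖)⁻¹ * ‖PF G (ξ, s)‖ ≤ M)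
    (hH : NiceST H) : ∫ z, duh G z * H z ∂(volume.prod volume) = ∫ z, FF G H z ∂(volume.prod (volume.prod volume)) := by
  have hM0 : 0 ≤ M := (integral_nonneg (fun ξ => by positivity)).trans (hM2 0)
  obtain ⟨hHm, ⟨B, hB⟩, R', hR'⟩ := id hH
  obtain ⟨R, hR, hRR⟩ : ∃ R, 0 ≤ R ∧ R' ≤ R := ⟨max 0 R', le_max_left _ _, le_max_right _ _⟩
  have hB0 : 0 ≤ B := (norm_nonneg _).trans (hB (0,0))
  have mw := wv_meas hG
  have hFi := FF_integrable hG hG0 hM1 hM2 hH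
  -- the triple integrand
  obtain ⟨Q, hQ⟩ : ∃ Q : W × (ℝ × ℝ) → ℂ, Q = fun z => wv G z.1 z.2.1 z.2.2 * H (z.1, z.2.2) := ⟨_, rfl⟩
  have iQ : Integrable Q (volume.prod (volume.prod volume)) := by
    have hS : MeasurableSet (closedBall (0:W) R ×ˢ (closedBall (0:ℝ) R ×ˢ closedBall (0:ℝ) R)) := measurableSet_closedBall.prod (measurableSet_closedBall.prod measurableSet_closedBall)
    have hi : Integrable ((closedBall (0:W) R ×ˢ (closedBall (0:ℝ) R ×ˢ closedBall (0:ℝ) R)).indicator (fun _ => (1 + 2 * R) * M * B)) (volume.prod (volume.prod volume)) := by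
      refine (integrable_indicator_iff hS).2 (integrableOn_const ?_)
      rw [Measure.prod_prod, Measure.prod_prod]
      exact (ENNReal.mul_lt_top measure_closedBall_lt_top (ENNReal.mul_lt_top measure_closedBall_lt_top measure_closedBall_lt_top)).ne
    refine hi.mono' ?_ (Filter.Eventually.of_forall fun z => ?_)
    · rw [hQ]
      apply Measurable.aestronglyMeasurable
      exact (mw.comp (f := fun z : W × (ℝ × ℝ) => (z.2, z.1)) (by fun_prop)).mul (hHm.comp (by fun_prop))
    · rw [hQ]
      simp only []
      by_cases h1 : R < ‖z.1‖ ∨ R < |z.2.2|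
      · rw [hR' (z.1, z.2.2) (h1.imp (fun h => lt_of_le_of_lt hRR h) (fun h => lt_of_le_of_lt hRR h)), mul_zero, norm_zero]
        exact Set.indicator_nonneg (fun _ _ => by positivity) _
      push Not at h1
      by_cases h2 : z.2.1 ∈ Set.Ioo 0 |z.2.2|
      · have hz : z ∈ (closedBall (0:W) R ×ˢ (closedBall (0:ℝ) R ×ˢ closedBall (0:ℝ) R)) := by
          refine ⟨by simpa using h1.1, ?_, by simpa using h1.2⟩
          simp only [mem_closedBall, dist_zero_right, Real.norm_eq_abs]
          rw [abs_of_pos h2.1]; linarith [h2.2, h1.2]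
        rw [Set.indicator_of_mem hz, norm_mul]
        have := wv_bound hG0 hM1 hM2 z.1 z.2.1 z.2.2
        rw [Set.indicator_of_mem h2] at this
        refine mul_le_mul (this.trans ?_) (hB _) (norm_nonneg _) (by positivity)
        gcongr
        exact h1.2
      · rw [wv_zero hG0 _ h2, zero_mul, norm_zero]
        exact Set.indicator_nonneg (fun _ _ => by positivity) _
  have iK : Integrable (fun q : ℝ × ℝ => ∫ x, Q (x, q)) (volume.prod volume) := iQ.integral_prod_right
  -- identity of K
  have eK : ∀ s t : ℝ, ∫ x, Q (x, (s, t)) = ∫ ξ, kd 0 ‖ξ‖ (t - s) * (PF G (ξ, s) * PFi H (ξ, t)) := by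
    intro s t
    have := selfadj_fourierInv (wv_int hG s t (hM1 s)) (hH.space t).integrable
    rw [hQ]
    refine this.trans ?_
    congr 1; ext ξ
    unfold PFi; ring
  have e1 : ∫ z, FF G H z ∂(volume.prod (volume.prod volume)) = ∫ q, (∫ x, Q (x, q)) ∂(volume.prod volume) := by
    rw [integral_prod_symm _ hFi, integral_prod_symm _ hFi.integral_prod_right, integral_prod _ iK]
    congr 1; ext s
    rw [← integral_add_left_eq_self (μ := (volume : Measure ℝ)) (fun t => ∫ x, Q (x, (s, t))) s]
    congr 1; ext r
    rw [eK]
    congr 1; ext ξ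
    simp only [FF, add_sub_cancel_left]
  have iD : Integrable (fun z => duh G z * H z) (volume.prod volume) := by
    have h0 : NiceST (fun z => duh G z * H z) := by
      have mD := duh_meas hG
      refine ⟨by fun_prop, ⟨R * ((1 + 2 * R) * M) * B, fun z => ?_⟩, R, fun z hz => ?_⟩
      · simp only []
        by_cases h1 : R < |z.2|
        · rw [hR' z (Or.inr (lt_of_le_of_lt hRR h1)), mul_zero, norm_zero]; positivity
        · push Not at h1
          rw [norm_mul]
          refine mul_le_mul ((duh_bound hG0 hM1 hM2 z).trans ?_) (hB _) (norm_nonneg _) (by positivity)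
          gcongr
      · simp only []
        rw [hR' z (hz.imp (fun h => lt_of_le_of_lt hRR h) (fun h => lt_of_le_of_lt hRR h)), mul_zero]
    exact h0.integrable
  rw [e1, ← integral_prod_symm _ iQ, integral_prod _ iQ, integral_prod _ iD]
  refine integral_congr_ae ?_
  filter_upwards [iQ.prod_right_ae] with x hx
  rw [integral_prod_symm _ hx]
  congr 1; ext t
  rw [hQ]
  simp only [duh]
  rw [integral_mul_const]
end Duh
end

noncomputable section
open MeasureTheory Metric Complex
open scoped ENNReal FourierTransform SchwartzMap
set_option linter.unusedSectionVars false
section ClaimC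
variable {W : Type*} [NormedAddCommGroup W] [InnerProductSpace ℝ W] [FiniteDimensional ℝ W] [MeasurableSpace W] [BorelSpace W]

lemma le_one_add_rpow {a p : ℝ} (ha : 0 ≤ a) (hp : 1 ≤ p) : a ≤ 1 + a ^ p := by
  rcases le_total a 1 with h | h
  · have := Real.rpow_nonneg ha p
    linarith
  · have := Real.rpow_le_rpow_of_exponent_le h hp
    rw [Real.rpow_one] at this
    linarith

lemma WtU.loc {p : ℝ} (hp : 1 ≤ p) {v : W → ℝ} (h : WtU p v) (y : W) {r : ℝ} (hr : 0 < r) :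
    ∫⁻ x in ball y r, ENNReal.ofReal (v x) ≤ volume (ball y r) + ENNReal.ofReal (r^((Module.finrank ℝ W : ℝ) - 2*p)) := by
  calc _ ≤ ∫⁻ x in ball y r, (1 + ENNReal.ofReal (v x ^ p)) := by
        apply lintegral_mono
        intro x
        simp only []
        rw [← ENNReal.ofReal_one, ← ENNReal.ofReal_add zero_le_one (Real.rpow_nonneg (h.2.1 x) p)]
        exact ENNReal.ofReal_le_ofReal (le_one_add_rpow (h.2.1 x) hp)
    _ = volume (ball y r) + ∫⁻ x in ball y r, ENNReal.ofReal (v x ^ p) := by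
        rw [lintegral_add_left measurable_const]; simp
    _ ≤ _ := by gcongr; exact h.2.2 y r hr

lemma WtU.locInt {p : ℝ} (hp : 1 ≤ p) {v : W → ℝ} (h : WtU p v) (R : ℝ) : IntegrableOn v (closedBall 0 R) := by
  refine ⟨h.1.aestronglyMeasurable, ?_⟩
  rw [HasFiniteIntegral]
  have hsub : closedBall (0:W) R ⊆ ball 0 (|R|+1) := closedBall_subset_ball (by linarith [le_abs_self R])
  have e : ∀ x, ‖v x‖ₑ = ENNReal.ofReal (v x) := fun x => by rw [Real.enorm_of_nonneg (h.2.1 x)]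
  simp_rw [e]
  refine (lintegral_mono_set hsub).trans_lt ((h.loc hp 0 (by positivity)).trans_lt ?_)
  exact ENNReal.add_lt_top.2 ⟨measure_ball_lt_top, ENNReal.ofReal_lt_top⟩

lemma fourier_smul' (c : ℂ) (P : W → ℂ) (x : W) : 𝓕 (fun y => c * P y) x = c * 𝓕 P x := by
  rw [Real.fourier_eq', Real.fourier_eq', ← integral_const_mul]
  congr 1; ext y; simp only [smul_eq_mul]; ring
lemma fourierInv_smul' (c : ℂ) (P : W → ℂ) (x : W) : 𝓕⁻ (fun y => c * P y) x = c * 𝓕⁻ P x := by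
  rw [Real.fourierInv_eq', Real.fourierInv_eq', ← integral_const_mul]
  congr 1; ext y; simp only [smul_eq_mul]; ring

lemma DB_scale (G H : W × ℝ → ℂ) {c : ℂ} (hc : c ≠ 0) : DB 0 (fun z => c * G z) (fun z => c⁻¹ * H z) = DB 0 G H := by
  unfold DB
  congr 1; ext ξ; congr 1; ext q
  have e1 : PF (fun z => c * G z) (ξ, q.2) = c * PF G (ξ, q.2) := fourier_smul' c _ _
  have e2 : PFi (fun z => c⁻¹ * H z) (ξ, q.2 + q.1) = c⁻¹ * PFi H (ξ, q.2 + q.1) := fourierInv_smul' c⁻¹ _ _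
  rw [e1, e2]
  field_simp

lemma N2_smul {α : Type*} [MeasurableSpace α] (μ : Measure α) (c : ℝ) (f : α → ℂ) : N2 μ (fun x => (c : ℂ) * f x) = c^2 * N2 μ f := by
  unfold N2
  rw [← integral_const_mul]
  congr 1; ext x
  rw [norm_mul, mul_pow, Complex.norm_real, Real.norm_eq_abs, sq_abs]

lemma NiceST.smul {f : W × ℝ → ℂ} (hf : NiceST f) (c : ℂ) : NiceST (fun z => c * f z) :=
  hf.mul_bdd (g := fun _ => c) measurable_const (B := ‖c‖) (fun _ => le_rfl)

lemma FB_scaled {p : ℝ} (hA : Adm W p) {v1 v2 : W → ℝ} (hv1 : Wt p v1) (hv2 : Wt p v2) {φ ψ : W × ℝ → ℂ} (hφ : NiceST φ) (hψ : NiceST ψ) {c : ℝ} (hc : 0 < c) :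
    ‖DB 0 (fun z => (Real.sqrt (v1 z.1) : ℂ) * φ z) (fun z => (Real.sqrt (v2 z.1) : ℂ) * ψ z)‖ ≤
      C2 W p * ((c * N2 (volume.prod volume) φ + c⁻¹ * N2 (volume.prod volume) ψ)/2) := by
  have hs : (Real.sqrt c : ℝ) ≠ 0 := (Real.sqrt_pos.2 hc).ne'
  have h := FB hA hv1 hv2 (hφ.smul (Real.sqrt c : ℂ)) (hψ.smul ((Real.sqrt c)⁻¹ : ℝ))
  rw [N2_smul, N2_smul, inv_pow, Real.sq_sqrt hc.le] at h
  refine le_trans (le_of_eq ?_) h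
  rw [← DB_scale _ _ (c := (Real.sqrt c : ℂ)) (by exact_mod_cast hs)]
  congr 2
  · ext z; ring
  · ext z; push_cast; ring

variable {n : ℕ}
local notation "E" => EuclideanSpace ℝ (Fin n)

/-- truncated forward cone -/
def KR (n : ℕ) (R : ℝ) : Set (EuclideanSpace ℝ (Fin n) × ℝ) := {z | 0 < z.2 ∧ ‖z.1‖ + n * z.2 ≤ R}

lemma KR_meas (R : ℝ) : MeasurableSet (KR n R) := by
  refine MeasurableSet.inter (s₁ := {z : E × ℝ | 0 < z.2}) (s₂ := {z : E × ℝ | ‖z.1‖ + n * z.2 ≤ R}) ?_ ?_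
  · exact measurableSet_lt measurable_const measurable_snd
  · exact measurableSet_le (f := fun z : E × ℝ => ‖z.1‖ + n * z.2) (by fun_prop) measurable_const

lemma KR_bd (hn : 0 < n) {R : ℝ} {z : E × ℝ} (hz : z ∈ KR n R) : ‖z.1‖ ≤ R ∧ |z.2| ≤ R := by
  obtain ⟨h1, h2⟩ := hz
  have h3 : (1:ℝ) ≤ n := by exact_mod_cast hn
  have h4 : z.2 ≤ n * z.2 := by nlinarith
  refine ⟨by linarith, ?_⟩
  rw [abs_of_pos h1]
  linarith [norm_nonneg z.1]

lemma KR_sub (hn : 0 < n) (R : ℝ) : KR n R ⊆ closedBall (0:E) R ×ˢ closedBall (0:ℝ) R := fun z hz =>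
  ⟨by simpa using (KR_bd hn hz).1, by simpa using (KR_bd hn hz).2⟩

lemma u_bdd (hn : 0 < n) {u : E × ℝ → ℂ} (hu : Continuous u) (R : ℝ) : ∃ U, 0 ≤ U ∧ ∀ z ∈ KR n R, ‖u z‖ ≤ U := by
  have hc : IsCompact (closedBall (0:E) R ×ˢ closedBall (0:ℝ) R) := (isCompact_closedBall _ _).prod (isCompact_closedBall _ _)
  obtain ⟨U, hU⟩ := hc.exists_bound_of_continuousOn hu.continuousOn
  exact ⟨max U 0, le_max_right _ _, fun z hz => (hU z (KR_sub hn R hz)).trans (le_max_left _ _)⟩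

lemma a_fin (hn : 0 < n) {p : ℝ} (hp : 1 ≤ p) {v : E → ℝ} (hv : WtU p v) {u : E × ℝ → ℂ} (hu : Continuous u) (R : ℝ) :
    ∫⁻ z in KR n R, ENNReal.ofReal (v z.1 * ‖u z‖^2) ∂(volume.prod volume) < ⊤ := by
  obtain ⟨U, hU0, hU⟩ := u_bdd hn hu R
  have hi := hv.locInt hp R
  have h1 : Integrable (fun z : E × ℝ => ((closedBall (0:E) R).indicator v z.1) * ((closedBall (0:ℝ) R).indicator (fun _ => U^2) z.2)) (volume.prod volume) :=
    Integrable.mul_prod ((integrable_indicator_iff measurableSet_closedBall).2 hi) ((integrable_indicator_iff measurableSet_closedBall).2 (integrableOn_const measure_closedBall_lt_top.ne))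
  refine lt_of_le_of_lt ?_ h1.2
  rw [← lintegral_indicator (KR_meas R)]
  apply lintegral_mono
  intro z
  by_cases hz : z ∈ KR n R
  · rw [Set.indicator_of_mem hz]
    have hz2 := KR_sub hn R hz
    simp only []
    rw [Set.indicator_of_mem hz2.1, Set.indicator_of_mem hz2.2, Real.enorm_of_nonneg (mul_nonneg (hv.2.1 _) (by positivity))]
    apply ENNReal.ofReal_le_ofReal
    apply mul_le_mul_of_nonneg_left _ (hv.2.1 _)
    have := hU z hz
    gcongr
  · rw [Set.indicator_of_notMem hz]; simp

/-- unit phase of V -/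
def sg (V : E → ℂ) (y : E) : ℂ := V y / (‖V y‖ : ℂ)

lemma sg_norm (V : E → ℂ) (y : E) : ‖sg V y‖ ≤ 1 := by
  unfold sg
  rw [norm_div, Complex.norm_real, norm_norm]
  exact div_self_le_one _

lemma sg_mul (V : E → ℂ) (y : E) : (‖V y‖ : ℂ) * sg V y = V y := by
  unfold sg
  by_cases h : V y = 0
  · simp [h]
  · have : (‖V y‖ : ℂ) ≠ 0 := by simpa using h
    field_simp

lemma sg_meas {V : E → ℂ} (hV : Measurable V) : Measurable (sg V) := by unfold sg; fun_prop

lemma claim_c (hn : 3 ≤ n) {p : ℝ} (hA : Adm E p) {v : E → ℝ} (hv : WtU p v) {V : E → ℂ} (hV : Measurable V) {A : ℝ} (hA0 : 0 ≤ A) (hVA : ∀ y, ‖V y‖ = A * v y)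
    {u : E × ℝ → ℂ} (hu : Continuous u) {S : Set ℝ} (hS : MeasurableSet S) (hS0 : S ⊆ Set.Ioi 0) {G : E × ℝ → ℂ} (hGd : G = fun z => S.indicator (fun _ => V z.1 * u z) z.2)
    (hGi : ∀ s, Integrable (fun x => G (x, s))) {M : ℝ}
    (hM1 : ∀ s, Integrable (fun ξ : E => (1 + ‖ξ‖)⁻¹ * ‖PF G (ξ, s)‖)) (hM2 : ∀ s, ∫ ξ : E, (1 + ‖ξ‖)⁻¹ * ‖PF G (ξ, s)‖ ≤ M)
    {R κ : ℝ} (hκ : 0 < κ) (N : ℝ) :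
    ∫⁻ z in KR n R, ENNReal.ofReal (tru v N z.1 * ‖duh G z‖^2) ∂(volume.prod volume) ≤
      ENNReal.ofReal ((C2 E p * A)^2) * ∫⁻ z in KR n (R + κ), ENNReal.ofReal (v z.1 * ‖u z‖^2) ∂(volume.prod volume) := by
  have hn0 : 0 < n := by omega
  have hp1 : 1 ≤ p := by
    have := hA.2.1
    have h3 : (3:ℝ) ≤ Module.finrank ℝ E := by exact_mod_cast hA.1
    linarith
  have hp0 : 0 ≤ p := by linarith
  have hC : 0 < C2 E p := C2_pos p
  have hafin := a_fin hn0 hp1 hv hu (R + κ)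
  obtain ⟨a, ha⟩ : ∃ a, a = ∫⁻ z in KR n (R + κ), ENNReal.ofReal (v z.1 * ‖u z‖^2) ∂(volume.prod volume) := ⟨_, rfl⟩
  rw [← ha] at hafin ⊢
  obtain ⟨U, hU0, hU⟩ := u_bdd hn0 hu (R + κ)
  have hvm := hv.1
  have hv0 := hv.2.1
  have hum : Measurable u := hu.measurable
  have hSm : MeasurableSet {z : E × ℝ | z.2 ∈ S} := measurable_snd hS
  have hGm : Measurable G := by
    have : G = {z : E × ℝ | z.2 ∈ S}.indicator (fun z => V z.1 * u z) := by
      rw [hGd]; ext z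
      by_cases hz : z.2 ∈ S
      · rw [Set.indicator_of_mem hz, Set.indicator_of_mem (s := {z : E × ℝ | z.2 ∈ S}) hz]
      · rw [Set.indicator_of_notMem hz, Set.indicator_of_notMem (s := {z : E × ℝ | z.2 ∈ S}) hz]
    rw [this]
    exact Measurable.indicator (by fun_prop) hSm
  have hG0 : ∀ z : E × ℝ, z.2 ≤ 0 → G z = 0 := by
    intro z hz
    rw [hGd]
    exact Set.indicator_of_notMem (fun h => absurd (hS0 h) (by simpa using hz)) _
  have hwt := hv.tru hp0 N
  obtain ⟨w, hw⟩ : ∃ w, w = tru v N := ⟨_, rfl⟩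
  rw [← hw] at hwt ⊢
  obtain ⟨hwm, hw0, ⟨Bw, hBw⟩, -⟩ := id hwt
  have mD := duh_meas hGm
  have hDb := duh_bound hG0 hM1 hM2
  have hM0 : 0 ≤ M := (integral_nonneg (fun ξ => by positivity)).trans (hM2 0)
  have hcm : Measurable (fun z => (starRingEnd ℂ) (duh G z)) := Complex.continuous_conj.measurable.comp mD
  -- psi
  obtain ⟨ψ, hψd⟩ : ∃ ψ : E × ℝ → ℂ, ψ = (KR n R).indicator (fun z => (Real.sqrt (w z.1) : ℂ) * (starRingEnd ℂ) (duh G z)) := ⟨_, rfl⟩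
  have hψ : NiceST ψ := by
    refine ⟨?_, ⟨Real.sqrt Bw * (|R| * ((1 + 2 * |R|) * M)), fun z => ?_⟩, R, fun z hz => ?_⟩
    · rw [hψd]; exact Measurable.indicator (by fun_prop) (KR_meas R)
    · rw [hψd]
      by_cases hz : z ∈ KR n R
      · rw [Set.indicator_of_mem hz, norm_mul, RCLike.norm_conj, Complex.norm_real, Real.norm_of_nonneg (Real.sqrt_nonneg _)]
        have hzR : |z.2| ≤ |R| := (KR_bd hn0 hz).2.trans (le_abs_self _)
        refine mul_le_mul (Real.sqrt_le_sqrt (hBw _)) ((hDb z).trans ?_) (norm_nonneg _) (Real.sqrt_nonneg _)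
        gcongr
      · rw [Set.indicator_of_notMem hz, norm_zero]; positivity
    · rw [hψd]; apply Set.indicator_of_notMem
      intro hzK
      have := KR_bd hn0 hzK
      rcases hz with h | h <;> linarith
  obtain ⟨H, hH⟩ : ∃ H : E × ℝ → ℂ, H = (fun z => (Real.sqrt (w z.1) : ℂ) * ψ z) := ⟨_, rfl⟩
  have hHn : NiceST H := by rw [hH]; exact hψ.sqrt_mul hwt
  have hpt : ∀ z, duh G z * H z = ((‖ψ z‖^2 : ℝ) : ℂ) := by
    intro z
    rw [hH, hψd]
    by_cases hz : z ∈ KR n R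
    · simp only [Set.indicator_of_mem hz, norm_mul, RCLike.norm_conj, Complex.norm_real, Real.norm_of_nonneg (Real.sqrt_nonneg _)]
      rw [mul_pow, Real.sq_sqrt (hw0 _)]
      have : (duh G z) * (starRingEnd ℂ) (duh G z) = ((‖duh G z‖^2 : ℝ) : ℂ) := by rw [Complex.mul_conj, Complex.normSq_eq_norm_sq]
      have h2 : ((Real.sqrt (w z.1) : ℝ) : ℂ) * (Real.sqrt (w z.1) : ℝ) = (w z.1 : ℝ) := by rw [← Complex.ofReal_mul, Real.mul_self_sqrt (hw0 _)]
      rw [Complex.ofReal_mul, ← this, ← h2]; ring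
    · simp only [Set.indicator_of_notMem hz]; simp
  have hX1 : ∫⁻ z in KR n R, ENNReal.ofReal (w z.1 * ‖duh G z‖^2) ∂(volume.prod volume) = ENNReal.ofReal (N2 (volume.prod volume) ψ) := by
    unfold N2
    rw [ofReal_integral_eq_lintegral_ofReal (integrable_sq (hψ.memLp 2)) (Filter.Eventually.of_forall fun z => by positivity), ← lintegral_indicator (KR_meas R)]
    congr 1; ext z
    rw [hψd]
    by_cases hz : z ∈ KR n R
    · simp only [Set.indicator_of_mem hz, norm_mul, RCLike.norm_conj, Complex.norm_real, Real.norm_of_nonneg (Real.sqrt_nonneg _)]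
      rw [mul_pow, Real.sq_sqrt (hw0 _)]
    · simp only [Set.indicator_of_notMem hz]; simp
  obtain ⟨X, hX⟩ : ∃ X, X = N2 (volume.prod volume) ψ := ⟨_, rfl⟩
  have hX2 : ((X : ℝ) : ℂ) = ∫ z, FF G H z ∂(volume.prod (volume.prod volume)) := by
    rw [← duh_dual hGm hG0 hM1 hM2 hHn, hX]
    simp_rw [hpt]
    rw [integral_complex_ofReal]; rfl
  rw [hX1, ← hX]
  have hX0 : 0 ≤ X := by rw [hX]; exact N2_nonneg _ _
  -- translates
  have htr : ∀ y : E, MeasurePreserving (fun z : E × ℝ => (z.1 + y, z.2)) (volume.prod volume) (volume.prod volume) := fun y =>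
    (measurePreserving_add_right volume y).prod (MeasurePreserving.id volume)
  have hemb : ∀ y : E, MeasurableEmbedding (fun z : E × ℝ => (z.1 + y, z.2)) := fun y =>
    ((MeasurableEquiv.addRight y).prodCongr (MeasurableEquiv.refl ℝ)).measurableEmbedding
  have hψy : ∀ y : E, NiceST (fun z : E × ℝ => ψ (z.1 + y, z.2)) := by
    intro y
    obtain ⟨hm, ⟨B, hB⟩, T, hT⟩ := id hψ
    refine ⟨by fun_prop, ⟨B, fun z => hB _⟩, T + ‖y‖, fun z hz => hT _ ?_⟩
    rcases hz with h | h
    · left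
      have : ‖z.1‖ ≤ ‖z.1 + y‖ + ‖y‖ := by
        calc ‖z.1‖ = ‖(z.1 + y) - y‖ := by simp
          _ ≤ _ := norm_sub_le _ _
      simp only []
      linarith
    · right; simp only []; linarith [norm_nonneg y]
  have hNy : ∀ y : E, N2 (volume.prod volume) (fun z : E × ℝ => ψ (z.1 + y, z.2)) = X := by
    intro y
    rw [hX]
    exact (htr y).integral_comp (hemb y) (fun z => ‖ψ z‖^2)
  have hHyd : ∀ y : E, (fun z : E × ℝ => H (z.1 + y, z.2)) = fun z => (Real.sqrt (w (z.1 + y)) : ℂ) * ψ (z.1 + y, z.2) := by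
    intro y; rw [hH]
  have hHy : ∀ y, NiceST (fun z : E × ℝ => H (z.1 + y, z.2)) := by
    intro y
    rw [hHyd]
    exact (hψy y).sqrt_mul (hwt.translate y)
  -- GK
  obtain ⟨GK, hGK⟩ : ∃ GK : E × ℝ → ℂ, GK = (KR n (R + κ)).indicator G := ⟨_, rfl⟩
  have hGKm : Measurable GK := by rw [hGK]; exact hGm.indicator (KR_meas _)
  have hGK1 : ∀ z : E × ℝ, ‖z.1‖ + n * z.2 ≤ R + κ → GK z = G z := by
    intro z hz
    rw [hGK]
    by_cases h0 : 0 < z.2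
    · exact Set.indicator_of_mem (s := KR n (R + κ)) ⟨h0, hz⟩ _
    · rw [hG0 z (not_lt.1 h0), Set.indicator_of_notMem (fun h => h0 h.1)]
  have hGK2 : ∀ z, ‖GK z‖ ≤ ‖G z‖ := fun z => by rw [hGK]; exact norm_indicator_le_norm_self _ _
  have hGle : ∀ z, ‖G z‖ ≤ ‖V z.1‖ * ‖u z‖ := fun z => by
    rw [hGd]
    refine (norm_indicator_le_norm_self _ _).trans ?_
    rw [norm_mul]
  have hlocV : IntegrableOn (fun x => A * v x * U) (closedBall (0:E) (R + κ)) := ((hv.locInt hp1 (R+κ)).const_mul A).mul_const U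
  have hB' : ∀ s, ∫ x, ‖GK (x, s)‖ ≤ ∫ x, (closedBall (0:E) (R + κ)).indicator (fun x => A * v x * U) x := by
    intro s
    refine integral_mono_of_nonneg (Filter.Eventually.of_forall fun x => norm_nonneg _) ((integrable_indicator_iff measurableSet_closedBall).2 hlocV) (Filter.Eventually.of_forall fun x => ?_)
    simp only []
    by_cases hz : (x, s) ∈ KR n (R + κ)
    · rw [Set.indicator_of_mem (KR_sub hn0 _ hz).1]
      refine (hGK2 _).trans ((hGle _).trans ?_)
      rw [hVA]
      exact mul_le_mul_of_nonneg_left (hU _ hz) (mul_nonneg hA0 (hv0 _))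
    · rw [hGK, Set.indicator_of_notMem hz, norm_zero]
      exact Set.indicator_nonneg (fun x _ => mul_nonneg (mul_nonneg hA0 (hv0 _)) hU0) _
  -- Gn and phi
  obtain ⟨φ, hφd⟩ : ∃ φ : ℕ → E × ℝ → ℂ, φ = fun (k : ℕ) => (KR n (R + κ) ∩ {z : E × ℝ | z.2 ∈ S}).indicator (fun z : E × ℝ => (A : ℂ) * sg V z.1 * (Real.sqrt (tru v k z.1) : ℂ) * u z) := ⟨_, rfl⟩
  obtain ⟨Gn, hGn⟩ : ∃ Gn : ℕ → E × ℝ → ℂ, Gn = fun (k : ℕ) z => (Real.sqrt (tru v k z.1) : ℂ) * φ k z := ⟨_, rfl⟩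
  have hsgm := sg_meas hV
  have hφn : ∀ k, NiceST (φ k) := by
    intro k
    obtain ⟨htm, ht0, ⟨Bt, hBt⟩, -⟩ := hv.tru hp0 k
    refine ⟨?_, ⟨A * 1 * Real.sqrt Bt * U, fun z => ?_⟩, R + κ, fun z hz => ?_⟩
    · rw [hφd]; exact Measurable.indicator (by fun_prop) ((KR_meas _).inter hSm)
    · rw [hφd]
      simp only []
      by_cases hz : z ∈ KR n (R+κ) ∩ {z : E × ℝ | z.2 ∈ S}
      · rw [Set.indicator_of_mem hz, norm_mul, norm_mul, norm_mul, Complex.norm_real, Complex.norm_real, Real.norm_of_nonneg (Real.sqrt_nonneg _), Real.norm_of_nonneg hA0]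
        have h1 := sg_norm V z.1
        have h2 := hU z hz.1
        have h3 := Real.sqrt_le_sqrt (hBt z.1)
        gcongr
      · rw [Set.indicator_of_notMem hz, norm_zero]; positivity
    · rw [hφd]; apply Set.indicator_of_notMem
      intro hzK
      have := KR_bd hn0 hzK.1
      rcases hz with h | h <;> linarith
  have hGnn : ∀ k, NiceST (Gn k) := by
    intro k; rw [hGn]; exact (hφn k).sqrt_mul (hv.tru hp0 k)
  have hGnv : ∀ (k : ℕ) z, Gn k z = {z : E × ℝ | v z.1 ≤ k}.indicator GK z := by
    intro k z
    rw [hGn, hφd, hGK, hGd]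
    simp only []
    by_cases hz : z ∈ KR n (R+κ)
    · by_cases hzS : z.2 ∈ S
      · have hz2 : z ∈ KR n (R+κ) ∩ {z : E × ℝ | z.2 ∈ S} := ⟨hz, hzS⟩
        rw [Set.indicator_of_mem hz2]
        by_cases hk : v z.1 ≤ k
        · have hk2 : z ∈ {z : E × ℝ | v z.1 ≤ k} := hk
          rw [Set.indicator_of_mem hk2, Set.indicator_of_mem hz, Set.indicator_of_mem hzS]
          have ht : tru v k z.1 = v z.1 := Set.indicator_of_mem (s := {x | v x ≤ (k:ℝ)}) hk _
          rw [ht]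
          have h2 : ((Real.sqrt (v z.1) : ℝ) : ℂ) * (Real.sqrt (v z.1) : ℝ) = (v z.1 : ℝ) := by rw [← Complex.ofReal_mul, Real.mul_self_sqrt (hv0 _)]
          have h3 := sg_mul V z.1
          rw [hVA] at h3
          calc _ = (A * ((Real.sqrt (v z.1) : ℂ) * (Real.sqrt (v z.1) : ℂ))) * sg V z.1 * u z := by ring
            _ = _ := by
              rw [h2]
              rw [← h3]
              push_cast; ring
        · have hk2 : z ∉ {z : E × ℝ | v z.1 ≤ k} := hk
          rw [Set.indicator_of_notMem hk2]
          have ht : tru v k z.1 = 0 := Set.indicator_of_notMem (s := {x | v x ≤ (k:ℝ)}) hk _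
          rw [ht]; simp
      · have hz2 : z ∉ KR n (R+κ) ∩ {z : E × ℝ | z.2 ∈ S} := fun h => hzS h.2
        rw [Set.indicator_of_notMem hz2, mul_zero]
        symm
        apply Set.indicator_apply_eq_zero.2
        intro _
        rw [Set.indicator_of_mem hz, Set.indicator_of_notMem hzS]
    · have hz2 : z ∉ KR n (R+κ) ∩ {z : E × ℝ | z.2 ∈ S} := fun h => hz h.1
      rw [Set.indicator_of_notMem hz2, mul_zero]
      symm
      apply Set.indicator_apply_eq_zero.2
      intro _
      rw [Set.indicator_of_notMem hz]
  have hGn1 : ∀ k z, ‖Gn k z‖ ≤ ‖GK z‖ := fun k z => by rw [hGnv]; exact norm_indicator_le_norm_self _ _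
  have hGn2 : ∀ z, Filter.Tendsto (fun k => Gn k z) Filter.atTop (nhds (GK z)) := by
    intro z
    obtain ⟨k0, hk0⟩ := exists_nat_ge (v z.1)
    refine tendsto_const_nhds.congr' ?_
    filter_upwards [Filter.eventually_ge_atTop k0] with k hk
    rw [hGnv]
    exact (Set.indicator_of_mem (s := {z : E × ℝ | v z.1 ≤ k}) (show v z.1 ≤ k from hk0.trans (by exact_mod_cast hk)) _).symm
  have hφN : ∀ k, N2 (volume.prod volume) (φ k) ≤ A^2 * a.toReal := by
    intro k
    have h1 := N2_eq_lintegral ((hφn k).memLp 2)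
    have h2 : ENNReal.ofReal (N2 (volume.prod volume) (φ k)) ≤ ENNReal.ofReal (A^2) * a := by
      rw [← h1, ha, ← lintegral_const_mul' _ _ ENNReal.ofReal_ne_top, ← lintegral_indicator (KR_meas _)]
      apply lintegral_mono
      intro z
      simp only []
      by_cases hz : z ∈ KR n (R+κ) ∩ {z : E × ℝ | z.2 ∈ S}
      · rw [Set.indicator_of_mem hz.1, ← ENNReal.ofReal_mul (by positivity), ← ofReal_norm, ← ENNReal.ofReal_pow (norm_nonneg _)]
        apply ENNReal.ofReal_le_ofReal
        rw [hφd]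
        simp only []
        have ht0 : 0 ≤ tru v k z.1 := (hv.tru hp0 k).2.1 _
        have htv : tru v k z.1 ≤ v z.1 := Set.indicator_le_self' (fun _ _ => hv0 _) _
        rw [Set.indicator_of_mem hz, norm_mul, norm_mul, norm_mul, Complex.norm_real, Complex.norm_real, Real.norm_of_nonneg (Real.sqrt_nonneg _), Real.norm_of_nonneg hA0,
          mul_pow, mul_pow, mul_pow, Real.sq_sqrt ht0]
        have hs2 : ‖sg V z.1‖^2 ≤ 1 := by
          have := sg_norm V z.1
          have h0 := norm_nonneg (sg V z.1)
          nlinarith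
        calc A ^ 2 * ‖sg V z.1‖ ^ 2 * tru v (↑k) z.1 * ‖u z‖ ^ 2 ≤ A^2 * 1 * v z.1 * ‖u z‖^2 := by gcongr
          _ = _ := by ring
      · have : φ k z = 0 := by rw [hφd]; exact Set.indicator_of_notMem hz _
        rw [this]; simp
    have h3 : ENNReal.ofReal (A^2) * a = ENNReal.ofReal (A^2 * a.toReal) := by
      rw [ENNReal.ofReal_mul (by positivity), ENNReal.ofReal_toReal hafin.ne]
    rw [h3] at h2
    exact (ENNReal.ofReal_le_ofReal_iff (by positivity)).1 h2
  have hDB : ∀ k y, ‖DB 0 (Gn k) (fun z => H (z.1 + y, z.2))‖ ≤ C2 E p * ((C2 E p * (A^2 * a.toReal) + (C2 E p)⁻¹ * X)/2) := by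
    intro k y
    rw [hHyd, hGn]
    refine (FB_scaled hA (hv.tru hp0 k) (hwt.translate y) (hφn k) (hψy y) hC).trans ?_
    rw [hNy]
    have := hφN k
    gcongr
  have hHs : ∀ z : E × ℝ, R < ‖z.1‖ + n * z.2 → H z = 0 := by
    intro z hz
    have : ψ z = 0 := by rw [hψd]; exact Set.indicator_of_notMem (fun h => absurd h.2 (not_le.2 hz)) _
    rw [hH]; simp only [this, mul_zero]
  have main := core_est hn0 hGm hG0 hGi hM1 hM2 hHn hκ hHs hGKm hGK1 hGK2 hB' hGnn hGn1 hGn2 hDB hHy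
  rw [← hX2, Complex.norm_real, Real.norm_of_nonneg hX0] at main
  have fin : X ≤ (C2 E p * A)^2 * a.toReal := by
    have e : C2 E p * ((C2 E p * (A^2 * a.toReal) + (C2 E p)⁻¹ * X)/2) = ((C2 E p * A)^2 * a.toReal + X)/2 := by
      field_simp
    rw [e] at main
    linarith
  calc ENNReal.ofReal X ≤ ENNReal.ofReal ((C2 E p * A)^2 * a.toReal) := ENNReal.ofReal_le_ofReal fin
    _ = _ := by rw [ENNReal.ofReal_mul (by positivity), ENNReal.ofReal_toReal hafin.ne]
end ClaimC
end

noncomputable section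
open MeasureTheory Metric Complex
open scoped ENNReal FourierTransform SchwartzMap
set_option linter.unusedSectionVars false
section ClaimA
variable {W : Type*} [NormedAddCommGroup W] [InnerProductSpace ℝ W] [FiniteDimensional ℝ W] [MeasurableSpace W] [BorelSpace W]

lemma RLsin {B : Set ℝ} (hB : MeasurableSet B) (hfin : volume B ≠ ⊤) (hpos : 0 < volume B) :
    ∃ ρ0 > (0:ℝ), ∀ ρ ≥ ρ0, (volume B).toReal / 4 ≤ ∫ τ in B, |Real.sin (τ * ρ)| := by
  have hb : 0 < (volume B).toReal := ENNReal.toReal_pos hpos.ne' hfin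
  have : IsFiniteMeasure (volume.restrict B) := ⟨by rw [Measure.restrict_apply_univ]; exact lt_top_iff_ne_top.2 hfin⟩
  have h1 := Real.zero_at_infty_fourier (E := ℂ) (B.indicator (fun _ => (1:ℂ)))
  have h2 : Filter.Tendsto (fun ρ : ℝ => 𝓕 (B.indicator (fun _ => (1:ℂ))) (ρ / Real.pi)) Filter.atTop (nhds 0) :=
    (h1.mono_left atTop_le_cocompact).comp (Filter.tendsto_id.atTop_div_const Real.pi_pos)
  have h3 := (tendsto_order.1 h2.norm).2 ((volume B).toReal / 2) (by rw [norm_zero]; positivity)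
  obtain ⟨ρ1, hρ1⟩ := Filter.eventually_atTop.1 h3
  refine ⟨max ρ1 1, by positivity, fun ρ hρ => ?_⟩
  have h4 := hρ1 ρ ((le_max_left _ _).trans hρ)
  have e : (𝓕 (B.indicator (fun _ => (1:ℂ))) (ρ / Real.pi)).re = ∫ τ in B, Real.cos (2 * (τ * ρ)) := by
    rw [Real.fourier_eq']
    have e0 : ∀ x : ℝ, Complex.exp (↑(-2 * Real.pi * inner ℝ x (ρ / Real.pi)) * I) • B.indicator (fun _ => (1:ℂ)) x = B.indicator (fun x => Complex.exp (((-(2 * (x * ρ)) : ℝ) : ℂ) * I)) x := by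
      intro x
      by_cases hx : x ∈ B
      · rw [Set.indicator_of_mem hx, Set.indicator_of_mem hx, smul_eq_mul, mul_one]
        congr 3
        have := Real.pi_pos.ne'
        simp only [RCLike.inner_apply, conj_trivial]
        field_simp
      · rw [Set.indicator_of_notMem hx, Set.indicator_of_notMem hx, smul_zero]
    simp_rw [e0]
    rw [integral_indicator hB]
    have hi : Integrable (fun x : ℝ => Complex.exp (((-(2 * (x * ρ)) : ℝ) : ℂ) * I)) (volume.restrict B) := by
      refine Integrable.of_bound (C := 1) (Measurable.aestronglyMeasurable (by fun_prop)) (Filter.Eventually.of_forall fun x => ?_)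
      rw [Complex.norm_exp_ofReal_mul_I]
    have := integral_re (𝕜 := ℂ) hi
    simp only [RCLike.re_eq_complex_re] at this
    rw [← this]
    congr 1; ext x
    rw [Complex.exp_ofReal_mul_I_re, Real.cos_neg]
  have h5 : ∫ τ in B, Real.cos (2 * (τ * ρ)) ≤ (volume B).toReal / 2 := by
    rw [← e]; exact (Complex.re_le_norm _).trans h4.le
  have ic : Integrable (fun τ : ℝ => Real.cos (2 * (τ * ρ))) (volume.restrict B) :=
    Integrable.of_bound (C := 1) (Measurable.aestronglyMeasurable (by fun_prop)) (Filter.Eventually.of_forall fun x => by simpa using Real.abs_cos_le_one _)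
  have is : Integrable (fun τ : ℝ => |Real.sin (τ * ρ)|) (volume.restrict B) :=
    Integrable.of_bound (C := 1) (Measurable.aestronglyMeasurable (by fun_prop)) (Filter.Eventually.of_forall fun x => by simpa using Real.abs_sin_le_one _)
  calc (volume B).toReal / 4 ≤ ((volume B).toReal - ∫ τ in B, Real.cos (2 * (τ * ρ))) / 2 := by linarith
    _ = ∫ τ in B, (1 - Real.cos (2 * (τ * ρ))) / 2 := by
        rw [integral_div, integral_sub (integrable_const _) ic]
        simp [Measure.real]
    _ ≤ _ := by
        refine integral_mono (((integrable_const _).sub ic).div_const 2) is fun τ => ?_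
        simp only []
        have h6 : (1 - Real.cos (2 * (τ * ρ))) / 2 = |Real.sin (τ * ρ)|^2 := by
          rw [sq_abs, Real.sin_sq_eq_half_sub]; ring
        rw [h6]
        have h7 := Real.abs_sin_le_one (τ * ρ)
        have h8 := abs_nonneg (Real.sin (τ * ρ))
        nlinarith

lemma claim_a {g : W → ℝ} (hg : Measurable g) (h0 : ∀ x, 0 ≤ g x) {Bg : ℝ} (hb : ∀ x, g x ≤ Bg)
    (hinf : ∫⁻ ξ, ENNReal.ofReal ((1 + ‖ξ‖)⁻¹ * g ξ) = ⊤) :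
    ∀ᵐ τ : ℝ, ∫⁻ ξ, ENNReal.ofReal (|Real.sin (τ * ‖ξ‖)| / ‖ξ‖ * g ξ) = ⊤ := by
  obtain ⟨Φ, hΦ⟩ : ∃ Φ : ℝ → ℝ≥0∞, Φ = fun τ => ∫⁻ ξ, ENNReal.ofReal (|Real.sin (τ * ‖ξ‖)| / ‖ξ‖ * g ξ) := ⟨_, rfl⟩
  have mF : Measurable (fun q : ℝ × W => ENNReal.ofReal (|Real.sin (q.1 * ‖q.2‖)| / ‖q.2‖ * g q.2)) := by fun_prop
  have mΦ : Measurable Φ := by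
    rw [hΦ]
    exact Measurable.lintegral_prod_right' (f := fun q : ℝ × W => ENNReal.ofReal (|Real.sin (q.1 * ‖q.2‖)| / ‖q.2‖ * g q.2)) mF
  by_contra hcon
  have hne : volume {τ : ℝ | ¬ Φ τ = ⊤} ≠ 0 := by
    intro h; apply hcon
    rw [hΦ] at h
    exact h
  obtain ⟨B, hBd⟩ : ∃ B : ℕ → Set ℝ, B = fun k : ℕ => {τ | Φ τ ≤ (k : ℝ≥0∞)} ∩ Set.Icc (-(k:ℝ)) k := ⟨_, rfl⟩
  have hun : {τ : ℝ | ¬ Φ τ = ⊤} ⊆ ⋃ k, B k := by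
    intro τ hτ
    obtain ⟨k1, hk1⟩ := ENNReal.exists_nat_gt (show Φ τ ≠ ⊤ from hτ)
    obtain ⟨k2, hk2⟩ := exists_nat_ge |τ|
    refine Set.mem_iUnion.2 ⟨max k1 k2, ?_⟩
    rw [hBd]
    have h2 : |τ| ≤ ((max k1 k2 : ℕ) : ℝ) := hk2.trans (by exact_mod_cast le_max_right _ _)
    exact ⟨hk1.le.trans (by exact_mod_cast le_max_left _ _), (abs_le.1 h2).1, (abs_le.1 h2).2⟩
  have hex : ∃ k, volume (B k) ≠ 0 := by
    by_contra hc
    push Not at hc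
    exact hne (measure_mono_null hun (measure_iUnion_null hc))
  obtain ⟨k, hk⟩ := hex
  have hBm : MeasurableSet (B k) := by
    rw [hBd]; exact (measurableSet_le mΦ measurable_const).inter measurableSet_Icc
  have hBf : volume (B k) ≠ ⊤ := by
    refine ne_top_of_le_ne_top (b := volume (Set.Icc (-(k:ℝ)) k)) (by simp) (measure_mono ?_)
    rw [hBd]; exact Set.inter_subset_right
  obtain ⟨ρ0, hρ0, hρ⟩ := RLsin hBm hBf (pos_iff_ne_zero.2 hk)
  have hbpos : 0 < (volume (B k)).toReal := ENNReal.toReal_pos hk hBf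
  have : IsFiniteMeasure (volume.restrict (B k)) := ⟨by rw [Measure.restrict_apply_univ]; exact lt_top_iff_ne_top.2 hBf⟩
  -- Fubini
  have f1 : ∫⁻ τ in B k, Φ τ < ⊤ := by
    calc _ ≤ ∫⁻ τ in B k, (k : ℝ≥0∞) := by
          refine setLIntegral_mono measurable_const fun τ hτ => ?_
          rw [hBd] at hτ
          exact hτ.1
      _ < ⊤ := by
          rw [setLIntegral_const]
          exact ENNReal.mul_lt_top (by simp) (lt_top_iff_ne_top.2 hBf)
  have f2 : ∫⁻ τ in B k, Φ τ = ∫⁻ ξ, (∫⁻ τ in B k, ENNReal.ofReal (|Real.sin (τ * ‖ξ‖)| / ‖ξ‖ * g ξ)) := by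
    rw [hΦ]
    rw [lintegral_lintegral_swap]
    exact mF.aemeasurable
  have f3 : ∀ ξ : W, ρ0 ≤ ‖ξ‖ → ENNReal.ofReal ((volume (B k)).toReal / 4) * ENNReal.ofReal ((1 + ‖ξ‖)⁻¹ * g ξ) ≤ ∫⁻ τ in B k, ENNReal.ofReal (|Real.sin (τ * ‖ξ‖)| / ‖ξ‖ * g ξ) := by
    intro ξ hξ
    have hξ0 : 0 < ‖ξ‖ := hρ0.trans_le hξ
    have hh := hρ ‖ξ‖ hξ
    have is : Integrable (fun τ : ℝ => |Real.sin (τ * ‖ξ‖)| / ‖ξ‖ * g ξ) (volume.restrict (B k)) :=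
      ((Integrable.of_bound (C := 1) (Measurable.aestronglyMeasurable (by fun_prop)) (Filter.Eventually.of_forall fun x => by simpa using Real.abs_sin_le_one _)).div_const _).mul_const _
    rw [← ofReal_integral_eq_lintegral_ofReal is (Filter.Eventually.of_forall fun τ => mul_nonneg (by positivity) (h0 _)), ← ENNReal.ofReal_mul (by positivity)]
    apply ENNReal.ofReal_le_ofReal
    rw [integral_mul_const, integral_div, ← mul_assoc]
    apply mul_le_mul_of_nonneg_right _ (h0 _)
    rw [← div_eq_mul_inv]
    apply div_le_div₀ _ hh hξ0 (by linarith)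
    linarith
  have f4 : ∫⁻ ξ in {ξ : W | ρ0 ≤ ‖ξ‖}, ENNReal.ofReal ((1 + ‖ξ‖)⁻¹ * g ξ) < ⊤ := by
    have : ENNReal.ofReal ((volume (B k)).toReal / 4) * ∫⁻ ξ in {ξ : W | ρ0 ≤ ‖ξ‖}, ENNReal.ofReal ((1 + ‖ξ‖)⁻¹ * g ξ) < ⊤ := by
      rw [← lintegral_const_mul' _ _ ENNReal.ofReal_ne_top]
      have hms : MeasurableSet {ξ : W | ρ0 ≤ ‖ξ‖} := measurableSet_le measurable_const measurable_norm
      refine lt_of_le_of_lt ?_ f1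
      rw [f2, ← lintegral_indicator hms]
      apply lintegral_mono
      intro ξ
      by_cases hξ : ξ ∈ {ξ : W | ρ0 ≤ ‖ξ‖}
      · rw [Set.indicator_of_mem hξ]; exact f3 ξ hξ
      · rw [Set.indicator_of_notMem hξ]; simp
    refine lt_top_iff_ne_top.2 fun hc => ?_
    rw [hc, ENNReal.mul_top (by simpa using hbpos)] at this
    exact lt_irrefl _ this
  have f5 : ∫⁻ ξ in {ξ : W | ρ0 ≤ ‖ξ‖}ᶜ, ENNReal.ofReal ((1 + ‖ξ‖)⁻¹ * g ξ) < ⊤ := by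
    calc _ ≤ ∫⁻ ξ in closedBall (0:W) ρ0, ENNReal.ofReal Bg := by
          refine (lintegral_mono fun ξ => ?_).trans (lintegral_mono_set ?_)
          · apply ENNReal.ofReal_le_ofReal
            have : (1 + ‖ξ‖)⁻¹ ≤ 1 := inv_le_one_of_one_le₀ (by linarith [norm_nonneg ξ])
            exact (mul_le_of_le_one_left (h0 _) this).trans (hb _)
          · intro ξ hξ
            simp only [Set.mem_compl_iff] at hξ
            have : ¬ (ρ0 ≤ ‖ξ‖) := hξ
            simpa using (not_le.1 this).le
      _ < ⊤ := by
          rw [setLIntegral_const]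
          exact ENNReal.mul_lt_top ENNReal.ofReal_lt_top measure_closedBall_lt_top
  have hms : MeasurableSet {ξ : W | ρ0 ≤ ‖ξ‖} := measurableSet_le measurable_const measurable_norm
  rw [← lintegral_add_compl _ hms] at hinf
  exact (ENNReal.add_lt_top.2 ⟨f4, f5⟩).ne hinf
end ClaimA
end

noncomputable section
open MeasureTheory Metric Complex
open scoped ENNReal FourierTransform SchwartzMap
set_option linter.unusedSectionVars false
section GInt
variable {W : Type*} [NormedAddCommGroup W] [InnerProductSpace ℝ W] [FiniteDimensional ℝ W] [MeasurableSpace W] [BorelSpace W]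

lemma WtU.decay_int {p : ℝ} (hp : 1 ≤ p) {v : W → ℝ} (h : WtU p v) {C : ℝ} (hC : 0 ≤ C) :
    ∫⁻ x, ENNReal.ofReal (C * ((1 + ‖x‖)^(Module.finrank ℝ W + 2))⁻¹ * v x) < ⊤ := by
  obtain ⟨d, hd⟩ : ∃ d, d = Module.finrank ℝ W := ⟨_, rfl⟩
  rw [← hd]
  have hvm := h.1
  obtain ⟨c, hc0, hc⟩ : ∃ c : ℝ, 0 ≤ c ∧ volume (ball (0:W) 1) = ENNReal.ofReal c := ⟨(volume (ball (0:W) 1)).toReal, ENNReal.toReal_nonneg, (ENNReal.ofReal_toReal measure_ball_lt_top.ne).symm⟩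
  have hball : ∀ j : ℕ, ∫⁻ x in ball (0:W) (j+1), ENNReal.ofReal (v x) ≤ ENNReal.ofReal ((c + 1) * ((j:ℝ)+1)^d) := by
    intro j
    have hj : (0:ℝ) < j + 1 := by positivity
    refine (h.loc hp 0 hj).trans ?_
    rw [Measure.addHaar_ball_of_pos _ _ hj, hc, ← hd, ← ENNReal.ofReal_mul (by positivity), ← ENNReal.ofReal_add (by positivity) (by positivity)]
    apply ENNReal.ofReal_le_ofReal
    have h1 : ((j:ℝ)+1)^((d:ℝ) - 2*p) ≤ ((j:ℝ)+1)^(d:ℝ) := Real.rpow_le_rpow_of_exponent_le (by linarith [Nat.cast_nonneg (α := ℝ) j]) (by linarith)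
    rw [Real.rpow_natCast] at h1
    linarith
  have hpt : ∀ x : W, ENNReal.ofReal (C * ((1 + ‖x‖)^(d + 2))⁻¹ * v x) ≤ ∑' j : ℕ, ENNReal.ofReal (C * (((j:ℝ)+1)^(d+2))⁻¹) * (ball (0:W) (j+1)).indicator (fun x => ENNReal.ofReal (v x)) x := by
    intro x
    refine le_trans ?_ (ENNReal.le_tsum ⌊‖x‖⌋₊)
    have hx : x ∈ ball (0:W) (⌊‖x‖⌋₊ + 1) := by simpa using Nat.lt_floor_add_one ‖x‖
    rw [Set.indicator_of_mem hx, ← ENNReal.ofReal_mul (by positivity)]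
    apply ENNReal.ofReal_le_ofReal
    have hfl := Nat.floor_le (norm_nonneg x)
    have h2 : (1 + ‖x‖) ≥ ((⌊‖x‖⌋₊ : ℝ) + 1) := by linarith
    have := h.2.1 x
    gcongr
  refine (lintegral_mono hpt).trans_lt ?_
  rw [lintegral_tsum (fun j => ((Measurable.indicator (by fun_prop) measurableSet_ball).const_mul _).aemeasurable)]
  have hterm : ∀ j : ℕ, ∫⁻ x, ENNReal.ofReal (C * (((j:ℝ)+1)^(d+2))⁻¹) * (ball (0:W) (j+1)).indicator (fun x => ENNReal.ofReal (v x)) x ≤ ENNReal.ofReal (C * (c + 1) * (((j + 1 : ℕ) : ℝ)^2)⁻¹) := by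
    intro j
    rw [lintegral_const_mul' _ _ ENNReal.ofReal_ne_top, lintegral_indicator measurableSet_ball]
    refine (mul_le_mul_right (hball j) _).trans ?_
    rw [← ENNReal.ofReal_mul (by positivity)]
    apply ENNReal.ofReal_le_ofReal
    apply le_of_eq
    have : ((j:ℝ)+1) ≠ 0 := by positivity
    push_cast
    rw [pow_add]
    field_simp
  refine (ENNReal.tsum_le_tsum hterm).trans_lt ?_
  have hs : Summable (fun j : ℕ => C * (c + 1) * (((j + 1 : ℕ) : ℝ)^2)⁻¹) :=
    ((summable_nat_add_iff 1).2 (Real.summable_nat_pow_inv.2 (by norm_num : 1 < 2))).mul_left _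
  rw [← ENNReal.ofReal_tsum_of_nonneg (fun j => by positivity) hs]
  exact ENNReal.ofReal_lt_top

lemma G_integrable {p : ℝ} (hp : 1 ≤ p) {v : W → ℝ} (h : WtU p v) {V : W → ℂ} (hV : Measurable V) {A : ℝ} (hA0 : 0 ≤ A) (hVA : ∀ y, ‖V y‖ = A * v y) (φ : 𝓢(W, ℂ)) :
    Integrable (fun y => V y * φ y) := by
  obtain ⟨C, hC, hφ⟩ := schwartz_decay φ (Module.finrank ℝ W + 2)
  have hφc := φ.continuous
  refine ⟨Measurable.aestronglyMeasurable (by fun_prop), ?_⟩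
  refine lt_of_le_of_lt (lintegral_mono fun x => ?_) (h.decay_int hp (C := A * C) (by positivity))
  rw [← ofReal_norm]
  apply ENNReal.ofReal_le_ofReal
  rw [norm_mul, hVA]
  have h1 := h.2.1 x
  calc A * v x * ‖φ x‖ ≤ A * v x * (C * ((1+‖x‖)^(Module.finrank ℝ W + 2))⁻¹) := by gcongr; exact hφ x
    _ = _ := by ring
end GInt
end

noncomputable section
open MeasureTheory Metric Complex
open scoped ENNReal FourierTransform SchwartzMap
set_option linter.unusedSectionVars false
section ClaimB
variable {W : Type*} [NormedAddCommGroup W] [InnerProductSpace ℝ W] [FiniteDimensional ℝ W] [MeasurableSpace W] [BorelSpace W]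

/-- size of the time slice on the Fourier side -/
def MMs (G : W × ℝ → ℂ) (s : ℝ) : ℝ≥0∞ := ∫⁻ ξ, ENNReal.ofReal ((1 + ‖ξ‖)⁻¹ * ‖PF G (ξ, s)‖)

lemma MMs_meas {G : W × ℝ → ℂ} (hG : Measurable G) : Measurable (MMs G) := by
  have h := measurable_PF hG
  unfold MMs
  exact Measurable.lintegral_prod_right' (f := fun q : ℝ × W => ENNReal.ofReal ((1 + ‖q.2‖)⁻¹ * ‖PF G (q.2, q.1)‖)) (by fun_prop)

/-- good times -/
def Sk (G : W × ℝ → ℂ) (k : ℕ) : Set ℝ := {s | 0 < s ∧ MMs G s ≤ k}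

lemma Sk_meas {G : W × ℝ → ℂ} (hG : Measurable G) (k : ℕ) : MeasurableSet (Sk G k) :=
  MeasurableSet.inter (s₁ := {s : ℝ | 0 < s}) (s₂ := {s | MMs G s ≤ k}) measurableSet_Ioi (measurableSet_le (MMs_meas hG) measurable_const)

/-- restriction to good times -/
def Gk (G : W × ℝ → ℂ) (k : ℕ) (z : W × ℝ) : ℂ := (Sk G k).indicator (fun _ => G z) z.2

lemma Gk_mem {G : W × ℝ → ℂ} {k : ℕ} {s : ℝ} (hs : s ∈ Sk G k) (x : W) : Gk G k (x, s) = G (x, s) := Set.indicator_of_mem hs _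
lemma Gk_notMem {G : W × ℝ → ℂ} {k : ℕ} {s : ℝ} (hs : s ∉ Sk G k) (x : W) : Gk G k (x, s) = 0 := Set.indicator_of_notMem hs _

lemma Gk_meas {G : W × ℝ → ℂ} (hG : Measurable G) (k : ℕ) : Measurable (Gk G k) := by
  have hm : MeasurableSet {z : W × ℝ | z.2 ∈ Sk G k} := measurable_snd (Sk_meas hG k)
  have : Gk G k = {z : W × ℝ | z.2 ∈ Sk G k}.indicator G := by
    ext z
    by_cases hz : z.2 ∈ Sk G k
    · rw [Set.indicator_of_mem (s := {z : W × ℝ | z.2 ∈ Sk G k}) hz]; exact Set.indicator_of_mem hz _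
    · rw [Set.indicator_of_notMem (s := {z : W × ℝ | z.2 ∈ Sk G k}) hz]; exact Set.indicator_of_notMem hz _
  rw [this]; exact hG.indicator hm

lemma Gk_zero (G : W × ℝ → ℂ) (k : ℕ) (z : W × ℝ) (hz : z.2 ≤ 0) : Gk G k z = 0 :=
  Set.indicator_of_notMem (fun h => absurd h.1 (not_lt.2 hz)) _

lemma PF_Gk_mem {G : W × ℝ → ℂ} {k : ℕ} {s : ℝ} (hs : s ∈ Sk G k) (ξ : W) : PF (Gk G k) (ξ, s) = PF G (ξ, s) := by
  unfold PF; simp only [Gk_mem hs]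
lemma PF_Gk_notMem {G : W × ℝ → ℂ} {k : ℕ} {s : ℝ} (hs : s ∉ Sk G k) (ξ : W) : PF (Gk G k) (ξ, s) = 0 :=
  PF_zero' (fun x => Gk_notMem hs x) ξ

lemma MMs_int {G : W × ℝ → ℂ} (hG : Measurable G) {s : ℝ} (h : MMs G s < ⊤) : Integrable (fun ξ => (1 + ‖ξ‖)⁻¹ * ‖PF G (ξ, s)‖) := by
  have h1 := measurable_PF hG
  refine ⟨Measurable.aestronglyMeasurable (by fun_prop), ?_⟩
  refine lt_of_le_of_lt (le_of_eq ?_) h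
  unfold MMs
  congr 1; ext ξ
  rw [Real.enorm_of_nonneg (by positivity)]

lemma Gk_M1 {G : W × ℝ → ℂ} (hG : Measurable G) (k : ℕ) (s : ℝ) : Integrable (fun ξ => (1 + ‖ξ‖)⁻¹ * ‖PF (Gk G k) (ξ, s)‖) := by
  by_cases hs : s ∈ Sk G k
  · simp only [PF_Gk_mem hs]
    exact MMs_int hG (hs.2.trans_lt (by simp))
  · simp only [PF_Gk_notMem hs]; simp

lemma Gk_M2 {G : W × ℝ → ℂ} (hG : Measurable G) (k : ℕ) (s : ℝ) : ∫ ξ, (1 + ‖ξ‖)⁻¹ * ‖PF (Gk G k) (ξ, s)‖ ≤ k := by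
  by_cases hs : s ∈ Sk G k
  · simp only [PF_Gk_mem hs]
    have hi := MMs_int hG (hs.2.trans_lt (by simp))
    have := ofReal_integral_eq_lintegral_ofReal hi (Filter.Eventually.of_forall fun ξ => by positivity)
    have h2 : ENNReal.ofReal (∫ ξ, (1 + ‖ξ‖)⁻¹ * ‖PF G (ξ, s)‖) ≤ ENNReal.ofReal k := by
      rw [this, ENNReal.ofReal_natCast]; exact hs.2
    exact (ENNReal.ofReal_le_ofReal_iff (by positivity)).1 h2
  · simp only [PF_Gk_notMem hs]; simp

/-- the true Duhamel integrand -/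
def dm (G : W × ℝ → ℂ) (x : W) (s t : ℝ) : ℂ := 𝓕⁻ (fun ξ => sincMult (t - s) ‖ξ‖ * PF G (ξ, s)) x

lemma kd_pos {r : ℝ} (hr : 0 < r) (ρ : ℝ) : kd 0 ρ r = sincMult r ρ := by
  unfold kd sincMult
  rw [Set.indicator_of_mem (by simpa using hr)]
  simp

lemma wv_Gk_mem {G : W × ℝ → ℂ} {k : ℕ} {s t : ℝ} (hs : s ∈ Sk G k) (ht : s < t) (x : W) : wv (Gk G k) x s t = dm G x s t := by
  unfold wv dm
  simp only [PF_Gk_mem hs, kd_pos (sub_pos.2 ht)]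

lemma wv_Gk_notMem {G : W × ℝ → ℂ} {k : ℕ} {s t : ℝ} (hs : s ∉ Sk G k) (x : W) : wv (Gk G k) x s t = 0 := by
  unfold wv
  simp only [PF_Gk_notMem hs]
  rw [Real.fourierInv_eq']; simp

lemma fourierInv_undef {f : W → ℂ} (hf : Measurable f) (h : ∫⁻ ξ, ENNReal.ofReal ‖f ξ‖ = ⊤) (x : W) : 𝓕⁻ f x = 0 := by
  rw [Real.fourierInv_eq']
  apply integral_undef
  intro hi
  have h2 := hi.2
  rw [HasFiniteIntegral] at h2
  refine h2.ne ?_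
  rw [← h]
  congr 1; ext ξ
  rw [← ofReal_norm, norm_smul, Complex.norm_exp_ofReal_mul_I, one_mul]

lemma dm_bad {G : W × ℝ → ℂ} (hG : Measurable G) (hGi : ∀ s, Integrable (fun x => G (x, s))) :
    ∀ᵐ t : ℝ, ∀ᵐ s : ℝ, MMs G s = ⊤ → ∀ x, dm G x s t = 0 := by
  have mP := measurable_PF hG
  have mΦ : Measurable (fun q : ℝ × ℝ => ∫⁻ ξ : W, ENNReal.ofReal (|Real.sin ((q.2 - q.1) * ‖ξ‖)| / ‖ξ‖ * ‖PF G (ξ, q.1)‖)) :=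
    Measurable.lintegral_prod_right' (f := fun r : (ℝ × ℝ) × W => ENNReal.ofReal (|Real.sin ((r.1.2 - r.1.1) * ‖r.2‖)| / ‖r.2‖ * ‖PF G (r.2, r.1.1)‖)) (by fun_prop)
  have key : ∀ᵐ s : ℝ, ∀ᵐ t : ℝ, MMs G s = ⊤ → ∫⁻ ξ : W, ENNReal.ofReal (|Real.sin ((t - s) * ‖ξ‖)| / ‖ξ‖ * ‖PF G (ξ, s)‖) = ⊤ := by
    refine Filter.Eventually.of_forall fun s => ?_
    by_cases h : MMs G s = ⊤
    · have h1 := claim_a (g := fun ξ => ‖PF G (ξ, s)‖) (by fun_prop) (fun _ => norm_nonneg _) (Bg := ∫ x, ‖G (x, s)‖) (fun ξ => norm_fourier_le' (fun x => G (x, s)) ξ) h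
      have h2 := (measurePreserving_sub_right volume s).quasiMeasurePreserving.ae h1
      filter_upwards [h2] with t ht _
      exact ht
    · exact Filter.Eventually.of_forall fun t ht => absurd ht h
  have hms : MeasurableSet {q : ℝ × ℝ | MMs G q.1 = ⊤ → ∫⁻ ξ : W, ENNReal.ofReal (|Real.sin ((q.2 - q.1) * ‖ξ‖)| / ‖ξ‖ * ‖PF G (ξ, q.1)‖) = ⊤} := by
    have m1 : MeasurableSet {q : ℝ × ℝ | MMs G q.1 = ⊤} := ((MMs_meas hG).comp measurable_fst) (measurableSet_singleton _)
    have m2 : MeasurableSet {q : ℝ × ℝ | ∫⁻ ξ : W, ENNReal.ofReal (|Real.sin ((q.2 - q.1) * ‖ξ‖)| / ‖ξ‖ * ‖PF G (ξ, q.1)‖) = ⊤} := mΦ (measurableSet_singleton _)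
    exact MeasurableSet.imp m1 m2
  have key2 := (Measure.ae_ae_comm hms).1 key
  filter_upwards [key2] with t ht
  filter_upwards [ht] with s hs hM x
  unfold dm
  refine fourierInv_undef (f := fun ξ => sincMult (t - s) ‖ξ‖ * PF G (ξ, s)) ?_ ?_ x
  · unfold sincMult; fun_prop
  · rw [← hs hM]
    congr 1; ext ξ
    rw [norm_mul]
    unfold sincMult
    rw [Complex.norm_real, Real.norm_eq_abs, abs_div, abs_norm]

lemma claim_b {G : W × ℝ → ℂ} (hG : Measurable G) (hGi : ∀ s, Integrable (fun x => G (x, s))) :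
    ∀ᵐ t : ℝ, 0 < t → ∀ x, (∫ s in (0:ℝ)..t, dm G x s t) = 0 ∨ Filter.Tendsto (fun k => duh (Gk G k) (x, t)) Filter.atTop (nhds (∫ s in (0:ℝ)..t, dm G x s t)) := by
  filter_upwards [dm_bad hG hGi] with t ht htp x
  by_cases hint : IntervalIntegrable (fun s => dm G x s t) volume 0 t
  · right
    rw [intervalIntegral.integral_of_le htp.le, ← integral_indicator measurableSet_Ioc]
    have hi : Integrable ((Set.Ioc 0 t).indicator (fun s => dm G x s t)) := by
      rw [integrable_indicator_iff measurableSet_Ioc]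
      exact (intervalIntegrable_iff_integrableOn_Ioc_of_le htp.le).1 hint
    have hne : ∀ᵐ s : ℝ, s ≠ t := by simp [ae_iff, measure_singleton]
    have hout : ∀ k s, s ∉ Set.Ioo 0 t → wv (Gk G k) x s t = 0 := fun k s hs => by
      apply wv_zero (Gk_zero G k)
      rwa [abs_of_pos htp]
    unfold duh
    refine tendsto_integral_of_dominated_convergence (fun s => ‖(Set.Ioc 0 t).indicator (fun s => dm G x s t) s‖) (fun k => ?_) hi.norm (fun k => Filter.Eventually.of_forall fun s => ?_) ?_
    · have := wv_meas (Gk_meas hG k)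
      apply Measurable.aestronglyMeasurable
      exact this.comp (f := fun s : ℝ => ((s, t), x)) (by fun_prop)
    · by_cases hs : s ∈ Set.Ioo 0 t
      · rw [Set.indicator_of_mem (Set.Ioo_subset_Ioc_self hs)]
        by_cases hk : s ∈ Sk G k
        · simp only []
          rw [wv_Gk_mem hk hs.2]
        · simp only []
          rw [wv_Gk_notMem hk, norm_zero]; positivity
      · simp only []
        rw [hout k s hs, norm_zero]; positivity
    · filter_upwards [ht, hne] with s hs hst
      by_cases hs2 : s ∈ Set.Ioo 0 t
      · rw [Set.indicator_of_mem (Set.Ioo_subset_Ioc_self hs2)]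
        by_cases hM : MMs G s = ⊤
        · rw [hs hM x]
          refine tendsto_const_nhds.congr fun k => ?_
          rw [wv_Gk_notMem]
          intro hk
          have h5 : MMs G s < ⊤ := lt_of_le_of_lt hk.2 (ENNReal.natCast_lt_top k)
          rw [hM] at h5
          exact lt_irrefl _ h5
        · obtain ⟨k1, hk1⟩ := ENNReal.exists_nat_gt hM
          refine tendsto_const_nhds.congr' ?_
          filter_upwards [Filter.eventually_ge_atTop k1] with k hk
          rw [wv_Gk_mem ⟨hs2.1, hk1.le.trans (by exact_mod_cast hk)⟩ hs2.2]
      · rw [Set.indicator_of_notMem]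
        · refine tendsto_const_nhds.congr fun k => ?_
          rw [hout k s hs2]
        · intro h
          exact hs2 ⟨h.1, lt_of_le_of_ne h.2 hst⟩
  · left
    exact intervalIntegral.integral_undef hint

variable {n : ℕ}
local notation "E" => EuclideanSpace ℝ (Fin n)

lemma w_est (hn : 3 ≤ n) {p : ℝ} (hA : Adm E p) {v : E → ℝ} (hv : WtU p v) {V : E → ℂ} (hV : Measurable V) {A : ℝ} (hA0 : 0 ≤ A) (hVA : ∀ y, ‖V y‖ = A * v y)
    {u : E × ℝ → ℂ} (hu : Continuous u) (hGi : ∀ s, Integrable (fun x => V x * u (x, s))) {R κ : ℝ} (hκ : 0 < κ) :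
    ∫⁻ z in KR n R, ENNReal.ofReal (v z.1 * ‖∫ s in (0:ℝ)..z.2, dm (fun z => V z.1 * u z) z.1 s z.2‖^2) ∂(volume.prod volume) ≤
      ENNReal.ofReal ((C2 E p * A)^2) * ∫⁻ z in KR n (R + κ), ENNReal.ofReal (v z.1 * ‖u z‖^2) ∂(volume.prod volume) := by
  have hum := hu.measurable
  have hp0 : 0 ≤ p := by
    have := hA.2.1
    have h3 : (3:ℝ) ≤ Module.finrank ℝ E := by exact_mod_cast hA.1
    linarith
  obtain ⟨G, hGd⟩ : ∃ G : E × ℝ → ℂ, G = fun z => V z.1 * u z := ⟨_, rfl⟩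
  have hG : Measurable G := by rw [hGd]; fun_prop
  have hGi' : ∀ s, Integrable (fun x => G (x, s)) := by rw [hGd]; exact hGi
  rw [← hGd]
  have hest : ∀ k : ℕ, ∫⁻ z in KR n R, ENNReal.ofReal (tru v k z.1 * ‖duh (Gk G k) z‖^2) ∂(volume.prod volume) ≤
      ENNReal.ofReal ((C2 E p * A)^2) * ∫⁻ z in KR n (R + κ), ENNReal.ofReal (v z.1 * ‖u z‖^2) ∂(volume.prod volume) := by
    intro k
    refine claim_c hn hA hv hV hA0 hVA hu (Sk_meas hG k) (fun s hs => hs.1) (G := Gk G k) ?_ ?_ (Gk_M1 hG k) (Gk_M2 hG k) hκ k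
    · ext z; unfold Gk; simp only [hGd]
    · intro s
      by_cases hs : s ∈ Sk G k
      · simp only [Gk_mem hs]; exact hGi' s
      · simp only [Gk_notMem hs]; simp
  have hm : ∀ k : ℕ, Measurable (fun z : E × ℝ => ENNReal.ofReal (tru v k z.1 * ‖duh (Gk G k) z‖^2)) := by
    intro k
    have h1 := duh_meas (Gk_meas hG k)
    have h2 := (hv.tru hp0 k).1
    fun_prop
  have hpt : ∀ᵐ z ∂((volume : Measure E).prod (volume : Measure ℝ)), 0 < z.2 → ENNReal.ofReal (v z.1 * ‖∫ s in (0:ℝ)..z.2, dm G z.1 s z.2‖^2) ≤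
      Filter.liminf (fun k : ℕ => ENNReal.ofReal (tru v k z.1 * ‖duh (Gk G k) z‖^2)) Filter.atTop := by
    have h1 := (Measure.quasiMeasurePreserving_snd (μ := (volume : Measure E)) (ν := (volume : Measure ℝ))).ae (claim_b hG hGi')
    filter_upwards [h1] with z hz hz0
    rcases hz hz0 z.1 with h | h
    · rw [h]; simp
    · apply le_of_eq
      symm
      apply Filter.Tendsto.liminf_eq
      apply (ENNReal.continuous_ofReal.tendsto _).comp
      have ht : Filter.Tendsto (fun k : ℕ => tru v k z.1) Filter.atTop (nhds (v z.1)) := by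
        obtain ⟨k0, hk0⟩ := exists_nat_ge (v z.1)
        refine tendsto_const_nhds.congr' ?_
        filter_upwards [Filter.eventually_ge_atTop k0] with k hk
        exact (Set.indicator_of_mem (s := {x | v x ≤ (k:ℝ)}) (show v z.1 ≤ k from hk0.trans (by exact_mod_cast hk)) _).symm
      exact ht.mul (h.norm.pow 2)
  calc _ ≤ ∫⁻ z in KR n R, Filter.liminf (fun k : ℕ => ENNReal.ofReal (tru v k z.1 * ‖duh (Gk G k) z‖^2)) Filter.atTop ∂(volume.prod volume) := by
        refine lintegral_mono_ae ((ae_restrict_iff' (KR_meas R)).2 ?_)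
        filter_upwards [hpt] with z hz hzK
        exact hz hzK.1
    _ ≤ Filter.liminf (fun k : ℕ => ∫⁻ z in KR n R, ENNReal.ofReal (tru v k z.1 * ‖duh (Gk G k) z‖^2) ∂(volume.prod volume)) Filter.atTop := lintegral_liminf_le (u := Filter.atTop) hm
    _ ≤ _ := by
        refine Filter.liminf_le_of_frequently_le' (Filter.Eventually.frequently (Filter.Eventually.of_forall hest))
end ClaimB
end

noncomputable section

open MeasureTheory Metric Complex
open scoped ENNReal FourierTransform SchwartzMap
set_option linter.unusedSectionVars false

lemma absorb_iter {a : ℝ → ℝ≥0∞} {F : ℝ≥0∞} (hm : Monotone a) (hf : ∀ R, a R < ⊤)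
    (h : ∀ R κ : ℝ, 0 < κ → a R ≤ F + 2⁻¹ * a (R + κ)) (R : ℝ) : a R ≤ 2 * F := by
  have h1 : ∀ k : ℕ, ∀ R κ : ℝ, 0 < κ → a R ≤ 2 * F + (2⁻¹)^k * a (R + k * κ) := by
    intro k
    induction k with
    | zero => intro R κ hκ; simp
    | succ k ih =>
      intro R κ hκ
      have h2 := ih (R + κ) κ hκ
      have h3 : R + κ + k * κ = R + ((k + 1 : ℕ) : ℝ) * κ := by push_cast; ring
      rw [h3] at h2
      calc a R ≤ F + 2⁻¹ * a (R + κ) := h R κ hκ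
        _ ≤ F + 2⁻¹ * (2 * F + (2⁻¹)^k * a (R + ((k + 1 : ℕ) : ℝ) * κ)) := by gcongr
        _ = _ := by
          rw [mul_add, ← mul_assoc, ENNReal.inv_mul_cancel (by simp) (by simp), one_mul, ← mul_assoc, ← pow_succ', ← add_assoc, two_mul]
  have h4 : ∀ k : ℕ, a R ≤ 2 * F + (2⁻¹)^k * a (R + 1) := by
    intro k
    refine (h1 k R (1 / (k + 1)) (by positivity)).trans ?_
    gcongr
    apply hm
    have : (k:ℝ) * (1 / (k + 1)) ≤ 1 := by
      rw [mul_one_div, div_le_one (by positivity)]; linarith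
    linarith
  have h5 : Filter.Tendsto (fun k : ℕ => 2 * F + (2⁻¹ : ℝ≥0∞)^k * a (R + 1)) Filter.atTop (nhds (2 * F + 0 * a (R + 1))) := by
    refine Filter.Tendsto.add tendsto_const_nhds ?_
    exact ENNReal.Tendsto.mul_const (ENNReal.tendsto_pow_atTop_nhds_zero_of_lt_one (by simp)) (Or.inr (hf _).ne)
  rw [zero_mul, add_zero] at h5
  exact ge_of_tendsto' h5 h4

lemma two_ofReal_le {q : ℝ} (hq : q ≤ 1/4) : 2 * ENNReal.ofReal q ≤ 2⁻¹ := by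
  have h2 : (2:ℝ≥0∞) = ENNReal.ofReal 2 := by simp
  rw [h2, ← ENNReal.ofReal_mul (by norm_num), ← ENNReal.ofReal_inv_of_pos (by norm_num)]
  apply ENNReal.ofReal_le_ofReal
  linarith

section Half
variable {n : ℕ}
local notation "E" => EuclideanSpace ℝ (Fin n)

lemma frw_meas (hn : 3 ≤ n) (f g : 𝓢(E, ℂ)) : Measurable (frw f g) := by
  have h : frw f g = fun z => HW (amp (-I) f g) z + HW (amp I f g) (z.1, -z.2) := funext (frw_eq hn f g)
  rw [h]
  have h1 := HW_meas (amp_meas (-I) f g)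
  have h2 := HW_meas (amp_meas I f g)
  fun_prop

lemma KR_mono : Monotone (KR n) := fun _ _ h _ hz => ⟨hz.1, hz.2.trans h⟩

lemma half_time_est (hn : 3 ≤ n) {p : ℝ} (hA : Adm E p) {v : E → ℝ} (hv : WtU p v) {V : E → ℂ} (hV : Measurable V) {A : ℝ} (hA0 : 0 ≤ A) (hVA : ∀ y, ‖V y‖ = A * v y)
    (hsm : (C2 E p * A)^2 ≤ 1/4)
    {u : E × ℝ → ℂ} (hu : Continuous u) (hGi : ∀ s, Integrable (fun x => V x * u (x, s))) (f g : 𝓢(E, ℂ))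
    (heq : ∀ z : E × ℝ, 0 < z.2 → u z = frw f g z + ∫ s in (0:ℝ)..z.2, dm (fun z => V z.1 * u z) z.1 s z.2) :
    ∫⁻ z in {z : E × ℝ | 0 < z.2}, ENNReal.ofReal (v z.1 * ‖u z‖^2) ∂(volume.prod volume) ≤
      2 * (2 * (ENNReal.ofReal (16 * Real.pi * C2 E p) * (sobNorm n (1/2) f ^ 2 + sobNorm n (-(1/2)) g ^ 2))) := by
  have hp1 : 1 ≤ p := by
    have := hA.2.1
    have h3 : (3:ℝ) ≤ Module.finrank ℝ E := by exact_mod_cast hA.1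
    linarith
  have hfe := free_est hn hA (by linarith) hv f g
  obtain ⟨F, hF⟩ : ∃ F, F = ENNReal.ofReal (16 * Real.pi * C2 E p) * (sobNorm n (1/2) f ^ 2 + sobNorm n (-(1/2)) g ^ 2) := ⟨_, rfl⟩
  rw [← hF] at hfe ⊢
  have hfm := frw_meas hn f g
  have hvm := hv.1
  have hk : ∀ R : ℝ, ∫⁻ z in KR n R, ENNReal.ofReal (v z.1 * ‖u z‖^2) ∂(volume.prod volume) ≤ 2 * (2 * F) := by
    refine absorb_iter (a := fun R => ∫⁻ z in KR n R, ENNReal.ofReal (v z.1 * ‖u z‖^2) ∂(volume.prod volume)) ?_ ?_ ?_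
    · intro R R' h
      exact lintegral_mono_set (KR_mono h)
    · exact a_fin (by omega) hp1 hv hu
    · intro R κ hκ
      have hw := w_est hn hA hv hV hA0 hVA hu hGi (R := R) hκ
      calc ∫⁻ z in KR n R, ENNReal.ofReal (v z.1 * ‖u z‖^2) ∂(volume.prod volume)
          ≤ ∫⁻ z in KR n R, (2 * ENNReal.ofReal (v z.1 * ‖frw f g z‖^2) + 2 * ENNReal.ofReal (v z.1 * ‖∫ s in (0:ℝ)..z.2, dm (fun z => V z.1 * u z) z.1 s z.2‖^2)) ∂(volume.prod volume) := by
            refine setLIntegral_mono' (KR_meas R) fun z hz => ?_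
            rw [heq z hz.1]
            obtain ⟨w, hw⟩ : ∃ w, w = ∫ s in (0:ℝ)..z.2, dm (fun z => V z.1 * u z) z.1 s z.2 := ⟨_, rfl⟩
            rw [← hw]
            have h2 : (2:ℝ≥0∞) = ENNReal.ofReal 2 := by simp
            have hv0 := hv.2.1 z.1
            rw [h2, ← ENNReal.ofReal_mul (by norm_num), ← ENNReal.ofReal_mul (by norm_num), ← ENNReal.ofReal_add (by positivity) (by positivity)]
            apply ENNReal.ofReal_le_ofReal
            have h3 := norm_add_le (frw f g z) w
            have h4 : ‖frw f g z + w‖^2 ≤ 2 * ‖frw f g z‖^2 + 2 * ‖w‖^2 := by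
              nlinarith [norm_nonneg (frw f g z + w), sq_nonneg (‖frw f g z‖ - ‖w‖)]
            nlinarith
        _ = 2 * ∫⁻ z in KR n R, ENNReal.ofReal (v z.1 * ‖frw f g z‖^2) ∂(volume.prod volume) + 2 * ∫⁻ z in KR n R, ENNReal.ofReal (v z.1 * ‖∫ s in (0:ℝ)..z.2, dm (fun z => V z.1 * u z) z.1 s z.2‖^2) ∂(volume.prod volume) := by
            rw [lintegral_add_left (by fun_prop), lintegral_const_mul' _ _ (by simp), lintegral_const_mul' _ _ (by simp)]
        _ ≤ 2 * F + 2 * (ENNReal.ofReal ((C2 E p * A)^2) * ∫⁻ z in KR n (R + κ), ENNReal.ofReal (v z.1 * ‖u z‖^2) ∂(volume.prod volume)) := by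
            gcongr
            exact (setLIntegral_le_lintegral _ _).trans hfe
        _ ≤ _ := by
            rw [← mul_assoc]
            exact add_le_add le_rfl (mul_le_mul_left (two_ofReal_le hsm) _)
  have hU : {z : E × ℝ | 0 < z.2} = ⋃ k : ℕ, KR n (k:ℝ) := by
    ext z
    simp only [Set.mem_iUnion]
    constructor
    · intro hz
      obtain ⟨k, hk⟩ := exists_nat_ge (‖z.1‖ + n * z.2)
      exact ⟨k, hz, hk⟩
    · rintro ⟨k, hk⟩
      exact hk.1
  rw [hU, setLIntegral_iUnion_of_directed]
  · exact iSup_le fun k => hk k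
  · exact Monotone.directed_le (fun i j h => KR_mono (by exact_mod_cast h))
end Half
end

noncomputable section

open MeasureTheory Metric Complex
open scoped ENNReal FourierTransform SchwartzMap
set_option linter.unusedSectionVars false

section Full
variable {n : ℕ}
local notation "E" => EuclideanSpace ℝ (Fin n)

lemma mOp_neg_fun (m : ℝ → ℂ) (g : E → ℂ) (x : E) : mOp n m (fun y => - g y) x = - mOp n m g x := by
  unfold mOp
  have h1 : ∀ ξ, 𝓕 (fun y => - g y) ξ = (-1) * 𝓕 g ξ := by
    intro ξ
    rw [← fourier_smul']
    simp
  have h2 : (fun ξ : E => m ‖ξ‖ * 𝓕 (fun y => - g y) ξ) = fun ξ => (-1) * (m ‖ξ‖ * 𝓕 g ξ) := by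
    ext ξ; rw [h1]; ring
  rw [h2, fourierInv_smul']; ring

lemma mOp_sinc_neg (t : ℝ) (g : E → ℂ) (x : E) : mOp n (sincMult (-t)) g x = - mOp n (sincMult t) g x := by
  unfold mOp
  have h2 : (fun ξ : E => sincMult (-t) ‖ξ‖ * 𝓕 g ξ) = fun ξ => (-1) * (sincMult t ‖ξ‖ * 𝓕 g ξ) := by
    ext ξ
    have : sincMult (-t) ‖ξ‖ = - sincMult t ‖ξ‖ := by
      unfold sincMult; rw [neg_mul, Real.sin_neg, neg_div, Complex.ofReal_neg]
    rw [this]; ring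
  rw [h2, fourierInv_smul']; ring

lemma cosMult_neg (t : ℝ) : cosMult (-t) = cosMult t := by
  ext ρ; unfold cosMult; rw [neg_mul, Real.cos_neg]

lemma neg_coe_fun (g : 𝓢(E, ℂ)) : (⇑(-g) : E → ℂ) = fun y => - g y := by
  ext y; rfl

lemma frw_neg (f g : 𝓢(E, ℂ)) (x : E) (t : ℝ) : frw f (-g) (x, t) = frw f g (x, -t) := by
  unfold frw
  simp only []
  rw [cosMult_neg, mOp_sinc_neg, neg_coe_fun, mOp_neg_fun]

lemma sobNorm_neg (γ : ℝ) (g : 𝓢(E, ℂ)) : sobNorm n γ (⇑(-g)) = sobNorm n γ g := by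
  unfold sobNorm
  have : mOp n (powMult γ) (⇑(-g)) = - mOp n (powMult γ) g := by
    ext x; rw [neg_coe_fun, mOp_neg_fun]; rfl
  rw [this, eLpNorm_neg]

lemma full_est (hn : 3 ≤ n) {p : ℝ} (hA : Adm E p) {v : E → ℝ} (hv : WtU p v) {V : E → ℂ} (hV : Measurable V) {A : ℝ} (hA0 : 0 ≤ A) (hVA : ∀ y, ‖V y‖ = A * v y)
    (hsm : (C2 E p * A)^2 ≤ 1/4)
    {u : E × ℝ → ℂ} (hu : Continuous u) (hGi : ∀ s, Integrable (fun x => V x * u (x, s))) (f g : 𝓢(E, ℂ))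
    (heq : ∀ z : E × ℝ, u z = frw f g z + ∫ s in (0:ℝ)..z.2, dm (fun z => V z.1 * u z) z.1 s z.2) :
    ∫⁻ z, ENNReal.ofReal (v z.1 * ‖u z‖^2) ∂(volume.prod volume) ≤
      8 * (ENNReal.ofReal (16 * Real.pi * C2 E p) * (sobNorm n (1/2) f ^ 2 + sobNorm n (-(1/2)) g ^ 2)) := by
  have h1 := half_time_est hn hA hv hV hA0 hVA hsm hu hGi f g (fun z _ => heq z)
  have h2 := half_time_est hn hA hv hV hA0 hVA hsm (u := fun z => u (z.1, -z.2)) (by fun_prop) (fun s => hGi (-s)) f (-g) (by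
    rintro ⟨x, t⟩ _
    simp only []
    rw [heq (x, -t), frw_neg]
    congr 1
    simp only []
    have h3 : ∀ s, dm (fun z : E × ℝ => V z.1 * u (z.1, -z.2)) x s t = - dm (fun z : E × ℝ => V z.1 * u z) x (-s) (-t) := by
      intro s
      have e1 : dm (fun z : E × ℝ => V z.1 * u (z.1, -z.2)) x s t = mOp n (sincMult (t - s)) (fun y => V y * u (y, -s)) x := rfl
      have e2 : dm (fun z : E × ℝ => V z.1 * u z) x (-s) (-t) = mOp n (sincMult (-t - -s)) (fun y => V y * u (y, -s)) x := rfl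
      rw [e1, e2, show -t - -s = -(t - s) by ring, mOp_sinc_neg, neg_neg]
    simp_rw [h3]
    rw [intervalIntegral.integral_neg, intervalIntegral.integral_comp_neg (fun s => dm (fun z : E × ℝ => V z.1 * u z) x s (-t)), neg_zero, intervalIntegral.integral_symm])
  rw [sobNorm_neg] at h2
  have hum := hu.measurable
  have hvm := hv.1
  have hmp : MeasurePreserving (fun z : E × ℝ => (z.1, -z.2)) (volume.prod volume) (volume.prod volume) :=
    (MeasurePreserving.id volume).prod (Measure.measurePreserving_neg volume)
  have h4 : ∫⁻ z in {z : E × ℝ | 0 < z.2}, ENNReal.ofReal (v z.1 * ‖u (z.1, -z.2)‖^2) ∂(volume.prod volume) =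
      ∫⁻ z in {z : E × ℝ | z.2 < 0}, ENNReal.ofReal (v z.1 * ‖u z‖^2) ∂(volume.prod volume) := by
    have h5 := hmp.setLIntegral_comp_preimage (s := {z : E × ℝ | z.2 < 0}) (measurableSet_lt measurable_snd measurable_const)
      (f := fun z => ENNReal.ofReal (v z.1 * ‖u z‖^2)) (by fun_prop)
    rw [← h5]
    congr 2
    ext z
    show 0 < z.2 ↔ -z.2 < 0
    simp
  rw [h4] at h2
  obtain ⟨F, hF⟩ : ∃ F, F = ENNReal.ofReal (16 * Real.pi * C2 E p) * (sobNorm n (1/2) f ^ 2 + sobNorm n (-(1/2)) g ^ 2) := ⟨_, rfl⟩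
  rw [← hF] at h1 h2 ⊢
  have h0 : ∫⁻ z in {z : E × ℝ | z.2 = 0}, ENNReal.ofReal (v z.1 * ‖u z‖^2) ∂(volume.prod volume) = 0 := by
    apply setLIntegral_measure_zero
    have : {z : E × ℝ | z.2 = 0} = Set.univ ×ˢ {0} := by ext z; simp
    rw [this, Measure.prod_prod]; simp
  have hcov : (Set.univ : Set (E × ℝ)) ⊆ ({z | 0 < z.2} ∪ {z | z.2 < 0}) ∪ {z | z.2 = 0} := by
    intro z _
    rcases lt_trichotomy z.2 0 with h | h | h
    · exact Or.inl (Or.inr h)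
    · exact Or.inr h
    · exact Or.inl (Or.inl h)
  rw [← setLIntegral_univ]
  calc _ ≤ _ := lintegral_mono_set hcov
    _ ≤ _ := lintegral_union_le _ _ _
    _ ≤ (2 * (2 * F) + 2 * (2 * F)) + 0 := by
        gcongr
        · exact (lintegral_union_le _ _ _).trans (add_le_add h1 h2)
        · exact h0.le
    _ = _ := by ring
end Full
end

noncomputable section

open MeasureTheory Metric Complex
open scoped ENNReal FourierTransform SchwartzMap
set_option linter.unusedSectionVars false

section Fin
variable {n : ℕ}
local notation "E" => EuclideanSpace ℝ (Fin n)

lemma fp_ball {p : ℝ} (hp : 0 < p) {V : E → ℂ} {A : ℝ} (hA0 : 0 ≤ A) (hA : fpNorm n p V = ENNReal.ofReal A) (x : E) {r : ℝ} (hr : 0 < r) :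
    ∫⁻ y in ball x r, ENNReal.ofReal (‖V y‖ ^ p) ≤ ENNReal.ofReal (A^p * r^((n:ℝ) - 2 * p)) := by
  have h1 : ENNReal.ofReal (r ^ (2 - n / p)) * (∫⁻ y in ball x r, ENNReal.ofReal (‖V y‖ ^ p)) ^ (1 / p) ≤ ENNReal.ofReal A := by
    rw [← hA]
    unfold fpNorm
    exact le_iSup_of_le x (le_iSup_of_le r (le_iSup_of_le hr le_rfl))
  obtain ⟨J, hJ⟩ : ∃ J, J = ∫⁻ y in ball x r, ENNReal.ofReal (‖V y‖ ^ p) := ⟨_, rfl⟩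
  rw [← hJ] at h1 ⊢
  have h2 : J ^ (1/p) ≤ ENNReal.ofReal (A * r ^ ((n:ℝ) / p - 2)) := by
    calc J ^ (1/p) = ENNReal.ofReal (r ^ ((n:ℝ) / p - 2)) * (ENNReal.ofReal (r ^ (2 - n / p)) * J ^ (1/p)) := by
          rw [← mul_assoc, ← ENNReal.ofReal_mul (by positivity), ← Real.rpow_add hr]
          simp
      _ ≤ ENNReal.ofReal (r ^ ((n:ℝ) / p - 2)) * ENNReal.ofReal A := by gcongr
      _ = _ := by rw [← ENNReal.ofReal_mul (by positivity), mul_comm]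
  calc J = (J ^ (1/p)) ^ p := by rw [← ENNReal.rpow_mul, one_div_mul_cancel hp.ne', ENNReal.rpow_one]
    _ ≤ (ENNReal.ofReal (A * r ^ ((n:ℝ) / p - 2))) ^ p := ENNReal.rpow_le_rpow h2 hp.le
    _ = _ := by
        rw [ENNReal.ofReal_rpow_of_nonneg (by positivity) hp.le, Real.mul_rpow hA0 (by positivity), ← Real.rpow_mul hr.le]
        congr 4
        field_simp

lemma V_zero {p : ℝ} (hp : 0 < p) {V : E → ℂ} (hV : Measurable V) {A : ℝ} (hA0 : 0 ≤ A) (hA : fpNorm n p V = ENNReal.ofReal A)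
    (h : A = 0 ∨ (n:ℝ) < 2 * p) : ∀ᵐ x : E, V x = 0 := by
  have hb : ∀ r : ℝ, ∫⁻ y in ball (0:E) r, ENNReal.ofReal (‖V y‖ ^ p) ≤ 0 := by
    intro r
    have h1 : ∀ᶠ R : ℝ in Filter.atTop, ∫⁻ y in ball (0:E) r, ENNReal.ofReal (‖V y‖ ^ p) ≤ ENNReal.ofReal (A^p * R^((n:ℝ) - 2 * p)) := by
      filter_upwards [Filter.eventually_ge_atTop r, Filter.eventually_gt_atTop 0] with R h1 h2
      exact (lintegral_mono_set (ball_subset_ball h1)).trans (fp_ball hp hA0 hA 0 h2)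
    have h2 : Filter.Tendsto (fun R : ℝ => ENNReal.ofReal (A^p * R^((n:ℝ) - 2 * p))) Filter.atTop (nhds 0) := by
      rw [← ENNReal.ofReal_zero]
      apply (ENNReal.continuous_ofReal.tendsto _).comp
      rcases h with h | h
      · rw [h, Real.zero_rpow hp.ne']; simp
      · have h3 := (tendsto_rpow_neg_atTop (y := 2 * p - n) (by linarith)).const_mul (A^p)
        simpa using h3
    exact ge_of_tendsto h2 h1
  have h0 : ∫⁻ y : E, ENNReal.ofReal (‖V y‖ ^ p) ≤ 0 := by
    refine lint_exhaust (S := fun k : ℕ => ball (0:E) k) ?_ ?_ (fun k => hb k)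
    · intro i j hij
      exact ball_subset_ball (by exact_mod_cast hij)
    · intro x
      obtain ⟨k, hk⟩ := exists_nat_gt ‖x‖
      exact ⟨k, by simpa using hk⟩
  have h1 := (lintegral_eq_zero_iff (by fun_prop)).1 (le_antisymm h0 (by simp))
  filter_upwards [h1] with x hx
  have h2 : ENNReal.ofReal (‖V x‖ ^ p) = 0 := hx
  rw [ENNReal.ofReal_eq_zero] at h2
  by_contra hne
  have h3 : 0 < ‖V x‖ := norm_pos_iff.2 hne
  have := Real.rpow_pos_of_pos h3 p
  linarith

lemma WtU_of_fp {p : ℝ} (hp : 0 < p) {V : E → ℂ} (hV : Measurable V) {A : ℝ} (hA0 : 0 < A) (hA : fpNorm n p V = ENNReal.ofReal A) :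
    WtU p (fun x => ‖V x‖ / A) := by
  refine ⟨by fun_prop, fun x => by positivity, ?_⟩
  intro y r hr
  have h1 := fp_ball hp hA0.le hA y hr
  have h2 : ∀ x, ENNReal.ofReal ((‖V x‖ / A)^p) = ENNReal.ofReal ((A^p)⁻¹) * ENNReal.ofReal (‖V x‖ ^ p) := by
    intro x
    rw [← ENNReal.ofReal_mul (by positivity), Real.div_rpow (by positivity) hA0.le]
    congr 1; ring
  simp_rw [h2]
  rw [lintegral_const_mul' _ _ (by simp), finrank_euclideanSpace_fin]
  calc _ ≤ ENNReal.ofReal ((A^p)⁻¹) * ENNReal.ofReal (A^p * r^((n:ℝ) - 2 * p)) := by gcongr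
    _ = _ := by
      rw [← ENNReal.ofReal_mul (by positivity)]
      congr 1
      have : A^p ≠ 0 := (Real.rpow_pos_of_pos hA0 p).ne'
      field_simp

lemma final_alg {A C D : ℝ} (hA : 0 ≤ A) (hC : 0 ≤ C) (hD : 0 ≤ D) (hCD : C^2 = 8 * D) (a b X : ℝ≥0∞) (hX : X ≤ 8 * (ENNReal.ofReal D * (a^2 + b^2))) :
    (ENNReal.ofReal A * X) ^ ((1:ℝ)/2) ≤ ENNReal.ofReal C * ENNReal.ofReal A ^ ((1:ℝ)/2) * (a + b) := by
  have h1 : ENNReal.ofReal A * X ≤ (ENNReal.ofReal C * ENNReal.ofReal A ^ ((1:ℝ)/2) * (a + b)) ^ (2:ℝ) := by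
    have e1 : (ENNReal.ofReal A ^ ((1:ℝ)/2)) ^ (2:ℝ) = ENNReal.ofReal A := by
      rw [← ENNReal.rpow_mul]; norm_num
    rw [ENNReal.mul_rpow_of_nonneg _ _ (by norm_num), ENNReal.mul_rpow_of_nonneg _ _ (by norm_num), e1, ENNReal.rpow_two, ENNReal.rpow_two,
      ← ENNReal.ofReal_pow hC, hCD, ENNReal.ofReal_mul (by norm_num)]
    have e8 : ENNReal.ofReal 8 = 8 := by simp
    have hab : a^2 + b^2 ≤ (a+b)^2 := by
      have : (a+b)^2 = a^2 + b^2 + 2 * a * b := by ring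
      rw [this]; exact le_self_add
    rw [e8]
    calc ENNReal.ofReal A * X ≤ ENNReal.ofReal A * (8 * (ENNReal.ofReal D * (a + b)^2)) := by
          refine mul_le_mul_right (hX.trans ?_) _
          gcongr
      _ = _ := by ring
  calc _ ≤ ((ENNReal.ofReal C * ENNReal.ofReal A ^ ((1:ℝ)/2) * (a + b)) ^ (2:ℝ)) ^ ((1:ℝ)/2) := ENNReal.rpow_le_rpow h1 (by norm_num)
    _ = _ := by rw [← ENNReal.rpow_mul]; norm_num
end Fin

theorem weighted_L2_solution (n : ℕ) (hn : 3 ≤ n) (p : ℝ) (hp : ((n : ℝ) - 1) / 2 < p) :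
    ∃ ε > (0 : ℝ), ∃ C > (0 : ℝ),
      ∀ V : EuclideanSpace ℝ (Fin n) → ℂ, Measurable V →
        fpNorm n p V ≤ ENNReal.ofReal ε →
        ∀ f g : 𝓢(EuclideanSpace ℝ (Fin n), ℂ), ∀ u : EuclideanSpace ℝ (Fin n) → ℝ → ℂ,
          (∀ t : ℝ, IsSchwartz (fun x => u x t)) →
          Continuous (fun z : EuclideanSpace ℝ (Fin n) × ℝ => u z.1 z.2) →
          (∀ t : ℝ, ∀ x, u x t = mOp n (cosMult t) (⇑f) x + mOp n (sincMult t) (⇑g) x +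
            ∫ s in (0 : ℝ)..t, mOp n (sincMult (t - s)) (fun y => V y * u y s) x) →
          wtNorm n (fun x => (‖V x‖₊ : ℝ≥0∞)) u ≤
            ENNReal.ofReal C * fpNorm n p V ^ ((1 : ℝ) / 2) *
              (sobNorm n (1 / 2) (⇑f) + sobNorm n (-(1 / 2)) (⇑g)) := by
  have hn3 : (3:ℝ) ≤ n := by exact_mod_cast hn
  have hp1 : 1 < p := by linarith
  have hp0 : 0 < p := by linarith
  obtain ⟨c, hc⟩ : ∃ c, c = C2 (EuclideanSpace ℝ (Fin n)) p := ⟨_, rfl⟩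
  have hc0 : 0 < c := by rw [hc]; exact C2_pos p
  have hpi := Real.pi_pos
  refine ⟨1 / (2 * c), by positivity, Real.sqrt (8 * (16 * Real.pi * c)), by positivity, ?_⟩
  intro V hV hfp f g u huS hu heq
  obtain ⟨A, hA⟩ : ∃ A, A = (fpNorm n p V).toReal := ⟨_, rfl⟩
  have hA0 : 0 ≤ A := by rw [hA]; exact ENNReal.toReal_nonneg
  have hfpA : fpNorm n p V = ENNReal.ofReal A := by
    rw [hA, ENNReal.ofReal_toReal]
    exact ne_top_of_le_ne_top ENNReal.ofReal_ne_top hfp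
  by_cases htr : A = 0 ∨ (n:ℝ) < 2 * p
  · have h0 := V_zero hp0 hV hA0 hfpA htr
    have h1 : wtNorm n (fun x => (‖V x‖₊ : ℝ≥0∞)) u = 0 := by
      unfold wtNorm
      have h2 : ∀ t : ℝ, ∫⁻ x : EuclideanSpace ℝ (Fin n), (‖u x t‖₊ : ℝ≥0∞) ^ (2 : ℝ) * (‖V x‖₊ : ℝ≥0∞) = 0 := by
        intro t
        have h3 : ∀ᵐ x : EuclideanSpace ℝ (Fin n), (‖u x t‖₊ : ℝ≥0∞) ^ (2 : ℝ) * (‖V x‖₊ : ℝ≥0∞) = 0 := by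
          filter_upwards [h0] with x hx
          rw [hx]; simp
        rw [lintegral_congr_ae h3, lintegral_zero]
      simp_rw [h2]
      rw [lintegral_zero]; norm_num
    rw [h1]; simp
  · push Not at htr
    obtain ⟨hAne, h2p⟩ := htr
    have hApos : 0 < A := lt_of_le_of_ne hA0 (Ne.symm hAne)
    have hfr : Module.finrank ℝ (EuclideanSpace ℝ (Fin n)) = n := finrank_euclideanSpace_fin
    have hAdm : Adm (EuclideanSpace ℝ (Fin n)) p := by
      refine ⟨by rw [hfr]; exact hn, by rw [hfr]; exact hp, by rw [hfr]; exact h2p⟩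
    have hv := WtU_of_fp hp0 hV hApos hfpA
    obtain ⟨v, hvd⟩ : ∃ v : EuclideanSpace ℝ (Fin n) → ℝ, v = fun x => ‖V x‖ / A := ⟨_, rfl⟩
    rw [← hvd] at hv
    have hVA : ∀ y, ‖V y‖ = A * v y := by
      intro y; rw [hvd]; field_simp
    have hAe : A ≤ 1 / (2 * c) := by
      rw [hfpA] at hfp
      exact (ENNReal.ofReal_le_ofReal_iff (by positivity)).1 hfp
    have hsm : (C2 (EuclideanSpace ℝ (Fin n)) p * A)^2 ≤ 1/4 := by
      rw [← hc]
      have h1 : c * A ≤ 1/2 := by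
        calc c * A ≤ c * (1 / (2 * c)) := by gcongr
          _ = 1/2 := by field_simp
      have h2 : 0 ≤ c * A := by positivity
      nlinarith
    have hGi : ∀ s, Integrable (fun x => V x * u x s) := by
      intro s
      obtain ⟨φ, hφ⟩ := huS s
      have h1 := G_integrable hp1.le hv hV hA0 hVA φ
      refine h1.congr (Filter.Eventually.of_forall fun x => ?_)
      simp only []
      rw [← hφ x]
    have hfull := full_est hn hAdm hv hV hA0 hVA hsm (u := fun z => u z.1 z.2) hu hGi f g (fun z => heq z.2 z.1)
    have hum := hu.measurable
    have hvm := hv.1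
    have hw : wtNorm n (fun x => (‖V x‖₊ : ℝ≥0∞)) u =
        (ENNReal.ofReal A * ∫⁻ z : EuclideanSpace ℝ (Fin n) × ℝ, ENNReal.ofReal (v z.1 * ‖u z.1 z.2‖^2) ∂(volume.prod volume)) ^ ((1:ℝ)/2) := by
      unfold wtNorm
      congr 1
      rw [lintegral_prod_symm _ (Measurable.aemeasurable (by fun_prop)), ← lintegral_const_mul' _ _ (by simp)]
      refine lintegral_congr fun t => ?_
      rw [← lintegral_const_mul' _ _ (by simp)]
      refine lintegral_congr fun x => ?_
      have hv0 := hv.2.1 x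
      rw [← ENNReal.ofReal_mul hA0, ← mul_assoc, ← hVA, ENNReal.ofReal_mul (norm_nonneg _), ENNReal.ofReal_pow (norm_nonneg _), ENNReal.rpow_two, mul_comm]
      congr 1
      · exact (ofReal_norm_eq_enorm _).symm
      · congr 1
        exact (ofReal_norm_eq_enorm _).symm
    rw [hw, hfpA]
    rw [← hc] at hfull
    exact final_alg hA0 (Real.sqrt_nonneg _) (by positivity) (Real.sq_sqrt (by positivity)) _ _ _ hfull

end
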